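/- Let P_{(k_0,k_1,…,k_r,k_{r+1})}^{(m_0,m_1,…,m_r)} be a quipu with k_0 ≥ 1 and k_{r+1} ≥ 1, and set n_i = k_0 + Σ_{j=1}^{i} (m_{j−1} + k_j + 1) for 1 ≤ i ≤ r+1. Then for a quiver D that is an orientation of a quipu, the path algebra kD is derived equivalent to the linear Nakayama algebra A_{n_{r+1},(k_0,n_1,n_2,…,n_r)}^{(m_0+2, m_1+2, …, m_r+2)} if and only if the underlying undirected graph of D is isomorphic to P_{(k_0,k_1,…,k_r,k_{r+1})}^{(m_0,m_1,…,m_r)}. -/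

import Mathlib

open CategoryTheory

/-- A finite quiver: a finite vertex type, an arrow type, and source/target maps. -/
structure PreQuiver where
  V : Type
  A : Type
  [fintV : Fintype V]
  s : A → V
  t : A → V

attribute [instance] PreQuiver.fintV

/-- The defining relations presenting the path algebra of the quiver `Q` over `k`, together
with the zero relations given by the paths (lists of composable arrows) in `R`.  The
generators are the trivial paths `Sum.inl v` (one for each vertex) and the arrows
`Sum.inr a`; multiplication of generators corresponds to concatenation of paths, so that the
resulting algebra has as a basis the paths of `Q` (not passing through a relation of `R`). -/
inductive PathAlgRel (k : Type) [Field k] (Q : PreQuiver) (R : Set (List Q.A)) :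
    FreeAlgebra k (Q.V ⊕ Q.A) → FreeAlgebra k (Q.V ⊕ Q.A) → Prop
  | idem (v : Q.V) :
      PathAlgRel k Q R (FreeAlgebra.ι k (Sum.inl v) * FreeAlgebra.ι k (Sum.inl v))
        (FreeAlgebra.ι k (Sum.inl v))
  | orth (v w : Q.V) (h : v ≠ w) :
      PathAlgRel k Q R (FreeAlgebra.ι k (Sum.inl v) * FreeAlgebra.ι k (Sum.inl w)) 0
  | unit :
      PathAlgRel k Q R (∑ v : Q.V, FreeAlgebra.ι k (Sum.inl v)) 1
  | source (a : Q.A) :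
      PathAlgRel k Q R (FreeAlgebra.ι k (Sum.inl (Q.s a)) * FreeAlgebra.ι k (Sum.inr a))
        (FreeAlgebra.ι k (Sum.inr a))
  | target (a : Q.A) :
      PathAlgRel k Q R (FreeAlgebra.ι k (Sum.inr a) * FreeAlgebra.ι k (Sum.inl (Q.t a)))
        (FreeAlgebra.ι k (Sum.inr a))
  | zeroRel (p : List Q.A) (hp : p ∈ R) :
      PathAlgRel k Q R ((p.map fun a => FreeAlgebra.ι k (Sum.inr a)).prod) 0

/-- The path algebra of the quiver `Q` over the field `k`, modulo the two-sided ideal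
generated by the zero relations in `R`. -/
abbrev PathAlgebraRel (k : Type) [Field k] (Q : PreQuiver) (R : Set (List Q.A)) : Type :=
  RingQuot (PathAlgRel k Q R)

/-- The path algebra of the quiver `Q` over the field `k`. -/
abbrev PathAlgebra (k : Type) [Field k] (Q : PreQuiver) : Type :=
  PathAlgebraRel k Q ∅

noncomputable instance (C : Type*) [Category C] [Abelian C] : HasDerivedCategory C :=
  HasDerivedCategory.standard C

/-- Two `k`-algebras are *derived equivalent* if there is a triangulated equivalence between
the derived categories of their categories of right modules (i.e. of left modules over the
opposite rings). -/
def DerivedEquivalent (k : Type) [Field k] (A : Type) [Ring A] [Algebra k A]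
    (B : Type) [Ring B] [Algebra k B] : Prop :=
  ∃ (F : DerivedCategory (ModuleCat.{0} Aᵐᵒᵖ) ⥤ DerivedCategory (ModuleCat.{0} Bᵐᵒᵖ))
    (c : F.CommShift ℤ), haveI := c; (F.IsTriangulated ∧ F.IsEquivalence)

/-- The linearly ordered quiver `A_n` of Dynkin type `A`, with vertices `1, …, n`
(realized as `Fin n`) and an arrow from each vertex to the next one. -/
def linQuiver (n : ℕ) : PreQuiver where
  V := Fin n
  A := Fin (n - 1)
  s := fun a => ⟨a.1, by have := a.2; omega⟩
  t := fun a => ⟨a.1 + 1, by have := a.2; omega⟩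

/-- The path of length `l` in the quiver `A_n` starting at the (1-indexed) vertex `v`. -/
def linPath (n : ℕ) (v l : ℕ) : List (linQuiver n).A :=
  (List.range l).filterMap fun j =>
    if h : v - 1 + j < n - 1 then some ⟨v - 1 + j, h⟩ else none

/-- The linear Nakayama algebra `A_{n,(n_0,…,n_{t-1})}^{(l_0,…,l_{t-1})}`: the quotient of
the path algebra of `A_n` over `k` by the two-sided ideal generated, for each `i`, by the
path of length `ls i` starting at the vertex `ns i`. -/
abbrev NakayamaAlgebra (k : Type) [Field k] (n t : ℕ) (ns ls : Fin t → ℕ) : Type :=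
  PathAlgebraRel k (linQuiver n) {p | ∃ i : Fin t, p = linPath n (ns i) (ls i)}

/-- The hypotheses on the data of a linear Nakayama algebra
`A_{n,(n_0,…,n_{t-1})}^{(l_0,…,l_{t-1})}` with almost separate relations: each relation
starts at a vertex `ns i ≥ 1` and has length `ls i ≥ 2`, the start vertices are strictly
increasing, the end vertices `ns i + ls i` are strictly increasing and at most `n`, and the
overlap of two relations is at most one arrow (`ns j ≥ ns i + ls i - 1` for `i < j`). -/
structure IsASNakayama (n t : ℕ) (ns ls : Fin t → ℕ) : Prop where
  one_le : ∀ i, 1 ≤ ns i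
  two_le : ∀ i, 2 ≤ ls i
  start_lt : ∀ i j, i < j → ns i < ns j
  end_lt : ∀ i j, i < j → ns i + ls i < ns j + ls j
  end_le : ∀ i, ns i + ls i ≤ n
  almost_separate : ∀ i j, i < j → ns i + ls i ≤ ns j + 1

/-- The position on the main string (`0`-indexed) of the vertex `b i` of a quipu: there are
`k 0` vertices before `b 0`, then `k 1` vertices between `b 0` and `b 1`, and so on. -/
def bpos (r : ℕ) (kk : Fin (r + 2) → ℕ) (i : Fin (r + 1)) : ℕ :=
  i.1 + ∑ j : Fin (r + 2), if j.1 ≤ i.1 then kk j else 0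

/-- The vertex set of the quipu `P_{(k_0,…,k_{r+1})}^{(m_0,…,m_r)}`: the main string has
`r + 1 + ∑ k_i` vertices, and the `i`-th cord contributes `m i` further vertices. -/
abbrev QuipuV (r : ℕ) (kk : Fin (r + 2) → ℕ) (mm : Fin (r + 1) → ℕ) : Type :=
  Fin (r + 1 + ∑ i, kk i) ⊕ Σ i : Fin (r + 1), Fin (mm i)

/-- The quipu `P_{(k_0,…,k_{r+1})}^{(m_0,…,m_r)}` as a simple graph: a main string which is a
path containing, in order, `k 0` vertices, the vertex `b 0`, `k 1` vertices, the vertex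
`b 1`, …, the vertex `b r` and finally `k (r+1)` vertices, together with, for each `i`, a
path with `m i` edges (the `i`-th cord) attached to the vertex `b i`. -/
def quipuGraph (r : ℕ) (kk : Fin (r + 2) → ℕ) (mm : Fin (r + 1) → ℕ) :
    SimpleGraph (QuipuV r kk mm) :=
  SimpleGraph.fromRel fun x y =>
    match x, y with
    | Sum.inl v, Sum.inl w => w.1 = v.1 + 1
    | Sum.inl v, Sum.inr ⟨i, j⟩ => v.1 = bpos r kk i ∧ j.1 = 0
    | Sum.inr ⟨i, j⟩, Sum.inr ⟨i', j'⟩ => i.1 = i'.1 ∧ j'.1 = j.1 + 1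
    | Sum.inr _, Sum.inl _ => False

/-- An orientation of a graph, given by a relation selecting a direction for each edge,
regarded as a quiver. -/
def orientQuiver (V : Type) [Fintype V] (o : V → V → Prop) : PreQuiver where
  V := V
  A := { p : V × V // o p.1 p.2 }
  s := fun a => a.1.1
  t := fun a => a.1.2

/-- `o` is an orientation of the simple graph `G` if each edge of `G` is directed in exactly
one way by `o`, and `o` directs nothing else. -/
def IsOrientation {V : Type} (G : SimpleGraph V) (o : V → V → Prop) : Prop :=
  (∀ v w, G.Adj v w ↔ o v w ∨ o w v) ∧ ∀ v w, o v w → ¬o w v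

namespace QN
section comb
open Classical

/-- Rooted tree structure. -/
structure Rooted {V : Type} (G : SimpleGraph V) (v : V) where
  par : V → V
  dep : V → ℕ
  dep_root : dep v = 0
  dep_par : ∀ x, x ≠ v → dep x = dep (par x) + 1
  adj : ∀ x y, G.Adj x y ↔ (x ≠ v ∧ y = par x) ∨ (y ≠ v ∧ x = par y)

theorem exists_rooted {V : Type} {G : SimpleGraph V} (hG : G.IsTree) (v : V) :
    Nonempty (Rooted G v) := by
  have hc := hG.1
  have ex : ∀ x, x ≠ v → ∃ y, G.Adj x y ∧ G.dist x v = G.dist y v + 1 := by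
    intro x hx
    obtain ⟨p, hp⟩ := hc.exists_walk_length_eq_dist x v
    cases p with
    | nil => exact absurd rfl hx
    | cons h q =>
      rename_i y
      refine ⟨y, h, ?_⟩
      have h1 := SimpleGraph.dist_le q
      have h2 := hc.dist_triangle (u := x) (v := y) (w := v)
      rw [SimpleGraph.dist_eq_one_iff_adj.2 h] at h2
      simp at hp
      omega
  have uni : ∀ x y z, G.Adj x y → G.Adj x z → G.dist x v = G.dist y v + 1 →
      G.dist x v = G.dist z v + 1 → y = z := by
    intro x y z hy hz hdy hdz
    obtain ⟨p, hp⟩ := hc.exists_walk_length_eq_dist y v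
    obtain ⟨q, hq⟩ := hc.exists_walk_length_eq_dist z v
    have hP := SimpleGraph.Walk.isPath_of_length_eq_dist (SimpleGraph.Walk.cons hy p)
      (by simp; omega)
    have hQ := SimpleGraph.Walk.isPath_of_length_eq_dist (SimpleGraph.Walk.cons hz q)
      (by simp; omega)
    have := (hG.existsUnique_path x v).unique hP hQ
    simp at this
    exact this.1
  choose! par hpar1 hpar2 using ex
  refine ⟨⟨par, fun x => G.dist x v, by simp, hpar2, ?_⟩⟩
  intro x y
  constructor
  · intro h
    rcases hG.dist_eq_dist_add_one_of_adj v h with h1 | h1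
    · rw [SimpleGraph.dist_comm, SimpleGraph.dist_comm (u := v)] at h1
      have hx : x ≠ v := by rintro rfl; simp at h1
      exact Or.inl ⟨hx, uni x _ _ h (hpar1 x hx) h1 (hpar2 x hx)⟩
    · rw [SimpleGraph.dist_comm, SimpleGraph.dist_comm (u := v)] at h1
      have hx : y ≠ v := by rintro rfl; simp at h1
      exact Or.inr ⟨hx, uni y _ _ h.symm (hpar1 y hx) h1 (hpar2 y hx)⟩
  · rintro (⟨h, rfl⟩ | ⟨h, rfl⟩)
    · exact hpar1 _ h
    · exact (hpar1 _ h).symm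

/-- flip all arrows at a vertex -/
def flipAt {V : Type} (i : V) (o : V → V → Prop) : V → V → Prop :=
  fun v w => if v = i ∨ w = i then o w v else o v w

def IsSink {V : Type} (o : V → V → Prop) (i : V) : Prop := ∀ w, ¬ o i w
def IsSource {V : Type} (o : V → V → Prop) (i : V) : Prop := ∀ w, ¬ o w i

theorem flipAt_flipAt {V : Type} (i : V) (o : V → V → Prop) : flipAt i (flipAt i o) = o := by
  funext v w
  simp only [flipAt, eq_iff_iff]
  by_cases h : v = i <;> by_cases h' : w = i <;> simp [h, h']

theorem flipAt_orient {V : Type} {G : SimpleGraph V} {o : V → V → Prop} (h : IsOrientation G o)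
    (i : V) : IsOrientation G (flipAt i o) := by
  refine ⟨fun v w => ?_, fun v w => ?_⟩
  · rw [h.1]; simp only [flipAt]
    by_cases h1 : v = i <;> by_cases h' : w = i <;> simp [h1, h', or_comm]
  · simp only [flipAt]
    by_cases h1 : v = i <;> by_cases h' : w = i <;> simp [h1, h']
    · exact fun a => h.2 _ _ a a
    · exact h.2 _ _
    · exact h.2 _ _
    · exact h.2 _ _

theorem flipAt_sink {V : Type} {o : V → V → Prop} {i : V} (h : IsSink o i) :
    IsSource (flipAt i o) i := by
  intro w; simp [flipAt, h w]
theorem flipAt_source {V : Type} {o : V → V → Prop} {i : V} (h : IsSource o i) :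
    IsSink (flipAt i o) i := by
  intro w; simp [flipAt, h w]

def Rooted.toward {V : Type} {G : SimpleGraph V} {v : V} (T : Rooted G v) : V → V → Prop :=
  fun x y => x ≠ v ∧ y = T.par x

theorem Rooted.par_ne {V : Type} {G : SimpleGraph V} {v : V} (T : Rooted G v) {x : V}
    (hx : x ≠ v) : T.par x ≠ x := by
  intro h; have := T.dep_par x hx; rw [h] at this; omega

theorem Rooted.toward_orient {V : Type} {G : SimpleGraph V} {v : V} (T : Rooted G v) :
    IsOrientation G T.toward := by
  refine ⟨fun x y => T.adj x y, ?_⟩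
  rintro x y ⟨h1, rfl⟩ ⟨h2, h3⟩
  have := T.dep_par x h1
  have h4 := T.dep_par _ h2
  rw [← h3] at h4; omega

/-- step: sink reflection away from v -/
def StepAway {V : Type} (v : V) (o o' : V → V → Prop) : Prop :=
  ∃ i, i ≠ v ∧ IsSink o i ∧ o' = flipAt i o

theorem lemmaT {V : Type} [Fintype V] {G : SimpleGraph V} {v : V} (T : Rooted G v)
    (o : V → V → Prop) (ho : IsOrientation G o) :
    Relation.ReflTransGen (StepAway v) o T.toward := by
  obtain ⟨D, hD⟩ : ∃ D, ∀ x, T.dep x < D := by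
    refine ⟨(Finset.univ.sup T.dep) + 1, fun x => ?_⟩
    have := Finset.le_sup (f := T.dep) (Finset.mem_univ x)
    omega
  set N := Fintype.card V + 1 with hN
  let term : (V → V → Prop) → V → ℕ := fun o x =>
    if x ≠ v ∧ o (T.par x) x then N ^ (D - T.dep x) else 0
  induction hm : ∑ x, term o x using Nat.strong_induction_on generalizing o with
  | _ m ih =>
  by_cases hex : ∃ x, x ≠ v ∧ o (T.par x) x
  · -- max depth
    obtain ⟨w, hw, hmax⟩ := Finset.exists_max_image
      (Finset.univ.filter fun x => x ≠ v ∧ o (T.par x) x) T.dep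
      (by obtain ⟨x, hx⟩ := hex; exact ⟨x, by simpa using hx⟩)
    simp only [Finset.mem_filter, Finset.mem_univ, true_and] at hw hmax
    have hsink : IsSink o w := by
      intro y hy
      rcases (T.adj w y).1 ((ho.1 _ _).2 (Or.inl hy)) with ⟨_, rfl⟩ | ⟨h1, h2⟩
      · exact ho.2 _ _ hy hw.2
      · have := hmax y ⟨h1, by rw [← h2]; exact hy⟩
        have h3 := T.dep_par y h1
        rw [← h2] at h3; omega
    refine Relation.ReflTransGen.head (b := flipAt w o) ⟨w, hw.1, hsink, rfl⟩ ?_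
    refine ih _ ?_ _ (flipAt_orient ho w) rfl
    rw [← hm]
    have hdw := hD w
    have key : ∀ x, x ≠ w → term (flipAt w o) x ≤ term o x + N ^ (D - T.dep w - 1) := by
      intro x hx
      by_cases hxv : x = v
      · simp [term, hxv]
      by_cases hpx : T.par x = w
      · have h3 := T.dep_par x hxv
        have : term (flipAt w o) x ≤ N ^ (D - T.dep x) := by
          simp only [term]; split_ifs <;> simp
        rw [h3, hpx] at this
        have h5 : D - (T.dep w + 1) = D - T.dep w - 1 := by omega
        rw [h5] at this; omega
      · have : term (flipAt w o) x = term o x := by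
          simp [term, flipAt, hx, hpx]
        omega
    have kw : term (flipAt w o) w = 0 := by
      simp only [term, flipAt]; simp
      intro _ h; exact absurd h (hsink _)
    have kw' : term o w = N * N ^ (D - T.dep w - 1) := by
      simp only [term]; rw [if_pos hw, ← pow_succ']
      congr 1; omega
    rw [← Finset.add_sum_erase _ _ (Finset.mem_univ w), ← Finset.add_sum_erase _ _ (Finset.mem_univ w),
      kw, kw']
    have : ∑ x ∈ Finset.univ.erase w, term (flipAt w o) x ≤
        ∑ x ∈ Finset.univ.erase w, (term o x + N ^ (D - T.dep w - 1)) :=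
      Finset.sum_le_sum fun x hx => key x (Finset.ne_of_mem_erase hx)
    rw [Finset.sum_add_distrib, Finset.sum_const, Finset.card_erase_of_mem (Finset.mem_univ w),
      Finset.card_univ, smul_eq_mul] at this
    have hpos : 0 < N ^ (D - T.dep w - 1) := Nat.pow_pos (by omega)
    have : (Fintype.card V - 1) * N ^ (D - T.dep w - 1) < N * N ^ (D - T.dep w - 1) :=
      Nat.mul_lt_mul_of_pos_right (by omega) hpos
    omega
  · push Not at hex
    have : o = T.toward := by
      funext x y
      simp only [Rooted.toward, eq_iff_iff]
      constructor
      · intro h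
        rcases (T.adj x y).1 ((ho.1 _ _).2 (Or.inl h)) with h1 | ⟨h1, h2⟩
        · exact h1
        · exact absurd (h2 ▸ h) (hex y h1)
      · rintro ⟨h1, rfl⟩
        rcases (ho.1 _ _).1 ((T.adj x (T.par x)).2 (Or.inl ⟨h1, rfl⟩)) with h2 | h2
        · exact h2
        · exact absurd h2 (hex x h1)
    rw [this]

/-- General form of connecting two orientations by sink and source reflections. -/
def StepAny {V : Type} (o o' : V → V → Prop) : Prop :=
  ∃ i, (IsSink o i ∨ IsSource o i) ∧ o' = flipAt i o

theorem stepAny_symm {V : Type} {o o' : V → V → Prop} (h : StepAny o o') : StepAny o' o := by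
  obtain ⟨i, h, rfl⟩ := h
  exact ⟨i, h.symm.imp flipAt_source flipAt_sink, (flipAt_flipAt i o).symm⟩

theorem reach_any {V : Type} [Fintype V] {G : SimpleGraph V} (hG : G.IsTree)
    (o o' : V → V → Prop) (ho : IsOrientation G o) (ho' : IsOrientation G o') :
    Relation.ReflTransGen StepAny o o' := by
  obtain ⟨v⟩ := hG.1.nonempty
  obtain ⟨T⟩ := exists_rooted hG v
  have h1 : Relation.ReflTransGen StepAny o T.toward :=
    Relation.ReflTransGen.mono (fun a b ⟨i, _, h, e⟩ => ⟨i, Or.inl h, e⟩) _ _ (lemmaT T o ho)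
  have h2 : Relation.ReflTransGen StepAny o' T.toward :=
    Relation.ReflTransGen.mono (fun a b ⟨i, _, h, e⟩ => ⟨i, Or.inl h, e⟩) _ _ (lemmaT T o' ho')
  refine h1.trans ?_
  clear h1
  generalize T.toward = t at h2
  induction h2 with
  | refl => exact Relation.ReflTransGen.refl
  | tail _ h ih => exact Relation.ReflTransGen.head (stepAny_symm h) ih

end comb
end QN

namespace QN
set_option linter.all false
section comb2
open Classical

/-- basis vector -/
noncomputable def bv {V : Type} (R : Type) [CommRing R] (v : V) : V → R := Pi.single v 1

/-- Euler form -/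
noncomputable def eul {V : Type} [Fintype V] (R : Type) [CommRing R] (o : V → V → Prop) :
    (V → R) →ₗ[R] (V → R) →ₗ[R] R :=
  Matrix.toLinearMap₂' R (Matrix.of fun v w => (if v = w then (1 : R) else 0) - if o v w then 1 else 0)

theorem eul_apply {V : Type} [Fintype V] {R : Type} [CommRing R] (o : V → V → Prop) (x y : V → R) :
    eul R o x y = ∑ v, x v * y v - ∑ v, ∑ w, if o v w then x v * y w else 0 := by
  simp [eul, Matrix.toLinearMap₂'_apply, mul_sub, Finset.sum_sub_distrib, mul_comm, mul_left_comm]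

theorem eul_left {V : Type} [Fintype V] {R : Type} [CommRing R] (o : V → V → Prop) (u : V) (y : V → R) :
    eul R o (bv R u) y = y u - ∑ w, if o u w then y w else 0 := by
  rw [eul_apply]
  congr 1
  · simp [bv, Pi.single_apply]
  · rw [Finset.sum_eq_single u]
    · simp [bv]
    · intro v _ hv; simp [bv, Pi.single_apply, hv]
    · simp

theorem eul_right {V : Type} [Fintype V] {R : Type} [CommRing R] (o : V → V → Prop) (u : V) (y : V → R) :
    eul R o y (bv R u) = y u - ∑ w, if o w u then y w else 0 := by
  rw [eul_apply]
  congr 1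
  · simp [bv, Pi.single_apply]
  · refine Finset.sum_congr rfl fun v _ => ?_
    rw [Finset.sum_eq_single u]
    · simp [bv]
    · intro v _ hv; simp [bv, Pi.single_apply, hv]
    · simp

theorem eul_toward_left {V : Type} [Fintype V] {R : Type} [CommRing R] {G : SimpleGraph V} {v : V}
    (T : Rooted G v) (u : V) (y : V → R) :
    eul R T.toward (bv R u) y = y u - if u = v then 0 else y (T.par u) := by
  rw [eul_left]
  by_cases h : u = v <;> simp [Rooted.toward, h]

theorem eul_toward_right {V : Type} [Fintype V] {R : Type} [CommRing R] {G : SimpleGraph V} {v : V}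
    (T : Rooted G v) (u : V) (y : V → R) :
    eul R T.toward y (bv R u) = y u - ∑ c, if c ≠ v ∧ u = T.par c then y c else 0 := by
  rw [eul_right]
  refine congrArg _ (Finset.sum_congr rfl fun c _ => ?_)
  by_cases h : c ≠ v ∧ u = T.par c
  · rw [if_pos h, if_pos (show T.toward c u from h)]
  · rw [if_neg h, if_neg (show ¬ T.toward c u from h)]

def Coh {V : Type} (x : V → ℤ) : Prop := (∀ v, 0 ≤ x v) ∨ (∀ v, x v ≤ 0)

theorem vec_eq_sum {V : Type} [Fintype V] {R : Type} [CommRing R] (x : V → R) :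
    x = ∑ v, x v • bv R v := by
  funext w; simp [bv, Pi.single_apply]

theorem bv_apply {V : Type} {R : Type} [CommRing R] (v w : V) :
    bv R v w = if w = v then 1 else 0 := by simp [bv, Pi.single_apply]

theorem bv_inj {V : Type} {R : Type} [CommRing R] [Nontrivial R] {v w : V} (h : bv R v = bv R w) :
    v = w := by
  have := congrFun h v
  simp [bv_apply] at this
  exact this

theorem perm_iso {V V' : Type} [Fintype V] [Fintype V'] {G : SimpleGraph V} {G' : SimpleGraph V'}
    {o : V → V → Prop} {o' : V' → V' → Prop} (ho : IsOrientation G o) (ho' : IsOrientation G' o')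
    (φ : (V → ℤ) ≃ₗ[ℤ] (V' → ℤ)) (iso : ∀ x y, eul ℤ o' (φ x) (φ y) = eul ℤ o x y)
    (h1 : ∀ v, ∃ y, φ (bv ℤ v) = bv ℤ y) (h2 : ∀ y, ∃ v, φ (bv ℤ v) = bv ℤ y) :
    Nonempty (G ≃g G') := by
  choose f hf using h1
  have hb : Function.Bijective f := by
    constructor
    · intro a b hab
      have : φ (bv ℤ a) = φ (bv ℤ b) := by rw [hf, hf, hab]
      exact bv_inj (φ.injective this)
    · intro y
      obtain ⟨v, hv⟩ := h2 y
      exact ⟨v, bv_inj ((hf v).symm.trans hv)⟩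
  have key : ∀ {V : Type} [Fintype V] {G : SimpleGraph V} {o : V → V → Prop}
      (_ : IsOrientation G o) (a b : V),
      G.Adj a b ↔ a ≠ b ∧ eul ℤ o (bv ℤ a) (bv ℤ b) + eul ℤ o (bv ℤ b) (bv ℤ a) < 0 := by
    intro V _ G o ho a b
    rw [eul_left, eul_left]
    simp only [bv_apply]
    have e1 : ∀ a b, (∑ w, if o a w then (if w = b then (1 : ℤ) else 0) else 0)
        = if o a b then 1 else 0 := by
      intro a b
      rw [Finset.sum_eq_single b] <;> simp +contextual
    rw [e1, e1]
    by_cases hab : a = b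
    · simp [hab]
    have := ho.1 a b
    have h3 := ho.2 a b
    simp only [hab, Ne.symm hab, if_false, this, ne_eq, not_false_eq_true, true_and, Ne.symm]
    by_cases p : o a b <;> by_cases q : o b a <;> simp [p, q]
  refine ⟨⟨Equiv.ofBijective f hb, ?_⟩⟩
  intro a b
  rw [key ho' _ _, key ho]
  simp only [Equiv.ofBijective_apply, ← hf, iso, ne_eq, hb.1.eq_iff]

section caseT
variable {V V' : Type} [Fintype V] [Fintype V'] {G : SimpleGraph V} {G' : SimpleGraph V'}
  {v : V} {x : V'} (T : Rooted G v) (T' : Rooted G' x)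

def SS (φ : (V → ℤ) ≃ₗ[ℤ] (V' → ℤ)) (n : ℕ) : Prop :=
  (∀ w, T.dep w ≤ n → ∃ y, T'.dep y = T.dep w ∧ φ (bv ℤ w) = bv ℤ y) ∧
  (∀ y, T'.dep y ≤ n → ∃ w, T.dep w = T'.dep y ∧ φ (bv ℤ w) = bv ℤ y)

theorem SS.symm {φ : (V → ℤ) ≃ₗ[ℤ] (V' → ℤ)} {n : ℕ} (h : SS T T' φ n) : SS T' T φ.symm n := by
  refine ⟨fun w hw => ?_, fun w hw => ?_⟩
  · obtain ⟨y, h1, h2⟩ := h.2 w hw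
    exact ⟨y, h1, by rw [← h2]; simp⟩
  · obtain ⟨y, h1, h2⟩ := h.1 w hw
    exact ⟨y, h1, by rw [← h2]; simp⟩

variable (φ : (V → ℤ) ≃ₗ[ℤ] (V' → ℤ))
  (iso : ∀ a b, eul ℤ T'.toward (φ a) (φ b) = eul ℤ T.toward a b)
  (sg : ∀ w, Coh (φ (bv ℤ w)))
include iso

theorem lemA {n : ℕ} (hS : SS T T' φ n) (w : V) (hw : n + 1 ≤ T.dep w) (d : ℕ) :
    ∀ y, T'.dep y = d → d ≤ n → φ (bv ℤ w) y = 0 := by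
  induction d using Nat.strong_induction_on with
  | _ d ih =>
  intro y hy hd
  obtain ⟨u, hu, hu2⟩ := hS.2 y (by omega)
  have h1 := iso (bv ℤ u) (bv ℤ w)
  rw [hu2, eul_toward_left, eul_toward_left, bv_apply, bv_apply] at h1
  have hne : u ≠ w := by rintro rfl; omega
  rw [if_neg hne] at h1
  have h2 : (if y = x then 0 else φ (bv ℤ w) (T'.par y)) = 0 := by
    split_ifs with h
    · rfl
    · have := T'.dep_par y h
      exact ih (T'.dep (T'.par y)) (by omega) _ rfl (by omega)
  have h3 : (if u = v then 0 else if T.par u = w then (1 : ℤ) else 0) = 0 := by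
    split_ifs with h h'
    · rfl
    · have := T.dep_par u h
      rw [h'] at this; omega
    · rfl
  rw [h2, h3] at h1
  simpa using h1

theorem lemB {n : ℕ} (hS : SS T T' φ n) (w : V) (hw : n + 1 ≤ T.dep w) (y : V') (hy : T'.dep y ≤ n)
    (u : V) (hu : φ (bv ℤ u) = bv ℤ y) (hud : T.dep u = T'.dep y) :
    (∑ c, if c ≠ x ∧ y = T'.par c then φ (bv ℤ w) c else 0) = if u = T.par w then 1 else 0 := by
  have h1 := iso (bv ℤ w) (bv ℤ u)
  rw [hu, eul_toward_right, eul_toward_left, lemA T T' φ iso hS w hw _ y rfl hy, bv_apply, bv_apply] at h1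
  have hne : w ≠ u := by rintro rfl; omega
  have hwv : w ≠ v := by rintro rfl; rw [T.dep_root] at hw; omega
  rw [if_neg hne, if_neg hwv] at h1
  simp only [eq_comm (a := u)]
  linarith

include sg

theorem lemC {n : ℕ} (hS : SS T T' φ n) (w : V) (hw : n + 2 ≤ T.dep w) (y : V')
    (hy : T'.dep y ≤ n + 1) : φ (bv ℤ w) y = 0 := by
  rcases Nat.lt_or_ge n (T'.dep y) with h | h
  · have hyx : y ≠ x := by rintro rfl; rw [T'.dep_root] at h; omega
    have hp := T'.dep_par y hyx
    obtain ⟨u, hu, hu2⟩ := hS.2 (T'.par y) (by omega)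
    have h1 := lemB T T' φ iso hS w (by omega) _ (by omega) u hu2 hu
    have hwv : w ≠ v := by rintro rfl; rw [T.dep_root] at hw; omega
    rw [if_neg (by rintro rfl; have := T.dep_par w hwv; omega)] at h1
    have h2 : ∀ c ∈ Finset.univ, (if c ≠ x ∧ T'.par y = T'.par c then φ (bv ℤ w) c else 0) = 0 := by
      rcases sg w with hs | hs
      · exact (Finset.sum_eq_zero_iff_of_nonneg (fun c _ => by split_ifs; exacts [hs c, le_rfl])).1 h1
      · exact (Finset.sum_eq_zero_iff_of_nonpos (fun c _ => by split_ifs; exacts [hs c, le_rfl])).1 h1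
    simpa [hyx] using h2 y (Finset.mem_univ y)
  · exact lemA T T' φ iso hS w (by omega) _ y rfl h

theorem lemD {n : ℕ} (hS : SS T T' φ n) (w : V) (hw : T.dep w = n + 1) :
    ∃ c, T'.dep c = n + 1 ∧ ∀ y, T'.dep y ≤ n + 1 → φ (bv ℤ w) y = bv ℤ c y := by
  have hwv : w ≠ v := by rintro rfl; rw [T.dep_root] at hw; omega
  have hdp := T.dep_par w hwv
  obtain ⟨y0, hy0, hy1⟩ := hS.1 (T.par w) (by omega)
  have h0 := lemB T T' φ iso hS w (by omega) y0 (by omega) _ hy1 hy0.symm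
  rw [if_pos rfl] at h0
  have hpos : ∀ y, 0 ≤ φ (bv ℤ w) y := by
    rcases sg w with hs | hs
    · exact hs
    · have : (∑ c, if c ≠ x ∧ y0 = T'.par c then φ (bv ℤ w) c else 0) ≤ 0 :=
        Finset.sum_nonpos fun c _ => by split_ifs; exacts [hs c, le_rfl]
      omega
  obtain ⟨c, _, hc⟩ : ∃ c ∈ Finset.univ, (if c ≠ x ∧ y0 = T'.par c then φ (bv ℤ w) c else 0) ≠ 0 := by
    by_contra hcon; push Not at hcon
    rw [Finset.sum_eq_zero hcon] at h0; omega
  have hc1 : c ≠ x ∧ y0 = T'.par c := by by_contra h; simp only [if_neg h] at hc; exact hc rfl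
  rw [if_pos hc1] at hc
  have hdc : T'.dep c = n + 1 := by
    have := T'.dep_par c hc1.1; rw [← hc1.2] at this; omega
  rw [← Finset.add_sum_erase _ _ (Finset.mem_univ c), if_pos hc1] at h0
  have hnn : ∀ z ∈ Finset.univ.erase c, 0 ≤ (if z ≠ x ∧ y0 = T'.par z then φ (bv ℤ w) z else 0) :=
    fun z _ => by split_ifs; exacts [hpos z, le_rfl]
  have hsn := Finset.sum_nonneg hnn
  have hcp := hpos c
  have hc2 : φ (bv ℤ w) c = 1 := by omega
  have hs0 := (Finset.sum_eq_zero_iff_of_nonneg hnn).1 (by omega)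
  refine ⟨c, hdc, fun y hy => ?_⟩
  rw [bv_apply]
  split_ifs with hyc
  · rw [hyc, hc2]
  rcases Nat.lt_or_ge n (T'.dep y) with h | h
  · have hyx : y ≠ x := by rintro rfl; rw [T'.dep_root] at h; omega
    have hp := T'.dep_par y hyx
    by_cases hpy : T'.par y = y0
    · simpa [hyx, hpy] using hs0 y (by simp [hyc])
    obtain ⟨u, hu, hu2⟩ := hS.2 (T'.par y) (by omega)
    have h1 := lemB T T' φ iso hS w (by omega) _ (by omega) u hu2 hu
    rw [if_neg (by rintro rfl; rw [hu2] at hy1; exact hpy (bv_inj hy1))] at h1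
    have h2 := (Finset.sum_eq_zero_iff_of_nonneg (fun c _ => by split_ifs; exacts [hpos c, le_rfl])).1 h1
    simpa [hyx] using h2 y (Finset.mem_univ y)
  · exact lemA T T' φ iso hS w (by omega) _ y rfl h

variable (sg' : ∀ y, Coh (φ.symm (bv ℤ y)))

include sg'

theorem lemE {n : ℕ} (hS : SS T T' φ n) (w : V) (hw : T.dep w = n + 1) :
    ∃ c, T'.dep c = T.dep w ∧ φ (bv ℤ w) = bv ℤ c := by
  obtain ⟨c, hc, hcy⟩ := lemD T T' φ iso sg hS w hw
  refine ⟨c, by omega, ?_⟩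
  set f := φ (bv ℤ w) - bv ℤ c with hf
  have hf0 : ∀ y, T'.dep y ≤ n + 1 → f y = 0 := fun y hy => by simp [hf, hcy y hy]
  have hEf : ∀ w', n + 2 ≤ T.dep w' → eul ℤ T'.toward f (φ (bv ℤ w')) = 0 := by
    intro w' hw'
    rw [hf, map_sub, LinearMap.sub_apply, iso, eul_toward_left, eul_toward_left, bv_apply, bv_apply]
    rw [lemC T T' φ iso sg hS w' hw' c (by omega), if_neg (by rintro rfl; omega)]
    have hwv : w ≠ v := by rintro rfl; rw [T.dep_root] at hw; omega
    have hcx : c ≠ x := by rintro rfl; rw [T'.dep_root] at hc; omega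
    rw [if_neg hwv, if_neg hcx]
    have hp := T.dep_par w hwv
    have hp' := T'.dep_par c hcx
    rw [lemC T T' φ iso sg hS w' hw' (T'.par c) (by omega), if_neg (by rintro rfl; omega)]
    simp
  by_contra hne
  have hfn : ∃ y, f y ≠ 0 := by
    by_contra h; push Not at h
    exact hne (sub_eq_zero.1 (funext h))
  obtain ⟨y, hy, hmax⟩ := Finset.exists_max_image (Finset.univ.filter fun y => f y ≠ 0) T'.dep
    (by obtain ⟨y, hy⟩ := hfn; exact ⟨y, by simpa using hy⟩)
  simp only [Finset.mem_filter, Finset.mem_univ, true_and] at hy hmax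
  have hdy : n + 2 ≤ T'.dep y := by
    by_contra h; exact hy (hf0 y (by omega))
  have h1 : eul ℤ T'.toward f (bv ℤ y) = f y := by
    rw [eul_toward_right, Finset.sum_eq_zero, sub_zero]
    intro c _
    split_ifs with h
    · by_contra h'
      have := hmax c h'
      have h3 := T'.dep_par c h.1
      rw [← h.2] at h3; omega
    · rfl
  have h2 : bv ℤ y = φ (φ.symm (bv ℤ y)) := by simp
  have iso' : ∀ a b, eul ℤ T.toward (φ.symm a) (φ.symm b) = eul ℤ T'.toward a b := by
    intro a b; rw [← iso]; simp
  have h3 := lemC T' T φ.symm iso' sg' hS.symm y hdy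
  rw [h2, vec_eq_sum (φ.symm (bv ℤ y)), map_sum, map_sum, Finset.sum_eq_zero] at h1
  · exact hy h1.symm
  · intro w' _
    rw [map_smul, map_smul]
    rcases Nat.lt_or_ge (n + 1) (T.dep w') with h | h
    · rw [hEf w' h, smul_zero]
    · rw [h3 w' h, zero_smul]

theorem caseT_iso (h0 : φ (bv ℤ v) = bv ℤ x) : Nonempty (G ≃g G') := by
  have iso' : ∀ a b, eul ℤ T.toward (φ.symm a) (φ.symm b) = eul ℤ T'.toward a b := by
    intro a b; rw [← iso]; simp
  have root : ∀ {V : Type} {G : SimpleGraph V} {v : V} (T : Rooted G v) (w : V),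
      T.dep w = 0 → w = v := by
    intro V G v T w h; by_contra h'; have := T.dep_par w h'; omega
  have hS : ∀ n, SS T T' φ n := by
    intro n
    induction n with
    | zero =>
      refine ⟨fun w hw => ?_, fun y hy => ?_⟩
      · have := root T w (by omega)
        subst this
        exact ⟨x, by rw [T.dep_root, T'.dep_root], h0⟩
      · have := root T' y (by omega)
        subst this
        exact ⟨v, by rw [T.dep_root, T'.dep_root], h0⟩
    | succ n ih =>
      refine ⟨fun w hw => ?_, fun y hy => ?_⟩
      · rcases Nat.lt_or_ge n (T.dep w) with h | h
        · exact lemE T T' φ iso sg sg' ih w (by omega)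
        · exact ih.1 w h
      · rcases Nat.lt_or_ge n (T'.dep y) with h | h
        · obtain ⟨c, h1, h2⟩ := lemE T' T φ.symm iso' sg' (by simpa using sg) ih.symm y (by omega)
          exact ⟨c, h1, by rw [← h2]; simp⟩
        · exact ih.2 y h
  refine perm_iso T.toward_orient T'.toward_orient φ iso (fun w => ?_) (fun y => ?_)
  · obtain ⟨y, _, h⟩ := (hS _).1 w le_rfl; exact ⟨y, h⟩
  · obtain ⟨y, _, h⟩ := (hS _).2 y le_rfl; exact ⟨y, h⟩

end caseT
end comb2
end QN

namespace QN
set_option linter.all false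
section comb3
open Classical

/-- sum over neighbours -/
noncomputable def nbr {V : Type} [Fintype V] {R : Type} [CommRing R] (G : SimpleGraph V) (x : V → R)
    (i : V) : R := ∑ w, if G.Adj i w then x w else 0

theorem nbr_add {V : Type} [Fintype V] {R : Type} [CommRing R] (G : SimpleGraph V) (x y : V → R) (i : V) :
    nbr G (x + y) i = nbr G x i + nbr G y i := by
  simp only [nbr, ← Finset.sum_add_distrib]
  refine Finset.sum_congr rfl fun w _ => ?_
  split_ifs <;> simp

theorem nbr_smul {V : Type} [Fintype V] {R : Type} [CommRing R] (G : SimpleGraph V) (c : R) (x : V → R) (i : V) :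
    nbr G (c • x) i = c * nbr G x i := by
  simp only [nbr, Finset.mul_sum]
  refine Finset.sum_congr rfl fun w _ => ?_
  split_ifs <;> simp

/-- reflection -/
noncomputable def reflFun {V : Type} [Fintype V] (G : SimpleGraph V) (i : V) :
    (V → ℤ) →ₗ[ℤ] (V → ℤ) where
  toFun x := Function.update x i (- x i + nbr G x i)
  map_add' x y := by
    funext w
    by_cases h : w = i
    · subst h; simp [nbr_add]; ring
    · simp [h]
  map_smul' c x := by
    funext w
    by_cases h : w = i
    · subst h
      simp only [Function.update_self, Pi.smul_apply, nbr_smul, smul_eq_mul, RingHom.id_apply]; ring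
    · simp [h]

theorem nbr_update {V : Type} [Fintype V] (G : SimpleGraph V) (i : V) (x : V → ℤ) (a : ℤ) :
    nbr G (Function.update x i a) i = nbr G x i := by
  simp only [nbr]
  refine Finset.sum_congr rfl fun w _ => ?_
  by_cases h : w = i
  · subst h; simp
  · simp [h]

noncomputable def refl {V : Type} [Fintype V] (G : SimpleGraph V) (i : V) :
    (V → ℤ) ≃ₗ[ℤ] (V → ℤ) :=
  LinearEquiv.ofInvolutive (reflFun G i) (by
    intro x
    funext w
    simp only [reflFun, LinearMap.coe_mk, AddHom.coe_mk]
    by_cases h : w = i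
    · subst h; simp [nbr_update]
    · simp [h])

theorem refl_apply {V : Type} [Fintype V] (G : SimpleGraph V) (i : V) (x : V → ℤ) (w : V) :
    refl G i x w = if w = i then - x i + nbr G x i else x w := by
  simp only [refl, LinearEquiv.coe_ofInvolutive, reflFun, LinearMap.coe_mk, AddHom.coe_mk]
  by_cases h : w = i
  · subst h; simp
  · simp [h]

theorem refl_refl {V : Type} [Fintype V] (G : SimpleGraph V) (i : V) (x : V → ℤ) :
    refl G i (refl G i x) = x := by
  funext w
  rw [refl_apply]
  split_ifs with h
  · subst h
    have : nbr G (refl G w x) w = nbr G x w := by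
      simp only [nbr]
      refine Finset.sum_congr rfl fun z _ => ?_
      rw [refl_apply]
      by_cases h : z = w
      · subst h; simp
      · simp [h]
    rw [this, refl_apply]; simp
  · rw [refl_apply, if_neg h]

theorem nbr_bv {V : Type} [Fintype V] (G : SimpleGraph V) (i v : V) :
    nbr G (bv ℤ v) i = if G.Adj i v then 1 else 0 := by
  simp only [nbr, bv_apply]
  rw [Finset.sum_eq_single v] <;> simp +contextual

theorem refl_bv_of_not_adj {V : Type} [Fintype V] (G : SimpleGraph V) (i v : V) (h : i ≠ v)
    (h' : ¬ G.Adj i v) : refl G i (bv ℤ v) = bv ℤ v := by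
  funext w
  rw [refl_apply]
  split_ifs with hw
  · rw [nbr_bv, if_neg h', hw, bv_apply, if_neg h]; simp
  · rfl

/-- The family of maps induced by derived equivalences. -/
structure Fam {V V' : Type} [Fintype V] [Fintype V'] (G : SimpleGraph V) (G' : SimpleGraph V')
    (I : (V → V → Prop) → (V' → V' → Prop) → ((V → ℤ) ≃ₗ[ℤ] (V' → ℤ)) → Prop) : Prop where
  or1 : ∀ o o' φ, I o o' φ → IsOrientation G o
  or2 : ∀ o o' φ, I o o' φ → IsOrientation G' o'
  iso : ∀ o o' φ, I o o' φ → ∀ x y, eul ℤ o' (φ x) (φ y) = eul ℤ o x y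
  sg : ∀ o o' φ, I o o' φ → ∀ v, Coh (φ (bv ℤ v))
  sg' : ∀ o o' φ, I o o' φ → ∀ v, Coh (φ.symm (bv ℤ v))
  neg : ∀ o o' φ, I o o' φ → I o o' (φ.trans (LinearEquiv.neg ℤ))
  left : ∀ o o' φ i, I o o' φ → (IsSink o i ∨ IsSource o i) → I (flipAt i o) o' ((refl G i).trans φ)
  right : ∀ o o' φ i, I o o' φ → (IsSink o' i ∨ IsSource o' i) → I o (flipAt i o') (φ.trans (refl G' i))

theorem not_adj_of_sinks {V : Type} {G : SimpleGraph V} {o : V → V → Prop} (ho : IsOrientation G o)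
    {i v : V} (hi : IsSink o i) (hv : IsSink o v) : ¬ G.Adj i v := by
  intro h
  rcases (ho.1 _ _).1 h with h | h
  · exact hi _ h
  · exact hv _ h

theorem sink_flip {V : Type} {G : SimpleGraph V} {o : V → V → Prop} (ho : IsOrientation G o)
    {i v : V} (hi : IsSink o i) (hv : IsSink o v) (hne : i ≠ v) : IsSink (flipAt i o) v := by
  intro w hw
  simp only [flipAt] at hw
  split_ifs at hw with h
  · rcases h with h | h
    · exact hne h.symm
    · subst h; exact hi _ hw
  · exact hv _ hw

section
variable {V V' : Type} [Fintype V] [Fintype V'] {G : SimpleGraph V} {G' : SimpleGraph V'}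
  {I : (V → V → Prop) → (V' → V' → Prop) → ((V → ℤ) ≃ₗ[ℤ] (V' → ℤ)) → Prop}

theorem Fam.caseT (F : Fam G G' I) (hG : G.IsTree) (hG' : G'.IsTree) {o o' φ} (h : I o o' φ)
    {v : V} {x : V'} (hv : IsSink o v) (hx : IsSink o' x) (he : φ (bv ℤ v) = bv ℤ x) :
    Nonempty (G ≃g G') := by
  obtain ⟨T⟩ := exists_rooted hG v
  obtain ⟨T'⟩ := exists_rooted hG' x
  have h1 : ∀ t, Relation.ReflTransGen (StepAway v) o t →
      IsSink t v ∧ ∃ φ, I t o' φ ∧ φ (bv ℤ v) = bv ℤ x := by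
    intro t ht
    induction ht with
    | refl => exact ⟨hv, φ, h, he⟩
    | tail _ hs ih =>
      obtain ⟨hsv, φ, h, he⟩ := ih
      obtain ⟨i, hi, hsi, rfl⟩ := hs
      have ho := F.or1 _ _ _ h
      refine ⟨sink_flip ho hsi hsv hi, _, F.left _ _ _ i h (Or.inl hsi), ?_⟩
      rw [LinearEquiv.trans_apply, refl_bv_of_not_adj _ _ _ hi (not_adj_of_sinks ho hsi hsv), he]
  obtain ⟨hsv, φ1, h1, he1⟩ := h1 _ (lemmaT T o (F.or1 _ _ _ h))
  have h2 : ∀ t, Relation.ReflTransGen (StepAway x) o' t →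
      IsSink t x ∧ ∃ φ, I T.toward t φ ∧ φ (bv ℤ v) = bv ℤ x := by
    intro t ht
    induction ht with
    | refl => exact ⟨hx, φ1, h1, he1⟩
    | tail _ hs ih =>
      obtain ⟨hsv, φ, h, he⟩ := ih
      obtain ⟨i, hi, hsi, rfl⟩ := hs
      have ho := F.or2 _ _ _ h
      refine ⟨sink_flip ho hsi hsv hi, _, F.right _ _ _ i h (Or.inl hsi), ?_⟩
      rw [LinearEquiv.trans_apply, he, refl_bv_of_not_adj _ _ _ hi (not_adj_of_sinks ho hsi hsv)]
  obtain ⟨_, φ2, h2, he2⟩ := h2 _ (lemmaT T' o' (F.or2 _ _ _ h))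
  exact caseT_iso T T' φ2 (F.iso _ _ _ h2) (F.sg _ _ _ h2) (F.sg' _ _ _ h2) he2

theorem Fam.caseT' (F : Fam G G' I) (hG : G.IsTree) (hG' : G'.IsTree) {o o' φ} (h : I o o' φ)
    {v : V} {x : V'} (hv : IsSink o v) (hx : IsSink o' x) (c : ℤ) (he : φ (bv ℤ v) = c • bv ℤ x) :
    Nonempty (G ≃g G') := by
  have h1 := F.iso _ _ _ h (bv ℤ v) (bv ℤ v)
  have self : ∀ {V : Type} [Fintype V] {o : V → V → Prop} {v : V} (_ : IsSink o v),
      eul ℤ o (bv ℤ v) (bv ℤ v) = 1 := by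
    intro V _ o v hv
    rw [eul_left, Finset.sum_eq_zero]
    · simp [bv_apply]
    · intro w _; simp [hv w]
  rw [he, map_smul, map_smul, LinearMap.smul_apply, self hv, self hx] at h1
  have : c * c = 1 := by simpa using h1
  rcases mul_self_eq_one_iff.1 this with rfl | rfl
  · exact F.caseT hG hG' h hv hx (by simpa using he)
  · exact F.caseT hG hG' (F.neg _ _ _ h) hv hx (by simp [he])

/-- nonnegativity is preserved by reflections unless case T -/
theorem Fam.pos_pres (F : Fam G G' I) (hG : G.IsTree) (hG' : G'.IsTree) (hno : ¬ Nonempty (G ≃g G'))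
    {o o' φ} (h : I o o' φ) {v : V} (hv : IsSink o v) {i : V'} (hi : IsSink o' i ∨ IsSource o' i)
    (hp : ∀ y, 0 ≤ φ (bv ℤ v) y) : ∀ y, 0 ≤ refl G' i (φ (bv ℤ v)) y := by
  have h' := F.right _ _ _ i h hi
  rcases F.sg _ _ _ h' v with hs | hs
  · exact hs
  · exfalso
    apply hno
    have h0 : ∀ y, y ≠ i → φ (bv ℤ v) y = 0 := by
      intro y hy
      have := hs y
      rw [LinearEquiv.trans_apply, refl_apply, if_neg hy] at this
      exact le_antisymm this (hp y)
    have h1 : φ (bv ℤ v) = (φ (bv ℤ v) i) • bv ℤ i := by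
      funext y
      by_cases hy : y = i
      · subst hy; simp [bv_apply]
      · rw [h0 y hy]; simp [bv_apply, hy]
    rcases hi with hi | hi
    · exact F.caseT' hG hG' h hv hi _ h1
    · refine F.caseT' hG hG' h' hv (flipAt_source hi) (-(φ (bv ℤ v) i)) ?_
      rw [LinearEquiv.trans_apply]
      funext y
      rw [refl_apply]
      split_ifs with hy
      · subst hy
        have : nbr G' (φ (bv ℤ v)) y = 0 := by
          rw [nbr, Finset.sum_eq_zero]
          intro w _
          split_ifs with hw
          · exact h0 w (fun e => by subst e; exact G'.loopless.irrefl _ hw)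
          · rfl
        rw [this]; simp [bv_apply]
      · rw [h0 y hy]; simp [bv_apply, hy]

/-- reverse orientation -/
def opp {V : Type} (o : V → V → Prop) : V → V → Prop := fun a b => o b a

/-- partial bipartite reflection -/
theorem Fam.cox (F : Fam G G' I) (hG : G.IsTree) (hG' : G'.IsTree) (hno : ¬ Nonempty (G ≃g G'))
    {o o' φ} (h : I o o' φ) {v : V} (hv : IsSink o v) (C : V' → Prop)
    (hC : ∀ a b, G'.Adj a b → (C a ↔ ¬ C b))
    (hs : (∀ i, C i → IsSink o' i) ∨ (∀ i, C i → IsSource o' i))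
    (hp : ∀ y, 0 ≤ φ (bv ℤ v) y) :
    ∃ φ', I o (opp o') φ' ∧ (∀ y, 0 ≤ φ' (bv ℤ v) y) ∧
      ∀ i, φ' (bv ℤ v) i = if C i then - φ (bv ℤ v) i + nbr G' (φ (bv ℤ v)) i else φ (bv ℤ v) i := by
  have ho' := F.or2 _ _ _ h
  have main : ∀ S : Finset V', (∀ i ∈ S, C i) →
      ∃ φ', I o (fun a b => if a ∈ S ∨ b ∈ S then o' b a else o' a b) φ' ∧
        (∀ y, 0 ≤ φ' (bv ℤ v) y) ∧
        ∀ i, φ' (bv ℤ v) i = if i ∈ S then - φ (bv ℤ v) i + nbr G' (φ (bv ℤ v)) i else φ (bv ℤ v) i := by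
    intro S
    induction S using Finset.induction_on with
    | empty => intro _; exact ⟨φ, by simpa using h, hp, by simp⟩
    | insert i S hi ih =>
      intro hS
      obtain ⟨φ1, h1, hp1, he1⟩ := ih (fun j hj => hS j (Finset.mem_insert_of_mem hj))
      have hCi : C i := hS i (Finset.mem_insert_self _ _)
      have nadj : ∀ w, C w → ¬ o' i w ∧ ¬ o' w i := by
        intro w hw
        constructor <;> intro hh
        · exact (hC i w ((ho'.1 _ _).2 (Or.inl hh))).1 hCi hw
        · exact (hC i w ((ho'.1 _ _).2 (Or.inr hh))).1 hCi hw
      have hss : IsSink (fun a b => if a ∈ S ∨ b ∈ S then o' b a else o' a b) i ∨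
          IsSource (fun a b => if a ∈ S ∨ b ∈ S then o' b a else o' a b) i := by
        refine hs.imp (fun hs w hw => ?_) (fun hs w hw => ?_)
        · simp only [hi, false_or] at hw
          split_ifs at hw with hwS
          · exact (nadj w (hS w (Finset.mem_insert_of_mem hwS))).2 hw
          · exact hs i hCi w hw
        · simp only [hi, or_false] at hw
          split_ifs at hw with hwS
          · exact (nadj w (hS w (Finset.mem_insert_of_mem hwS))).1 hw
          · exact hs i hCi w hw
      refine ⟨φ1.trans (refl G' i), ?_, F.pos_pres hG hG' hno h1 hv hss hp1, ?_⟩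
      · convert F.right _ _ _ i h1 hss using 1
        funext a b
        simp only [flipAt, Finset.mem_insert, eq_iff_iff]
        by_cases ha : a = i
        · subst ha
          by_cases hb : b ∈ S
          · have := nadj b (hS b (Finset.mem_insert_of_mem hb))
            simp [this, hb]
          · simp [hb, hi]
        · by_cases hbi : b = i
          · subst hbi
            by_cases ha' : a ∈ S
            · have := nadj a (hS a (Finset.mem_insert_of_mem ha'))
              simp [this, ha']
            · simp [ha', hi]
          · simp [ha, hbi]
      · intro j
        rw [LinearEquiv.trans_apply, refl_apply]
        by_cases hj : j = i
        · subst hj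
          rw [if_pos rfl, if_pos (Finset.mem_insert_self _ _), he1, if_neg hi]
          congr 1
          simp only [nbr]
          refine Finset.sum_congr rfl fun w _ => ?_
          split_ifs with hw
          · rw [he1, if_neg]
            intro hwS
            exact (hC _ _ hw).1 hCi (hS w (Finset.mem_insert_of_mem hwS))
          · rfl
        · rw [if_neg hj, he1]
          simp [hj]
  obtain ⟨φ', h1, h2, h3⟩ := main (Finset.univ.filter C) (by simp)
  refine ⟨φ', ?_, h2, by simpa using h3⟩
  convert h1 using 1
  funext a b
  simp only [opp, Finset.mem_filter, Finset.mem_univ, true_and, eq_iff_iff]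
  by_cases hab : G'.Adj a b
  · have := hC a b hab
    by_cases hb : C b <;> simp [this, hb]
  · have h4 : ¬ o' a b := fun h => hab ((ho'.1 _ _).2 (Or.inl h))
    have h5 : ¬ o' b a := fun h => hab ((ho'.1 _ _).2 (Or.inr h))
    simp [h4, h5]

end

/-- Perron vector -/
theorem perron {V : Type} [Fintype V] (G : SimpleGraph V) (hG : G.Connected) :
    ∃ (l : ℝ) (y : V → ℝ), (∀ v, 0 < y v) ∧ ∀ v, nbr G y v = l * y v := by
  haveI : Nonempty V := hG.nonempty
  let q : (V → ℝ) → ℝ := fun x => ∑ v, x v * nbr G x v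
  have hq : Continuous q := by
    refine continuous_finsetSum _ fun v _ => (continuous_apply v).mul ?_
    refine continuous_finsetSum _ fun w _ => ?_
    split_ifs
    · exact continuous_apply w
    · exact continuous_const
  let K : Set (V → ℝ) := {x | (∀ v, 0 ≤ x v) ∧ ∑ v, x v ^ 2 = 1}
  have hKc : IsCompact K := by
    refine Metric.isCompact_of_isClosed_isBounded ?_ ?_
    · refine IsClosed.inter ?_ ?_
      · have : {x : V → ℝ | ∀ v, 0 ≤ x v} = ⋂ v, {x | 0 ≤ x v} := by ext; simp
        change IsClosed {x : V → ℝ | ∀ v, 0 ≤ x v}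
        rw [this]
        exact isClosed_iInter fun v => isClosed_le continuous_const (continuous_apply v)
      · exact isClosed_eq (by fun_prop) continuous_const
    · refine (Metric.isBounded_closedBall (x := (0 : V → ℝ)) (r := 1)).subset ?_
      rintro x ⟨h0, h1⟩
      rw [mem_closedBall_zero_iff, pi_norm_le_iff_of_nonneg zero_le_one]
      intro v
      rw [Real.norm_eq_abs, abs_le_one_iff_mul_self_le_one]
      have := Finset.single_le_sum (f := fun v => x v ^ 2) (fun v _ => sq_nonneg _) (Finset.mem_univ v)
      nlinarith
  have hKn : K.Nonempty := by
    obtain ⟨v⟩ := ‹Nonempty V›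
    refine ⟨Pi.single v 1, fun w => ?_, ?_⟩
    · simp only [Pi.single_apply]; split_ifs <;> norm_num
    · simp [Pi.single_apply]
  obtain ⟨y, hyK, hmax⟩ := hKc.exists_isMaxOn hKn hq.continuousOn
  have hhom : ∀ (c : ℝ) x, q (c • x) = c ^ 2 * q x := by
    intro c x
    simp only [q, Finset.mul_sum, nbr_smul, Pi.smul_apply, smul_eq_mul]
    exact Finset.sum_congr rfl fun v _ => by ring
  have hle : ∀ x, q x ≤ q y * ∑ v, x v ^ 2 := by
    intro x
    let z : V → ℝ := fun v => |x v|
    have h1 : q x ≤ q z := by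
      refine Finset.sum_le_sum fun v _ => ?_
      simp only [nbr, Finset.mul_sum]
      refine Finset.sum_le_sum fun w _ => ?_
      split_ifs
      · rw [← abs_mul]; exact le_abs_self _
      · simp
    have h2 : ∑ v, x v ^ 2 = ∑ v, z v ^ 2 := by simp [z]
    rw [h2]
    refine h1.trans ?_
    by_cases h0 : ∑ v, z v ^ 2 = 0
    · have hz : z = 0 := by
        funext v
        have := (Finset.sum_eq_zero_iff_of_nonneg (fun v _ => sq_nonneg (z v))).1 h0 v (Finset.mem_univ v)
        simpa using this
      rw [hz]
      have := hhom 0 0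
      simp at this
      rw [this]; simp
    · have hpos : 0 < ∑ v, z v ^ 2 := lt_of_le_of_ne (Finset.sum_nonneg fun v _ => sq_nonneg _) (Ne.symm h0)
      set N := ∑ v, z v ^ 2 with hN
      have hmem : (Real.sqrt N)⁻¹ • z ∈ K := by
        refine ⟨fun v => mul_nonneg (by positivity) (abs_nonneg _), ?_⟩
        simp only [Pi.smul_apply, smul_eq_mul, mul_pow, ← Finset.mul_sum, ← hN, inv_pow,
          Real.sq_sqrt hpos.le]
        field_simp
      have := hmax hmem
      simp only [Set.mem_setOf_eq] at this
      rw [hhom, inv_pow, Real.sq_sqrt hpos.le] at this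
      rw [inv_mul_le_iff₀ hpos] at this
      linarith
  have heig : ∀ v, nbr G y v = q y * y v := by
    intro v
    have sym : ∑ u, y u * nbr G (Pi.single v (1 : ℝ)) u = nbr G y v := by
      simp only [nbr]
      refine Finset.sum_congr rfl fun w _ => ?_
      rw [Finset.sum_eq_single v]
      · by_cases h : G.Adj w v
        · simp [h, h.symm]
        · simp [h, show ¬ G.Adj v w from fun h' => h h'.symm]
      · intro b _ hb; simp [hb]
      · simp
    have hv0 : nbr G (Pi.single v (1 : ℝ)) v = 0 := by
      simp only [nbr]
      refine Finset.sum_eq_zero fun w _ => ?_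
      by_cases h : w = v
      · subst h; simp
      · simp [h]
    have ssum : ∀ f : V → ℝ, ∑ u, (Pi.single v 1 : V → ℝ) u * f u = f v := by
      intro f
      rw [Finset.sum_eq_single v]
      · simp
      · intro b _ hb; simp [hb]
      · simp
    have hexp : ∀ t : ℝ, q (y + t • Pi.single v 1) = q y + 2 * t * nbr G y v := by
      intro t
      simp only [q, nbr_add, nbr_smul, Pi.add_apply, Pi.smul_apply, smul_eq_mul]
      have : ∀ u, (y u + t * (Pi.single v 1 : V → ℝ) u) * (nbr G y u + t * nbr G (Pi.single v 1) u)
        = y u * nbr G y u + t * (y u * nbr G (Pi.single v 1) u)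
          + (Pi.single v 1 : V → ℝ) u * (t * nbr G y u + t ^ 2 * nbr G (Pi.single v 1) u) := by
        intro u; ring
      simp only [this, Finset.sum_add_distrib, ← Finset.mul_sum, sym, ssum, hv0]
      ring
    have hsq : ∀ t : ℝ, ∑ u, (y + t • (Pi.single v 1 : V → ℝ)) u ^ 2 = 1 + 2 * t * y v + t ^ 2 := by
      intro t
      have : ∀ u, (y + t • (Pi.single v 1 : V → ℝ)) u ^ 2
        = y u ^ 2 + (Pi.single v 1 : V → ℝ) u * (2 * t * y u + t ^ 2 * (Pi.single v 1 : V → ℝ) u) := by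
        intro u; simp only [Pi.add_apply, Pi.smul_apply, smul_eq_mul]; ring
      simp only [this, Finset.sum_add_distrib, hyK.2, ssum]
      simp; ring
    have hall : ∀ t : ℝ, 0 ≤ 2 * t * (q y * y v - nbr G y v) + q y * t ^ 2 := by
      intro t
      have := hle (y + t • Pi.single v 1)
      rw [hexp, hsq] at this
      nlinarith
    set c := q y * y v - nbr G y v with hc
    have hc0 : c = 0 := by
      by_contra hne
      have hq1 : 0 < |q y| + 1 := by positivity
      have h3 := hall (-c / (|q y| + 1))
      have h4 : 2 * (-c / (|q y| + 1)) * c + q y * (-c / (|q y| + 1)) ^ 2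
        = c ^ 2 * (q y - 2 * (|q y| + 1)) / (|q y| + 1) ^ 2 := by
        field_simp; ring
      rw [h4] at h3
      have h5 : c ^ 2 * (q y - 2 * (|q y| + 1)) < 0 := by
        have := le_abs_self (q y)
        have h6 : 0 < c ^ 2 := by positivity
        have h7 := abs_nonneg (q y)
        nlinarith
      have : c ^ 2 * (q y - 2 * (|q y| + 1)) / (|q y| + 1) ^ 2 < 0 := div_neg_of_neg_of_pos h5 (by positivity)
      linarith
    linarith
  refine ⟨q y, y, ?_, heig⟩
  have hzero : ∀ a b, G.Adj a b → y a = 0 → y b = 0 := by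
    intro a b hab ha
    have := heig a
    rw [ha, mul_zero, nbr, Finset.sum_eq_zero_iff_of_nonneg] at this
    · simpa [hab] using this b (Finset.mem_univ b)
    · intro w _; split_ifs; exacts [hyK.1 w, le_rfl]
  intro v
  rcases (hyK.1 v).lt_or_eq with h | h
  · exact h
  · exfalso
    have hz : ∀ w, y w = 0 := by
      intro w
      obtain ⟨p⟩ := hG.preconnected v w
      have : ∀ {a b : V} (p : G.Walk a b), y a = 0 → y b = 0 := by
        intro a b p
        induction p with
        | nil => exact id
        | cons h _ ih => exact fun ha => ih (hzero _ _ h ha)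
      exact this p h.symm
    have := hyK.2
    simp [hz] at this

/-- one-signed recurrences -/
theorem seqLemma (P : ℝ → ℝ → Prop) (l ρ : ℝ) (hρ : 1 ≤ ρ) (hl : l ≤ ρ + ρ⁻¹)
    (hstep : ∀ p q, P p q → P q (l * q - p)) (hnn : ∀ p q, P p q → 0 ≤ p ∧ 0 ≤ q)
    {p q : ℝ} (h : P p q) : p ≤ ρ * q := by
  by_contra hcon
  push Not at hcon
  have hρ0 : 0 < ρ := by linarith
  set δ := p / ρ - q with hδ
  have hδ0 : 0 < δ := by
    rw [hδ, sub_pos, lt_div_iff₀ hρ0]; linarith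
  have key : ∀ n : ℕ, ∃ a b, P a b ∧ δ ≤ a / ρ - b ∧ a ≤ p - n * δ := by
    intro n
    induction n with
    | zero => exact ⟨p, q, h, le_rfl, by simp⟩
    | succ n ih =>
      obtain ⟨a, b, hab, h1, h2⟩ := ih
      obtain ⟨ha, hb⟩ := hnn _ _ hab
      refine ⟨b, l * b - a, hstep _ _ hab, ?_, ?_⟩
      · have h3 : l * b ≤ (ρ + ρ⁻¹) * b := mul_le_mul_of_nonneg_right hl hb
        have h4 : b / ρ - (l * b - a) ≥ a - ρ * b := by
          have : b / ρ = ρ⁻¹ * b := by rw [div_eq_inv_mul]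
          nlinarith
        have h5 : a - ρ * b = ρ * (a / ρ - b) := by field_simp
        nlinarith
      · have h6 : a / ρ ≤ a := div_le_self ha hρ
        push_cast; linarith
  obtain ⟨n, hn⟩ := exists_nat_gt (p / δ)
  obtain ⟨a, b, hab, _, h2⟩ := key n
  have := (hnn _ _ hab).1
  rw [div_lt_iff₀ hδ0] at hn
  linarith

end comb3
end QN

namespace QN
set_option linter.all false
section comb4
open Classical

/-- bipartite orientation, sinks in `c` -/
def bip {V : Type} (G : SimpleGraph V) (c : V → Prop) : V → V → Prop :=
  fun a b => G.Adj a b ∧ ¬ c a ∧ c b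

noncomputable def SC {V : Type} [Fintype V] (c : V → Prop) (x y : V → ℝ) : ℝ :=
  ∑ a, if c a then x a * y a else 0

theorem SC_congr {V : Type} [Fintype V] {c : V → Prop} {x y x' y' : V → ℝ} (k : ℝ)
    (h : ∀ a, c a → x a * y a = k * (x' a * y' a)) : SC c x y = k * SC c x' y' := by
  simp only [SC, Finset.mul_sum]
  refine Finset.sum_congr rfl fun a _ => ?_
  split_ifs with ha
  · exact h a ha
  · simp

theorem SC_add {V : Type} [Fintype V] (c : V → Prop) (x y : V → ℝ) :
    ∑ a, x a * y a = SC c x y + SC (fun a => ¬ c a) x y := by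
  simp only [SC, ← Finset.sum_add_distrib]
  refine Finset.sum_congr rfl fun a _ => ?_
  by_cases h : c a <;> simp [h]

section
variable {V : Type} [Fintype V] {G : SimpleGraph V} {c : V → Prop}
  (hc : ∀ a b, G.Adj a b → (c a ↔ ¬ c b))
include hc

theorem bip_orient : IsOrientation G (bip G c) := by
  refine ⟨fun v w => ?_, fun v w h h' => h.2.1 h'.2.2⟩
  simp only [bip]
  constructor
  · intro h
    have := hc v w h
    by_cases hw : c w
    · exact Or.inl ⟨h, fun hv => this.1 hv hw, hw⟩
    · exact Or.inr ⟨h.symm, hw, this.2 hw⟩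
  · rintro (h | h)
    · exact h.1
    · exact h.1.symm

theorem eul_bip1 (x y : V → ℝ) :
    eul ℝ (bip G c) x y = SC c x y + SC (fun a => ¬ c a) x y - SC (fun a => ¬ c a) x (nbr G y) := by
  rw [eul_apply, SC_add c]
  congr 1
  simp only [SC]
  refine Finset.sum_congr rfl fun v _ => ?_
  by_cases h : ¬ c v
  · rw [if_pos h]
    simp only [nbr, Finset.mul_sum]
    refine Finset.sum_congr rfl fun w _ => ?_
    by_cases hw : G.Adj v w
    · have : c w := by have := hc v w hw; by_contra h'; exact h (this.2 h')
      simp [bip, h, hw, this]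
    · simp [bip, hw]
  · rw [if_neg h]
    refine Finset.sum_eq_zero fun w _ => ?_
    rw [if_neg (fun h' => h h'.2.1)]

theorem bipSym (x y : V → ℝ) : SC (fun a => ¬ c a) x (nbr G y) = SC c (nbr G x) y := by
  have h : ∀ (z x y : V → ℝ) (p : V → Prop), SC p x (nbr G y) = ∑ a, ∑ b, if p a ∧ G.Adj a b then x a * y b else 0 := by
    intro z x y p
    simp only [SC, nbr, Finset.mul_sum]
    refine Finset.sum_congr rfl fun a _ => ?_
    by_cases hp : p a <;> simp [hp]
  have h2 : SC c (nbr G x) y = SC c y (nbr G x) := by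
    simp only [SC]; exact Finset.sum_congr rfl fun a _ => by rw [mul_comm]
  rw [h2, h x, h x, Finset.sum_comm]
  refine Finset.sum_congr rfl fun a _ => Finset.sum_congr rfl fun b _ => ?_
  have : (¬ c b ∧ G.Adj b a) ↔ (c a ∧ G.Adj a b) := by
    constructor
    · rintro ⟨h1, h2⟩; exact ⟨(hc a b h2.symm).2 h1, h2.symm⟩
    · rintro ⟨h1, h2⟩; exact ⟨(hc a b h2).1 h1, h2.symm⟩
  by_cases hh : c a ∧ G.Adj a b
  · rw [if_pos (this.2 hh), if_pos hh, mul_comm]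
  · rw [if_neg (fun h => hh (this.1 h)), if_neg hh]

theorem eul_bip2 (x y : V → ℝ) :
    eul ℝ (bip G c) x y = SC c x y + SC (fun a => ¬ c a) x y - SC c (nbr G x) y := by
  rw [eul_bip1 hc, bipSym hc]

theorem eulL_c (u : V → ℝ) {v : V} (hv : c v) : eul ℝ (bip G c) (bv ℝ v) u = u v := by
  rw [eul_left, Finset.sum_eq_zero, sub_zero]
  intro w _; rw [if_neg (fun h => h.2.1 hv)]

theorem eulR_c (u : V → ℝ) {v : V} (hv : c v) : eul ℝ (bip G c) u (bv ℝ v) = u v - nbr G u v := by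
  rw [eul_right]
  congr 1
  refine Finset.sum_congr rfl fun w _ => ?_
  have : bip G c w v ↔ G.Adj v w :=
    ⟨fun h => h.1.symm, fun h => ⟨h.symm, (hc v w h).1 hv, hv⟩⟩
  rw [if_congr this rfl rfl]

theorem eulL_n (u : V → ℝ) {v : V} (hv : ¬ c v) : eul ℝ (bip G c) (bv ℝ v) u = u v - nbr G u v := by
  rw [eul_left]
  congr 1
  refine Finset.sum_congr rfl fun w _ => ?_
  have : bip G c v w ↔ G.Adj v w :=
    ⟨fun h => h.1, fun h => ⟨h, hv, by by_contra h'; exact hv ((hc v w h).2 h')⟩⟩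
  rw [if_congr this rfl rfl]

theorem eulR_n (u : V → ℝ) {v : V} (hv : ¬ c v) : eul ℝ (bip G c) u (bv ℝ v) = u v := by
  rw [eul_right, Finset.sum_eq_zero, sub_zero]
  intro w _; rw [if_neg (fun h => hv h.2.2)]

theorem nbr_c {k : ℝ} {x y : V → ℝ} (h : ∀ a, ¬ c a → x a = k * y a) {i : V} (hi : c i) :
    nbr G x i = k * nbr G y i := by
  simp only [nbr, Finset.mul_sum]
  refine Finset.sum_congr rfl fun w _ => ?_
  split_ifs with hw
  · exact h w ((hc _ _ hw).1 hi)
  · simp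

theorem nbr_n {k : ℝ} {x y : V → ℝ} (h : ∀ a, c a → x a = k * y a) {i : V} (hi : ¬ c i) :
    nbr G x i = k * nbr G y i := by
  simp only [nbr, Finset.mul_sum]
  refine Finset.sum_congr rfl fun w _ => ?_
  split_ifs with hw
  · refine h w ?_
    by_contra h'; exact hi ((hc _ _ hw).2 h')
  · simp

end

theorem endgame {V V' : Type} [Fintype V] [Fintype V'] [Nonempty V'] {G : SimpleGraph V} {G' : SimpleGraph V'}
    {c : V → Prop} {c' : V' → Prop} (hc : ∀ a b, G.Adj a b → (c a ↔ ¬ c b))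
    (hc' : ∀ a b, G'.Adj a b → (c' a ↔ ¬ c' b)) (Φ : (V → ℝ) →ₗ[ℝ] (V' → ℝ))
    (iso : ∀ x y, eul ℝ (bip G' c') (Φ x) (Φ y) = eul ℝ (bip G c) x y)
    (surj : Function.Surjective Φ) (y : V' → ℝ) (hy : ∀ i, 0 < y i) (l : ℝ)
    (eig : ∀ i, nbr G' y i = l * y i) (ρ : ℝ) (hρ : 1 ≤ ρ) (hl : l = ρ + ρ⁻¹)
    (h1 : ρ = 1 → ∀ v, c v → SC c' y (Φ (bv ℝ v)) = SC (fun a => ¬ c' a) y (Φ (bv ℝ v)))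
    (h2 : ∀ v, c v → 0 ≤ (ρ * SC (fun a => ¬ c' a) y (Φ (bv ℝ v)) - SC c' y (Φ (bv ℝ v))) *
      (ρ * SC c' y (Φ (bv ℝ v)) - SC (fun a => ¬ c' a) y (Φ (bv ℝ v)))) : False := by
  have hρ0 : 0 < ρ := by linarith
  let wp : V' → ℝ := fun i => if c' i then ρ * y i else y i
  let wm : V' → ℝ := fun i => if c' i then y i else ρ * y i
  have scomm : ∀ (p : V' → Prop) (x z : V' → ℝ), SC p x z = SC p z x := by
    intro p x z; simp only [SC]; exact Finset.sum_congr rfl fun a _ => by rw [mul_comm]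
  have nbp1 : ∀ i, c' i → nbr G' wp i = l * y i := fun i hi => by
    rw [nbr_c hc' (k := 1) (y := y) (fun a ha => by simp [wp, ha]) hi, eig]; ring
  have nbp2 : ∀ i, ¬ c' i → nbr G' wp i = ρ * l * y i := fun i hi => by
    rw [nbr_n hc' (k := ρ) (y := y) (fun a ha => by simp [wp, ha]) hi, eig]; ring
  have nbm1 : ∀ i, c' i → nbr G' wm i = ρ * l * y i := fun i hi => by
    rw [nbr_c hc' (k := ρ) (y := y) (fun a ha => by simp [wm, ha]) hi, eig]; ring
  have nbm2 : ∀ i, ¬ c' i → nbr G' wm i = l * y i := fun i hi => by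
    rw [nbr_n hc' (k := 1) (y := y) (fun a ha => by simp [wm, ha]) hi, eig]; ring
  -- pairings
  have pl : ∀ b, eul ℝ (bip G' c') wp b = (ρ - l) * SC c' y b + SC (fun a => ¬ c' a) y b := by
    intro b
    rw [eul_bip2 hc', SC_congr (c := c') (x := wp) (x' := y) (y' := b) ρ (fun a ha => by simp [wp, ha]; ring),
      SC_congr (c := fun a => ¬ c' a) (x := wp) (x' := y) (y' := b) 1 (fun a ha => by simp [wp, ha]),
      SC_congr (c := c') (x := nbr G' wp) (x' := y) (y' := b) l (fun a ha => by rw [nbp1 a ha]; ring)]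
    ring
  have pr : ∀ b, eul ℝ (bip G' c') b wp = ρ * SC c' y b + (1 - ρ * l) * SC (fun a => ¬ c' a) y b := by
    intro b
    rw [eul_bip1 hc', SC_congr (c := c') (y := wp) (x' := y) (y' := b) ρ (fun a ha => by simp [wp, ha]; ring),
      SC_congr (c := fun a => ¬ c' a) (y := wp) (x' := y) (y' := b) 1 (fun a ha => by simp [wp, ha]; ring),
      SC_congr (c := fun a => ¬ c' a) (y := nbr G' wp) (x' := y) (y' := b) (ρ * l) (fun a ha => by rw [nbp2 a ha]; ring)]
    ring
  have ml : ∀ b, eul ℝ (bip G' c') wm b = (1 - ρ * l) * SC c' y b + ρ * SC (fun a => ¬ c' a) y b := by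
    intro b
    rw [eul_bip2 hc', SC_congr (c := c') (x := wm) (x' := y) (y' := b) 1 (fun a ha => by simp [wm, ha]),
      SC_congr (c := fun a => ¬ c' a) (x := wm) (x' := y) (y' := b) ρ (fun a ha => by simp [wm, ha]; ring),
      SC_congr (c := c') (x := nbr G' wm) (x' := y) (y' := b) (ρ * l) (fun a ha => by rw [nbm1 a ha]; ring)]
    ring
  have mr : ∀ b, eul ℝ (bip G' c') b wm = SC c' y b + (ρ - l) * SC (fun a => ¬ c' a) y b := by
    intro b
    rw [eul_bip1 hc', SC_congr (c := c') (y := wm) (x' := y) (y' := b) 1 (fun a ha => by simp [wm, ha]; ring),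
      SC_congr (c := fun a => ¬ c' a) (y := wm) (x' := y) (y' := b) ρ (fun a ha => by simp [wm, ha]; ring),
      SC_congr (c := fun a => ¬ c' a) (y := nbr G' wm) (x' := y) (y' := b) l (fun a ha => by rw [nbm2 a ha]; ring)]
    ring
  have hρl : ρ * l = ρ ^ 2 + 1 := by rw [hl]; field_simp
  have hρl' : ρ - l = - ρ⁻¹ := by rw [hl]; ring
  obtain ⟨up, hup⟩ := surj wp
  obtain ⟨um, hum⟩ := surj wm
  have relp : ∀ x, eul ℝ (bip G c) x up = - ρ ^ 2 * eul ℝ (bip G c) up x := by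
    intro x
    rw [← iso, ← iso, hup, pl, pr, hρl, hρl']
    field_simp; ring
  have relm : ∀ x, eul ℝ (bip G c) um x = - ρ ^ 2 * eul ℝ (bip G c) x um := by
    intro x
    rw [← iso, ← iso, hum, ml, mr, hρl, hρl']
    field_simp; ring
  have upv : ∀ v, c v → up v = - ρ * (ρ * SC (fun a => ¬ c' a) y (Φ (bv ℝ v)) - SC c' y (Φ (bv ℝ v))) := by
    intro v hv
    rw [← eulL_c hc up hv, ← iso, hup, pr, hρl]; ring
  have umv : ∀ v, c v → um v = ρ⁻¹ * (ρ * SC c' y (Φ (bv ℝ v)) - SC (fun a => ¬ c' a) y (Φ (bv ℝ v))) := by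
    intro v hv
    rw [← eulL_c hc um hv, ← iso, hum, mr, hρl']; field_simp; ring
  rcases hρ.eq_or_lt with h | h
  · -- ρ = 1
    have hr : ρ = 1 := h.symm
    have z1 : ∀ v, c v → up v = 0 := by
      intro v hv
      rw [upv v hv, hr, h1 hr v hv]; ring
    have z2 : ∀ v, ¬ c v → up v = 0 := by
      intro v hv
      have := relp (bv ℝ v)
      rw [eulL_n hc _ hv, eulR_n hc _ hv, nbr_n hc (k := 0) (y := 0) (fun a ha => by simp [z1 a ha]) hv, hr] at this
      linarith
    have z : up = 0 := by
      funext v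
      by_cases hv : c v
      · exact z1 v hv
      · exact z2 v hv
    obtain ⟨i⟩ := ‹Nonempty V'›
    have : wp i = 0 := by rw [← hup, z]; simp
    have hyi := hy i
    simp only [wp] at this
    split_ifs at this
    · rw [hr] at this; linarith
    · linarith
  · have nm1 : ∀ v, c v → nbr G um v = (1 + ρ ^ 2) * um v := by
      intro v hv
      have := relm (bv ℝ v)
      rw [eulL_c hc _ hv, eulR_c hc _ hv] at this
      linarith
    have nm2 : ∀ v, ¬ c v → nbr G um v = (1 + (ρ⁻¹) ^ 2) * um v := by
      intro v hv
      have := relm (bv ℝ v)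
      rw [eulL_n hc _ hv, eulR_n hc _ hv] at this
      have : (ρ⁻¹) ^ 2 * um v = (ρ⁻¹) ^ 2 * (-ρ ^ 2 * (um v - nbr G um v)) := by
        linear_combination (ρ⁻¹) ^ 2 * this
      rw [show (ρ⁻¹) ^ 2 * (-ρ ^ 2 * (um v - nbr G um v)) = nbr G um v - um v by field_simp; ring] at this
      linarith
    have np2 : ∀ v, ¬ c v → nbr G up v = (1 + ρ ^ 2) * up v := by
      intro v hv
      have := relp (bv ℝ v)
      rw [eulL_n hc _ hv, eulR_n hc _ hv] at this
      linarith
    have hP : SC (fun a => ¬ c a) up um = SC c up um := by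
      have := bipSym hc um up
      rw [SC_congr (y := nbr G up) (x' := up) (y' := um) (1 + ρ ^ 2) (fun a ha => by rw [np2 a ha]; ring),
        SC_congr (x := nbr G um) (x' := up) (y' := um) (1 + ρ ^ 2) (fun a ha => by rw [nm1 a ha]; ring)] at this
      exact mul_left_cancel₀ (by positivity) this
    have hP0 : SC c up um ≤ 0 := by
      refine Finset.sum_nonpos fun v _ => ?_
      split_ifs with hv
      · have := h2 v hv
        rw [upv v hv, umv v hv]
        rw [show ∀ a b : ℝ, -ρ * a * (ρ⁻¹ * b) = -(a * b) from fun a b => by field_simp]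
        linarith
      · exact le_rfl
    have e1 : eul ℝ (bip G c) up um = (1 - (ρ⁻¹) ^ 2) * SC c up um := by
      rw [eul_bip1 hc, SC_congr (y := nbr G um) (x' := up) (y' := um) (1 + (ρ⁻¹) ^ 2)
        (fun a ha => by rw [nm2 a ha]; ring), hP]
      ring
    have hN : SC (fun a => ¬ c' a) y y = SC c' y y := by
      have := bipSym hc' y y
      rw [SC_congr (y := nbr G' y) (x' := y) (y' := y) l (fun a ha => by rw [eig]; ring),
        SC_congr (x := nbr G' y) (x' := y) (y' := y) l (fun a ha => by rw [eig]; ring)] at this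
      refine mul_left_cancel₀ ?_ this
      rw [hl]; positivity
    have hNpos : 0 < SC c' y y := by
      have h5 := SC_add c' y y
      have : 0 < ∑ a, y a * y a := Finset.sum_pos (fun a _ => mul_pos (hy a) (hy a)) Finset.univ_nonempty
      linarith
    have e2 : eul ℝ (bip G' c') wp wm = (ρ - ρ⁻¹) * SC c' y y := by
      rw [pl, SC_congr (y := wm) (x' := y) (y' := y) 1 (fun a ha => by simp [wm, ha]),
        SC_congr (c := fun a => ¬ c' a) (y := wm) (x' := y) (y' := y) ρ (fun a ha => by simp [wm, ha]; ring), hN, hρl']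
      ring
    have h6 := iso up um
    rw [hup, hum, e1, e2] at h6
    have hi : ρ⁻¹ < 1 := inv_lt_one_of_one_lt₀ h
    have hi0 : 0 < ρ⁻¹ := by positivity
    have : 0 < (ρ - ρ⁻¹) * SC c' y y := mul_pos (by linarith) hNpos
    have : (1 - (ρ⁻¹) ^ 2) * SC c up um ≤ 0 := mul_nonpos_of_nonneg_of_nonpos (by nlinarith) hP0
    linarith

theorem eul_cast {V : Type} [Fintype V] (o : V → V → Prop) (x y : V → ℤ) :
    eul ℝ o (fun i => (x i : ℝ)) (fun i => (y i : ℝ)) = ((eul ℤ o x y : ℤ) : ℝ) := by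
  rw [eul_apply, eul_apply]
  push_cast
  simp only [apply_ite (Int.cast : ℤ → ℝ)]

theorem nbr_cast {V : Type} [Fintype V] (G : SimpleGraph V) (x : V → ℤ) (i : V) :
    nbr G (fun i => (x i : ℝ)) i = ((nbr G x i : ℤ) : ℝ) := by
  simp only [nbr]; push_cast
  simp only [apply_ite (Int.cast : ℤ → ℝ)]

theorem famC {V V' : Type} [Fintype V] [Fintype V'] {G : SimpleGraph V} {G' : SimpleGraph V'}
    {I : (V → V → Prop) → (V' → V' → Prop) → ((V → ℤ) ≃ₗ[ℤ] (V' → ℤ)) → Prop}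
    (F : Fam G G' I) (hG : G.IsTree) (hG' : G'.IsTree) {o o' φ} (h : I o o' φ) :
    Nonempty (G ≃g G') := by
  by_contra hno
  -- colourings
  have col : ∀ {V : Type} [Fintype V] {G : SimpleGraph V} (hG : G.IsTree),
      ∃ c : V → Prop, (∀ a b, G.Adj a b → (c a ↔ ¬ c b)) ∧ ∃ v, c v := by
    intro V _ G hG
    obtain ⟨v⟩ := hG.1.nonempty
    obtain ⟨T⟩ := exists_rooted hG v
    refine ⟨fun x => Even (T.dep x), fun a b hab => ?_, v, by simp [T.dep_root]⟩
    rcases (T.adj a b).1 hab with ⟨h1, rfl⟩ | ⟨h1, rfl⟩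
    · have := T.dep_par a h1
      simp only [this, Nat.even_add_one]
    · have := T.dep_par b h1
      simp only [this, Nat.even_add_one, not_not]
  obtain ⟨c, hc, v0, hv0⟩ := col hG
  obtain ⟨c', hc', x0, hx0⟩ := col hG'
  haveI : Nonempty V' := ⟨x0⟩
  -- move to bipartite orientations
  have hL : ∀ t, Relation.ReflTransGen StepAny o t → ∃ φ, I t o' φ := by
    intro t ht
    induction ht with
    | refl => exact ⟨φ, h⟩
    | tail _ hs ih =>
      obtain ⟨φ, hφ⟩ := ih
      obtain ⟨i, hi, rfl⟩ := hs
      exact ⟨_, F.left _ _ _ i hφ hi⟩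
  obtain ⟨φ1, h1⟩ := hL _ (reach_any hG o (bip G c) (F.or1 _ _ _ h) (bip_orient hc))
  have hR : ∀ t, Relation.ReflTransGen StepAny o' t → ∃ φ, I (bip G c) t φ := by
    intro t ht
    induction ht with
    | refl => exact ⟨φ1, h1⟩
    | tail _ hs ih =>
      obtain ⟨φ, hφ⟩ := ih
      obtain ⟨i, hi, rfl⟩ := hs
      exact ⟨_, F.right _ _ _ i hφ hi⟩
  obtain ⟨ψ, hψ⟩ := hR _ (reach_any hG' o' (bip G' c') (F.or2 _ _ _ h) (bip_orient hc'))
  clear hL hR h1 φ1 h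
  obtain ⟨l, y, hy, eig⟩ := perron G' hG'.1
  have hsink : ∀ v, c v → IsSink (bip G c) v := fun v hv w hw => hw.2.1 hv
  -- the class of nonnegative vectors
  let ca : (V' → ℤ) → V' → ℝ := fun b i => (b i : ℝ)
  let PP : V → ℝ → ℝ → Prop := fun v p q => ∃ φ, (I (bip G c) (bip G' c') φ ∨ I (bip G c) (opp (bip G' c')) φ) ∧
    (∀ i, 0 ≤ φ (bv ℤ v) i) ∧
    ((SC c' y (ca (φ (bv ℤ v))) = p ∧ SC (fun a => ¬ c' a) y (ca (φ (bv ℤ v))) = q) ∨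
     (SC c' y (ca (φ (bv ℤ v))) = q ∧ SC (fun a => ¬ c' a) y (ca (φ (bv ℤ v))) = p))
  have PPnn : ∀ v p q, PP v p q → 0 ≤ p ∧ 0 ≤ q := by
    rintro v p q ⟨φ, _, hp, hh⟩
    have h0 : ∀ d : V' → Prop, 0 ≤ SC d y (ca (φ (bv ℤ v))) := fun d =>
      Finset.sum_nonneg fun i _ => by
        split_ifs
        · exact mul_nonneg (hy i).le (Int.cast_nonneg (hp i))
        · exact le_rfl
    rcases hh with ⟨rfl, rfl⟩ | ⟨rfl, rfl⟩
    · exact ⟨h0 _, h0 _⟩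
    · exact ⟨h0 _, h0 _⟩
  have hcn' : ∀ a b, G'.Adj a b → ((¬ c' a) ↔ ¬ ¬ c' b) := fun a b hab => by rw [hc' a b hab]
  have coxc : ∀ (d : V' → Prop), (d = c' ∨ d = fun a => ¬ c' a) → ∀ v, c v → ∀ φ,
      (I (bip G c) (bip G' c') φ ∨ I (bip G c) (opp (bip G' c')) φ) → (∀ i, 0 ≤ φ (bv ℤ v) i) →
      ∃ φ', (I (bip G c) (bip G' c') φ' ∨ I (bip G c) (opp (bip G' c')) φ') ∧ (∀ i, 0 ≤ φ' (bv ℤ v) i) ∧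
        SC d y (ca (φ' (bv ℤ v))) = l * SC (fun a => ¬ d a) y (ca (φ (bv ℤ v))) - SC d y (ca (φ (bv ℤ v))) ∧
        SC (fun a => ¬ d a) y (ca (φ' (bv ℤ v))) = SC (fun a => ¬ d a) y (ca (φ (bv ℤ v))) := by
    intro d hd v hv φ hφ hp
    have hdd : ∀ a b, G'.Adj a b → (d a ↔ ¬ d b) := by
      rcases hd with rfl | rfl
      · exact hc'
      · exact hcn'
    have fin : ∀ φ' : (V → ℤ) ≃ₗ[ℤ] (V' → ℤ), (∀ i, φ' (bv ℤ v) i = if d i then - φ (bv ℤ v) i + nbr G' (φ (bv ℤ v)) i else φ (bv ℤ v) i) →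
        SC d y (ca (φ' (bv ℤ v))) = l * SC (fun a => ¬ d a) y (ca (φ (bv ℤ v))) - SC d y (ca (φ (bv ℤ v))) ∧
        SC (fun a => ¬ d a) y (ca (φ' (bv ℤ v))) = SC (fun a => ¬ d a) y (ca (φ (bv ℤ v))) := by
      intro φ' hφ'
      constructor
      · have e1 : SC d y (ca (φ' (bv ℤ v))) = SC d y (nbr G' (ca (φ (bv ℤ v)))) - SC d y (ca (φ (bv ℤ v))) := by
          simp only [SC, ← Finset.sum_sub_distrib]
          refine Finset.sum_congr rfl fun i _ => ?_
          split_ifs with hi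
          · simp only [ca]
            rw [nbr_cast, hφ', if_pos hi]; push_cast; ring
          · simp
        rw [e1]
        congr 1
        have e2 := bipSym (c := fun a => ¬ d a) (G := G') (fun a b hab => by rw [hdd a b hab]) y (ca (φ (bv ℤ v)))
        simp only [not_not] at e2
        rw [e2]
        exact SC_congr l (fun a _ => by rw [eig]; ring)
      · simp only [SC]
        refine Finset.sum_congr rfl fun i _ => ?_
        by_cases hi : d i
        · simp [hi]
        · simp only [ca]; rw [hφ', if_neg hi]
    rcases hφ with hφ | hφ
    · obtain ⟨φ', a1, a2, a3⟩ := F.cox hG hG' hno hφ (hsink v hv) d hdd (by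
        rcases hd with rfl | rfl
        · exact Or.inl fun i hi w hw => hw.2.1 hi
        · exact Or.inr fun i hi w hw => hi hw.2.2) hp
      exact ⟨φ', Or.inr a1, a2, fin φ' a3⟩
    · obtain ⟨φ', a1, a2, a3⟩ := F.cox hG hG' hno hφ (hsink v hv) d hdd (by
        rcases hd with rfl | rfl
        · exact Or.inr fun i hi w hw => hw.2.1 hi
        · exact Or.inl fun i hi w hw => hi hw.2.2) hp
      exact ⟨φ', Or.inl a1, a2, fin φ' a3⟩
  have PPstep : ∀ v, c v → ∀ p q, PP v p q → PP v q (l * q - p) := by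
    rintro v hv p q ⟨φ, hφ, hp, hh⟩
    rcases hh with ⟨h1, h2⟩ | ⟨h1, h2⟩
    · obtain ⟨φ', a1, a2, a3, a4⟩ := coxc c' (Or.inl rfl) v hv φ hφ hp
      exact ⟨φ', a1, a2, Or.inr ⟨by rw [a3, h1, h2], by rw [a4, h2]⟩⟩
    · obtain ⟨φ', a1, a2, a3, a4⟩ := coxc (fun a => ¬ c' a) (Or.inr rfl) v hv φ hφ hp
      simp only [not_not] at a3 a4
      exact ⟨φ', a1, a2, Or.inl ⟨by rw [a4, h1], by rw [a3, h1, h2]⟩⟩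
  -- bounds
  have bound : ∀ ρ : ℝ, 1 ≤ ρ → l ≤ ρ + ρ⁻¹ → ∀ v, c v → ∀ p q, PP v p q → p ≤ ρ * q := by
    intro ρ hρ hl v hv p q hpq
    exact seqLemma (PP v) l ρ hρ hl (PPstep v hv) (PPnn v) hpq
  have symPP : ∀ v p q, PP v p q → PP v q p := by
    rintro v p q ⟨φ, hφ, hp, hh⟩; exact ⟨φ, hφ, hp, hh.symm⟩
  have start : ∀ v, c v → ∃ e : ℝ, (e = 1 ∨ e = -1) ∧
      PP v (e * SC c' y (ca (ψ (bv ℤ v)))) (e * SC (fun a => ¬ c' a) y (ca (ψ (bv ℤ v)))) := by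
    intro v hv
    rcases F.sg _ _ _ hψ v with hs | hs
    · exact ⟨1, Or.inl rfl, ψ, Or.inl hψ, hs, Or.inl ⟨by simp, by simp⟩⟩
    · refine ⟨-1, Or.inr rfl, _, Or.inl (F.neg _ _ _ hψ), fun i => by simpa using hs i, Or.inl ⟨?_, ?_⟩⟩
      · exact SC_congr (-1) (fun a _ => by simp [ca])
      · exact SC_congr (-1) (fun a _ => by simp [ca])
  rcases lt_or_ge l 2 with hl | hl
  · obtain ⟨e, he, hP⟩ := start v0 hv0
    have b1 := bound 1 le_rfl (by norm_num; linarith) v0 hv0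
    set p := e * SC c' y (ca (ψ (bv ℤ v0)))
    set q := e * SC (fun a => ¬ c' a) y (ca (ψ (bv ℤ v0)))
    have e1 : p = q := le_antisymm (by simpa using b1 _ _ hP) (by simpa using b1 _ _ (symPP _ _ _ hP))
    have hP2 := PPstep v0 hv0 _ _ hP
    have e2 : q = l * q - p := le_antisymm (by simpa using b1 _ _ hP2) (by simpa using b1 _ _ (symPP _ _ _ hP2))
    have hq : q = 0 := by
      have : (2 - l) * q = 0 := by rw [e1] at e2; linarith
      rcases mul_eq_zero.1 this with h | h
      · linarith
      · exact h
    obtain ⟨φ, hφ, hp, hh⟩ := hP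
    have z0 : SC c' y (ca (φ (bv ℤ v0))) = 0 ∧ SC (fun a => ¬ c' a) y (ca (φ (bv ℤ v0))) = 0 := by
      rw [e1, hq] at hh; rcases hh with h | h <;> exact h
    have nn : ∀ i, 0 ≤ y i * ca (φ (bv ℤ v0)) i := fun i => mul_nonneg (hy i).le (Int.cast_nonneg (hp i))
    have := SC_add c' y (ca (φ (bv ℤ v0)))
    rw [z0.1, z0.2, add_zero, Finset.sum_eq_zero_iff_of_nonneg (fun i _ => nn i)] at this
    have hz : φ (bv ℤ v0) = 0 := by
      funext i
      rcases mul_eq_zero.1 (this i (Finset.mem_univ i)) with h | h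
      · exact absurd h (hy i).ne'
      · simpa [ca] using h
    have := φ.map_eq_zero_iff.1 hz
    have := congrFun this v0
    simp [bv_apply] at this
  · obtain ⟨ρ, hρ, hlρ⟩ : ∃ ρ : ℝ, 1 ≤ ρ ∧ l = ρ + ρ⁻¹ := by
      have hd : 0 ≤ l ^ 2 - 4 := by nlinarith
      have hs := Real.sq_sqrt hd
      have hs0 := Real.sqrt_nonneg (l ^ 2 - 4)
      refine ⟨(l + Real.sqrt (l ^ 2 - 4)) / 2, by linarith, ?_⟩
      have hpos : 0 < l + Real.sqrt (l ^ 2 - 4) := by linarith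
      field_simp
      nlinarith
    let Φ : (V → ℝ) →ₗ[ℝ] (V' → ℝ) := ∑ v, (LinearMap.proj v : (V → ℝ) →ₗ[ℝ] ℝ).smulRight (ca (ψ (bv ℤ v)))
    have Φbv : ∀ v, Φ (bv ℝ v) = ca (ψ (bv ℤ v)) := by
      intro v
      funext i
      simp only [Φ, LinearMap.sum_apply, Finset.sum_apply, LinearMap.smulRight_apply, LinearMap.proj_apply, Pi.smul_apply]
      rw [Finset.sum_eq_single v (fun w _ hw => by simp [bv_apply, hw]) (by simp)]
      simp [bv_apply]
    have Φcast : ∀ z : V → ℤ, Φ (fun i => (z i : ℝ)) = ca (ψ z) := by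
      intro z
      funext i
      conv_rhs => rw [vec_eq_sum z, map_sum]
      simp only [map_smul]
      simp [Φ, LinearMap.sum_apply, Finset.sum_apply, ca]
    have iso : ∀ a b, eul ℝ (bip G' c') (Φ a) (Φ b) = eul ℝ (bip G c) a b := by
      intro a b
      rw [vec_eq_sum a, vec_eq_sum b]
      simp only [map_sum, LinearMap.sum_apply, map_smul, LinearMap.smul_apply]
      refine Finset.sum_congr rfl fun i _ => ?_
      congr 1
      refine Finset.sum_congr rfl fun j _ => ?_
      congr 1
      rw [Φbv, Φbv]
      simp only [ca]
      rw [eul_cast, F.iso _ _ _ hψ]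
      rw [← eul_cast]
      have : ∀ w : V, (fun k => ((bv ℤ w k : ℤ) : ℝ)) = bv ℝ w := by
        intro w; funext k; simp [bv_apply]
      rw [this, this]
    have surj : Function.Surjective Φ := by
      intro w
      refine ⟨∑ i, w i • (fun k => ((ψ.symm (bv ℤ i) k : ℤ) : ℝ)), ?_⟩
      rw [map_sum]
      conv_rhs => rw [vec_eq_sum w]
      refine Finset.sum_congr rfl fun i _ => ?_
      rw [map_smul, Φcast]
      congr 1
      funext k; simp [ca, bv_apply]
    refine endgame hc hc' Φ iso surj y hy l eig ρ hρ hlρ ?_ ?_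
    · intro hr v hv
      obtain ⟨e, he, hP⟩ := start v hv
      have b1 := bound ρ hρ hlρ.le v hv _ _ hP
      have b2 := bound ρ hρ hlρ.le v hv _ _ (symPP _ _ _ hP)
      rw [Φbv]
      rw [hr] at b1 b2
      rcases he with rfl | rfl <;> linarith
    · intro v hv
      obtain ⟨e, he, hP⟩ := start v hv
      have b1 := bound ρ hρ hlρ.le v hv _ _ hP
      have b2 := bound ρ hρ hlρ.le v hv _ _ (symPP _ _ _ hP)
      rw [Φbv]
      rcases he with rfl | rfl
      · exact mul_nonneg (by linarith) (by linarith)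
      · exact mul_nonneg_of_nonpos_of_nonpos (by linarith) (by linarith)

end comb4
end QN

namespace QN
set_option linter.all false
section coneFun
open CategoryTheory CategoryTheory.Limits CochainComplex CochainComplex.HomComplex
universe v u v' u'

/-- chain-level action of an additive functor (agrees definitionally with `mapHomologicalComplex`) -/
noncomputable abbrev mc {A : Type u} [Category.{v} A] [Abelian A] {B : Type u'} [Category.{v'} B] [Abelian B]
    (F : A ⥤ B) [F.Additive] : CochainComplex A ℤ ⥤ CochainComplex B ℤ where
  obj K := { X := fun i => F.obj (K.X i), d := fun i j => F.map (K.d i j),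
             shape := fun i j h => by rw [K.shape i j h, F.map_zero]
             d_comp_d' := fun i j l _ _ => by rw [← F.map_comp, K.d_comp_d, F.map_zero] }
  map f := { f := fun i => F.map (f.f i), comm' := fun i j _ => by dsimp; rw [← F.map_comp, ← F.map_comp, f.comm] }
  map_id K := by ext i; simp
  map_comp f g := by ext i; simp

/-- chain-level action of a natural transformation -/
@[simps] noncomputable def mt {A : Type u} [Category.{v} A] [Abelian A] {B : Type u'} [Category.{v'} B] [Abelian B]
    {F G : A ⥤ B} [F.Additive] [G.Additive] (η : F ⟶ G) (K : CochainComplex A ℤ) : (mc F).obj K ⟶ (mc G).obj K where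
  f := fun i => η.app _
  comm' := fun i j _ => by simp

theorem mt_nat {A : Type u} [Category.{v} A] [Abelian A] {B : Type u'} [Category.{v'} B] [Abelian B]
    {F G : A ⥤ B} [F.Additive] [G.Additive] (η : F ⟶ G) {K L : CochainComplex A ℤ} (f : K ⟶ L) :
    mt η K ≫ (mc G).map f = (mc F).map f ≫ mt η L := by
  ext i; simp

theorem mc_eq {A : Type u} [Category.{v} A] [Abelian A] {B : Type u'} [Category.{v'} B] [Abelian B]
    (F : A ⥤ B) [F.Additive] : mc F = F.mapHomologicalComplex (ComplexShape.up ℤ) := rfl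

/-- action of an additive functor on cochains -/
noncomputable def cmap {A : Type u} [Category.{v} A] [Abelian A] {B : Type u'} [Category.{v'} B] [Abelian B]
    (F : A ⥤ B) [F.Additive] {K L : CochainComplex A ℤ} {n : ℤ} (z : Cochain K L n) : Cochain ((mc F).obj K) ((mc F).obj L) n :=
  Cochain.mk fun p q h => F.map (z.v p q h)
@[simp] theorem cmap_v {A : Type u} [Category.{v} A] [Abelian A] {B : Type u'} [Category.{v'} B] [Abelian B]
    (F : A ⥤ B) [F.Additive] {K L : CochainComplex A ℤ} {n : ℤ} (z : Cochain K L n) (p q : ℤ) (h : p + n = q) :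
    (cmap F z).v p q h = F.map (z.v p q h) := rfl
theorem δ_cmap {A : Type u} [Category.{v} A] [Abelian A] {B : Type u'} [Category.{v'} B] [Abelian B]
    (F : A ⥤ B) [F.Additive] {K L : CochainComplex A ℤ} (n m : ℤ) (z : Cochain K L n) :
    δ n m (cmap F z) = cmap F (δ n m z) := δ_map n m z F

section
variable {A : Type u} [Category.{v} A] [Abelian A]

theorem coco_ext {M K L : CochainComplex A ℤ} {φ : K ⟶ L} {f g : M ⟶ mappingCocone φ}
    (h1 : ∀ p, f.f p ≫ (mappingCocone.fst φ).f p = g.f p ≫ (mappingCocone.fst φ).f p)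
    (h2 : ∀ p q hpq, f.f p ≫ (mappingCocone.snd φ).v p q hpq = g.f p ≫ (mappingCocone.snd φ).v p q hpq) : f = g := by
  ext p
  rw [← Category.comp_id (f.f p), ← Category.comp_id (g.f p), ← mappingCocone.id_X φ p (p + -1) rfl]
  simp only [Preadditive.comp_add, reassoc_of% (h2 p (p+-1) rfl), reassoc_of% (h1 p)]

theorem δsnd {K L : CochainComplex A ℤ} (φ : K ⟶ L) :
    δ (-1) 0 (mappingCocone.snd φ) = - Cochain.ofHom (mappingCocone.fst φ ≫ φ) := by
  have : mappingCocone.snd φ = mappingCocone.descCochain φ (0 : Cochain K L (-1)) (Cochain.ofHom (𝟙 L)) (by simp) := by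
    ext p q hpq
    rw [← Category.id_comp ((mappingCocone.snd φ).v p q hpq), ← Category.id_comp ((mappingCocone.descCochain φ _ _ _).v p q hpq),
      ← mappingCocone.id_X φ p q hpq]
    simp only [Preadditive.add_comp, Category.assoc, mappingCocone.inl_v_snd_v, mappingCocone.inr_v_snd_v,
      mappingCocone.inl_v_descCochain_v]
    rw [mappingCocone.inr_v_descCochain_v]
    simp
  rw [this, mappingCocone.δ_descCochain _ _ _ _ 1 (by simp)]
  ext p
  simp

noncomputable def cocoMap {K₁ L₁ K₂ L₂ : CochainComplex A ℤ} (φ₁ : K₁ ⟶ L₁) (φ₂ : K₂ ⟶ L₂) (a : K₁ ⟶ K₂) (b : L₁ ⟶ L₂)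
    (comm : φ₁ ≫ b = a ≫ φ₂) : mappingCocone φ₁ ⟶ mappingCocone φ₂ :=
  mappingCocone.lift φ₂ (mappingCocone.fst φ₁ ≫ a) ((mappingCocone.snd φ₁).comp (Cochain.ofHom b) (add_zero _)) (by
    rw [δ_comp_ofHom, δsnd]
    simp [← Cochain.ofHom_comp, comm])

variable {K₁ L₁ K₂ L₂ : CochainComplex A ℤ} (φ₁ : K₁ ⟶ L₁) (φ₂ : K₂ ⟶ L₂) (a : K₁ ⟶ K₂) (b : L₁ ⟶ L₂)
    (comm : φ₁ ≫ b = a ≫ φ₂)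

theorem cocoMap_fst (p : ℤ) : (cocoMap φ₁ φ₂ a b comm).f p ≫ (mappingCocone.fst φ₂).f p = (mappingCocone.fst φ₁).f p ≫ a.f p := by
  simp [cocoMap]
theorem cocoMap_snd (p q : ℤ) (h : p + -1 = q) : (cocoMap φ₁ φ₂ a b comm).f p ≫ (mappingCocone.snd φ₂).v p q h = 
   (mappingCocone.snd φ₁).v p q h ≫ b.f q := by
  simp [cocoMap]
theorem coneMap_inl (p q : ℤ) (h : p + -1 = q) : (mappingCone.inl φ₁).v p q h ≫ (mappingCone.map φ₁ φ₂ a b comm).f q = 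
   a.f p ≫ (mappingCone.inl φ₂).v p q h := by
  simp [mappingCone.map]
theorem coneMap_inr (p : ℤ)  : (mappingCone.inr φ₁).f p ≫ (mappingCone.map φ₁ φ₂ a b comm).f p = 
   b.f p ≫ (mappingCone.inr φ₂).f p := by
  simp [mappingCone.map]
end

variable {A : Type u} [Category.{v} A] [Abelian A] {B : Type u'} [Category.{v'} B] [Abelian B]

/-- cone of a natural transformation of additive functors -/
noncomputable abbrev coneF {G₁ G₀ : A ⥤ B} [G₁.Additive] [G₀.Additive] (η : G₁ ⟶ G₀) :
    CochainComplex A ℤ ⥤ CochainComplex B ℤ where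
  obj K := mappingCone (mt η K)
  map f := mappingCone.map _ _ ((mc G₁).map f) ((mc G₀).map f) (mt_nat η f)
  map_id K := by
    ext p
    apply mappingCone.ext_from _ (p+1) p rfl
    · rw [coneMap_inl]; simp
    · rw [coneMap_inr]; simp
  map_comp f g := by
    ext p
    apply mappingCone.ext_from _ (p+1) p rfl
    · rw [coneMap_inl, HomologicalComplex.comp_f, reassoc_of% coneMap_inl, coneMap_inl]; simp
    · rw [coneMap_inr, HomologicalComplex.comp_f, reassoc_of% coneMap_inr, coneMap_inr]; simp

/-- cocone of a natural transformation of additive functors -/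
noncomputable abbrev coconeF {G₁ G₀ : A ⥤ B} [G₁.Additive] [G₀.Additive] (η : G₁ ⟶ G₀) :
    CochainComplex A ℤ ⥤ CochainComplex B ℤ where
  obj K := mappingCocone (mt η K)
  map f := cocoMap _ _ ((mc G₁).map f) ((mc G₀).map f) (mt_nat η f)
  map_id K := by
    apply coco_ext
    · intro p; rw [cocoMap_fst]; simp
    · intro p q h; rw [cocoMap_snd]; simp
  map_comp f g := by
    apply coco_ext
    · intro p; simp only [HomologicalComplex.comp_f, Category.assoc, cocoMap_fst]
      rw [reassoc_of% cocoMap_fst]; simp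
    · intro p q h; simp only [HomologicalComplex.comp_f, Category.assoc, cocoMap_snd]
      rw [reassoc_of% cocoMap_snd]; simp

/-- the data giving rise to a cone/cocone adjunction -/
structure CData (A : Type u) [Category.{v} A] [Abelian A] (B : Type u') [Category.{v'} B] [Abelian B] where
  G₁ : A ⥤ B
  G₀ : A ⥤ B
  F₀ : B ⥤ A
  F₁ : B ⥤ A
  [aG₁ : G₁.Additive]
  [aG₀ : G₀.Additive]
  [aF₀ : F₀.Additive]
  [aF₁ : F₁.Additive]
  η : G₁ ⟶ G₀
  ξ : F₀ ⟶ F₁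
  u (X : A) : X ⟶ F₀.obj (G₀.obj X)
  v (X : A) : X ⟶ F₁.obj (G₁.obj X)
  q (Y : B) : G₀.obj (F₀.obj Y) ⟶ Y
  p (Y : B) : G₁.obj (F₁.obj Y) ⟶ Y
  nu {X X' : A} (f : X ⟶ X') : f ≫ u X' = u X ≫ F₀.map (G₀.map f)
  nv {X X' : A} (f : X ⟶ X') : f ≫ v X' = v X ≫ F₁.map (G₁.map f)
  nq {Y Y' : B} (f : Y ⟶ Y') : G₀.map (F₀.map f) ≫ q Y' = q Y ≫ f
  np {Y Y' : B} (f : Y ⟶ Y') : G₁.map (F₁.map f) ≫ p Y' = p Y ≫ f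
  t0 (X : A) : G₀.map (u X) ≫ q (G₀.obj X) = 𝟙 _
  t0' (Y : B) : u (F₀.obj Y) ≫ F₀.map (q Y) = 𝟙 _
  t1 (X : A) : G₁.map (v X) ≫ p (G₁.obj X) = 𝟙 _
  t1' (Y : B) : v (F₁.obj Y) ≫ F₁.map (p Y) = 𝟙 _
  c1 (X : A) : u X ≫ ξ.app (G₀.obj X) = v X ≫ F₁.map (η.app X)
  c2 (Y : B) : G₁.map (ξ.app Y) ≫ p Y = η.app (F₀.obj Y) ≫ q Y

namespace CData
attribute [instance] aG₁ aG₀ aF₀ aF₁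
variable (d : CData A B)

/-- chain level unit of `u` -/
@[simps] abbrev U (K : CochainComplex A ℤ) : K ⟶ (mc d.F₀).obj ((mc d.G₀).obj K) where
  f i := d.u _
  comm' i j _ := (d.nu _).symm
@[simps] abbrev VV (K : CochainComplex A ℤ) : K ⟶ (mc d.F₁).obj ((mc d.G₁).obj K) where
  f i := d.v _
  comm' i j _ := (d.nv _).symm
@[simps] abbrev QQ (K : CochainComplex B ℤ) : (mc d.G₀).obj ((mc d.F₀).obj K) ⟶ K where
  f i := d.q _
  comm' i j _ := (d.nq _).symm
@[simps] abbrev PP (K : CochainComplex B ℤ) : (mc d.G₁).obj ((mc d.F₁).obj K) ⟶ K where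
  f i := d.p _
  comm' i j _ := (d.np _).symm

noncomputable abbrev Psi := coneF d.η
noncomputable abbrev Theta := coconeF d.ξ

noncomputable def unitA (K : CochainComplex A ℤ) : K ⟶ mappingCocone (mt d.ξ (mappingCone (mt d.η K))) :=
  mappingCocone.lift (mt d.ξ (mappingCone (mt d.η K))) (d.U K ≫ (mc d.F₀).map (mappingCone.inr (mt d.η K)))
    (-(Cochain.ofHom (d.VV K)).comp (cmap d.F₁ (mappingCone.inl (mt d.η K))) (zero_add _)) (by
    rw [δ_neg, δ_ofHom_comp, δ_cmap, mappingCone.δ_inl]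
    ext p
    simp
    rw [← reassoc_of% (d.c1 (K.X p)), ← d.ξ.naturality]
    simp)

noncomputable def counitA (L : CochainComplex B ℤ) : mappingCone (mt d.η (mappingCocone (mt d.ξ L))) ⟶ L :=
  mappingCone.desc (mt d.η (mappingCocone (mt d.ξ L))) (-(cmap d.G₁ (mappingCocone.snd (mt d.ξ L))).comp (Cochain.ofHom (d.PP L)) (add_zero _))
    ((mc d.G₀).map (mappingCocone.fst (mt d.ξ L)) ≫ d.QQ L) (by
    rw [δ_neg, δ_comp_ofHom, δ_cmap, δsnd]
    ext p
    simp
    rw [← reassoc_of% (d.η.naturality), ← d.c2])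

theorem unitA_fst (K : CochainComplex A ℤ) (p : ℤ) : (d.unitA K).f p ≫ (mappingCocone.fst _).f p =
   d.u _ ≫ d.F₀.map ((mappingCone.inr (mt d.η K)).f p) := by
  simp [unitA]
theorem unitA_snd (K : CochainComplex A ℤ) (p q : ℤ) (h) : (d.unitA K).f p ≫ (mappingCocone.snd _).v p q h =
   - d.v _ ≫ d.F₁.map ((mappingCone.inl (mt d.η K)).v p q h) := by
  simp [unitA]
theorem inr_counitA (L : CochainComplex B ℤ) (p : ℤ) : (mappingCone.inr _).f p ≫ (d.counitA L).f p =
   d.G₀.map ((mappingCocone.fst (mt d.ξ L)).f p) ≫ d.q _ := by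
  simp [counitA]
theorem inl_counitA (L : CochainComplex B ℤ) (p q : ℤ) (h) : (mappingCone.inl _).v p q h ≫ (d.counitA L).f q =
   - d.G₁.map ((mappingCocone.snd (mt d.ξ L)).v p q h) ≫ d.p _  := by
  simp [counitA]

theorem unitA_nat {K K' : CochainComplex A ℤ} (f : K ⟶ K') : f ≫ d.unitA K' = d.unitA K ≫ d.Theta.map (d.Psi.map f) := by
  apply coco_ext
  · intro p
    simp only [HomologicalComplex.comp_f, Category.assoc, unitA_fst, coconeF, coneF, cocoMap_fst]
    rw [reassoc_of% d.unitA_fst, reassoc_of% d.nu]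
    simp [← Functor.map_comp, coneMap_inr]
  · intro p q h
    simp only [HomologicalComplex.comp_f, Category.assoc, unitA_snd, coconeF, coneF, cocoMap_snd]
    rw [reassoc_of% d.unitA_snd, Preadditive.comp_neg, reassoc_of% d.nv]
    simp [← Functor.map_comp, coneMap_inl]

theorem counitA_nat {K K' : CochainComplex B ℤ} (f : K ⟶ K') : d.Psi.map (d.Theta.map f) ≫ d.counitA K' = d.counitA K ≫ f := by
  ext p
  apply mappingCone.ext_from _ (p+1) p rfl
  · simp only [HomologicalComplex.comp_f, coconeF, coneF]
    rw [reassoc_of% coneMap_inl, inl_counitA, reassoc_of% inl_counitA, Preadditive.comp_neg]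
    simp [← Functor.map_comp_assoc, cocoMap_snd, d.np]
  · simp only [HomologicalComplex.comp_f, coconeF, coneF]
    rw [reassoc_of% coneMap_inr, inr_counitA, reassoc_of% inr_counitA]
    simp [← Functor.map_comp_assoc, cocoMap_fst, d.nq]

theorem tri1 (K : CochainComplex A ℤ) : d.Psi.map (d.unitA K) ≫ d.counitA (d.Psi.obj K) = 𝟙 _ := by
  ext p
  apply mappingCone.ext_from _ (p+1) p rfl
  · simp only [HomologicalComplex.comp_f, coconeF, coneF]
    rw [reassoc_of% coneMap_inl, inl_counitA,  Preadditive.comp_neg]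
    simp [← Functor.map_comp_assoc, unitA_snd, d.np]
    rw [reassoc_of% d.t1]
  · simp only [HomologicalComplex.comp_f, coconeF, coneF]
    rw [reassoc_of% coneMap_inr, inr_counitA]
    simp [← Functor.map_comp_assoc, unitA_fst, d.nq]
    rw [reassoc_of% d.t0]

theorem tri2 (K : CochainComplex B ℤ) : d.unitA (d.Theta.obj K) ≫ d.Theta.map (d.counitA K) = 𝟙 _ := by
  apply coco_ext
  · intro p
    simp only [HomologicalComplex.comp_f, Category.assoc, unitA_fst, coconeF, coneF, cocoMap_fst]
    rw [reassoc_of% d.unitA_fst]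
    simp [← Functor.map_comp, inr_counitA]
    rw [Functor.map_comp, ← reassoc_of% d.nu, d.t0']
    simp
  · intro p q h
    simp only [HomologicalComplex.comp_f, Category.assoc, coconeF, coneF, cocoMap_snd]
    rw [reassoc_of% d.unitA_snd, Preadditive.neg_comp]
    simp [← Functor.map_comp, inl_counitA]
    rw [Functor.map_comp, ← reassoc_of% d.nv, d.t1']
    simp

noncomputable def adj : d.Psi ⊣ d.Theta := Adjunction.mkOfUnitCounit
  { unit := { app := d.unitA, naturality := fun _ _ f => d.unitA_nat f }
    counit := { app := d.counitA, naturality := fun _ _ f => d.counitA_nat f }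
    left_triangle := by ext1; ext1 K; simpa using d.tri1 K
    right_triangle := by ext1; ext1 K; simpa using d.tri2 K }

end CData
end coneFun
end QN

namespace QN
set_option linter.all false
section coneFun2
open CategoryTheory CategoryTheory.Limits CochainComplex CochainComplex.HomComplex CategoryTheory.Pretriangulated
universe v u v' u'
section
variable {A : Type u} [Category.{v} A] [Abelian A]

theorem qis_iff {K L : CochainComplex A ℤ} (f : K ⟶ L) : QuasiIso f ↔ IsIso (DerivedCategory.Q.map f) :=
  (DerivedCategory.isIso_Q_map_iff_quasiIso _ f).symm

theorem qis_coneMap {K₁ L₁ K₂ L₂ : CochainComplex A ℤ} (φ₁ : K₁ ⟶ L₁) (φ₂ : K₂ ⟶ L₂) (a : K₁ ⟶ K₂) (b : L₁ ⟶ L₂)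
    (comm : φ₁ ≫ b = a ≫ φ₂) (ha : QuasiIso a) (hb : QuasiIso b) : QuasiIso (mappingCone.map φ₁ φ₂ a b comm) := by
  rw [qis_iff] at *
  exact isIso₃_of_isIso₁₂ (DerivedCategory.Q.mapTriangle.map (mappingCone.triangleMap φ₁ φ₂ a b comm))
    (DerivedCategory.mappingCone_triangle_distinguished φ₁) (DerivedCategory.mappingCone_triangle_distinguished φ₂) ha hb

theorem cocoMap_eq {K₁ L₁ K₂ L₂ : CochainComplex A ℤ} (φ₁ : K₁ ⟶ L₁) (φ₂ : K₂ ⟶ L₂) (a : K₁ ⟶ K₂) (b : L₁ ⟶ L₂)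
    (comm : φ₁ ≫ b = a ≫ φ₂) : cocoMap φ₁ φ₂ a b comm = (CategoryTheory.shiftFunctor (CochainComplex A ℤ) (-1 : ℤ)).map (mappingCone.map φ₁ φ₂ a b comm) := by
  apply coco_ext
  · intro p
    rw [cocoMap_fst]
    have h1 : (mappingCocone.fst φ₁).f p = (mappingCone.fst φ₁).1.v (p + -1) p (by lia) := by
      simp [mappingCocone.fst, Cochain.leftShift_v (n := 1) _ _ _ _ _ p _ (p + -1) (by lia)]
      erw [Category.id_comp]
      exact neg_neg _
    have h2 : (mappingCocone.fst φ₂).f p = (mappingCone.fst φ₂).1.v (p + -1) p (by lia) := by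
      simp [mappingCocone.fst, Cochain.leftShift_v (n := 1) _ _ _ _ _ p _ (p + -1) (by lia)]
      erw [Category.id_comp]
      exact neg_neg _
    rw [h1, h2]
    change (mappingCone.fst φ₁).1.v (p + -1) p (by lia) ≫ a.f p = (mappingCone.map φ₁ φ₂ a b comm).f (p + -1) ≫ (mappingCone.fst φ₂).1.v (p + -1) p (by lia)
    apply mappingCone.ext_from _ p (p+-1) (by lia)
    · rw [reassoc_of% coneMap_inl]; simp
    · rw [reassoc_of% coneMap_inr]; simp
  · intro p q hpq
    subst hpq
    rw [cocoMap_snd]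
    have h1 : (mappingCocone.snd φ₁).v p (p+-1) rfl = (mappingCone.snd φ₁).v (p + -1) (p+-1) (by lia) := by
      rw [mappingCocone.snd]
      refine (Cochain.leftShift_v _ _ _ _ p (p+-1) rfl (p+-1) (by lia)).trans ?_
      simp [Int.negOnePow_even 2 ⟨1, rfl⟩]
      erw [Category.id_comp]
    have h2 : (mappingCocone.snd φ₂).v p (p+-1) rfl = (mappingCone.snd φ₂).v (p + -1) (p+-1) (by lia) := by
      rw [mappingCocone.snd]
      refine (Cochain.leftShift_v _ _ _ _ p (p+-1) rfl (p+-1) (by lia)).trans ?_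
      simp [Int.negOnePow_even 2 ⟨1, rfl⟩]
      erw [Category.id_comp]
    rw [h1, h2]
    change (mappingCone.snd φ₁).v (p + -1) (p+-1) (by lia) ≫ b.f (p+-1) = (mappingCone.map φ₁ φ₂ a b comm).f (p + -1) ≫ (mappingCone.snd φ₂).v (p + -1) (p+-1) (by lia)
    apply mappingCone.ext_from _ p (p+-1) (by lia)
    · rw [reassoc_of% coneMap_inl]; simp
    · rw [reassoc_of% coneMap_inr]; simp

theorem qis_cocoMap {K₁ L₁ K₂ L₂ : CochainComplex A ℤ} (φ₁ : K₁ ⟶ L₁) (φ₂ : K₂ ⟶ L₂) (a : K₁ ⟶ K₂) (b : L₁ ⟶ L₂)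
    (comm : φ₁ ≫ b = a ≫ φ₂) (ha : QuasiIso a) (hb : QuasiIso b) : QuasiIso (cocoMap φ₁ φ₂ a b comm) := by
  have := qis_coneMap φ₁ φ₂ a b comm ha hb
  rw [cocoMap_eq]
  change QuasiIso ((CategoryTheory.shiftFunctor (CochainComplex A ℤ) (-1 : ℤ)).map (mappingCone.map φ₁ φ₂ a b comm))
  rw [qis_iff] at this ⊢
  refine (NatIso.isIso_map_iff ((DerivedCategory.Q (C:=A)).commShiftIso (-1 : ℤ)) _).2 ?_
  rw [Functor.comp_map]
  infer_instance
end
variable {A : Type u} [Category.{v} A] [Abelian A] {B : Type u'} [Category.{v'} B] [Abelian B]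

theorem qis_mc (F : A ⥤ B) [F.Additive] [PreservesFiniteLimits F] [PreservesFiniteColimits F] {K L : CochainComplex A ℤ}
    (f : K ⟶ L) (hf : QuasiIso f) : QuasiIso ((mc F).map f) := 
  inferInstanceAs (QuasiIso ((F.mapHomologicalComplex _).map f))

/-- exact functor -/
class Ex (F : A ⥤ B) : Prop where
  add : F.Additive
  lim : PreservesFiniteLimits F
  colim : PreservesFiniteColimits F
attribute [instance] Ex.add Ex.lim Ex.colim

section
variable {G₁ G₀ : A ⥤ B} [Ex G₁] [Ex G₀] (η : G₁ ⟶ G₀)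
theorem cone_inverts : (HomologicalComplex.quasiIso A (ComplexShape.up ℤ)).IsInvertedBy (coneF η ⋙ DerivedCategory.Q) := by
  intro K L f hf
  have : QuasiIso ((coneF η).map f) := qis_coneMap _ _ _ _ (mt_nat η f) (qis_mc _ f hf) (qis_mc _ f hf)
  exact (qis_iff _).1 this
theorem cocone_inverts : (HomologicalComplex.quasiIso A (ComplexShape.up ℤ)).IsInvertedBy (coconeF η ⋙ DerivedCategory.Q) := by
  intro K L f hf
  have : QuasiIso ((coconeF η).map f) := qis_cocoMap _ _ _ _ (mt_nat η f) (qis_mc _ f hf) (qis_mc _ f hf)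
  exact (qis_iff _).1 this

noncomputable def coneD : DerivedCategory A ⥤ DerivedCategory B := Localization.lift _ (cone_inverts η) DerivedCategory.Q
noncomputable def coconeD : DerivedCategory A ⥤ DerivedCategory B := Localization.lift _ (cocone_inverts η) DerivedCategory.Q
noncomputable def coneD_iso : DerivedCategory.Q ⋙ coneD η ≅ coneF η ⋙ DerivedCategory.Q := Localization.fac _ (cone_inverts η) DerivedCategory.Q
noncomputable def coconeD_iso : DerivedCategory.Q ⋙ coconeD η ≅ coconeF η ⋙ DerivedCategory.Q := Localization.fac _ (cocone_inverts η) DerivedCategory.Q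
noncomputable instance : CatCommSq (coneF η) DerivedCategory.Q DerivedCategory.Q (coneD η) := ⟨(coneD_iso η).symm⟩
noncomputable instance : CatCommSq (coconeF η) DerivedCategory.Q DerivedCategory.Q (coconeD η) := ⟨(coconeD_iso η).symm⟩
end

/-- `CData` with exactness -/
class ExD (d : CData A B) : Prop where
  e1 : Ex d.G₁
  e2 : Ex d.G₀
  e3 : Ex d.F₀
  e4 : Ex d.F₁
attribute [instance] ExD.e1 ExD.e2 ExD.e3 ExD.e4

noncomputable def adjD (d : CData A B) [ExD d] : coneD d.η ⊣ coconeD d.ξ :=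
  d.adj.localization DerivedCategory.Q (HomologicalComplex.quasiIso A (ComplexShape.up ℤ))
    DerivedCategory.Q (HomologicalComplex.quasiIso B (ComplexShape.up ℤ)) _ _

theorem isIso_of_Q {C : Type*} [Category C] {F G : DerivedCategory A ⥤ C} (α : F ⟶ G) (h : ∀ K, IsIso (α.app (DerivedCategory.Q.obj K))) : IsIso α := by
  have : ∀ X, IsIso (α.app X) := by
    intro X
    have := h (DerivedCategory.Q.objPreimage X)
    exact (NatTrans.isIso_app_iff_of_iso α (DerivedCategory.Q.objObjPreimageIso X)).1 this
  exact NatIso.isIso_of_isIso_app α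

theorem equivD (d : CData A B) [ExD d] (h1 : ∀ K, QuasiIso (d.unitA K)) (h2 : ∀ K, QuasiIso (d.counitA K)) :
    (coconeD d.ξ).IsEquivalence := by
  have : IsIso (adjD d).unit := by
    apply isIso_of_Q
    intro K
    rw [adjD, Adjunction.localization_unit_app]
    have : IsIso (DerivedCategory.Q.map (d.adj.unit.app K)) := (qis_iff _).1 (h1 K)
    infer_instance
  have : IsIso (adjD d).counit := by
    apply isIso_of_Q
    intro K
    rw [adjD, Adjunction.localization_counit_app]
    have : IsIso (DerivedCategory.Q.map (d.adj.counit.app K)) := (qis_iff _).1 (h2 K)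
    infer_instance
  exact (adjD d).toEquivalence.isEquivalence_inverse
end coneFun2
end QN

namespace QN
set_option linter.all false
section univ
open CategoryTheory CategoryTheory.Limits CochainComplex CochainComplex.HomComplex CategoryTheory.Pretriangulated
universe v u v' u'
variable {A : Type u} [Category.{v} A] [Abelian A] {B : Type u'} [Category.{v'} B] [Abelian B]

section
variable {G₁ G₀ w : A ⥤ B} [Ex G₁] [Ex G₀] [Ex w] (η : G₁ ⟶ G₀) (ρ : G₀ ⟶ w)
  (h0 : ∀ X, η.app X ≫ ρ.app X = 0) (hS : ∀ X, (ShortComplex.mk _ _ (h0 X)).ShortExact)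

noncomputable abbrev sesC (K : CochainComplex A ℤ) : ShortComplex (CochainComplex B ℤ) :=
  ShortComplex.mk (mt η K) (mt ρ K) (by ext i; exact h0 _)

noncomputable def coneD_iso_w : coneD η ≅ w.mapDerivedCategory := by
  have hq : ∀ K, QuasiIso (mappingCone.descShortComplex (sesC η ρ h0 K)) := by
    intro K
    apply mappingCone.quasiIso_descShortComplex
    apply HomologicalComplex.shortExact_of_degreewise_shortExact
    intro i
    exact hS _
  let e : coneF η ⋙ DerivedCategory.Q ≅ w.mapHomologicalComplex (ComplexShape.up ℤ) ⋙ DerivedCategory.Q :=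
    NatIso.ofComponents (fun K =>
      @asIso _ _ _ _ (DerivedCategory.Q.map (mappingCone.descShortComplex (sesC η ρ h0 K))) ((qis_iff _).1 (hq K))) (by
        intro K L f
        let m : sesC η ρ h0 K ⟶ sesC η ρ h0 L :=
          { τ₁ := (mc G₁).map f, τ₂ := (mc G₀).map f, τ₃ := (mc w).map f
            comm₁₂ := (mt_nat η f).symm
            comm₂₃ := (mt_nat ρ f).symm }
        have := congrArg (fun z => DerivedCategory.Q.map z) (mappingCone.map_descShortComplex _ _ m)
        simp only [Functor.map_comp] at this
        exact this)
  haveI : Localization.Lifting DerivedCategory.Q (HomologicalComplex.quasiIso A (ComplexShape.up ℤ))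
    (coneF η ⋙ DerivedCategory.Q) (coneD η) := ⟨coneD_iso η⟩
  exact Localization.liftNatIso DerivedCategory.Q (HomologicalComplex.quasiIso A (ComplexShape.up ℤ))
    (coneF η ⋙ DerivedCategory.Q) (w.mapHomologicalComplex (ComplexShape.up ℤ) ⋙ DerivedCategory.Q) _ _ e
end

section
variable (A)
abbrev Mor := ComposableArrows A 1

open ZeroObject
noncomputable abbrev uz : A ⥤ Mor A where
  obj X := ComposableArrows.mk₁ (0 : (0 : A) ⟶ X)
  map f := ComposableArrows.homMk₁ (0 : (0:A) ⟶ (0:A)) f (by exact zero_comp.trans comp_zero.symm)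
  map_id X := ComposableArrows.hom_ext₁ (by exact (isZero_zero A).eq_of_src _ _) rfl
  map_comp f g := ComposableArrows.hom_ext₁ (by exact (isZero_zero A).eq_of_src _ _) rfl
noncomputable abbrev ut : A ⥤ Mor A where
  obj X := ComposableArrows.mk₁ (𝟙 X)
  map f := ComposableArrows.homMk₁ f f (by exact (Category.id_comp f).trans (Category.comp_id f).symm)
  map_id X := ComposableArrows.hom_ext₁ rfl rfl
  map_comp f g := ComposableArrows.hom_ext₁ rfl rfl
noncomputable abbrev uw : A ⥤ Mor A where
  obj X := ComposableArrows.mk₁ (0 : X ⟶ (0:A))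
  map f := ComposableArrows.homMk₁ f (0 : (0:A) ⟶ (0:A)) (by exact zero_comp.trans comp_zero.symm)
  map_id X := ComposableArrows.hom_ext₁ rfl (by exact (isZero_zero A).eq_of_src _ _)
  map_comp f g := ComposableArrows.hom_ext₁ rfl (by exact (isZero_zero A).eq_of_src _ _)
noncomputable abbrev ue0 : Mor A ⥤ A := (evaluation _ _).obj 0
noncomputable abbrev ue1 : Mor A ⥤ A := (evaluation _ _).obj 1

theorem mor_lim (F : A ⥤ Mor B) [h0 : PreservesFiniteLimits (F ⋙ ue0 B)] [h1 : PreservesFiniteLimits (F ⋙ ue1 B)] : PreservesFiniteLimits F := by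
  refine ⟨fun J _ _ => ⟨fun {K} => ?_⟩⟩
  apply preservesLimit_of_evaluation
  intro i
  match i with
  | 0 => exact (h0.preservesFiniteLimits J).preservesLimit
  | 1 => exact (h1.preservesFiniteLimits J).preservesLimit
theorem mor_colim (F : A ⥤ Mor B) [h0 : PreservesFiniteColimits (F ⋙ ue0 B)] [h1 : PreservesFiniteColimits (F ⋙ ue1 B)] : PreservesFiniteColimits F := by
  refine ⟨fun J _ _ => ⟨fun {K} => ?_⟩⟩
  apply preservesColimit_of_evaluation
  intro i
  match i with
  | 0 => exact (h0.preservesFiniteColimits J).preservesColimit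
  | 1 => exact (h1.preservesFiniteColimits J).preservesColimit
theorem mor_ex (F : A ⥤ Mor B) (F0 F1 : A ⥤ B) [Ex F0] [Ex F1] (e0 : F ⋙ ue0 B ≅ F0) (e1 : F ⋙ ue1 B ≅ F1) : Ex F := by
  haveI := preservesFiniteLimits_of_natIso e0.symm
  haveI := preservesFiniteLimits_of_natIso e1.symm
  haveI := preservesFiniteColimits_of_natIso e0.symm
  haveI := preservesFiniteColimits_of_natIso e1.symm
  have := mor_lim A F
  exact ⟨Functor.additive_of_preserves_binary_products F, this, mor_colim A F⟩
instance : Ex (𝟭 A) := ⟨inferInstance, inferInstance, inferInstance⟩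
instance : Ex (ue0 A) := ⟨inferInstance, inferInstance, inferInstance⟩
instance : Ex (ue1 A) := ⟨inferInstance, inferInstance, inferInstance⟩
noncomputable abbrev zf : A ⥤ A where
  obj X := 0
  map f := 0
instance : Ex (zf A) := by
  have hz : IsZero (zf A) := (Functor.isZero_iff _).2 fun X => isZero_zero A
  exact ⟨⟨fun {_ _ _ _} => (isZero_zero A).eq_of_src _ _⟩, ⟨fun J _ _ => Functor.preservesLimitsOfShape_of_isZero _ hz J⟩, ⟨fun J _ _ => Functor.preservesColimitsOfShape_of_isZero _ hz J⟩⟩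
instance : Ex (uz A) := mor_ex A _ (zf A) (𝟭 A) (Iso.refl _) (Iso.refl _)
instance : Ex (ut A) := mor_ex A _ (𝟭 A) (𝟭 A) (Iso.refl _) (Iso.refl _)
instance : Ex (uw A) := mor_ex A _ (𝟭 A) (zf A) (Iso.refl _) (Iso.refl _)

noncomputable def ud : CData A (Mor A) where
  G₁ := uz A
  G₀ := ut A
  F₀ := ue0 A
  F₁ := ue1 A
  η := { app := fun X => ComposableArrows.homMk₁ (0 : (0:A) ⟶ X) (𝟙 X) (by exact (isZero_zero A).eq_of_src _ _)
         naturality := fun X Y f => ComposableArrows.hom_ext₁ (by exact (isZero_zero A).eq_of_src _ _) (by exact (Category.comp_id f).trans (Category.id_comp f).symm) }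
  ξ := { app := fun Y => Y.map' 0 1
         naturality := fun X Y f => (f.naturality _).symm }
  u X := 𝟙 X
  v X := 𝟙 X
  q Y := ComposableArrows.homMk₁ (𝟙 (Y.obj 0)) (Y.map' 0 1) rfl
  p Y := ComposableArrows.homMk₁ (0 : (0:A) ⟶ _) (𝟙 (Y.obj 1)) (by exact (isZero_zero A).eq_of_src _ _)
  nu f := (Category.comp_id f).trans (Category.id_comp f).symm
  nv f := (Category.comp_id f).trans (Category.id_comp f).symm
  nq f := ComposableArrows.hom_ext₁ (by exact (Category.comp_id _).trans (Category.id_comp _).symm) (by exact (f.naturality _).symm)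
  np f := ComposableArrows.hom_ext₁ (by exact (isZero_zero A).eq_of_src _ _) (by exact (Category.comp_id _).trans (Category.id_comp _).symm)
  t0 X := ComposableArrows.hom_ext₁ (by exact Category.comp_id _) (by exact Category.comp_id _)
  t0' Y := by exact Category.comp_id _
  t1 X := ComposableArrows.hom_ext₁ (by exact (isZero_zero A).eq_of_src _ _) (by exact Category.comp_id _)
  t1' X := by exact Category.comp_id _
  c1 X := rfl
  c2 Y := ComposableArrows.hom_ext₁ (by exact (isZero_zero A).eq_of_src _ _) (by exact (Category.comp_id _).trans (Category.id_comp _).symm)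
instance : ExD (ud A) := ⟨inferInstanceAs (Ex (uz A)), inferInstanceAs (Ex (ut A)), inferInstanceAs (Ex (ue0 A)), inferInstanceAs (Ex (ue1 A))⟩
noncomputable def urho : (ud A).G₀ ⟶ uw A :=
  { app := fun X => ComposableArrows.homMk₁ (𝟙 X) (0 : X ⟶ (0:A)) (by exact (isZero_zero A).eq_of_tgt _ _)
    naturality := fun X Y f => ComposableArrows.hom_ext₁ (by exact (Category.comp_id f).trans (Category.id_comp f).symm) (by exact (isZero_zero A).eq_of_tgt _ _) }

theorem u0 (X : A) : (ud A).η.app X ≫ (urho A).app X = 0 :=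
  ComposableArrows.hom_ext₁ (by exact (isZero_zero A).eq_of_src _ _) (by exact (isZero_zero A).eq_of_tgt _ _)

theorem uS (X : A) : (ShortComplex.mk _ _ (u0 A X)).ShortExact := by
  have : ∀ i, ((ShortComplex.mk _ _ (u0 A X)).map ((evaluation _ _).obj i)).ShortExact := by
    intro i
    have hh1 : (0 : X ⟶ (0:A)) ≫ (0 : (0:A) ⟶ X) + 𝟙 X ≫ 𝟙 X = 𝟙 X := by simp
    have hh2 : 𝟙 X ≫ 𝟙 X + (0 : X ⟶ (0:A)) ≫ (0 : (0:A) ⟶ X)  = 𝟙 X := by simp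
    match i with
    | 0 => 
      apply ShortComplex.Splitting.shortExact
      exact { r := (0 : X ⟶ (0:A)), s := 𝟙 X, f_r := (isZero_zero A).eq_of_src _ _, s_g := Category.comp_id _, id := hh1 }
    | 1 => 
      apply ShortComplex.Splitting.shortExact
      exact { r := 𝟙 X, s := (0 : (0:A) ⟶ X), f_r := Category.comp_id _, s_g := (isZero_zero A).eq_of_src _ _, id := hh2 }
  have hm : ∀ i, Mono (((ud A).η.app X).app i) := fun i => (this i).mono_f
  have he : ∀ i, Epi (((urho A).app X).app i) := fun i => (this i).epi_g
  refine @ShortComplex.ShortExact.mk _ _ _ _ ?_ (NatTrans.mono_of_mono_app _) (NatTrans.epi_of_epi_app _)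
  rw [ShortComplex.exact_iff_isZero_homology]
  refine (Functor.isZero_iff _).2 fun i => ?_
  exact ((ShortComplex.exact_iff_isZero_homology _).1 (this i).exact).of_iso (ShortComplex.mapHomologyIso _ ((evaluation _ _).obj i)).symm

/-- the derived fibre functor is right adjoint to a derived exact functor -/
noncomputable def uadj : (uw A).mapDerivedCategory ⊣ coconeD (ud A).ξ :=
  (adjD (ud A)).ofNatIsoLeft (coneD_iso_w (ud A).η (urho A) (u0 A) (uS A))

noncomputable instance ucs : (coconeD (ud A).ξ).CommShift ℤ := (uadj A).rightAdjointCommShift ℤ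
instance utri : (coconeD (ud A).ξ).IsTriangulated := by
  haveI := (uadj A).commShift_of_leftAdjoint ℤ
  exact (uadj A).isTriangulated_rightAdjoint
end

section
variable {F₀ F₁ : B ⥤ A} [Ex F₀] [Ex F₁] (ξ : F₀ ⟶ F₁)
noncomputable abbrev uE : B ⥤ Mor A where
  obj Y := ComposableArrows.mk₁ (ξ.app Y)
  map f := ComposableArrows.homMk₁ (F₀.map f) (F₁.map f) (by exact (ξ.naturality f).symm)
  map_id X := ComposableArrows.hom_ext₁ (F₀.map_id _) (F₁.map_id _)
  map_comp f g := ComposableArrows.hom_ext₁ (F₀.map_comp _ _) (F₁.map_comp _ _)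
instance : Ex (uE ξ) := mor_ex _ _ F₀ F₁ (Iso.refl _) (Iso.refl _)

noncomputable def coconeT : DerivedCategory B ⥤ DerivedCategory A := (uE ξ).mapDerivedCategory ⋙ coconeD (ud A).ξ
noncomputable instance : (coconeT ξ).CommShift ℤ := inferInstanceAs (((uE ξ).mapDerivedCategory ⋙ coconeD (ud A).ξ).CommShift ℤ)
instance : (coconeT ξ).IsTriangulated := inferInstanceAs (((uE ξ).mapDerivedCategory ⋙ coconeD (ud A).ξ).IsTriangulated)

noncomputable def coconeT_fac : DerivedCategory.Q ⋙ coconeT ξ ≅ coconeF ξ ⋙ DerivedCategory.Q :=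
  Functor.isoWhiskerRight ((uE ξ).mapDerivedCategoryFactors) (coconeD (ud A).ξ) ≪≫
    Functor.isoWhiskerLeft ((uE ξ).mapHomologicalComplex _) (coconeD_iso (ud A).ξ)
noncomputable def coconeT_iso : coconeT ξ ≅ coconeD ξ :=
  haveI : Localization.Lifting DerivedCategory.Q (HomologicalComplex.quasiIso B (ComplexShape.up ℤ))
    (coconeF ξ ⋙ DerivedCategory.Q) (coconeD ξ) := ⟨coconeD_iso ξ⟩
  haveI : Localization.Lifting DerivedCategory.Q (HomologicalComplex.quasiIso B (ComplexShape.up ℤ))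
    (coconeF ξ ⋙ DerivedCategory.Q) (coconeT ξ) := ⟨coconeT_fac ξ⟩
  Localization.liftNatIso DerivedCategory.Q (HomologicalComplex.quasiIso B (ComplexShape.up ℤ))
    (coconeF ξ ⋙ DerivedCategory.Q) (coconeF ξ ⋙ DerivedCategory.Q) _ _ (Iso.refl _)
end

theorem equivT (d : CData A B) [ExD d] (h1 : ∀ K, QuasiIso (d.unitA K)) (h2 : ∀ K, QuasiIso (d.counitA K)) :
    (coconeT d.ξ).IsEquivalence := by
  have := equivD d h1 h2
  exact Functor.isEquivalence_of_iso (coconeT_iso d.ξ).symm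
end univ
end QN

namespace QN
set_option linter.all false
section lemE
open CategoryTheory CategoryTheory.Limits CochainComplex CochainComplex.HomComplex CategoryTheory.Pretriangulated
universe v u v' u' v'' u''
section
variable {A : Type u} [Category.{v} A] [Abelian A]
variable {K L : CochainComplex A ℤ} (φ : K ⟶ L)

theorem coco_d_snd (p q r : ℤ) (h : p + 1 = q) (h' : p + -1 = r) :
    (mappingCocone φ).d p q ≫ (mappingCocone.snd φ).v q p (by lia) =
     - (mappingCocone.fst φ).f p ≫ φ.f p - (mappingCocone.snd φ).v p r h' ≫ L.d r p := by
  have := congrArg (fun z => Cochain.v z p p (add_zero p)) (δsnd φ)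
  simp only [δ_v (-1) 0 (by lia) _ p p (add_zero p) r q (by lia) h] at this
  simp at this
  rw [sub_eq_add_neg, ← this]; abel

theorem coco_inl_d (p q : ℤ) (h : p + 1 = q) : (mappingCocone.inl φ).v p p (add_zero p) ≫ (mappingCocone φ).d p q =
    K.d p q ≫ (mappingCocone.inl φ).v q q (add_zero q) - φ.f p ≫ (mappingCocone.inr φ).1.v p q h := by
  rw [← Category.comp_id ((mappingCocone φ).d p q), ← mappingCocone.id_X φ q p (by lia)]
  simp only [Preadditive.comp_add, ← reassoc_of% (mappingCocone.fst φ).comm, reassoc_of% (coco_d_snd φ p q (p+-1) h rfl)]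
  simp [sub_eq_add_neg, -HomologicalComplex.Hom.comm_assoc]
theorem coco_inr_d (p q r : ℤ) (h : p + 1 = q) (h' : q + 1 = r) : (mappingCocone.inr φ).1.v p q h ≫ (mappingCocone φ).d q r =
    - L.d p q ≫ (mappingCocone.inr φ).1.v q r h' := by
  rw [← Category.comp_id ((mappingCocone φ).d q r), ← mappingCocone.id_X φ r q (by lia)]
  simp only [Preadditive.comp_add, ← reassoc_of% (mappingCocone.fst φ).comm, reassoc_of% (coco_d_snd φ q r p h' (by lia))]
  simp [sub_eq_add_neg, -HomologicalComplex.Hom.comm_assoc]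
end

variable {A : Type u} [Category.{v} A] [Abelian A] {B : Type u'} [Category.{v'} B] [Abelian B]

section
variable {C : Type*} [Category C] [Preadditive C] {X T Y a b c N : C}

theorem tsplit (jl : a ⟶ X) (jr : N ⟶ X) (πl : X ⟶ a) (πr : X ⟶ N) (hx : πl ≫ jl + πr ≫ jr = 𝟙 X) 
    (h1 : jl ≫ πl = 𝟙 a) (h2 : jr ≫ πr = 𝟙 N) (h3 : jl ≫ πr = 0) (h4 : jr ≫ πl = 0)
    (ia : a ⟶ T) (ib : b ⟶ T) (ic : c ⟶ T) (pa : T ⟶ a) (pb : T ⟶ b) (pc : T ⟶ c)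
    (ht : pa ≫ ia + pb ≫ ib + pc ≫ ic = 𝟙 T) (aa : ia ≫ pa = 𝟙 a) (bb : ib ≫ pb = 𝟙 b) (cc : ic ≫ pc = 𝟙 c)
    (ab : ia ≫ pb = 0) (ac : ia ≫ pc = 0) (ba : ib ≫ pa = 0) (bc : ib ≫ pc = 0) (ca : ic ≫ pa = 0) (cb : ic ≫ pb = 0)
    (f : X ⟶ T) (g : T ⟶ Y) (w : f ≫ g = 0) (g1 : N ⟶ b) (g2 : N ⟶ c) (k1 : b ⟶ Y) (k2 : c ⟶ Y)
    (f1 : jl ≫ f = ia) (f2 : jr ≫ f = g1 ≫ ib + g2 ≫ ic) (e1 : ia ≫ g = 0) (e2 : ib ≫ g = k1) (e3 : ic ≫ g = k2)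
    (h : (IsIso g1 ∧ IsIso k2) ∨ (IsIso g2 ∧ IsIso k1)) : Nonempty (ShortComplex.mk f g w).Splitting := by
  have hw : g1 ≫ k1 + g2 ≫ k2 = 0 := by
    have := congrArg (fun z => jr ≫ z) w
    simpa [reassoc_of% f2, e2, e3] using this
  have hf : f = πl ≫ ia + πr ≫ (g1 ≫ ib + g2 ≫ ic) := by
    rw [← Category.id_comp f, ← hx]; simp [f1, f2]
  have hg : g = pb ≫ k1 + pc ≫ k2 := by
    rw [← Category.id_comp g, ← ht]; simp [e1, e2, e3]
  rcases h with ⟨i1, i2⟩ | ⟨i1, i2⟩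
  · have hw' : k1 ≫ inv k2 = - inv g1 ≫ g2 := by
      rw [← cancel_epi g1, ← cancel_mono k2]
      simp; rw [eq_neg_iff_add_eq_zero, hw]
    refine ⟨{ r := pa ≫ jl + pb ≫ inv g1 ≫ jr, s := inv k2 ≫ ic, f_r := ?_, s_g := ?_, id := ?_ }⟩
    · dsimp; rw [hf, ← hx]; simp [reassoc_of% aa, reassoc_of% ab, reassoc_of% ba, reassoc_of% bb, reassoc_of% ca, reassoc_of% cb]
    · dsimp; rw [hg]; simp [reassoc_of% cb, reassoc_of% cc]
    · subst hf hg; dsimp; rw [← ht]; simp [reassoc_of% h1, reassoc_of% h2, reassoc_of% h3, reassoc_of% h4, reassoc_of% hw']; abel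
  · have hw' : k2 ≫ inv k1 = - inv g2 ≫ g1 := by
      rw [← cancel_epi g2, ← cancel_mono k1]
      simp; rw [eq_neg_iff_add_eq_zero, add_comm, hw]
    refine ⟨{ r := pa ≫ jl + pc ≫ inv g2 ≫ jr, s := inv k1 ≫ ib, f_r := ?_, s_g := ?_, id := ?_ }⟩
    · dsimp; rw [hf, ← hx]; simp [reassoc_of% aa, reassoc_of% ac, reassoc_of% ba, reassoc_of% bc, reassoc_of% ca, reassoc_of% cc]
    · dsimp; rw [hg]; simp [reassoc_of% bb, reassoc_of% bc]
    · subst hf hg; dsimp; rw [← ht]; simp [reassoc_of% h1, reassoc_of% h2, reassoc_of% h3, reassoc_of% h4, reassoc_of% hw']; abel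

theorem tsplit' (jl : a ⟶ X) (jr : N ⟶ X) (πl : X ⟶ a) (πr : X ⟶ N) (hx : πl ≫ jl + πr ≫ jr = 𝟙 X) 
    (h1 : jl ≫ πl = 𝟙 a) (h2 : jr ≫ πr = 𝟙 N) (h3 : jl ≫ πr = 0) (h4 : jr ≫ πl = 0)
    (ia : a ⟶ T) (ib : b ⟶ T) (ic : c ⟶ T) (pa : T ⟶ a) (pb : T ⟶ b) (pc : T ⟶ c)
    (ht : pa ≫ ia + pb ≫ ib + pc ≫ ic = 𝟙 T) (aa : ia ≫ pa = 𝟙 a) (bb : ib ≫ pb = 𝟙 b) (cc : ic ≫ pc = 𝟙 c)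
    (ab : ia ≫ pb = 0) (ac : ia ≫ pc = 0) (ba : ib ≫ pa = 0) (bc : ib ≫ pc = 0) (ca : ic ≫ pa = 0) (cb : ic ≫ pb = 0)
    (f : Y ⟶ T) (g : T ⟶ X) (w : f ≫ g = 0) (g1 : b ⟶ N) (g2 : c ⟶ N) (k1 : Y ⟶ b) (k2 : Y ⟶ c)
    (f1 : g ≫ πl = pa) (f2 : g ≫ πr = pb ≫ g1 + pc ≫ g2) (e1 : f ≫ pa = 0) (e2 : f ≫ pb = k1) (e3 : f ≫ pc = k2)
    (h : (IsIso g1 ∧ IsIso k2) ∨ (IsIso g2 ∧ IsIso k1)) : Nonempty (ShortComplex.mk f g w).Splitting := by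
  have hw : k1 ≫ g1 + k2 ≫ g2 = 0 := by
    have := congrArg (fun z => z ≫ πr) w
    simpa [f2, reassoc_of% e2, reassoc_of% e3] using this
  have hf : g = pa ≫ jl + (pb ≫ g1 + pc ≫ g2) ≫ jr := by
    rw [← Category.comp_id g, ← hx]; simp [reassoc_of% f1, reassoc_of% f2]
  have hg : f = k1 ≫ ib + k2 ≫ ic := by
    rw [← Category.comp_id f, ← ht]; simp [reassoc_of% e1, reassoc_of% e2, reassoc_of% e3]
  rcases h with ⟨i1, i2⟩ | ⟨i1, i2⟩
  · have hw' : inv k2 ≫ k1 = - g2 ≫ inv g1 := by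
      rw [← cancel_epi k2, ← cancel_mono g1]
      simp; rw [eq_neg_iff_add_eq_zero, hw]
    refine ⟨{ s := πl ≫ ia + πr ≫ inv g1 ≫ ib, r := pc ≫ inv k2, f_r := ?_, s_g := ?_, id := ?_ }⟩
    · dsimp; rw [hg]; simp [reassoc_of% bc, reassoc_of% cc]
    · dsimp; rw [hf, ← hx]; simp [reassoc_of% aa, reassoc_of% ab, reassoc_of% ac, reassoc_of% ba, reassoc_of% bb, reassoc_of% bc]
    · subst hf hg; dsimp; rw [← ht]; simp [reassoc_of% h1, reassoc_of% h2, reassoc_of% h3, reassoc_of% h4, reassoc_of% hw']; abel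
  · have hw' : inv k1 ≫ k2 = - g1 ≫ inv g2 := by
      rw [← cancel_epi k1, ← cancel_mono g2]
      simp; rw [eq_neg_iff_add_eq_zero, add_comm, hw]
    refine ⟨{ s := πl ≫ ia + πr ≫ inv g2 ≫ ic, r := pb ≫ inv k1, f_r := ?_, s_g := ?_, id := ?_ }⟩
    · dsimp; rw [hg]; simp [reassoc_of% bb, reassoc_of% cb]
    · dsimp; rw [hf, ← hx]; simp [reassoc_of% aa, reassoc_of% ab, reassoc_of% ac, reassoc_of% ca, reassoc_of% cb, reassoc_of% cc]
    · subst hf hg; dsimp; rw [← ht]; simp [reassoc_of% h1, reassoc_of% h2, reassoc_of% h3, reassoc_of% h4, reassoc_of% hw']; abel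
end

/-- jointly exact family of exact functors -/
structure JF (B : Type u') [Category.{v'} B] [Abelian B] (ι : Type) (C : Type u'') [Category.{v''} C] [Abelian C] where
  E : ι → (B ⥤ C)
  [ad : ∀ x, (E x).Additive]
  ex : ∀ S : ShortComplex B, (∀ x, (S.map (E x)).ShortExact) → S.ShortExact
attribute [instance] JF.ad


theorem qis_g_of_ses {S : ShortComplex (CochainComplex A ℤ)} (hS : S.ShortExact) (h : IsZero (DerivedCategory.Q.obj S.X₁)) : QuasiIso S.g := by
  rw [qis_iff]
  exact (Triangle.isZero₁_iff_isIso₂ _ (DerivedCategory.triangleOfSES_distinguished hS)).1 h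
theorem qis_f_of_ses {S : ShortComplex (CochainComplex A ℤ)} (hS : S.ShortExact) (h : IsZero (DerivedCategory.Q.obj S.X₃)) : QuasiIso S.f := by
  rw [qis_iff]
  exact (Triangle.isZero₃_iff_isIso₁ _ (DerivedCategory.triangleOfSES_distinguished hS)).1 h
theorem isZero_cone_id (N : CochainComplex A ℤ) : IsZero (DerivedCategory.Q.obj (mappingCone (𝟙 N))) := by
  refine (Triangle.isZero₃_iff_isIso₁ _ (DerivedCategory.mappingCone_triangle_distinguished (𝟙 N))).2 ?_
  change IsIso (DerivedCategory.Q.map (𝟙 N)); infer_instance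
theorem isZero_cocone_id (N : CochainComplex A ℤ) : IsZero (DerivedCategory.Q.obj (mappingCocone (𝟙 N))) := by
  refine (Triangle.isZero₁_iff_isIso₂ _ (DerivedCategory.mappingCocone_triangle_distinguished (𝟙 N))).2 ?_
  change IsIso (DerivedCategory.Q.map (𝟙 N)); infer_instance

theorem ses_of_JF {ι : Type} {C : Type u''} [Category.{v''} C] [Abelian C] (J : JF B ι C) (S : ShortComplex (CochainComplex B ℤ))
    (h : ∀ p x, Nonempty ((S.map (HomologicalComplex.eval B _ p)).map (J.E x)).Splitting) : S.ShortExact := by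
  apply HomologicalComplex.shortExact_of_degreewise_shortExact
  intro p
  apply J.ex
  intro x
  exact (h p x).some.shortExact

section
variable (d : CData A B) (L : CochainComplex B ℤ) 

noncomputable def kα : Cochain ((mc d.G₁).obj ((mc d.F₀).obj L)) (mappingCone (mt d.η (mappingCocone (mt d.ξ L)))) (-1) :=
  (cmap d.G₁ (mappingCocone.inl (mt d.ξ L))).comp (mappingCone.inl (mt d.η (mappingCocone (mt d.ξ L)))) (zero_add _)
theorem kα_v (p q : ℤ) (h : p + -1 = q) : (kα d L).v p q h = d.G₁.map ((mappingCocone.inl (mt d.ξ L)).v p p (add_zero p)) ≫ 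
   (mappingCone.inl (mt d.η (mappingCocone (mt d.ξ L)))).v p q h := by
  simp [kα]

noncomputable def kβ : (mc d.G₁).obj ((mc d.F₀).obj L) ⟶ (mappingCone (mt d.η (mappingCocone (mt d.ξ L)))) :=
  Cocycle.homOf ⟨δ (-1) 0 (kα d L), by rw [Cocycle.mem_iff _ 1 (by simp)]; exact δ_δ _ _ _ _⟩

theorem ofHom_kβ : Cochain.ofHom (kβ d L) = δ (-1) 0 (kα d L) := by
  exact Cocycle.cochain_ofHom_homOf_eq_coe _

theorem kβ_f (p : ℤ) : (kβ d L).f p = d.G₁.map (d.ξ.app _) ≫ d.G₁.map ((mappingCocone.inr (mt d.ξ L)).1.v p (p+1) rfl) ≫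
     (mappingCone.inl (mt d.η (mappingCocone (mt d.ξ L)))).v (p+1) p (by lia) + 
     d.η.app _ ≫ d.G₀.map ((mappingCocone.inl (mt d.ξ L)).v p p (add_zero p)) ≫ (mappingCone.inr (mt d.η (mappingCocone (mt d.ξ L)))).f p := by
  have := congrArg (fun z => Cochain.v z p p (add_zero p)) (ofHom_kβ d L)
  simp only [δ_v (-1) 0 (by lia) _ p p (add_zero p) (p-1) (p+1) (by lia) rfl, Cochain.ofHom_v, kα_v, Category.assoc] at this
  rw [this, mappingCone.inl_v_d _ p (p-1) (p+1) (by lia) (by lia)]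
  simp [-Functor.map_comp, ← Functor.map_comp_assoc, coco_inl_d _ p (p+1) rfl]
  simp
  abel

noncomputable def kι : mappingCone (𝟙 ((mc d.G₁).obj ((mc d.F₀).obj L))) ⟶ (mappingCone (mt d.η (mappingCocone (mt d.ξ L)))) :=
  mappingCone.desc _ (kα d L) (kβ d L) (by simp [ofHom_kβ])

theorem kι_inl (p q : ℤ) (h) : (mappingCone.inl (𝟙 ((mc d.G₁).obj ((mc d.F₀).obj L)))).v p q h ≫ (kι d L).f q = (kα d L).v p q h := by
  simp [kι]
theorem kι_inr (p : ℤ) : (mappingCone.inr (𝟙 ((mc d.G₁).obj ((mc d.F₀).obj L)))).f p ≫ (kι d L).f p = (kβ d L).f p := by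
  simp [kι]
theorem kι_zero : kι d L ≫ d.counitA L = 0 := by
  have h1 : (kα d L).comp (Cochain.ofHom (d.counitA L)) (add_zero _) = 0 := by
    ext p q h
    simp [kα_v, d.inl_counitA L p q h, ← Functor.map_comp_assoc]
  have h2 : kβ d L ≫ d.counitA L = 0 := by
    ext p
    have := Cochain.congr_v (congrArg (δ (-1) 0) h1) p p (add_zero p)
    simpa [δ_comp_ofHom, ← ofHom_kβ] using this
  ext p
  apply mappingCone.ext_from _ (p+1) p rfl
  · have := Cochain.congr_v h1 (p+1) p (by lia)
    simpa [kι] using this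
  · have := congrArg (fun z => HomologicalComplex.Hom.f z p) h2
    simpa [kι] using this

theorem cnt1 (p q : ℤ) (h) : (kα d L).v p q h ≫ (d.counitA L).f q = 0 := by
  rw [kα_v, Category.assoc, d.inl_counitA]; simp [← Functor.map_comp_assoc]
theorem cnt2 (p q : ℤ) (h) : (d.G₁.map ((mappingCocone.inr (mt d.ξ L)).1.v q p (by lia)) ≫ 
    (mappingCone.inl (mt d.η (mappingCocone (mt d.ξ L)))).v p q h) ≫ (d.counitA L).f q = - d.p _ := by
  rw [Category.assoc, d.inl_counitA]; simp [← Functor.map_comp_assoc]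
theorem cnt3 (p : ℤ) : (d.G₀.map ((mappingCocone.inl (mt d.ξ L)).v p p (add_zero p)) ≫
    (mappingCone.inr (mt d.η (mappingCocone (mt d.ξ L)))).f p) ≫ (d.counitA L).f p = d.q _ := by
  rw [Category.assoc, d.inr_counitA]; simp [← Functor.map_comp_assoc]

theorem iso_neg {C D : Type*} [Category C] [Preadditive C] [Category D] [Preadditive D] (E : C ⥤ D) [E.Additive] {X Y : C} (f : X ⟶ Y)
    (h : IsIso (E.map f)) : IsIso (E.map (-f)) := by
  rw [Functor.map_neg]; exact ⟨-inv (E.map f), by simp, by simp⟩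

theorem qis_counit {ι : Type} {C : Type u''} [Category.{v''} C] [Abelian C] (J : JF B ι C) (hz : ∀ Y, IsZero (d.G₀.obj (d.F₁.obj Y)))
   (h : ∀ x, (∀ Y, IsIso ((J.E x).map (d.G₁.map (d.ξ.app Y))) ∧ IsIso ((J.E x).map (d.q Y))) ∨ 
     (∀ Y, IsIso ((J.E x).map (d.η.app (d.F₀.obj Y))) ∧ IsIso ((J.E x).map (d.p Y)))) : QuasiIso (d.counitA L) := by
  refine qis_g_of_ses (S := ShortComplex.mk _ _ (kι_zero d L)) ?_ (isZero_cone_id _)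
  apply ses_of_JF J
  intro p x
  let N := ((mc d.G₁).obj ((mc d.F₀).obj L))
  have M := fun {X Y : B} (f g : X ⟶ Y) (h : f = g) => congrArg (J.E x).map h
  refine tsplit ((J.E x).map ((mappingCone.inl (𝟙 N)).v (p+1) p (by lia))) ((J.E x).map ((mappingCone.inr (𝟙 N)).f p)) 
    ((J.E x).map ((mappingCone.fst (𝟙 N)).1.v p (p+1) rfl)) ((J.E x).map ((mappingCone.snd (𝟙 N)).v p p (add_zero p))) ?_ ?_ ?_ ?_ ?_
    ((J.E x).map ((kα d L).v (p+1) p (by lia)))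
    ((J.E x).map (d.G₁.map ((mappingCocone.inr (mt d.ξ L)).1.v p (p+1) rfl) ≫ (mappingCone.inl (mt d.η (mappingCocone (mt d.ξ L)))).v (p+1) p (by lia)))
    ((J.E x).map (d.G₀.map ((mappingCocone.inl (mt d.ξ L)).v p p (add_zero p)) ≫ (mappingCone.inr (mt d.η (mappingCocone (mt d.ξ L)))).f p))
    ((J.E x).map ((mappingCone.fst (mt d.η (mappingCocone (mt d.ξ L)))).1.v p (p+1) rfl ≫ d.G₁.map ((mappingCocone.fst (mt d.ξ L)).f (p+1))))
    ((J.E x).map ((mappingCone.fst (mt d.η (mappingCocone (mt d.ξ L)))).1.v p (p+1) rfl ≫ d.G₁.map ((mappingCocone.snd (mt d.ξ L)).v (p+1) p (by lia))))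
    ((J.E x).map ((mappingCone.snd (mt d.η (mappingCocone (mt d.ξ L)))).v p p (add_zero p) ≫ d.G₀.map ((mappingCocone.fst (mt d.ξ L)).f p)))
    ?_ ?_ ?_ ?_ ?_ ?_ ?_ ?_ ?_ ?_ _ _ _ ((J.E x).map (d.G₁.map (d.ξ.app _))) ((J.E x).map (d.η.app _)) ((J.E x).map (-d.p _))
    ((J.E x).map (d.q _)) ?_ ?_ ?_ ?_ ?_ ?_
  · rw [← Functor.map_comp, ← Functor.map_comp, ← Functor.map_add]; refine (M _ _ ?_).trans ((J.E x).map_id _); simp [mappingCone.id_X _ p (p+1) rfl]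
  · rw [← Functor.map_comp]; refine (M _ _ ?_).trans ((J.E x).map_id _); simp
  · rw [← Functor.map_comp]; refine (M _ _ ?_).trans ((J.E x).map_id _); simp
  · rw [← Functor.map_comp]; refine (M _ _ ?_).trans ((J.E x).map_zero _ _); simp
  · rw [← Functor.map_comp]; refine (M _ _ ?_).trans ((J.E x).map_zero _ _); simp
  · rw [← Functor.map_comp, ← Functor.map_comp, ← Functor.map_comp, ← Functor.map_add, ← Functor.map_add]; refine (M _ _ ?_).trans ((J.E x).map_id _)
    have i1 := mappingCone.id_X (mt d.η (mappingCocone (mt d.ξ L))) p (p+1) rfl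
    have i2 := congrArg d.G₁.map (mappingCocone.id_X (mt d.ξ L) (p+1) p (by lia))
    have i3 := congrArg d.G₀.map (mappingCocone.id_X (mt d.ξ L) p (p-1) (by lia))
    have i4 : d.G₀.map ((mappingCocone.snd (mt d.ξ L)).v p (p-1) (by lia)) = 0 := (hz _).eq_of_tgt _ _
    rw [d.G₁.map_add, d.G₁.map_id, d.G₁.map_comp, d.G₁.map_comp] at i2
    rw [d.G₀.map_add, d.G₀.map_id, d.G₀.map_comp, d.G₀.map_comp, i4, zero_comp, add_zero] at i3
    refine Eq.trans ?_ i1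
    rw [kα_v]
    simp only [Category.assoc, reassoc_of% i3]
    rw [← Preadditive.comp_add, ← Category.assoc (d.G₁.map _), ← Category.assoc (d.G₁.map _), ← Preadditive.add_comp, i2, Category.id_comp]
  · rw [← Functor.map_comp]; refine (M _ _ ?_).trans ((J.E x).map_id _); simp [kα_v]; simp [← Functor.map_comp]; rfl
  · rw [← Functor.map_comp]; refine (M _ _ ?_).trans ((J.E x).map_id _); simp; simp [← Functor.map_comp]
  · rw [← Functor.map_comp]; refine (M _ _ ?_).trans ((J.E x).map_id _); simp; simp [← Functor.map_comp]
  · rw [← Functor.map_comp]; refine (M _ _ ?_).trans ((J.E x).map_zero _ _); simp [kα_v]; simp [← Functor.map_comp]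
  · rw [← Functor.map_comp]; refine (M _ _ ?_).trans ((J.E x).map_zero _ _); simp [kα_v]
  · rw [← Functor.map_comp]; refine (M _ _ ?_).trans ((J.E x).map_zero _ _); simp; simp [← Functor.map_comp]
  · rw [← Functor.map_comp]; refine (M _ _ ?_).trans ((J.E x).map_zero _ _); simp
  · rw [← Functor.map_comp]; refine (M _ _ ?_).trans ((J.E x).map_zero _ _); simp
  · rw [← Functor.map_comp]; refine (M _ _ ?_).trans ((J.E x).map_zero _ _); simp
  · refine ((J.E x).map_comp _ _).symm.trans (M _ _ ?_); exact kι_inl ..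
  · rw [← Functor.map_comp, ← Functor.map_comp, ← Functor.map_add]; refine ((J.E x).map_comp _ _).symm.trans (M _ _ ?_); refine (kι_inr ..).trans ?_; rw [kβ_f]
  · refine ((J.E x).map_comp _ _).symm.trans ((M _ _ ?_).trans ((J.E x).map_zero _ _)); exact cnt1 ..
  · refine ((J.E x).map_comp _ _).symm.trans (M _ _ ?_); exact cnt2 ..
  · refine ((J.E x).map_comp _ _).symm.trans (M _ _ ?_); exact cnt3 ..
  · rcases h x with h | h
    · exact Or.inl (h _)
    · refine Or.inr ⟨(h _).1, ?_⟩
      exact iso_neg _ _ (h (L.X p)).2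
end

section
variable (d : CData A B) (K : CochainComplex A ℤ) 

noncomputable def lβ : Cochain (mappingCocone (mt d.ξ (mappingCone (mt d.η K)))) ((mc d.F₁).obj ((mc d.G₀).obj K)) (-1) :=
  (mappingCocone.snd (mt d.ξ (mappingCone (mt d.η K)))).comp (cmap d.F₁ (mappingCone.snd (mt d.η K))) (add_zero _)
theorem lβ_v (p q : ℤ) (h : p + -1 = q) : (lβ d K).v p q h = (mappingCocone.snd (mt d.ξ (mappingCone (mt d.η K)))).v p q h ≫
    d.F₁.map ((mappingCone.snd (mt d.η K)).v q q (add_zero q)) := by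
  simp [lβ]

noncomputable def lα : mappingCocone (mt d.ξ (mappingCone (mt d.η K))) ⟶ (mc d.F₁).obj ((mc d.G₀).obj K) :=
  Cocycle.homOf ⟨- δ (-1) 0 (lβ d K), by rw [Cocycle.mem_iff _ 1 (by simp), δ_neg, δ_δ, neg_zero]⟩

theorem ofHom_lα : Cochain.ofHom (lα d K) = - δ (-1) 0 (lβ d K) := by
  exact Cocycle.cochain_ofHom_homOf_eq_coe _

theorem lα_f (p : ℤ) : (lα d K).f p = ((mappingCocone.fst (mt d.ξ (mappingCone (mt d.η K)))).f p ≫ d.F₀.map ((mappingCone.snd (mt d.η K)).v p p (add_zero p))) ≫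
      d.ξ.app _ + 
     ((mappingCocone.snd (mt d.ξ (mappingCone (mt d.η K)))).v p (p-1) (by lia) ≫ d.F₁.map ((mappingCone.fst (mt d.η K)).1.v (p-1) p (by lia))) ≫ 
       d.F₁.map (d.η.app _) := by
  have := congrArg (fun z => Cochain.v z p p (add_zero p)) (ofHom_lα d K)
  simp only [Cochain.neg_v, δ_v (-1) 0 (by lia) _ p p (add_zero p) (p-1) (p+1) (by lia) rfl, Cochain.ofHom_v, lβ_v, Category.assoc] at this
  rw [this, ← Category.assoc ((mappingCocone _).d _ _), coco_d_snd _ p (p+1) (p-1) rfl (by lia)]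
  have h2 := mappingCone.d_snd_v (mt d.η K) (p-1) p (by lia)
  have h3 := congrArg d.F₁.map h2
  rw [d.F₁.map_add, d.F₁.map_comp, d.F₁.map_comp, d.F₁.map_comp] at h3
  simp [sub_eq_add_neg] at h3 ⊢
  rw [h3]
  simp
  abel

noncomputable def lπ : mappingCocone (mt d.ξ (mappingCone (mt d.η K))) ⟶ mappingCocone (𝟙 ((mc d.F₁).obj ((mc d.G₀).obj K))) :=
  mappingCocone.lift _ (lα d K) (lβ d K) (by simp [ofHom_lα])

theorem lπ_fst (p : ℤ) : (lπ d K).f p ≫ (mappingCocone.fst (𝟙 ((mc d.F₁).obj ((mc d.G₀).obj K)))).f p = (lα d K).f p := by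
  simp [lπ]
theorem lπ_snd (p q : ℤ) (h) : (lπ d K).f p ≫ (mappingCocone.snd (𝟙 ((mc d.F₁).obj ((mc d.G₀).obj K)))).v p q h = (lβ d K).v p q h := by
  simp [lπ]

theorem lπ_zero : d.unitA K ≫ lπ d K = 0 := by
  have h1 : (Cochain.ofHom (d.unitA K)).comp (lβ d K) (zero_add _) = 0 := by
    ext p q h
    simp only [Cochain.zero_cochain_comp_v, Cochain.ofHom_v, lβ_v]
    rw [reassoc_of% (d.unitA_snd K p q h)]
    simp [← Functor.map_comp]
  have h2 : d.unitA K ≫ lα d K = 0 := by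
    ext p
    have := Cochain.congr_v (congrArg (δ (-1) 0) h1) p p (add_zero p)
    simpa [δ_ofHom_comp, ← neg_eq_iff_eq_neg.2 (ofHom_lα d K)] using this
  apply coco_ext
  · intro p
    have := congrArg (fun z => HomologicalComplex.Hom.f z p) h2
    rw [HomologicalComplex.comp_f, Category.assoc, lπ_fst]
    simpa using this
  · intro p q h
    have := Cochain.congr_v h1 p q h
    rw [HomologicalComplex.comp_f, Category.assoc, lπ_snd]
    simpa using this

theorem unt1 (p q : ℤ) (h) : (d.unitA K).f p ≫ (lβ d K).v p q h = 0 := by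
  rw [lβ_v, reassoc_of% (d.unitA_snd K p q h)]; simp [← Functor.map_comp]
theorem unt2 (p : ℤ) : (d.unitA K).f p ≫ (mappingCocone.fst (mt d.ξ (mappingCone (mt d.η K)))).f p ≫ d.F₀.map ((mappingCone.snd (mt d.η K)).v p p (add_zero p)) = d.u _ := by
  rw [reassoc_of% (d.unitA_fst K p)]; simp [← Functor.map_comp]
theorem unt3 (p q : ℤ) (h) : (d.unitA K).f p ≫ (mappingCocone.snd (mt d.ξ (mappingCone (mt d.η K)))).v p q h ≫ d.F₁.map ((mappingCone.fst (mt d.η K)).1.v q p (by lia)) = - d.v _ := by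
  rw [reassoc_of% (d.unitA_snd K p)]; simp [← Functor.map_comp]

theorem qis_unit {ι : Type} {C : Type u''} [Category.{v''} C] [Abelian C] (J : JF A ι C) (hz : ∀ Y, IsZero (d.F₀.obj (d.G₁.obj Y)))
   (h : ∀ x, (∀ Y, IsIso ((J.E x).map (d.ξ.app (d.G₀.obj Y))) ∧ IsIso ((J.E x).map (d.v Y))) ∨ 
     (∀ Y, IsIso ((J.E x).map (d.F₁.map (d.η.app Y))) ∧ IsIso ((J.E x).map (d.u Y)))) : QuasiIso (d.unitA K) := by
  refine qis_f_of_ses (S := ShortComplex.mk _ _ (lπ_zero d K)) ?_ (isZero_cocone_id _)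
  apply ses_of_JF J
  intro p x
  let N := ((mc d.F₁).obj ((mc d.G₀).obj K))
  have M := fun {X Y : A} (f g : X ⟶ Y) (h : f = g) => congrArg (J.E x).map h
  refine tsplit' (a := (J.E x).obj (N.X (p-1))) (N := (J.E x).obj (N.X p)) ((J.E x).map ((mappingCocone.inr (𝟙 N)).1.v (p-1) p (by lia))) ((J.E x).map ((mappingCocone.inl (𝟙 N)).v p p (add_zero p))) 
    ((J.E x).map ((mappingCocone.snd (𝟙 N)).v p (p-1) (by lia))) ((J.E x).map ((mappingCocone.fst (𝟙 N)).f p)) ?_ ?_ ?_ ?_ ?_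
    ((J.E x).map (d.F₁.map ((mappingCone.inr (mt d.η K)).f (p-1)) ≫ (mappingCocone.inr (mt d.ξ (mappingCone (mt d.η K)))).1.v (p-1) p (by lia)))
    ((J.E x).map (d.F₀.map ((mappingCone.inr (mt d.η K)).f p) ≫ (mappingCocone.inl (mt d.ξ (mappingCone (mt d.η K)))).v p p (add_zero p)))
    ((J.E x).map (d.F₁.map ((mappingCone.inl (mt d.η K)).v p (p-1) (by lia)) ≫ (mappingCocone.inr (mt d.ξ (mappingCone (mt d.η K)))).1.v (p-1) p (by lia)))
    ((J.E x).map ((lβ d K).v p (p-1) (by lia)))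
    ((J.E x).map ((mappingCocone.fst (mt d.ξ (mappingCone (mt d.η K)))).f p ≫ d.F₀.map ((mappingCone.snd (mt d.η K)).v p p (add_zero p))))
    ((J.E x).map ((mappingCocone.snd (mt d.ξ (mappingCone (mt d.η K)))).v p (p-1) (by lia) ≫ d.F₁.map ((mappingCone.fst (mt d.η K)).1.v (p-1) p (by lia))))
    ?_ ?_ ?_ ?_ ?_ ?_ ?_ ?_ ?_ ?_ _ _ _ ((J.E x).map (d.ξ.app _)) ((J.E x).map (d.F₁.map (d.η.app _))) ((J.E x).map (d.u _))
    ((J.E x).map (-d.v _)) ?_ ?_ ?_ ?_ ?_ ?_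
  · rw [← Functor.map_comp, ← Functor.map_comp, ← Functor.map_add]; refine (M _ _ ?_).trans ((J.E x).map_id _)
    rw [add_comm]; exact mappingCocone.id_X _ p (p-1) (by lia)
  · rw [← Functor.map_comp]; refine (M _ _ ?_).trans ((J.E x).map_id _); simp
  · rw [← Functor.map_comp]; refine (M _ _ ?_).trans ((J.E x).map_id _); simp
  · rw [← Functor.map_comp]; refine (M _ _ ?_).trans ((J.E x).map_zero _ _); simp
  · rw [← Functor.map_comp]; refine (M _ _ ?_).trans ((J.E x).map_zero _ _); simp
  · rw [← Functor.map_comp, ← Functor.map_comp, ← Functor.map_comp, ← Functor.map_add, ← Functor.map_add]; refine (M _ _ ?_).trans ((J.E x).map_id _)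
    have i1 := mappingCocone.id_X (mt d.ξ (mappingCone (mt d.η K))) p (p-1) (by lia)
    have i2 := congrArg d.F₁.map (mappingCone.id_X (mt d.η K) (p-1) p (by lia))
    have i3 := congrArg d.F₀.map (mappingCone.id_X (mt d.η K) p (p+1) (by lia))
    have i4 : d.F₀.map ((mappingCone.inl (mt d.η K)).v (p+1) p (by lia)) = 0 := (hz _).eq_of_src _ _
    rw [d.F₁.map_add, d.F₁.map_id, d.F₁.map_comp, d.F₁.map_comp] at i2
    rw [d.F₀.map_add, d.F₀.map_id, d.F₀.map_comp, d.F₀.map_comp, i4, comp_zero, zero_add] at i3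
    refine Eq.trans ?_ i1
    rw [lβ_v]
    simp only [Category.assoc, reassoc_of% i3]
    rw [add_comm _ ((mappingCocone.fst _).f p ≫ _), add_assoc, ← Preadditive.comp_add, ← Category.assoc (d.F₁.map _), ← Category.assoc (d.F₁.map _), ← Preadditive.add_comp, add_comm (d.F₁.map ((mappingCone.snd (mt d.η K)).v (p - 1) (p - 1) _) ≫ _), i2, Category.id_comp]
  · rw [← Functor.map_comp]; refine (M _ _ ?_).trans ((J.E x).map_id _); simp [lβ_v]; simp [← Functor.map_comp]; rfl
  · rw [← Functor.map_comp]; refine (M _ _ ?_).trans ((J.E x).map_id _); simp; simp [← Functor.map_comp]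
  · rw [← Functor.map_comp]; refine (M _ _ ?_).trans ((J.E x).map_id _); simp; simp [← Functor.map_comp]
  · rw [← Functor.map_comp]; refine (M _ _ ?_).trans ((J.E x).map_zero _ _); simp 
  · rw [← Functor.map_comp]; refine (M _ _ ?_).trans ((J.E x).map_zero _ _); simp; simp [← Functor.map_comp]
  · rw [← Functor.map_comp]; refine (M _ _ ?_).trans ((J.E x).map_zero _ _); simp [lβ_v]
  · rw [← Functor.map_comp]; refine (M _ _ ?_).trans ((J.E x).map_zero _ _); simp
  · rw [← Functor.map_comp]; refine (M _ _ ?_).trans ((J.E x).map_zero _ _); simp [lβ_v]; simp [← Functor.map_comp]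
  · rw [← Functor.map_comp]; refine (M _ _ ?_).trans ((J.E x).map_zero _ _); simp
  · refine ((J.E x).map_comp _ _).symm.trans (M _ _ ?_); exact lπ_snd ..
  · rw [← Functor.map_comp, ← Functor.map_comp, ← Functor.map_add]; refine ((J.E x).map_comp _ _).symm.trans (M _ _ ?_); refine (lπ_fst ..).trans ?_; rw [lα_f]
  · refine ((J.E x).map_comp _ _).symm.trans ((M _ _ ?_).trans ((J.E x).map_zero _ _)); exact unt1 ..
  · refine ((J.E x).map_comp _ _).symm.trans (M _ _ ?_); exact unt2 ..
  · refine ((J.E x).map_comp _ _).symm.trans (M _ _ ?_); exact unt3 ..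
  · rcases h x with h | h
    · refine Or.inl ⟨(h _).1, ?_⟩
      exact iso_neg _ _ (h (K.X p)).2
    · exact Or.inr (h _)
end

/-- derived equivalence criterion -/
theorem equivJ (d : CData A B) [ExD d] {ι : Type} {C : Type u''} [Category.{v''} C] [Abelian C] (J : JF A ι C) 
   (hz : ∀ Y, IsZero (d.F₀.obj (d.G₁.obj Y)))
   (h : ∀ x, (∀ Y, IsIso ((J.E x).map (d.ξ.app (d.G₀.obj Y))) ∧ IsIso ((J.E x).map (d.v Y))) ∨ 
     (∀ Y, IsIso ((J.E x).map (d.F₁.map (d.η.app Y))) ∧ IsIso ((J.E x).map (d.u Y))))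
   {ι' : Type} {C' : Type u''} [Category.{v''} C'] [Abelian C'] (J' : JF B ι' C') (hz' : ∀ Y, IsZero (d.G₀.obj (d.F₁.obj Y)))
   (h' : ∀ x, (∀ Y, IsIso ((J'.E x).map (d.G₁.map (d.ξ.app Y))) ∧ IsIso ((J'.E x).map (d.q Y))) ∨ 
     (∀ Y, IsIso ((J'.E x).map (d.η.app (d.F₀.obj Y))) ∧ IsIso ((J'.E x).map (d.p Y)))) : (coconeT d.ξ).IsEquivalence :=
  equivT d (fun K => qis_unit d K J hz h) (fun K => qis_counit d K J' hz' h')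
end lemE
end QN

namespace QN
set_option linter.all false
section repcat
open CategoryTheory CategoryTheory.Limits
variable {k : Type} [Field k] {V A : Type}

/-- action of an arrow on the total space -/
noncomputable def actL {s t : A → V} (obj : V → ModuleCat.{0} k) (map : ∀ a, obj (s a) ⟶ obj (t a)) (a : A) :
    (∀ v, obj v) →ₗ[k] (∀ v, obj v) :=
  haveI := Classical.decEq V
  LinearMap.single k (fun v => obj v) (t a) ∘ₗ (map a).hom ∘ₗ LinearMap.proj (s a)

noncomputable def pathL {s t : A → V} (obj : V → ModuleCat.{0} k) (map : ∀ a, obj (s a) ⟶ obj (t a)) :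
    List A → ((∀ v, obj v) →ₗ[k] (∀ v, obj v))
  | [] => LinearMap.id
  | a :: p => pathL obj map p ∘ₗ actL obj map a

/-- Representations of a quiver with zero relations. -/
structure Rep (k : Type) [Field k] {V A : Type} (s t : A → V) (R : Set (List A)) : Type 1 where
  obj : V → ModuleCat.{0} k
  map : ∀ a, obj (s a) ⟶ obj (t a)
  rel : ∀ p ∈ R, pathL obj map p = 0

namespace Rep
variable {s t : A → V} {R : Set (List A)}

@[ext] structure Hom (M N : Rep k s t R) : Type where
  app : ∀ v, M.obj v ⟶ N.obj v
  nat : ∀ a, M.map a ≫ app (t a) = app (s a) ≫ N.map a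


instance : Category (Rep k s t R) where
  Hom := Hom
  id M := ⟨fun v => 𝟙 _, fun a => by simp⟩
  comp f g := ⟨fun v => f.app v ≫ g.app v, fun a => by rw [← Category.assoc, f.nat, Category.assoc, g.nat, Category.assoc]⟩
  id_comp f := by apply Hom.ext; funext v; exact Category.id_comp _
  comp_id f := by apply Hom.ext; funext v; exact Category.comp_id _
  assoc f g h := by apply Hom.ext; funext v; exact Category.assoc _ _ _

/-- components of a morphism -/
abbrev ap {M N : Rep k s t R} (f : M ⟶ N) (v : V) : M.obj v ⟶ N.obj v := Hom.app f v

theorem hext {M N : Rep k s t R} {f g : M ⟶ N} (h : ∀ v, ap f v = ap g v) : f = g := Hom.ext (funext h)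
theorem ap_nat {M N : Rep k s t R} (f : M ⟶ N) (a : A) : M.map a ≫ ap f (t a) = ap f (s a) ≫ N.map a := Hom.nat f a
theorem ap_nat' {M N : Rep k s t R} (f : M ⟶ N) (a : A) {X : ModuleCat k} (g : N.obj (t a) ⟶ X) :
    M.map a ≫ ap f (t a) ≫ g = ap f (s a) ≫ N.map a ≫ g := by rw [← Category.assoc, ap_nat, Category.assoc]
@[simp] theorem ap_id (M : Rep k s t R) (v : V) : ap (𝟙 M) v = 𝟙 _ := rfl
@[simp] theorem ap_comp {M N L : Rep k s t R} (f : M ⟶ N) (g : N ⟶ L) (v : V) : ap (f ≫ g) v = ap f v ≫ ap g v := rfl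
/-- constructor -/
def hom {M N : Rep k s t R} (app : ∀ v, M.obj v ⟶ N.obj v) (nat : ∀ a, M.map a ≫ app (t a) = app (s a) ≫ N.map a) : M ⟶ N := Hom.mk app nat

@[simp] theorem ap_hom {M N : Rep k s t R} (app : ∀ v, M.obj v ⟶ N.obj v) (nat : ∀ a, M.map a ≫ app (t a) = app (s a) ≫ N.map a) (v : V) :
    ap (hom app nat) v = app v := rfl

instance (M N : Rep k s t R) : Zero (M ⟶ N) := ⟨hom (fun v => 0) (fun a => by simp)⟩
instance (M N : Rep k s t R) : Add (M ⟶ N) := ⟨fun f g => hom (fun v => ap f v + ap g v) (fun a => by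
  rw [Preadditive.comp_add, Preadditive.add_comp, ap_nat, ap_nat])⟩
instance (M N : Rep k s t R) : Neg (M ⟶ N) := ⟨fun f => hom (fun v => - ap f v) (fun a => by
  rw [Preadditive.comp_neg, Preadditive.neg_comp, ap_nat])⟩
@[simp] theorem ap_zero (M N : Rep k s t R) (v : V) : ap (0 : M ⟶ N) v = 0 := rfl
@[simp] theorem ap_add {M N : Rep k s t R} (f g : M ⟶ N) (v : V) : ap (f + g) v = ap f v + ap g v := rfl
@[simp] theorem ap_neg {M N : Rep k s t R} (f : M ⟶ N) (v : V) : ap (-f) v = - ap f v := rfl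

instance : Preadditive (Rep k s t R) where
  homGroup M N :=
    { add_assoc := fun f g h => hext fun v => by simp [add_assoc]
      zero_add := fun f => hext fun v => by simp
      add_zero := fun f => hext fun v => by simp
      add_comm := fun f g => hext fun v => by simp [add_comm]
      neg_add_cancel := fun f => hext fun v => by simp
      nsmul := nsmulRec
      zsmul := zsmulRec }
  add_comp _ _ _ _ _ _ := hext fun v => by simp
  comp_add _ _ _ _ _ _ := hext fun v => by simp

/-- evaluation at a vertex -/
def E (k : Type) [Field k] {V A : Type} (s t : A → V) (R : Set (List A)) (v : V) : Rep k s t R ⥤ ModuleCat.{0} k where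
  obj M := M.obj v
  map f := ap f v
instance (v : V) : (E k s t R v).Additive := ⟨rfl⟩

theorem isIso_of_ap {M N : Rep k s t R} (f : M ⟶ N) (h : ∀ v, IsIso (ap f v)) : IsIso f :=
  ⟨hom (fun v => inv (ap f v)) (fun a => by rw [← cancel_epi (ap f (s a)), ← ap_nat' ]; simp),
    hext fun v => by simp, hext fun v => by simp⟩
end Rep
end repcat
end QN

namespace QN
set_option linter.all false
section repmod
open CategoryTheory CategoryTheory.Limits MulOpposite
variable {k : Type} [Field k] {V A : Type} [Fintype V]

abbrev PQ (s t : A → V) : PreQuiver := ⟨V, A, s, t⟩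
/-- opposite path algebra -/
abbrev Lam (k : Type) [Field k] {V A : Type} [Fintype V] (s t : A → V) (R : Set (List A)) : Type := (PathAlgebraRel k (PQ s t) R)ᵐᵒᵖ

variable {s t : A → V} {R : Set (List A)}

def gen (k : Type) [Field k] {V A : Type} [Fintype V] (s t : A → V) (R : Set (List A)) (x : V ⊕ A) : Lam k s t R :=
  op (RingQuot.mkAlgHom k (PathAlgRel k (PQ s t) R) (FreeAlgebra.ι k x))

theorem gen_idem (v : V) : gen k s t R (.inl v) * gen k s t R (.inl v) = gen k s t R (.inl v) := by
  rw [gen, ← op_mul, ← map_mul, RingQuot.mkAlgHom_rel k (PathAlgRel.idem (Q := PQ s t) v)]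
theorem gen_orth (v w : V) (h : w ≠ v) : gen k s t R (.inl v) * gen k s t R (.inl w) = 0 := by
  rw [gen, gen, ← op_mul, ← map_mul, RingQuot.mkAlgHom_rel k (PathAlgRel.orth (Q := PQ s t) w v h)]; simp
theorem gen_unit : ∑ v, gen k s t R (.inl v) = 1 := by
  have := RingQuot.mkAlgHom_rel k (PathAlgRel.unit (k := k) (Q := PQ s t) (R := R))
  simp only [gen]
  rw [← Finset.op_sum, ← map_sum]
  erw [this]
  simp
theorem gen_source (a : A) : gen k s t R (.inr a) * gen k s t R (.inl (s a)) = gen k s t R (.inr a) := by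
  rw [gen, gen, ← op_mul, ← map_mul, RingQuot.mkAlgHom_rel k (PathAlgRel.source (Q := PQ s t) a)]
theorem gen_target (a : A) : gen k s t R (.inl (t a)) * gen k s t R (.inr a) = gen k s t R (.inr a) := by
  rw [gen, gen, ← op_mul, ← map_mul, RingQuot.mkAlgHom_rel k (PathAlgRel.target (Q := PQ s t) a)]

/-- product over a path -/
def genP (k : Type) [Field k] {V A : Type} [Fintype V] (s t : A → V) (R : Set (List A)) : List A → Lam k s t R
  | [] => 1
  | a :: p => genP k s t R p * gen k s t R (.inr a)

theorem genP_eq (p : List A) : genP k s t R p = op (RingQuot.mkAlgHom k (PathAlgRel k (PQ s t) R) ((p.map fun a => FreeAlgebra.ι k (Sum.inr a)).prod)) := by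
  induction p with
  | nil => simp [genP]
  | cons a p ih => rw [genP, ih, gen, ← op_mul, ← map_mul, List.map_cons, List.prod_cons]
theorem genP_rel (p : List A) (hp : p ∈ R) : genP k s t R p = 0 := by
  rw [genP_eq, RingQuot.mkAlgHom_rel k (PathAlgRel.zeroRel (Q := PQ s t) p hp)]; simp

theorem lam_ind (P : Lam k s t R → Prop) (hs : ∀ c : k, P (algebraMap k _ c)) (hg : ∀ x, P (gen k s t R x))
    (hm : ∀ x y, P x → P y → P (x * y)) (ha : ∀ x y, P x → P y → P (x + y)) (l : Lam k s t R) : P l := by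
  obtain ⟨l⟩ := l
  obtain ⟨y, rfl⟩ := RingQuot.mkAlgHom_surjective k (PathAlgRel k (PQ s t) R) l
  change P (op _)
  induction y using FreeAlgebra.induction with
  | grade0 r => simpa using hs r
  | grade1 x => exact hg x
  | mul a b h1 h2 => rw [map_mul, op_mul]; exact hm _ _ h2 h1
  | add a b h1 h2 => rw [map_add, MulOpposite.op_add]; exact ha _ _ h1 h2

theorem lin_of_gen {M N : Type} [AddCommGroup M] [AddCommGroup N] [Module (Lam k s t R) M] [Module (Lam k s t R) N]
    (f : M →+ N) (hk : ∀ (c : k) m, f (algebraMap k (Lam k s t R) c • m) = algebraMap k (Lam k s t R) c • f m)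
    (hg : ∀ x m, f (gen k s t R x • m) = gen k s t R x • f m) (l : Lam k s t R) (m : M) : f (l • m) = l • f m := by
  revert m
  refine lam_ind (P := fun l => ∀ m, f (l • m) = l • f m) hk hg ?_ ?_ l
  · intro x y hx hy m; rw [mul_smul, hx, hy, mul_smul]
  · intro x y hx hy m; rw [add_smul, map_add, hx, hy, add_smul]

namespace Rep
/-- total space -/
def Tot (M : Rep k s t R) : Type := ∀ v, M.obj v
instance (M : Rep k s t R) : AddCommGroup (Tot M) := inferInstanceAs (AddCommGroup (∀ v, M.obj v))
instance (M : Rep k s t R) : Module k (Tot M) := inferInstanceAs (Module k (∀ v, M.obj v))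

noncomputable def sg (M : Rep k s t R) (v : V) : M.obj v →ₗ[k] Tot M :=
  haveI := Classical.decEq V; LinearMap.single k (fun v => M.obj v) v
theorem sg_same (M : Rep k s t R) (v : V) (x : M.obj v) : sg M v x v = x := by
  classical
  exact (Pi.single_eq_same (M := fun v => M.obj v) v x)
theorem sg_ne (M : Rep k s t R) (v u : V) (h : u ≠ v) (x : M.obj v) : sg M v x u = 0 := by
  classical
  exact (Pi.single_eq_of_ne (M := fun v => M.obj v) h x)
theorem sum_sg (M : Rep k s t R) (w : Tot M) : ∑ v, sg M v (w v) = w := by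
  classical
  exact Finset.univ_sum_single w
def pj (M : Rep k s t R) (v : V) : Tot M →ₗ[k] M.obj v := LinearMap.proj v
theorem pj_apply (M : Rep k s t R) (v : V) (w : Tot M) : pj M v w = w v := rfl

noncomputable def gact (M : Rep k s t R) : V ⊕ A → Module.End k (Tot M)
  | .inl v => sg M v ∘ₗ pj M v
  | .inr a => sg M (t a) ∘ₗ (M.map a).hom ∘ₗ pj M (s a)

noncomputable def pathT (M : Rep k s t R) (p : List A) : Module.End k (Tot M) := pathL M.obj M.map p
theorem pathT_nil (M : Rep k s t R) : pathT M [] = 1 := rfl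
theorem pathT_cons (M : Rep k s t R) (a : A) (p : List A) : pathT M (a :: p) = pathT M p * gact M (.inr a) := rfl
theorem pathT_rel (M : Rep k s t R) (p : List A) (h : p ∈ R) : pathT M p = 0 := M.rel p h

theorem gact_inl (M : Rep k s t R) (v : V) (w : Tot M) : gact M (.inl v) w = sg M v (w v) := rfl
theorem gact_inr (M : Rep k s t R) (a : A) (w : Tot M) : gact M (.inr a) w = sg M (t a) ((M.map a).hom (w (s a))) := rfl
theorem gactP (M : Rep k s t R) (p : List A) : (p.map fun a => (op (gact M (.inr a)) : (Module.End k (Tot M))ᵐᵒᵖ)).prod = op (pathT M p) := by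
  induction p with
  | nil => rfl
  | cons a p ih => rw [List.map_cons, List.prod_cons, ih, ← op_mul, pathT_cons]

noncomputable def rhoQ (M : Rep k s t R) : PathAlgebraRel k (PQ s t) R →ₐ[k] (Module.End k (Tot M))ᵐᵒᵖ :=
  RingQuot.liftAlgHom k ⟨FreeAlgebra.lift k (fun x => op (gact M x)), by
    classical
    intro x y h
    induction h with
    | idem v =>
      simp only [map_mul, FreeAlgebra.lift_ι_apply, ← op_mul]
      congr 1; ext w : 1; rw [Module.End.mul_apply, gact_inl, gact_inl, sg_same]
    | orth v w h =>
      simp only [map_mul, FreeAlgebra.lift_ι_apply, ← op_mul, map_zero]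
      rw [← MulOpposite.op_zero]
      congr 1; ext z : 1; rw [Module.End.mul_apply, gact_inl, gact_inl]
      rw [sg_ne _ _ _ (Ne.symm h), map_zero]; rfl
    | unit =>
      simp only [map_sum, FreeAlgebra.lift_ι_apply, map_one]
      rw [← Finset.op_sum, ← MulOpposite.op_one]
      congr 1; ext z : 1; rw [LinearMap.sum_apply]
      simp only [gact_inl]
      exact sum_sg M z
    | source a =>
      simp only [map_mul, FreeAlgebra.lift_ι_apply, ← op_mul]
      congr 1; ext w : 1; rw [Module.End.mul_apply, gact_inr, gact_inr, gact_inl, sg_same]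
    | target a =>
      simp only [map_mul, FreeAlgebra.lift_ι_apply, ← op_mul]
      congr 1; ext w : 1; rw [Module.End.mul_apply, gact_inl, gact_inr, sg_same]
    | zeroRel p hp =>
      simp only [map_list_prod, List.map_map, Function.comp_def, FreeAlgebra.lift_ι_apply, map_zero]
      rw [gactP, pathT_rel M p hp]; rfl⟩
noncomputable def rho (M : Rep k s t R) : Lam k s t R →ₐ[k] Module.End k (Tot M) := AlgHom.opComm (rhoQ M)
noncomputable instance (M : Rep k s t R) : Module (Lam k s t R) (Tot M) := Module.compHom (Tot M) (rho M).toRingHom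
theorem smul_def (M : Rep k s t R) (l : Lam k s t R) (w : Tot M) : l • w = rho M l w := rfl
theorem smul_k (M : Rep k s t R) (c : k) (w : Tot M) : algebraMap k (Lam k s t R) c • w = c • w := by
  rw [smul_def, AlgHom.commutes]; rfl
theorem smul_gen (M : Rep k s t R) (x : V ⊕ A) (w : Tot M) : gen k s t R x • w = gact M x w := by
  rw [smul_def]
  have : rho M (gen k s t R x) = unop (rhoQ M (RingQuot.mkAlgHom k _ (FreeAlgebra.ι k x))) := rfl
  rw [this, rhoQ, RingQuot.liftAlgHom_mkAlgHom_apply, FreeAlgebra.lift_ι_apply]; rfl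

theorem tot_sg {M N : Rep k s t R} (f : M ⟶ N) (v : V) (x : M.obj v) : (fun u => (ap f u).hom (sg M v x u)) = sg N v ((ap f v).hom x) := by
  funext u
  by_cases h : u = v
  · subst h; rw [sg_same, sg_same]
  · rw [sg_ne _ _ _ h, sg_ne _ _ _ h, map_zero]

noncomputable def totMap {M N : Rep k s t R} (f : M ⟶ N) : Tot M →ₗ[Lam k s t R] Tot N :=
  { toFun := fun w v => (ap f v).hom (w v)
    map_add' := fun w w' => by funext v; exact map_add _ _ _
    map_smul' := by
      intro l m
      refine lin_of_gen (M := Tot M) (N := Tot N) (AddMonoidHom.mk' (fun w v => (ap f v).hom (w v)) (fun w w' => by funext v; exact map_add _ _ _)) ?_ ?_ l m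
      · intro c m; rw [smul_k, smul_k]; funext v; exact map_smul (ap f v).hom _ _
      · classical
        intro x m; rw [smul_gen, smul_gen]
        rcases x with v | a
        · rw [gact_inl, gact_inl]; exact tot_sg f v _
        · rw [gact_inr, gact_inr]; refine (tot_sg f (t a) _).trans ?_
          have := ap_nat f a
          exact congrArg (sg N (t a)) (congrArg (fun z => z.hom (m (s a))) this) }

/-- to modules -/
noncomputable def Phi (k : Type) [Field k] {V A : Type} [Fintype V] (s t : A → V) (R : Set (List A)) : Rep k s t R ⥤ ModuleCat.{0} (Lam k s t R) where
  obj M := ModuleCat.of _ (Tot M)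
  map f := ModuleCat.ofHom (totMap f)
instance : (Phi k s t R).Additive := ⟨rfl⟩
end Rep
end repmod
end QN

namespace QN
set_option linter.all false
section repmodb
open CategoryTheory CategoryTheory.Limits MulOpposite
variable {k : Type} [Field k] {V A : Type} [Fintype V]
variable {s t : A → V} {R : Set (List A)}
namespace Rep

theorem Phi_map_apply {M N : Rep k s t R} (f : M ⟶ N) (w : Tot M) (v : V) : ((Phi k s t R).map f).hom w v = (ap f v).hom (w v) := rfl

instance : (Phi k s t R).Faithful where
  map_injective {M N} f g h := hext fun v => by
    ext x
    have := congrArg (fun z => (z.hom : Tot M → Tot N) (sg M v x) v) h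
    refine Eq.trans ?_ (this.trans ?_)
    · exact congrArg (ap f v).hom (sg_same M v x).symm
    · exact congrArg (ap g v).hom (sg_same M v x)

instance : (Phi k s t R).Full where
  map_surjective {M N} g := by
    let g' : Tot M →ₗ[Lam k s t R] Tot N := g.hom
    have hk : ∀ (c : k) w, g' (c • w) = c • g' w := fun c w => by rw [← smul_k, ← smul_k, map_smul]
    let gk : Tot M →ₗ[k] Tot N := { toFun := g', map_add' := map_add g', map_smul' := hk }
    have hgk : ∀ w, gk w = g' w := fun _ => rfl
    have hsg : ∀ v x, gk (sg M v x) = sg N v (gk (sg M v x) v) := fun v x => by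
      rw [← gact_inl, ← smul_gen, hgk, ← map_smul, smul_gen, gact_inl, sg_same]
    refine ⟨hom (fun v => ModuleCat.ofHom (pj N v ∘ₗ gk ∘ₗ sg M v)) ?_, ?_⟩
    · intro a; ext x
      change gk (sg M (t a) ((M.map a).hom x)) (t a) = (N.map a).hom (gk (sg M (s a) x) (s a))
      have : sg M (t a) ((M.map a).hom x) = gen k s t R (.inr a) • sg M (s a) x := by
        rw [smul_gen, gact_inr, sg_same]
      rw [this, hgk, map_smul, smul_gen, gact_inr, sg_same, hgk]
    · ext w
      change (fun v => gk (sg M v (w v)) v) = gk w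
      funext v
      conv_rhs => rw [← sum_sg M w, map_sum]
      rw [Finset.sum_congr rfl (fun u _ => hsg u (w u))]
      exact (congrFun (sum_sg N (fun u => gk (sg M u (w u)) u)) v).symm

section ess
variable (N : ModuleCat.{0} (Lam k s t R))
instance modk : Module k N := Module.compHom N (algebraMap k (Lam k s t R))
theorem modk_smul (c : k) (n : N) : c • n = algebraMap k (Lam k s t R) c • n := rfl
def genL (x : Lam k s t R) : N →ₗ[k] N where
  toFun n := x • n
  map_add' := smul_add _
  map_smul' c n := by
    rw [modk_smul, modk_smul, smul_smul, RingHom.id_apply, smul_smul, Algebra.commutes]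
theorem genL_apply (x : Lam k s t R) (n : N) : genL N x n = x • n := rfl
def ev (v : V) : Submodule k N := LinearMap.eqLocus (genL N (gen k s t R (.inl v))) LinearMap.id
theorem mem_ev (v : V) (n : N) : n ∈ ev N v ↔ gen k s t R (.inl v) • n = n := Iff.rfl
def emap (a : A) : ev N (s a) →ₗ[k] ev N (t a) := LinearMap.restrict (genL N (gen k s t R (.inr a))) (by
  intro n hn
  rw [mem_ev, genL_apply, smul_smul, gen_target])
abbrev eobj (v : V) : ModuleCat.{0} k := ModuleCat.of k (ev N v)
abbrev emapc (a : A) : eobj N (s a) ⟶ eobj N (t a) := ModuleCat.ofHom (emap N a)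
noncomputable def esum : (∀ v, eobj N v) →ₗ[k] N := ∑ v, (ev N v).subtype ∘ₗ LinearMap.proj v
theorem esum_apply (w : ∀ v, eobj N v) : esum N w = ∑ v, (w v : ev N v).1 := by
  rw [esum, LinearMap.sum_apply]; rfl
theorem ev_smul (v : V) (w : ∀ v, eobj N v) : gen k s t R (.inl v) • esum N w = (w v : ev N v).1 := by
  rw [esum_apply, Finset.smul_sum, Finset.sum_eq_single v]
  · exact (w v : ev N v).2
  · intro b _ hb
    have := (w b : ev N b).2
    rw [← (mem_ev N b _).1 this, smul_smul, gen_orth _ _ hb, zero_smul]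
  · simp
theorem esum_inj : Function.Injective (esum N) := by
  intro w w' h
  funext v
  apply Subtype.ext
  rw [← ev_smul, ← ev_smul, h]
noncomputable def esingle (v : V) : eobj N v →ₗ[k] (∀ v, eobj N v) :=
  haveI := Classical.decEq V
  LinearMap.single k (fun v => eobj N v) v
theorem esum_single (v : V) (x : ev N v) : esum N (esingle N v x) = x.1 := by
  classical
  rw [esum_apply, Finset.sum_eq_single v]
  · exact congrArg Subtype.val (Pi.single_eq_same (M := fun v => eobj N v) v x)
  · intro b _ hb
    exact congrArg Subtype.val (Pi.single_eq_of_ne (M := fun v => eobj N v) hb x)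
  · simp
theorem esum_act (a : A) (w : ∀ v, eobj N v) : esum N (actL (eobj N) (emapc N) a w) = gen k s t R (.inr a) • esum N w := by
  have : actL (eobj N) (emapc N) a w = esingle N (t a) (emap N a (w (s a))) := rfl
  rw [this, esum_single, ← gen_source, mul_smul, ev_smul]; rfl
theorem esum_path (p : List A) (w : ∀ v, eobj N v) : esum N (pathL (eobj N) (emapc N) p w) = genP k s t R p • esum N w := by
  induction p generalizing w with
  | nil => rw [genP, one_smul]; rfl
  | cons a p ih => rw [genP, mul_smul, ← esum_act, ← ih]; rfl
noncomputable def erep : Rep k s t R where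
  obj := eobj N
  map := emapc N
  rel p hp := by
    ext w : 1
    apply esum_inj
    rw [esum_path, genP_rel p hp, zero_smul]; exact (map_zero _).symm
theorem esum_surj : Function.Surjective (esum N) := fun n =>
  ⟨fun v => (⟨gen k s t R (.inl v) • n, by rw [mem_ev, smul_smul, gen_idem]⟩ : ev N v), by
    rw [esum_apply, ← Finset.sum_smul, gen_unit, one_smul]⟩
noncomputable def eiso : Tot (erep N) ≃ₗ[Lam k s t R] N :=
  LinearEquiv.ofBijective (M := Tot (erep N)) (M₂ := N)
   { toFun := esum N
     map_add' := map_add (esum N)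
     map_smul' := by
      intro l m
      refine lin_of_gen (M := Tot (erep N)) (N := N) (esum N).toAddMonoidHom ?_ ?_ l m
      · intro c m; rw [smul_k]; exact map_smul (esum N) c m
      · intro x m; rw [smul_gen]
        rcases x with v | a
        · refine (esum_single N v _).trans ?_
          exact (ev_smul N v m).symm
        · exact esum_act N a m } ⟨esum_inj N, esum_surj N⟩
end ess
instance : (Phi k s t R).EssSurj where
  mem_essImage N := ⟨erep N, ⟨(eiso N).toModuleIso⟩⟩
instance : (Phi k s t R).IsEquivalence where

instance : HasFiniteProducts (Rep k s t R) := ⟨fun n => Adjunction.hasLimitsOfShape_of_equivalence (Phi k s t R)⟩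
noncomputable instance : Abelian (Rep k s t R) := abelianOfEquivalence (Phi k s t R)

theorem exact_iff (S : ShortComplex (ModuleCat.{0} k)) : S.ShortExact ↔ Function.Injective S.f.hom ∧ (∀ y, S.g.hom y = 0 → ∃ x, S.f.hom x = y) ∧ Function.Surjective S.g.hom := by
  constructor
  · intro h
    exact ⟨(ModuleCat.mono_iff_injective _).1 h.mono_f, (ShortComplex.moduleCat_exact_iff S).1 h.exact, (ModuleCat.epi_iff_surjective _).1 h.epi_g⟩
  · rintro ⟨h1, h2, h3⟩
    exact { exact := (ShortComplex.moduleCat_exact_iff S).2 h2, mono_f := (ModuleCat.mono_iff_injective _).2 h1, epi_g := (ModuleCat.epi_iff_surjective _).2 h3 }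
theorem exact_iff' (S : ShortComplex (ModuleCat.{0} (Lam k s t R))) : S.ShortExact ↔ Function.Injective S.f.hom ∧ (∀ y, S.g.hom y = 0 → ∃ x, S.f.hom x = y) ∧ Function.Surjective S.g.hom := by
  constructor
  · intro h
    exact ⟨(ModuleCat.mono_iff_injective _).1 h.mono_f, (ShortComplex.moduleCat_exact_iff S).1 h.exact, (ModuleCat.epi_iff_surjective _).1 h.epi_g⟩
  · rintro ⟨h1, h2, h3⟩
    exact { exact := (ShortComplex.moduleCat_exact_iff S).2 h2, mono_f := (ModuleCat.mono_iff_injective _).2 h1, epi_g := (ModuleCat.epi_iff_surjective _).2 h3 }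

theorem se_iff_Phi (S : ShortComplex (Rep k s t R)) : S.ShortExact ↔ (S.map (Phi k s t R)).ShortExact := by
  constructor
  · intro h; exact h.map_of_exact _
  · intro h
    exact { exact := (ShortComplex.exact_map_iff_of_faithful S (Phi k s t R)).1 h.exact
            mono_f := (Phi k s t R).mono_of_mono_map h.mono_f
            epi_g := (Phi k s t R).epi_of_epi_map h.epi_g }

theorem se_iff (S : ShortComplex (Rep k s t R)) : S.ShortExact ↔ ∀ v, (S.map (E k s t R v)).ShortExact := by
  classical
  rw [se_iff_Phi, exact_iff']
  simp only [exact_iff]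
  have e1 : ∀ v x, totMap S.f (sg _ v x) = sg _ v ((ap S.f v).hom x) := fun v x => tot_sg _ _ _
  have e2 : ∀ v x, totMap S.g (sg _ v x) = sg _ v ((ap S.g v).hom x) := fun v x => tot_sg _ _ _
  have h1 : Function.Injective (totMap S.f) ↔ ∀ v, Function.Injective (ap S.f v).hom := by
    constructor
    · intro h v x y hxy
      have h2 : totMap S.f (sg _ v x) = totMap S.f (sg _ v y) := by rw [e1, e1, hxy]
      have := congrFun (h h2) v
      rwa [sg_same, sg_same] at this
    · intro h x y hxy; funext v; exact h v (congrFun hxy v)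
  have h2 : (∀ y, totMap S.g y = 0 → ∃ x, totMap S.f x = y) ↔ ∀ v, ∀ y, (ap S.g v).hom y = 0 → ∃ x, (ap S.f v).hom x = y := by
    constructor
    · intro h v y hy
      obtain ⟨x, hx⟩ := h (sg _ v y) (by rw [e2, hy, map_zero])
      exact ⟨x v, by have := congrFun hx v; rw [sg_same] at this; exact this⟩
    · intro h y hy
      choose x hx using fun v => h v (y v) (congrFun hy v)
      exact ⟨x, funext hx⟩
  have h3 : Function.Surjective (totMap S.g) ↔ ∀ v, Function.Surjective (ap S.g v).hom := by
    constructor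
    · intro h v y
      obtain ⟨x, hx⟩ := h (sg _ v y)
      exact ⟨x v, by have := congrFun hx v; rw [sg_same] at this; exact this⟩
    · intro h y
      choose x hx using fun v => h v (y v)
      exact ⟨x, funext hx⟩
  constructor
  · rintro ⟨a, b, c⟩ v
    exact ⟨h1.1 a v, h2.1 b v, h3.1 c v⟩
  · intro h
    exact ⟨h1.2 fun v => (h v).1, h2.2 fun v => (h v).2.1, h3.2 fun v => (h v).2.2⟩

theorem ex_of {C D : Type*} [Category C] [Category D] [Abelian C] [Abelian D] (F : C ⥤ D) [F.Additive]
    (h : ∀ S : ShortComplex C, S.ShortExact → (S.map F).ShortExact) : Ex F := by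
  have := (F.exact_tfae.out 0 3).1 h
  exact ⟨inferInstance, this.1, this.2⟩

instance exE (v : V) : Ex (E k s t R v) := ex_of _ fun S h => (se_iff S).1 h v

/-- jointly exact evaluations -/
noncomputable def JE (k : Type) [Field k] {V A : Type} [Fintype V] (s t : A → V) (R : Set (List A)) : JF (Rep k s t R) V (ModuleCat.{0} k) where
  E := E k s t R
  ex S h := (se_iff S).2 h

theorem ex_to {C : Type*} [Category C] [Abelian C] (F : C ⥤ Rep k s t R) [F.Additive] (h : ∀ v, ∀ S : ShortComplex C, S.ShortExact → (S.map (F ⋙ E k s t R v)).ShortExact) : Ex F :=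
  ex_of _ fun S hS => (se_iff _).2 fun v => h v S hS
end Rep
end repmodb
end QN

namespace QN
set_option linter.all false
section teq
open CategoryTheory CategoryTheory.Limits
universe v u v' u' v'' u''
variable {C : Type u} [Category.{v} C] [Abelian C] {D : Type u'} [Category.{v'} D] [Abelian D] {E : Type u''} [Category.{v''} E] [Abelian E]

/-- triangulated equivalences of derived categories -/
structure TEq (C : Type u) [Category.{v} C] [Abelian C] (D : Type u') [Category.{v'} D] [Abelian D] where
  F : DerivedCategory C ⥤ DerivedCategory D
  [c : F.CommShift ℤ]
  [tr : F.IsTriangulated]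
  [eqv : F.IsEquivalence]
attribute [instance] TEq.c TEq.tr TEq.eqv
namespace TEq
noncomputable def refl (C : Type u) [Category.{v} C] [Abelian C] : TEq C C := ⟨𝟭 _⟩
noncomputable def trans (e : TEq C D) (f : TEq D E) : TEq C E := ⟨e.F ⋙ f.F⟩
noncomputable def adj (e : TEq C D) : e.F ⊣ e.F.inv := e.F.asEquivalence.toAdjunction
noncomputable def symm (e : TEq C D) : TEq D C :=
  letI : e.F.inv.CommShift ℤ := e.adj.rightAdjointCommShift ℤ
  haveI : e.adj.CommShift ℤ := e.adj.commShift_of_leftAdjoint ℤ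
  haveI : e.F.inv.IsTriangulated := e.adj.isTriangulated_rightAdjoint
  { F := e.F.inv }
noncomputable def symm_iso (e : TEq C D) (X : DerivedCategory D) : e.F.obj (e.symm.F.obj X) ≅ X := e.F.asEquivalence.counitIso.app X
noncomputable def symm_iso' (e : TEq C D) (X : DerivedCategory C) : e.symm.F.obj (e.F.obj X) ≅ X := (e.F.asEquivalence.unitIso.app X).symm

theorem mapD_isEq (F : C ⥤ D) [F.Additive] [F.IsEquivalence] : F.mapDerivedCategory.IsEquivalence := by
  let Φ := F.mapHomologicalComplexUpToQuasiIsoLocalizerMorphism (ComplexShape.up ℤ)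
  have h1 : Φ.functor.IsEquivalence := by
    haveI : F.asEquivalence.functor.PreservesZeroMorphisms := inferInstanceAs F.PreservesZeroMorphisms
    exact (F.asEquivalence.mapHomologicalComplex (ComplexShape.up ℤ)).isEquivalence_functor
  have h2 : Φ.IsInduced := ⟨by
    ext K L f
    exact HomologicalComplex.quasiIso_map_iff_of_preservesHomology f F⟩
  have h3 := Φ.isLocalizedEquivalence_of_isInduced
  letI : CatCommSq Φ.functor DerivedCategory.Q DerivedCategory.Q F.mapDerivedCategory := ⟨F.mapDerivedCategoryFactors.symm⟩
  exact Φ.isEquivalence DerivedCategory.Q DerivedCategory.Q _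
noncomputable def ofEquiv (F : C ⥤ D) [F.Additive] [F.IsEquivalence] : TEq C D :=
  haveI := mapD_isEq F
  ⟨F.mapDerivedCategory⟩
end TEq

theorem derEq_iff {k : Type} [Field k] {V A V' A' : Type} [Fintype V] [Fintype V'] (s t : A → V) (R : Set (List A)) (s' t' : A' → V') (R' : Set (List A')) :
   DerivedEquivalent k (PathAlgebraRel k (PQ s t) R) (PathAlgebraRel k (PQ s' t') R') ↔ Nonempty (TEq (Rep k s t R) (Rep k s' t' R')) := by
  constructor
  · rintro ⟨F, c, h1, h2⟩
    exact ⟨(TEq.ofEquiv (Rep.Phi k s t R)).trans (TEq.trans ⟨F⟩ (TEq.ofEquiv (Rep.Phi k s' t' R')).symm)⟩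
  · rintro ⟨e⟩
    let f := ((TEq.ofEquiv (Rep.Phi k s t R)).symm.trans e).trans (TEq.ofEquiv (Rep.Phi k s' t' R'))
    exact ⟨f.F, f.c, f.tr, f.eqv⟩
end teq
section pull
open CategoryTheory CategoryTheory.Limits
variable {k : Type} [Field k] {V A : Type} {s t : A → V} {R : Set (List A)} {V' A' : Type} {s' t' : A' → V'} {R' : Set (List A')}

/-- isomorphism of quivers with relations -/
structure QIso (s t : A → V) (R : Set (List A)) (s' t' : A' → V') (R' : Set (List A')) where
  e : V ≃ V'
  f : A ≃ A'
  hs : ∀ a, s' (f a) = e (s a)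
  ht : ∀ a, t' (f a) = e (t a)
  hr : ∀ p, p ∈ R ↔ p.map f ∈ R'
def QIso.symm (φ : QIso s t R s' t' R') : QIso s' t' R' s t R where
  e := φ.e.symm
  f := φ.f.symm
  hs a := by rw [Equiv.eq_symm_apply, ← φ.hs, Equiv.apply_symm_apply]
  ht a := by rw [Equiv.eq_symm_apply, ← φ.ht, Equiv.apply_symm_apply]
  hr p := by rw [φ.hr, List.map_map]; simp

namespace Rep
/-- transported arrow map -/
def mp (M : Rep k s t R) (a : A) {x y : V} (hx : s a = x) (hy : t a = y) : M.obj x ⟶ M.obj y :=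
  eqToHom (by rw [hx]) ≫ M.map a ≫ eqToHom (by rw [hy])
theorem mp_nat {M N : Rep k s t R} (f : M ⟶ N) (a : A) {x y : V} (hx : s a = x) (hy : t a = y) :
   mp M a hx hy ≫ ap f y = ap f x ≫ mp N a hx hy := by subst hx hy; simp [mp, ap_nat]

theorem pull_act (φ : QIso s t R s' t' R') (M : Rep k s' t' R') (a : A) (w : ∀ v, M.obj v) :
    actL (fun v => M.obj (φ.e v)) (fun a => mp M (φ.f a) (φ.hs a) (φ.ht a)) a (fun v => w (φ.e v)) =
     fun v => actL M.obj M.map (φ.f a) w (φ.e v) := by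
  classical
  have key : ∀ (x y : V') (hx : s' (φ.f a) = x) (hy : t' (φ.f a) = y) u, (Pi.single y ((mp M (φ.f a) hx hy).hom (w x)) : ∀ v, M.obj v) u = (Pi.single (t' (φ.f a)) ((M.map (φ.f a)).hom (w (s' (φ.f a)))) : ∀ v, M.obj v) u := by
    rintro x y rfl rfl u; simp [mp]
  funext v
  have h2 : ∀ z, (Pi.single (M := fun v => M.obj (φ.e v)) (t a) z : ∀ v, M.obj (φ.e v)) v = (Pi.single (φ.e (t a)) z : ∀ v, M.obj v) (φ.e v) := by
    intro z
    by_cases h : v = t a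
    · subst h; simp
    · rw [Pi.single_eq_of_ne h, Pi.single_eq_of_ne (fun h' => h (φ.e.injective h'))]
  refine Eq.trans ?_ ((h2 _).trans ((key _ _ (φ.hs a) (φ.ht a) _).trans ?_))
  · simp [actL]
  · simp [actL]
theorem pull_path (φ : QIso s t R s' t' R') (M : Rep k s' t' R') (p : List A) (w : ∀ v, M.obj v) :
    pathL (fun v => M.obj (φ.e v)) (fun a => mp M (φ.f a) (φ.hs a) (φ.ht a)) p (fun v => w (φ.e v)) =
     fun v => pathL M.obj M.map (p.map φ.f) w (φ.e v) := by
  induction p generalizing w with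
  | nil => rfl
  | cons a p ih =>
    refine Eq.trans (congrArg (pathL (fun v => M.obj (φ.e v)) (fun a => mp M (φ.f a) (φ.hs a) (φ.ht a)) p) (pull_act φ M a w)) ?_
    exact ih _
theorem ext_w (φ : V ≃ V') (M : V' → Type) (w : ∀ v, M (φ v)) : ∃ w' : ∀ v, M v, w = fun v => w' (φ v) :=
  ⟨fun v => φ.apply_symm_apply v ▸ w (φ.symm v), by
    funext v
    have : ∀ u (h : φ u = φ v), (h ▸ w u : M (φ v)) = w v := by
      intro u h; have := φ.injective h; subst this; rfl
    exact (this _ _).symm⟩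

/-- pull back -/
def pull (φ : QIso s t R s' t' R') : Rep k s' t' R' ⥤ Rep k s t R where
  obj M := 
   { obj := fun v => M.obj (φ.e v)
     map := fun a => mp M (φ.f a) (φ.hs a) (φ.ht a)
     rel := fun p hp => by
      ext w : 1
      obtain ⟨w', rfl⟩ := ext_w φ.e (fun v => M.obj v) w
      rw [pull_path, M.rel _ ((φ.hr p).1 hp)]; rfl }
  map f := hom (fun v => ap f (φ.e v)) (fun a => mp_nat f (φ.f a) (φ.hs a) (φ.ht a))
instance (φ : QIso s t R s' t' R') : (pull (k := k) φ).Additive := ⟨rfl⟩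
theorem ap_pull (φ : QIso s t R s' t' R') {M N : Rep k s' t' R'} (f : M ⟶ N) (v : V) : ap ((pull φ).map f) v = ap f (φ.e v) := rfl
theorem mp_mp (M : Rep k s t R) (a a' : A) {x x' y y' : V} (hx : s a = x) (hy : t a = y) (hx' : s a' = x') (hy' : t a' = y') (h : a = a') :
   mp M a hx hy ≫ eqToHom (by rw [← hy, ← hy', h]) = eqToHom (by rw [← hx, ← hx', h]) ≫ mp M a' hx' hy' := by
  subst h hx hy hx' hy'; simp
theorem eqToHom_ap {M N : Rep k s t R} (f : M ⟶ N) {x y : V} (h : x = y) : eqToHom (congrArg M.obj h) ≫ ap f y = ap f x ≫ eqToHom (congrArg N.obj h) := by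
  subst h; simp
def pullHom (φ : QIso s t R s' t' R') (M : Rep k s' t' R') : (pull φ.symm).obj ((pull φ).obj M) ⟶ M :=
  hom (fun v => eqToHom (congrArg M.obj (φ.e.apply_symm_apply v))) (fun a => by
    have h : M.map a = mp M a rfl rfl := by simp [mp]
    rw [h]
    refine Eq.trans ?_ (mp_mp M (φ.f (φ.f.symm a)) a (x := φ.e (φ.symm.e (s' a))) (y := φ.e (φ.symm.e (t' a))) 
      (by rw [φ.hs, ← φ.symm.hs]; rfl) (by rw [φ.ht, ← φ.symm.ht]; rfl) rfl rfl (φ.f.apply_symm_apply a))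
    have : ∀ (x y : V) (hx : s (φ.f.symm a) = x) (hy : t (φ.f.symm a) = y), mp ((pull φ).obj M) (φ.f.symm a) hx hy = mp M (φ.f (φ.f.symm a)) (by rw [φ.hs, hx]) (by rw [φ.ht, hy]) := by
      rintro x y rfl rfl; exact (Category.id_comp _).trans (Category.comp_id _)
    rw [← this _ _ (φ.symm.hs a) (φ.symm.ht a)]; rfl)
noncomputable def pullIso (φ : QIso s t R s' t' R') : pull (k := k) φ ⋙ pull φ.symm ≅ 𝟭 _ :=
  NatIso.ofComponents (fun M => haveI := isIso_of_ap (pullHom φ M) (fun v => inferInstanceAs (IsIso (eqToHom (congrArg M.obj (φ.e.apply_symm_apply v))))); asIso (pullHom φ M)) (by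
    intro M N f
    apply hext; intro v
    exact (eqToHom_ap f (φ.e.apply_symm_apply v)).symm)
theorem symm_symm (φ : QIso s t R s' t' R') : φ.symm.symm = φ := rfl
instance (φ : QIso s t R s' t' R') : (pull (k := k) φ).IsEquivalence :=
  (CategoryTheory.Equivalence.mk (pull φ) (pull φ.symm) (pullIso φ).symm (pullIso φ.symm)).isEquivalence_functor
end Rep
end pull
end QN

namespace QN
set_option linter.all false
section reflec
open CategoryTheory CategoryTheory.Limits
variable {k : Type} [Field k]

/-- the zero module -/
abbrev zm (k : Type) [Field k] : ModuleCat.{0} k := ModuleCat.of k PUnit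
theorem zm_isZero : IsZero (zm k) := ModuleCat.isZero_of_subsingleton _
theorem zm_to {X : ModuleCat.{0} k} (f g : zm k ⟶ X) : f = g := zm_isZero.eq_of_src f g
theorem to_zm {X : ModuleCat.{0} k} (f g : X ⟶ zm k) : f = g := zm_isZero.eq_of_tgt f g
theorem zm_se {C : Type*} [Category C] [Abelian C] (F : C ⥤ ModuleCat.{0} k) [F.Additive] (h : ∀ X, IsZero (F.obj X)) (S : ShortComplex C) : (S.map F).ShortExact := by
  have h1 := ModuleCat.subsingleton_of_isZero (h S.X₁)
  have h2 := ModuleCat.subsingleton_of_isZero (h S.X₂)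
  have h3 := ModuleCat.subsingleton_of_isZero (h S.X₃)
  rw [Rep.exact_iff]
  exact ⟨fun x y _ => h1.elim _ _, fun y _ => ⟨0, h2.elim _ _⟩, fun y => ⟨0, h3.elim _ _⟩⟩

section T
variable {B : Type} [Fintype B]
/-- finite product -/
abbrev Tm (X : B → ModuleCat.{0} k) : ModuleCat.{0} k := ModuleCat.of k (∀ b, X b)
def Tpr (X : B → ModuleCat.{0} k) (b : B) : Tm X ⟶ X b := ModuleCat.ofHom (LinearMap.proj b)
noncomputable def Tin (X : B → ModuleCat.{0} k) (b : B) : X b ⟶ Tm X := haveI := Classical.decEq B; ModuleCat.ofHom (LinearMap.single k (fun b => X b) b)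
def Tlift {X : B → ModuleCat.{0} k} {Y : ModuleCat.{0} k} (f : ∀ b, Y ⟶ X b) : Y ⟶ Tm X := ModuleCat.ofHom (LinearMap.pi fun b => (f b).hom)
noncomputable def Tdesc {X : B → ModuleCat.{0} k} {Y : ModuleCat.{0} k} (f : ∀ b, X b ⟶ Y) : Tm X ⟶ Y := ModuleCat.ofHom (∑ b, (f b).hom ∘ₗ LinearMap.proj b)
@[simp] theorem Tlift_pr {X : B → ModuleCat.{0} k} {Y : ModuleCat.{0} k} (f : ∀ b, Y ⟶ X b) (b : B) : Tlift f ≫ Tpr X b = f b := rfl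
theorem Tin_desc {X : B → ModuleCat.{0} k} {Y : ModuleCat.{0} k} (f : ∀ b, X b ⟶ Y) (b : B) : Tin X b ≫ Tdesc f = f b := by
  classical
  ext x
  simp only [Tin, Tdesc, ModuleCat.hom_comp, ModuleCat.hom_ofHom, LinearMap.comp_apply, LinearMap.sum_apply, LinearMap.proj_apply, LinearMap.single_apply]
  rw [Finset.sum_eq_single b]
  · simp
  · intro b' _ hb; rw [Pi.single_eq_of_ne hb, map_zero]
  · simp
theorem Text {X : B → ModuleCat.{0} k} {Y : ModuleCat.{0} k} {f g : Y ⟶ Tm X} (h : ∀ b, f ≫ Tpr X b = g ≫ Tpr X b) : f = g := by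
  refine ModuleCat.hom_ext (LinearMap.ext fun y => funext fun b => ?_)
  exact congrArg (fun z => z.hom y) (h b)
theorem Text' {X : B → ModuleCat.{0} k} {Y : ModuleCat.{0} k} {f g : Tm X ⟶ Y} (h : ∀ b, Tin X b ≫ f = Tin X b ≫ g) : f = g := by
  classical
  refine ModuleCat.hom_ext (LinearMap.ext fun y => ?_)
  have h1 : ∑ b, (Tin X b).hom (y b) = y := by
    have := Finset.univ_sum_single (M := fun b => X b) y
    refine Eq.trans (Finset.sum_congr rfl fun b _ => ?_) this
    dsimp only [Tin, ModuleCat.hom_ofHom, LinearMap.single_apply]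
  rw [← h1, map_sum, map_sum]
  exact Finset.sum_congr rfl fun b _ => congrArg (fun z => z.hom (y b)) (h b)
def Tmap {X Y : B → ModuleCat.{0} k} (f : ∀ b, X b ⟶ Y b) : Tm X ⟶ Tm Y := Tlift fun b => Tpr X b ≫ f b
theorem Tmap_pr {X Y : B → ModuleCat.{0} k} (f : ∀ b, X b ⟶ Y b) (b : B) : Tmap f ≫ Tpr Y b = Tpr X b ≫ f b := rfl
theorem Tin_pr (X : B → ModuleCat.{0} k) (b : B) : Tin X b ≫ Tpr X b = 𝟙 _ := by
  classical
  ext x; simp [Tin, Tpr]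
theorem Tin_pr_ne (X : B → ModuleCat.{0} k) (b c : B) (h : c ≠ b) : Tin X b ≫ Tpr X c = 0 := by
  classical
  ext x; simp [Tin, Tpr, Pi.single_eq_of_ne h]
theorem Tin_map {X Y : B → ModuleCat.{0} k} (f : ∀ b, X b ⟶ Y b) (b : B) : Tin X b ≫ Tmap f = f b ≫ Tin Y b := by
  apply Text; intro c
  rw [Category.assoc, Tmap_pr, Category.assoc, ← Category.assoc]
  by_cases h : c = b
  · subst h; rw [Tin_pr, Tin_pr]; simp
  · rw [Tin_pr_ne _ _ _ h, Tin_pr_ne _ _ _ h]; simp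
theorem Tmap_id (X : B → ModuleCat.{0} k) : Tmap (fun b => 𝟙 (X b)) = 𝟙 _ := rfl
theorem Tmap_comp {X Y Z : B → ModuleCat.{0} k} (f : ∀ b, X b ⟶ Y b) (g : ∀ b, Y b ⟶ Z b) : Tmap (fun b => f b ≫ g b) = Tmap f ≫ Tmap g := rfl
theorem Tlift_map {X Y : B → ModuleCat.{0} k} {Z : ModuleCat.{0} k} (f : ∀ b, Z ⟶ X b) (g : ∀ b, X b ⟶ Y b) : Tlift f ≫ Tmap g = Tlift (fun b => f b ≫ g b) := rfl
theorem comp_Tlift {X : B → ModuleCat.{0} k} {Z Z' : ModuleCat.{0} k} (f : ∀ b, Z ⟶ X b) (g : Z' ⟶ Z) : g ≫ Tlift f = Tlift (fun b => g ≫ f b) := rfl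
theorem Tmap_desc {X Y : B → ModuleCat.{0} k} {Z : ModuleCat.{0} k} (f : ∀ b, X b ⟶ Y b) (g : ∀ b, Y b ⟶ Z) : Tmap f ≫ Tdesc g = Tdesc (fun b => f b ≫ g b) := by
  apply Text'; intro b
  rw [← Category.assoc, Tin_map, Category.assoc, Tin_desc, Tin_desc]
theorem Tdesc_comp {X : B → ModuleCat.{0} k} {Z Z' : ModuleCat.{0} k} (f : ∀ b, X b ⟶ Z) (g : Z ⟶ Z') : Tdesc f ≫ g = Tdesc (fun b => f b ≫ g) := by
  apply Text'; intro b
  rw [← Category.assoc, Tin_desc, Tin_desc]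
theorem Tdesc_in (X : B → ModuleCat.{0} k) : Tdesc (Tin X) = 𝟙 _ := by
  apply Text'; intro b; rw [Tin_desc, Category.comp_id]
theorem Tlift_prid (X : B → ModuleCat.{0} k) : Tlift (Tpr X) = 𝟙 _ := rfl
end T

variable {W B AW : Type} (sW tW : AW → W) (β : B → W)
/-- sources and targets when `none` is a sink / source -/
def sk : AW ⊕ B → Option W := Sum.elim (fun a => some (sW a)) (fun b => some (β b))
def tk (B : Type) : AW ⊕ B → Option W := Sum.elim (fun a => some (tW a)) (fun _ => none)
def sc (B : Type) : AW ⊕ B → Option W := tk sW B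
def tc : AW ⊕ B → Option W := sk tW β

abbrev RSink (k : Type) [Field k] {W B AW : Type} (sW tW : AW → W) (β : B → W) := Rep k (sk sW β) (tk tW B) ∅
abbrev RSrc (k : Type) [Field k] {W B AW : Type} (sW tW : AW → W) (β : B → W) := Rep k (sc sW B) (tc tW β) ∅

def ow (X : W → ModuleCat.{0} k) (Y : ModuleCat.{0} k) : Option W → ModuleCat.{0} k
  | none => Y
  | some w => X w
variable {sW tW β}
def mkK (X : W → ModuleCat.{0} k) (Y : ModuleCat.{0} k) (f : ∀ a, X (sW a) ⟶ X (tW a)) (g : ∀ b, X (β b) ⟶ Y) : RSink k sW tW β where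
  obj := ow X Y
  map := fun | .inl a => f a | .inr b => g b
  rel p hp := hp.elim
def mkC (X : W → ModuleCat.{0} k) (Y : ModuleCat.{0} k) (f : ∀ a, X (sW a) ⟶ X (tW a)) (g : ∀ b, Y ⟶ X (β b)) : RSrc k sW tW β where
  obj := ow X Y
  map := fun | .inl a => f a | .inr b => g b
  rel p hp := hp.elim
/-- structure maps -/
abbrev kX (M : RSink k sW tW β) (w : W) : ModuleCat.{0} k := M.obj (some w)
abbrev kY (M : RSink k sW tW β) : ModuleCat.{0} k := M.obj none
abbrev kf (M : RSink k sW tW β) (a : AW) : kX M (sW a) ⟶ kX M (tW a) := M.map (.inl a)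
abbrev kg (M : RSink k sW tW β) (b : B) : kX M (β b) ⟶ kY M := M.map (.inr b)
abbrev cX (M : RSrc k sW tW β) (w : W) : ModuleCat.{0} k := M.obj (some w)
abbrev cY (M : RSrc k sW tW β) : ModuleCat.{0} k := M.obj none
abbrev cf (M : RSrc k sW tW β) (a : AW) : cX M (sW a) ⟶ cX M (tW a) := M.map (.inl a)
abbrev cg (M : RSrc k sW tW β) (b : B) : cY M ⟶ cX M (β b) := M.map (.inr b)

def hk {M N : RSink k sW tW β} (x : ∀ w, kX M w ⟶ kX N w) (y : kY M ⟶ kY N) (h1 : ∀ a, kf M a ≫ x (tW a) = x (sW a) ≫ kf N a)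
   (h2 : ∀ b, kg M b ≫ y = x (β b) ≫ kg N b) : M ⟶ N :=
  Rep.hom (fun | none => y | some w => x w) (fun | .inl a => h1 a | .inr b => h2 b)
def hc {M N : RSrc k sW tW β} (x : ∀ w, cX M w ⟶ cX N w) (y : cY M ⟶ cY N) (h1 : ∀ a, cf M a ≫ x (tW a) = x (sW a) ≫ cf N a)
   (h2 : ∀ b, cg M b ≫ x (β b) = y ≫ cg N b) : M ⟶ N :=
  Rep.hom (fun | none => y | some w => x w) (fun | .inl a => h1 a | .inr b => h2 b)
theorem extO {s t : AW ⊕ B → Option W} {R} {M N : Rep k s t R} {f g : M ⟶ N} (h1 : ∀ w, Rep.ap f (some w) = Rep.ap g (some w)) (h2 : Rep.ap f none = Rep.ap g none) : f = g :=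
  Rep.hext fun | none => h2 | some w => h1 w

theorem kn1 {M N : RSink k sW tW β} (f : M ⟶ N) (a : AW) : kf M a ≫ Rep.ap f (some (tW a)) = Rep.ap f (some (sW a)) ≫ kf N a := Rep.ap_nat f (.inl a)
theorem kn2 {M N : RSink k sW tW β} (f : M ⟶ N) (b : B) : kg M b ≫ Rep.ap f none = Rep.ap f (some (β b)) ≫ kg N b := Rep.ap_nat f (.inr b)
theorem cn1 {M N : RSrc k sW tW β} (f : M ⟶ N) (a : AW) : cf M a ≫ Rep.ap f (some (tW a)) = Rep.ap f (some (sW a)) ≫ cf N a := Rep.ap_nat f (.inl a)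
theorem cn2 {M N : RSrc k sW tW β} (f : M ⟶ N) (b : B) : cg M b ≫ Rep.ap f (some (β b)) = Rep.ap f none ≫ cg N b := Rep.ap_nat f (.inr b)

variable [Fintype B]
def rG1 (k : Type) [Field k] (sW tW : AW → W) (β : B → W) : RSrc k sW tW β ⥤ RSink k sW tW β where
  obj M := mkK (fun _ => zm k) (cY M) (fun _ => 0) (fun _ => 0)
  map f := hk (fun _ => 𝟙 _) (Rep.ap f none) (fun _ => zm_to _ _) (fun _ => zm_to _ _)
  map_id _ := extO (fun _ => rfl) rfl
  map_comp _ _ := extO (fun _ => zm_to _ _) rfl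
def rF1 (k : Type) [Field k] (sW tW : AW → W) (β : B → W) : RSink k sW tW β ⥤ RSrc k sW tW β where
  obj M := mkC (fun _ => zm k) (kY M) (fun _ => 0) (fun _ => 0)
  map f := hc (fun _ => 𝟙 _) (Rep.ap f none) (fun _ => zm_to _ _) (fun _ => to_zm _ _)
  map_id _ := extO (fun _ => rfl) rfl
  map_comp _ _ := extO (fun _ => zm_to _ _) rfl
noncomputable def rG0 (k : Type) [Field k] (sW tW : AW → W) (β : B → W) : RSrc k sW tW β ⥤ RSink k sW tW β where
  obj M := mkK (cX M) (Tm fun b => cX M (β b)) (cf M) (Tin fun b => cX M (β b))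
  map {M N} f := hk (M := mkK _ _ _ _) (N := mkK _ _ _ _) (fun w => Rep.ap f (some w)) (Tmap fun b => Rep.ap f (some (β b))) (fun a => cn1 f a) 
    (fun b => Tin_map (fun b => Rep.ap f (some (β b))) b)
  map_id _ := extO (fun _ => rfl) rfl
  map_comp _ _ := extO (fun _ => rfl) rfl
noncomputable def rF0 (k : Type) [Field k] (sW tW : AW → W) (β : B → W) : RSink k sW tW β ⥤ RSrc k sW tW β where
  obj M := mkC (kX M) (Tm fun b => kX M (β b)) (kf M) (Tpr fun b => kX M (β b))
  map {M N} f := hc (M := mkC _ _ _ _) (N := mkC _ _ _ _) (fun w => Rep.ap f (some w)) (Tmap fun b => Rep.ap f (some (β b))) (fun a => kn1 f a) 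
    (fun b => (Tmap_pr (fun b => Rep.ap f (some (β b))) b).symm)
  map_id _ := extO (fun _ => rfl) rfl
  map_comp _ _ := extO (fun _ => rfl) rfl
instance : (rG1 k sW tW β).Additive := ⟨extO (fun _ => zm_to _ _) rfl⟩
instance : (rF1 k sW tW β).Additive := ⟨extO (fun _ => zm_to _ _) rfl⟩
instance : (rG0 k sW tW β).Additive := ⟨extO (fun _ => rfl) rfl⟩
instance : (rF0 k sW tW β).Additive := ⟨extO (fun _ => rfl) rfl⟩

variable [Fintype W] 
noncomputable def reflD (k : Type) [Field k] (sW tW : AW → W) (β : B → W) : CData (RSrc k sW tW β) (RSink k sW tW β) where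
  G₁ := rG1 k sW tW β
  G₀ := rG0 k sW tW β
  F₀ := rF0 k sW tW β
  F₁ := rF1 k sW tW β
  η := 
   { app := fun M => hk (M := mkK _ _ _ _) (N := mkK _ _ _ _) (fun _ => 0) (Tlift (cg M)) (fun _ => zm_to _ _) (fun _ => zm_to _ _)
     naturality := fun M N f => extO (fun _ => zm_to _ _) (Text fun b => (cn2 f b).symm) }
  ξ := 
   { app := fun M => hc (M := mkC _ _ _ _) (N := mkC _ _ _ _) (fun _ => 0) (Tdesc (kg M)) (fun _ => to_zm _ _) (fun _ => to_zm _ _)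
     naturality := fun M N f => extO (fun _ => to_zm _ _) ((Tmap_desc _ _).trans ((congrArg Tdesc (funext fun b => (kn2 f b).symm)).trans (Tdesc_comp _ _).symm)) }
  u M := hc (N := mkC _ _ _ _) (fun w => 𝟙 _) (Tlift (cg M)) (fun a => (Category.comp_id _).trans (Category.id_comp _).symm) (fun b => Category.comp_id _)
  v M := hc (N := mkC _ _ _ _) (fun w => 0) (𝟙 _) (fun a => to_zm _ _) (fun b => to_zm _ _)
  q N := hk (M := mkK _ _ _ _) (fun w => 𝟙 _) (Tdesc (kg N)) (fun a => (Category.comp_id _).trans (Category.id_comp _).symm) (fun b => (Tin_desc _ b).trans (Category.id_comp _).symm)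
  p N := hk (M := mkK _ _ _ _) (fun w => 0) (𝟙 _) (fun a => zm_to _ _) (fun b => zm_to _ _)
  nu f := extO (fun _ => (Category.comp_id _).trans (Category.id_comp _).symm) (Text fun b => (cn2 f b).symm)
  nv f := extO (fun _ => to_zm _ _) ((Category.comp_id _).trans (Category.id_comp _).symm)
  nq f := extO (fun _ => (Category.comp_id _).trans (Category.id_comp _).symm)
    ((Tmap_desc _ _).trans ((congrArg Tdesc (funext fun b => (kn2 f b).symm)).trans (Tdesc_comp _ _).symm))
  np f := extO (fun _ => zm_to _ _) ((Category.comp_id _).trans (Category.id_comp _).symm)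
  t0 M := extO (fun _ => Category.comp_id _) ((Category.id_comp _).trans (Tdesc_in _))
  t0' M := extO (fun _ => Category.comp_id _) rfl
  t1 M := extO (fun _ => zm_to _ _) (Category.comp_id _)
  t1' M := extO (fun _ => zm_to _ _) (Category.comp_id _)
  c1 M := extO (fun _ => to_zm _ _) (Eq.trans (show Tlift (cg M) ≫ Tdesc (Tin _) = Tlift (cg M) by rw [Tdesc_in, Category.comp_id]) (Category.id_comp _).symm)
  c2 M := extO (fun _ => zm_to _ _) (Eq.trans (Category.comp_id _) (Category.id_comp _).symm)

theorem T_se {ι : Type*} {S : ShortComplex (ModuleCat.{0} k)} {T : B → ShortComplex (ModuleCat.{0} k)} (h : ∀ b, (T b).ShortExact)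
   (e1 : S.X₁ = Tm (fun b => (T b).X₁)) (e2 : S.X₂ = Tm (fun b => (T b).X₂)) (e3 : S.X₃ = Tm (fun b => (T b).X₃))
   (hf : HEq S.f (Tmap fun b => (T b).f)) (hg : HEq S.g (Tmap fun b => (T b).g)) : S.ShortExact := by
  obtain ⟨f, g, w⟩ := S
  dsimp only at e1 e2 e3
  subst e1 e2 e3
  obtain rfl := eq_of_heq hf
  obtain rfl := eq_of_heq hg
  simp only [Rep.exact_iff] at h ⊢
  refine ⟨fun x y hxy => funext fun b => (h b).1 (congrFun hxy b), fun y hy => ?_, fun y => ?_⟩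
  · choose x hx using fun b => (h b).2.1 (y b) (congrFun hy b)
    exact ⟨x, funext hx⟩
  · choose x hx using fun b => (h b).2.2 (y b)
    exact ⟨x, funext hx⟩
instance : ExD (reflD k sW tW β) where
  e1 := Rep.ex_to (F := rG1 k sW tW β) fun
    | none, S, hS => (Rep.se_iff S).1 hS none
    | some w, S, hS => zm_se _ (fun _ => zm_isZero) S
  e2 := Rep.ex_to (F := rG0 k sW tW β) fun
    | none, S, hS => T_se (ι := ℕ) (T := fun b => S.map (Rep.E k (sc sW B) (tc tW β) ∅ (some (β b)))) (fun b => (Rep.se_iff S).1 hS _) rfl rfl rfl HEq.rfl HEq.rfl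
    | some w, S, hS => (Rep.se_iff S).1 hS (some w)
  e3 := Rep.ex_to (F := rF0 k sW tW β) fun
    | none, S, hS => T_se (ι := ℕ) (T := fun b => S.map (Rep.E k (sk sW β) (tk tW B) ∅ (some (β b)))) (fun b => (Rep.se_iff S).1 hS _) rfl rfl rfl HEq.rfl HEq.rfl
    | some w, S, hS => (Rep.se_iff S).1 hS (some w)
  e4 := Rep.ex_to (F := rF1 k sW tW β) fun
    | none, S, hS => (Rep.se_iff S).1 hS none
    | some w, S, hS => zm_se _ (fun _ => zm_isZero) S

theorem zz {X Y : ModuleCat.{0} k} (hX : IsZero X) (hY : IsZero Y) (f : X ⟶ Y) : IsIso f := ⟨0, hX.eq_of_src _ _, hY.eq_of_src _ _⟩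
theorem Rep.isZero_of {V A : Type} [Fintype V] {s t : A → V} {R : Set (List A)} {M : Rep k s t R} (h : ∀ v, IsZero (M.obj v)) : IsZero M := by
  rw [IsZero.iff_id_eq_zero]
  exact Rep.hext fun v => (h v).eq_of_src _ _
theorem Tm_zero : IsZero (Tm (k := k) (fun _ : B => zm k)) := ModuleCat.isZero_of_subsingleton _
theorem iso_id {X : ModuleCat.{0} k} (f : X ⟶ X) (h : f = 𝟙 X) : IsIso f := by subst h; infer_instance
theorem refl_eq : (coconeT (reflD k sW tW β).ξ).IsEquivalence := by
  refine equivJ (reflD k sW tW β) (Rep.JE _ _ _ _) ?_ ?_ (Rep.JE _ _ _ _) ?_ ?_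
  · intro Y; refine Rep.isZero_of (s := sc sW B) (t := tc tW β) ?_
    rintro (_|w)
    · exact Tm_zero
    · exact zm_isZero
  · rintro (_|w)
    · exact Or.inl fun Y => ⟨iso_id _ (Tdesc_in _), iso_id _ rfl⟩
    · exact Or.inr fun Y => ⟨zz zm_isZero zm_isZero _, iso_id _ rfl⟩
  · intro Y; refine Rep.isZero_of (s := sk sW β) (t := tk tW B) ?_
    rintro (_|w)
    · exact Tm_zero
    · exact zm_isZero
  · rintro (_|w)
    · exact Or.inr fun Y => ⟨iso_id _ (Tlift_prid _), iso_id _ rfl⟩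
    · exact Or.inl fun Y => ⟨zz zm_isZero zm_isZero _, iso_id _ rfl⟩
noncomputable def reflT (k : Type) [Field k] (sW tW : AW → W) (β : B → W) : TEq (RSink k sW tW β) (RSrc k sW tW β) :=
  haveI := refl_eq (k := k) (sW := sW) (tW := tW) (β := β)
  { F := coconeT (reflD k sW tW β).ξ }
end reflec
end QN

namespace QN
set_option linter.all false
section reflo
open CategoryTheory CategoryTheory.Limits
variable {V : Type} [Fintype V]

/-- source and target of the arrows of an oriented graph -/
abbrev oA (o : V → V → Prop) := {p : V × V // o p.1 p.2}
def oS (o : V → V → Prop) : oA o → V := fun a => a.1.1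
def oT (o : V → V → Prop) : oA o → V := fun a => a.1.2
abbrev RepO (k : Type) [Field k] (o : V → V → Prop) := Rep k (oS o) (oT o) ∅

abbrev oW (i : V) := {x : V // x ≠ i}
abbrev oB (o : V → V → Prop) (i : V) := {w : oW i // o w.1 i}
abbrev oAW (o : V → V → Prop) (i : V) := {p : oW i × oW i // o p.1.1 p.2.1}
def oSW (o : V → V → Prop) (i : V) : oAW o i → oW i := fun a => a.1.1
def oTW (o : V → V → Prop) (i : V) : oAW o i → oW i := fun a => a.1.2
def oβ (o : V → V → Prop) (i : V) : oB o i → oW i := fun a => a.1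

noncomputable def qkE {o : V → V → Prop} {i : V} (h : IsSink o i) : oAW o i ⊕ oB o i ≃ oA o :=
  Equiv.ofBijective (Sum.elim (fun p => ⟨(p.1.1.1, p.1.2.1), p.2⟩) (fun b => ⟨(b.1.1, i), b.2⟩)) (by
    constructor
    · rintro (⟨⟨⟨p, hp⟩, ⟨q, hq⟩⟩, hpq⟩ | ⟨⟨p, hp⟩, hpq⟩) (⟨⟨⟨p', hp'⟩, ⟨q', hq'⟩⟩, hpq'⟩ | ⟨⟨p', hp'⟩, hpq'⟩) h <;> simp at h ⊢
      · exact h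
      · exact hq h.2
      · exact hq' h.2.symm
      · exact h
    · rintro ⟨⟨p, q⟩, hpq⟩
      have hp : p ≠ i := by rintro rfl; exact h _ hpq
      by_cases hq : q = i
      · subst hq; exact ⟨.inr ⟨⟨p, hp⟩, hpq⟩, rfl⟩
      · exact ⟨.inl ⟨⟨⟨p, hp⟩, ⟨q, hq⟩⟩, hpq⟩, rfl⟩)

noncomputable def qcE {o : V → V → Prop} {i : V} (h : IsSink o i) : oAW o i ⊕ oB o i ≃ oA (flipAt i o) :=
  Equiv.ofBijective (Sum.elim (fun p => ⟨(p.1.1.1, p.1.2.1), by simpa [flipAt, p.1.1.2, p.1.2.2] using p.2⟩) 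
     (fun b => ⟨(i, b.1.1), by simpa [flipAt] using b.2⟩)) (by
    constructor
    · rintro (⟨⟨⟨p, hp⟩, ⟨q, hq⟩⟩, hpq⟩ | ⟨⟨p, hp⟩, hpq⟩) (⟨⟨⟨p', hp'⟩, ⟨q', hq'⟩⟩, hpq'⟩ | ⟨⟨p', hp'⟩, hpq'⟩) h <;> simp at h ⊢
      · exact h
      · exact hp h.1
      · exact hp' h.1.symm
      · exact h
    · rintro ⟨⟨p, q⟩, hpq⟩
      have hq : q ≠ i := by rintro rfl; exact h p (by simpa [flipAt] using hpq)
      by_cases hp : p = i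
      · subst hp; exact ⟨.inr ⟨⟨q, hq⟩, by simpa [flipAt] using hpq⟩, rfl⟩
      · exact ⟨.inl ⟨⟨⟨p, hp⟩, ⟨q, hq⟩⟩, by simpa [flipAt, hp, hq] using hpq⟩, rfl⟩)

open Classical in
noncomputable def qk {o : V → V → Prop} {i : V} (h : IsSink o i) :
    QIso (sk (oSW o i) (oβ o i)) (tk (oTW o i) (oB o i)) ∅ (oS o) (oT o) ∅ where
  e := Equiv.optionSubtypeNe i
  f := qkE h
  hs := by rintro (a | b) <;> rfl
  ht := by rintro (a | b) <;> rfl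
  hr := by simp
open Classical in
noncomputable def qc {o : V → V → Prop} {i : V} (h : IsSink o i) :
    QIso (sc (oSW o i) (oB o i)) (tc (oTW o i) (oβ o i)) ∅ (oS (flipAt i o)) (oT (flipAt i o)) ∅ where
  e := Equiv.optionSubtypeNe i
  f := qcE h
  hs := by rintro (a | b) <;> rfl
  ht := by rintro (a | b) <;> rfl
  hr := by simp

open Classical in
/-- reflection at a sink -/
noncomputable def reflO (k : Type) [Field k] {o : V → V → Prop} {i : V} (h : IsSink o i) : TEq (RepO k o) (RepO k (flipAt i o)) :=
  (TEq.ofEquiv (Rep.pull (k := k) (qk h))).trans ((reflT k (oSW o i) (oTW o i) (oβ o i)).trans (TEq.ofEquiv (Rep.pull (k := k) (qc h).symm)))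

theorem stepAny_TEq (k : Type) [Field k] {o o' : V → V → Prop} (h : StepAny o o') : Nonempty (TEq (RepO k o) (RepO k o')) := by
  obtain ⟨i, h | h, rfl⟩ := h
  · exact ⟨reflO k h⟩
  · have h1 := reflO k (flipAt_source h)
    rw [flipAt_flipAt] at h1
    exact ⟨h1.symm⟩
theorem orient_TEq (k : Type) [Field k] {G : SimpleGraph V} (hG : G.IsTree)
    (o o' : V → V → Prop) (ho : IsOrientation G o) (ho' : IsOrientation G o') : Nonempty (TEq (RepO k o) (RepO k o')) := by
  have h := reach_any hG o o' ho ho'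
  clear ho'
  induction h with
  | refl => exact ⟨TEq.refl _⟩
  | tail h1 h2 ih => 
    obtain ⟨e2⟩ := stepAny_TEq k h2
    obtain ⟨e1⟩ := ih
    exact ⟨e1.trans e2⟩
/-- transport along a bijection of vertices -/
noncomputable def relabO {V' : Type} [Fintype V'] (k : Type) [Field k] (e : V ≃ V') (o : V → V → Prop) (o' : V' → V' → Prop) (h : ∀ x y, o x y ↔ o' (e x) (e y)) :
    TEq (RepO k o) (RepO k o') :=
  TEq.symm (TEq.ofEquiv (Rep.pull (k := k) (R := ∅) (R' := ∅) (s := oS o) (t := oT o) (s' := oS o') (t' := oT o') 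
    { e := e, f := (e.prodCongr e).subtypeEquiv fun p => h _ _, hs := fun _ => rfl, ht := fun _ => rfl, hr := by simp }))
end reflo
end QN

namespace QN
set_option linter.all false
section nakstep
open CategoryTheory CategoryTheory.Limits
variable {k : Type} [Field k]

/-- vertices -/
inductive NV (L W : Type) (m : ℕ) : Type
  | l (x : L) : NV L W m
  | c (j : Fin (m+1)) : NV L W m
  | w (x : W) : NV L W m
/-- arrows -/
inductive NA (AL AW : Type) (m : ℕ) : Type
  | l (x : AL) : NA AL AW m
  | h : NA AL AW m
  | c (j : Fin m) : NA AL AW m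
  | z : NA AL AW m
  | w (x : AW) : NA AL AW m
def NV.eqv (L W : Type) (m : ℕ) : NV L W m ≃ L ⊕ Fin (m+1) ⊕ W where
  toFun | .l x => .inl x | .c j => .inr (.inl j) | .w x => .inr (.inr x)
  invFun | .inl x => .l x | .inr (.inl j) => .c j | .inr (.inr x) => .w x
  left_inv x := by cases x <;> rfl
  right_inv x := by rcases x with x|x|x <;> rfl
noncomputable instance (L W : Type) (m : ℕ) [Fintype L] [Fintype W] : Fintype (NV L W m) := Fintype.ofEquiv _ (NV.eqv L W m).symm

variable {L W AL AW : Type} {m : ℕ} 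

def nS (sL : AL → L) (sW : AW → W) (ae : L) : NA AL AW m → NV L W m
  | .l a => .l (sL a) | .h => .l ae | .c j => .c j.castSucc | .z => .c (Fin.last m) | .w a => .w (sW a)
def nT (tL : AL → L) (tW : AW → W) (w0 : W) : NA AL AW m → NV L W m
  | .l a => .l (tL a) | .h => .c 0 | .c j => .c j.succ | .z => .w w0 | .w a => .w (tW a)
def nS' (sL : AL → L) (sW : AW → W) (ae : L) (w0 : W) : NA AL AW m → NV L W m
  | .l a => .l (sL a) | .h => .l ae | .c j => .c j.castSucc | .z => .w w0 | .w a => .w (sW a)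
def nT' (tL : AL → L) (tW : AW → W) : NA AL AW m → NV L W m
  | .l a => .l (tL a) | .h => .c 0 | .c j => .c j.succ | .z => .c 0 | .w a => .w (tW a)
/-- left part of the arrows -/
def nι (AW : Type) (m : ℕ) : AL ⊕ Unit → NA AL AW m
  | .inl a => .l a | .inr _ => .h
/-- the tail of the relation -/
def ntl (AL AW : Type) (m : ℕ) : Fin (m+1) → List (NA AL AW m) := Fin.reverseInduction (motive := fun _ => List (NA AL AW m)) [.z] (fun j l => .c j :: l)
def nR' (AW : Type) (m : ℕ) (R : Set (List (AL ⊕ Unit))) : Set (List (NA AL AW m)) := {p | ∃ q ∈ R, p = q.map (nι AW m)}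
def nR (AW : Type) (m : ℕ) (R : Set (List (AL ⊕ Unit))) : Set (List (NA AL AW m)) := {p | (∃ q ∈ R, p = q.map (nι AW m)) ∨ p = .h :: ntl AL AW m 0}

theorem pathL_map {V A A' : Type} {s t : A → V} (ι : A' → A) (obj : V → ModuleCat.{0} k) (map : ∀ a, obj (s a) ⟶ obj (t a)) (p : List A') :
    pathL obj map (p.map ι) = pathL (s := s ∘ ι) (t := t ∘ ι) obj (fun a => map (ι a)) p := by
  induction p with
  | nil => rfl
  | cons a p ih => 
    show pathL obj map (p.map ι) ∘ₗ _ = _ ∘ₗ _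
    rw [ih]; rfl
/-- the action of a single map on the total space -/
noncomputable def actX {V : Type} (X : V → ModuleCat.{0} k) (x y : V) (g : X x ⟶ X y) : (∀ v, X v) →ₗ[k] (∀ v, X v) :=
  haveI := Classical.decEq V
  LinearMap.single k (fun v => X v) y ∘ₗ g.hom ∘ₗ LinearMap.proj x
theorem actX_nat {V : Type} {X Y : V → ModuleCat.{0} k} (f : ∀ v, X v ⟶ Y v) (x y : V) (g : X x ⟶ X y) (g' : Y x ⟶ Y y) (h : g ≫ f y = f x ≫ g') (w : ∀ v, X v) :
    actX Y x y g' (fun v => (f v).hom (w v)) = fun v => (f v).hom (actX X x y g w v) := by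
  classical
  have h1 : g'.hom ((f x).hom (w x)) = (f y).hom (g.hom (w x)) := congrArg (fun z => z.hom (w x)) h.symm
  funext v
  show (Pi.single y (g'.hom ((f x).hom (w x))) : ∀ v, Y v) v = (f v).hom ((Pi.single y (g.hom (w x)) : ∀ v, X v) v)
  rw [h1]
  by_cases hv : v = y
  · subst hv; simp
  · rw [Pi.single_eq_of_ne hv, Pi.single_eq_of_ne hv, map_zero]
theorem pathL_nat {V A : Type} {s t s' t' : A → V} {X Y : V → ModuleCat.{0} k} (mX : ∀ a, X (s a) ⟶ X (t a)) (mY : ∀ a, Y (s' a) ⟶ Y (t' a)) (f : ∀ v, X v ⟶ Y v)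
    (h : ∀ a (w : ∀ v, X v), actX Y _ _ (mY a) (fun v => (f v).hom (w v)) = fun v => (f v).hom (actX X _ _ (mX a) w v)) (p : List A) (w : ∀ v, X v) : pathL Y mY p (fun v => (f v).hom (w v)) = fun v => (f v).hom (pathL X mX p w v) := by
  induction p generalizing w with
  | nil => rfl
  | cons a p ih =>
    show pathL Y mY p (actL Y mY a _) = _
    refine (congrArg (pathL Y mY p) (h a w)).trans ?_
    rw [ih]; rfl
theorem pathL_surj {V A : Type} {s t s' t' : A → V} {X Y : V → ModuleCat.{0} k} (mX : ∀ a, X (s a) ⟶ X (t a)) (mY : ∀ a, Y (s' a) ⟶ Y (t' a)) (f : ∀ v, X v ⟶ Y v)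
    (h : ∀ a (w : ∀ v, X v), actX Y _ _ (mY a) (fun v => (f v).hom (w v)) = fun v => (f v).hom (actX X _ _ (mX a) w v))
    (hs : ∀ v, Function.Surjective (f v).hom) (p : List A) (h0 : pathL X mX p = 0) : pathL Y mY p = 0 := by
  refine LinearMap.ext fun w => ?_
  choose w' hw using fun v => hs v (w v)
  obtain rfl : (fun v => (f v).hom (w' v)) = w := funext hw
  rw [pathL_nat mX mY f h, h0]
  funext v; exact map_zero _
theorem actL_zero {V A : Type} {s t : A → V} {X : V → ModuleCat.{0} k} (mX : ∀ a, X (s a) ⟶ X (t a)) (a : A) (h : mX a = 0) : actL X mX a = 0 := by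
  unfold actL; rw [h]; simp
theorem pathL_z {V A : Type} {s t : A → V} {X : V → ModuleCat.{0} k} (mX : ∀ a, X (s a) ⟶ X (t a)) (p : List A) (h : ∃ a ∈ p, mX a = 0) : pathL X mX p = 0 := by
  obtain ⟨a, ha, h⟩ := h
  induction p with
  | nil => simp at ha
  | cons b p ih =>
    show pathL X mX p ∘ₗ actL X mX b = 0
    rcases List.mem_cons.1 ha with rfl | ha
    · rw [actL_zero _ _ h, LinearMap.comp_zero]
    · rw [ih ha, LinearMap.zero_comp]

variable {sL tL : AL → L} {sW tW : AW → W} {ae : L} {w0 : W} {R : Set (List (AL ⊕ Unit))}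
abbrev ROld (k : Type) [Field k] (m : ℕ) (sL tL : AL → L) (sW tW : AW → W) (ae : L) (w0 : W) (R : Set (List (AL ⊕ Unit))) := Rep k (nS (m := m) sL sW ae) (nT tL tW w0) (nR AW m R)
abbrev RNew (k : Type) [Field k] (m : ℕ) (sL tL : AL → L) (sW tW : AW → W) (ae : L) (w0 : W) (R : Set (List (AL ⊕ Unit))) := Rep k (nS' (m := m) sL sW ae w0) (nT' tL tW) (nR' AW m R)

section
variable (M : ROld k m sL tL sW tW ae w0 R)
/-- structure maps -/
abbrev ol (a : AL) : M.obj (.l (sL a)) ⟶ M.obj (.l (tL a)) := M.map (.l a)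
abbrev oh : M.obj (.l ae) ⟶ M.obj (.c 0) := M.map .h
abbrev oc (j : Fin m) : M.obj (.c j.castSucc) ⟶ M.obj (.c j.succ) := M.map (.c j)
abbrev oz : M.obj (.c (Fin.last m)) ⟶ M.obj (.w w0) := M.map .z
abbrev owm (a : AW) : M.obj (.w (sW a)) ⟶ M.obj (.w (tW a)) := M.map (.w a)
def nτ : ∀ j : Fin (m+1), M.obj (.c j) ⟶ M.obj (.w w0) := Fin.reverseInduction (motive := fun j => M.obj (.c j) ⟶ M.obj (.w w0)) (oz M) (fun j f => oc M j ≫ f)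
theorem nτ_last : nτ M (Fin.last m) = oz M := by simp [nτ]
theorem nτ_cs (j : Fin m) : nτ M j.castSucc = oc M j ≫ nτ M j.succ := by simp [nτ]
theorem ntl_last : ntl AL AW m (Fin.last m) = [.z] := by simp [ntl]
theorem ntl_cs (j : Fin m) : ntl AL AW m j.castSucc = .c j :: ntl AL AW m j.succ := by simp [ntl]
theorem ntl_mem (j : Fin (m+1)) : .z ∈ ntl AL AW m j := by
  refine Fin.reverseInduction ?_ (fun j ih => ?_) j
  · simp [ntl_last]
  · rw [ntl_cs]; exact List.mem_cons_of_mem _ ih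
open Classical in
theorem act_single {V A : Type} {s t : A → V} {X : V → ModuleCat.{0} k} (mX : ∀ a, X (s a) ⟶ X (t a)) (a : A) (x : X (s a)) :
   actL X mX a (Pi.single (s a) x : ∀ v, X v) = Pi.single (M := fun v => X v) (t a) ((mX a).hom x) := by
  unfold actL
  simp
open Classical in
theorem ntl_path (j : Fin (m+1)) (x : M.obj (.c j)) : pathL M.obj M.map (ntl AL AW m j) (Pi.single (NV.c j) x : ∀ v, M.obj v) = Pi.single (M := fun v => M.obj v) (NV.w w0) ((nτ M j).hom x) := by
  revert x
  refine Fin.reverseInduction (motive := fun j => ∀ x : M.obj (.c j), pathL M.obj M.map (ntl AL AW m j) (Pi.single (NV.c j) x : ∀ v, M.obj v) = Pi.single (M := fun v => M.obj v) (NV.w w0) ((nτ M j).hom x)) ?_ (fun j ih => ?_) j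
  · intro x
    rw [ntl_last, nτ_last]
    exact act_single M.map .z x
  · intro x
    rw [ntl_cs, nτ_cs]
    refine (congrArg (pathL M.obj M.map (ntl AL AW m j.succ)) (act_single M.map (.c j) x)).trans ?_
    exact ih _
theorem h_τ : oh M ≫ nτ M 0 = 0 := by
  classical
  refine ModuleCat.hom_ext (LinearMap.ext fun x => ?_)
  have h := M.rel _ (Or.inr rfl)
  have h1 : pathL M.obj M.map (.h :: ntl AL AW m 0) (Pi.single (NV.l ae) x : ∀ v, M.obj v) = 0 := by rw [h]; rfl
  have h2 := (congrArg (pathL M.obj M.map (ntl AL AW m 0)) (act_single M.map .h x)).symm.trans h1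
  have h3 := (ntl_path M 0 _).symm.trans h2
  have := congrFun h3 (.w w0)
  rw [Pi.single_eq_same] at this
  exact this
theorem nτ_nat {M N : ROld k m sL tL sW tW ae w0 R} (f : M ⟶ N) (j : Fin (m+1)) : nτ M j ≫ Rep.ap f (.w w0) = Rep.ap f (.c j) ≫ nτ N j := by
  refine Fin.reverseInduction (motive := fun j => nτ M j ≫ Rep.ap f (.w w0) = Rep.ap f (.c j) ≫ nτ N j) ?_ (fun j ih => ?_) j
  · rw [nτ_last, nτ_last]; exact Rep.ap_nat f .z
  · rw [nτ_cs, nτ_cs, Category.assoc, ih, ← Category.assoc, ← Category.assoc]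
    exact congrArg (· ≫ nτ N j.succ) (Rep.ap_nat f (.c j))
end
section
variable (M : RNew k m sL tL sW tW ae w0 R)
/-- structure maps -/
abbrev nl (a : AL) : M.obj (.l (sL a)) ⟶ M.obj (.l (tL a)) := M.map (.l a)
abbrev nh : M.obj (.l ae) ⟶ M.obj (.c 0) := M.map .h
abbrev nc (j : Fin m) : M.obj (.c j.castSucc) ⟶ M.obj (.c j.succ) := M.map (.c j)
abbrev nz : M.obj (.w w0) ⟶ M.obj (.c 0) := M.map .z
abbrev nwm (a : AW) : M.obj (.w (sW a)) ⟶ M.obj (.w (tW a)) := M.map (.w a)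
def nσ : ∀ j : Fin (m+1), M.obj (.w w0) ⟶ M.obj (.c j) := Fin.induction (motive := fun j => M.obj (.w w0) ⟶ M.obj (.c j)) (nz M) (fun j f => f ≫ nc M j)
theorem nσ_zero : nσ M 0 = nz M := rfl
theorem nσ_succ (j : Fin m) : nσ M j.succ = nσ M j.castSucc ≫ nc M j := by simp [nσ]
theorem nσ_nat {M N : RNew k m sL tL sW tW ae w0 R} (f : M ⟶ N) (j : Fin (m+1)) : nσ M j ≫ Rep.ap f (.c j) = Rep.ap f (.w w0) ≫ nσ N j := by
  refine Fin.induction (motive := fun j => nσ M j ≫ Rep.ap f (.c j) = Rep.ap f (.w w0) ≫ nσ N j) ?_ (fun j ih => ?_) j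
  · rw [nσ_zero, nσ_zero]; exact Rep.ap_nat f .z
  · rw [nσ_succ, nσ_succ, ← Category.assoc, ← ih, Category.assoc, Category.assoc]
    exact congrArg (nσ M j.castSucc ≫ ·) (Rep.ap_nat f (.c j))
end

section
variable (M : ROld k m sL tL sW tW ae w0 R) (N : RNew k m sL tL sW tW ae w0 R)
abbrev oO1 (X : NV L W m → ModuleCat.{0} k) : NV L W m → ModuleCat.{0} k
  | .l x => X (.l x) | .c j => X (.c j) | .w _ => zm k
abbrev oO0 (w0 : W) (X : NV L W m → ModuleCat.{0} k) : NV L W m → ModuleCat.{0} k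
  | .l x => zm k | .c j => X (.w w0) | .w x => X (.w x)
def o1f (X : NV L W m → ModuleCat.{0} k) : ∀ v, X v ⟶ oO1 X v
  | .l x => 𝟙 _ | .c j => 𝟙 _ | .w _ => 0
theorem o1f_surj (X : NV L W m → ModuleCat.{0} k) : ∀ v, Function.Surjective (o1f X v).hom
  | .l x => Function.surjective_id | .c j => Function.surjective_id | .w _ => fun y => ⟨0, Subsingleton.elim _ _⟩

/-- kills `W` -/
def nG1o (M : ROld k m sL tL sW tW ae w0 R) : RNew k m sL tL sW tW ae w0 R where
  obj := oO1 M.obj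
  map := fun | .l a => ol M a | .h => oh M | .c j => oc M j | .z => 0 | .w _ => 0
  rel p hp := by
    obtain ⟨q, hq, rfl⟩ := hp
    have h := M.rel _ (Or.inl ⟨q, hq, rfl⟩)
    rw [pathL_map] at h ⊢
    refine pathL_surj (X := M.obj) (Y := oO1 M.obj) _ _ (o1f M.obj) ?_ (o1f_surj _) q h
    rintro (a | a) w
    · exact actX_nat (o1f M.obj) (NV.l (sL a)) (NV.l (tL a)) _ _ ((Category.comp_id _).trans (Category.id_comp _).symm) w
    · exact actX_nat (o1f M.obj) (NV.l ae) (NV.c 0) _ _ ((Category.comp_id _).trans (Category.id_comp _).symm) w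
def nF1o (M : RNew k m sL tL sW tW ae w0 R) : ROld k m sL tL sW tW ae w0 R where
  obj := oO1 M.obj
  map := fun | .l a => nl M a | .h => nh M | .c j => nc M j | .z => 0 | .w _ => 0
  rel p hp := by
    rcases hp with ⟨q, hq, rfl⟩ | rfl
    · have h := M.rel _ (⟨q, hq, rfl⟩)
      rw [pathL_map] at h ⊢
      refine pathL_surj (X := M.obj) (Y := oO1 M.obj) _ _ (o1f M.obj) ?_ (o1f_surj _) q h
      rintro (a | a) w
      · exact actX_nat (o1f M.obj) (NV.l (sL a)) (NV.l (tL a)) _ _ ((Category.comp_id _).trans (Category.id_comp _).symm) w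
      · exact actX_nat (o1f M.obj) (NV.l ae) (NV.c 0) _ _ ((Category.comp_id _).trans (Category.id_comp _).symm) w
    · exact pathL_z _ _ ⟨.z, List.mem_cons_of_mem _ (ntl_mem 0), rfl⟩
def nG0o (hR : [] ∉ R) (M : ROld k m sL tL sW tW ae w0 R) : RNew k m sL tL sW tW ae w0 R where
  obj := oO0 w0 M.obj
  map := fun | .l a => 0 | .h => 0 | .c j => 𝟙 _ | .z => 𝟙 _ | .w a => owm M a
  rel p hp := by
    obtain ⟨q, hq, rfl⟩ := hp
    rcases q with _ | ⟨a | a, q⟩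
    · exact (hR hq).elim
    · exact pathL_z _ _ ⟨.l a, List.mem_cons_self, rfl⟩
    · exact pathL_z _ _ ⟨.h, List.mem_cons_self, rfl⟩
def nF0o (hR : [] ∉ R) (M : RNew k m sL tL sW tW ae w0 R) : ROld k m sL tL sW tW ae w0 R where
  obj := oO0 w0 M.obj
  map := fun | .l a => 0 | .h => 0 | .c j => 𝟙 _ | .z => 𝟙 _ | .w a => nwm M a
  rel p hp := by
    rcases hp with ⟨q, hq, rfl⟩ | rfl
    · rcases q with _ | ⟨a | a, q⟩
      · exact (hR hq).elim
      · exact pathL_z _ _ ⟨.l a, List.mem_cons_self, rfl⟩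
      · exact pathL_z _ _ ⟨.h, List.mem_cons_self, rfl⟩
    · exact pathL_z _ _ ⟨.h, List.mem_cons_self, rfl⟩
end
def oho {M N : ROld k m sL tL sW tW ae w0 R} (x : ∀ a, M.obj (.l a) ⟶ N.obj (.l a)) (y : ∀ j, M.obj (.c j) ⟶ N.obj (.c j)) (z : ∀ a, M.obj (.w a) ⟶ N.obj (.w a))
    (h1 : ∀ a, ol M a ≫ x (tL a) = x (sL a) ≫ ol N a) (h2 : oh M ≫ y 0 = x ae ≫ oh N) (h3 : ∀ j, oc M j ≫ y j.succ = y j.castSucc ≫ oc N j)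
    (h4 : oz M ≫ z w0 = y (Fin.last m) ≫ oz N) (h5 : ∀ a, owm M a ≫ z (tW a) = z (sW a) ≫ owm N a) : M ⟶ N :=
  Rep.hom (fun | .l a => x a | .c j => y j | .w a => z a) (fun | .l a => h1 a | .h => h2 | .c j => h3 j | .z => h4 | .w a => h5 a)
def nho {M N : RNew k m sL tL sW tW ae w0 R} (x : ∀ a, M.obj (.l a) ⟶ N.obj (.l a)) (y : ∀ j, M.obj (.c j) ⟶ N.obj (.c j)) (z : ∀ a, M.obj (.w a) ⟶ N.obj (.w a))
    (h1 : ∀ a, nl M a ≫ x (tL a) = x (sL a) ≫ nl N a) (h2 : nh M ≫ y 0 = x ae ≫ nh N) (h3 : ∀ j, nc M j ≫ y j.succ = y j.castSucc ≫ nc N j)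
    (h4 : nz M ≫ y 0 = z w0 ≫ nz N) (h5 : ∀ a, nwm M a ≫ z (tW a) = z (sW a) ≫ nwm N a) : M ⟶ N :=
  Rep.hom (fun | .l a => x a | .c j => y j | .w a => z a) (fun | .l a => h1 a | .h => h2 | .c j => h3 j | .z => h4 | .w a => h5 a)
theorem extN {s t : NA AL AW m → NV L W m} {R} {M N : Rep k s t R} {f g : M ⟶ N} (h1 : ∀ a, Rep.ap f (.l a) = Rep.ap g (.l a)) (h2 : ∀ j, Rep.ap f (.c j) = Rep.ap g (.c j)) 
   (h3 : ∀ a, Rep.ap f (.w a) = Rep.ap g (.w a)) : f = g :=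
  Rep.hext fun | .l a => h1 a | .c j => h2 j | .w a => h3 a
theorem ci {X Y : ModuleCat.{0} k} (f : X ⟶ Y) : f ≫ 𝟙 Y = 𝟙 X ≫ f := by simp
variable (R)
def nG1 (k : Type) [Field k] (m : ℕ) (sL tL : AL → L) (sW tW : AW → W) (ae : L) (w0 : W) : ROld k m sL tL sW tW ae w0 R ⥤ RNew k m sL tL sW tW ae w0 R where
  obj := nG1o
  map {M N} f := nho (M := nG1o M) (N := nG1o N) (fun a => Rep.ap f (.l a)) (fun j => Rep.ap f (.c j)) (fun _ => 𝟙 _)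
    (fun a => Rep.ap_nat f (.l a)) (Rep.ap_nat f .h) (fun j => Rep.ap_nat f (.c j)) (zm_to _ _) (fun _ => zm_to _ _)
  map_id _ := extN (fun _ => rfl) (fun _ => rfl) (fun _ => rfl)
  map_comp _ _ := extN (fun _ => rfl) (fun _ => rfl) (fun _ => zm_to _ _)
def nF1 (k : Type) [Field k] (m : ℕ) (sL tL : AL → L) (sW tW : AW → W) (ae : L) (w0 : W) : RNew k m sL tL sW tW ae w0 R ⥤ ROld k m sL tL sW tW ae w0 R where
  obj := nF1o
  map {M N} f := oho (M := nF1o M) (N := nF1o N) (fun a => Rep.ap f (.l a)) (fun j => Rep.ap f (.c j)) (fun _ => 𝟙 _)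
    (fun a => Rep.ap_nat f (.l a)) (Rep.ap_nat f .h) (fun j => Rep.ap_nat f (.c j)) (to_zm _ _) (fun _ => zm_to _ _)
  map_id _ := extN (fun _ => rfl) (fun _ => rfl) (fun _ => rfl)
  map_comp _ _ := extN (fun _ => rfl) (fun _ => rfl) (fun _ => zm_to _ _)
variable {R}
def nG0 (k : Type) [Field k] (m : ℕ) (sL tL : AL → L) (sW tW : AW → W) (ae : L) (w0 : W) (hR : [] ∉ R) : ROld k m sL tL sW tW ae w0 R ⥤ RNew k m sL tL sW tW ae w0 R where
  obj := nG0o hR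
  map {M N} f := nho (M := nG0o hR M) (N := nG0o hR N) (fun a => 𝟙 _) (fun j => Rep.ap f (.w w0)) (fun a => Rep.ap f (.w a))
    (fun a => zm_to _ _) (zm_to _ _) (fun j => (ci _).symm) ((ci _).symm) (fun a => Rep.ap_nat f (.w a))
  map_id _ := extN (fun _ => rfl) (fun _ => rfl) (fun _ => rfl)
  map_comp _ _ := extN (fun _ => zm_to _ _) (fun _ => rfl) (fun _ => rfl)
def nF0 (k : Type) [Field k] (m : ℕ) (sL tL : AL → L) (sW tW : AW → W) (ae : L) (w0 : W) (hR : [] ∉ R) : RNew k m sL tL sW tW ae w0 R ⥤ ROld k m sL tL sW tW ae w0 R where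
  obj := nF0o hR
  map {M N} f := oho (M := nF0o hR M) (N := nF0o hR N) (fun a => 𝟙 _) (fun j => Rep.ap f (.w w0)) (fun a => Rep.ap f (.w a))
    (fun a => zm_to _ _) (zm_to _ _) (fun j => (ci _).symm) ((ci _).symm) (fun a => Rep.ap_nat f (.w a))
  map_id _ := extN (fun _ => rfl) (fun _ => rfl) (fun _ => rfl)
  map_comp _ _ := extN (fun _ => zm_to _ _) (fun _ => rfl) (fun _ => rfl)
instance : (nG1 R k m sL tL sW tW ae w0).Additive := ⟨extN (fun _ => rfl) (fun _ => rfl) (fun _ => zm_to _ _)⟩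
instance : (nF1 R k m sL tL sW tW ae w0).Additive := ⟨extN (fun _ => rfl) (fun _ => rfl) (fun _ => zm_to _ _)⟩
instance (hR : [] ∉ R) : (nG0 k m sL tL sW tW ae w0 hR).Additive := ⟨extN (fun _ => zm_to _ _) (fun _ => rfl) (fun _ => rfl)⟩
instance (hR : [] ∉ R) : (nF0 k m sL tL sW tW ae w0 hR).Additive := ⟨extN (fun _ => zm_to _ _) (fun _ => rfl) (fun _ => rfl)⟩

theorem nτF (hR : [] ∉ R) (N : RNew k m sL tL sW tW ae w0 R) (j : Fin (m+1)) : nτ (nF0o hR N) j = 𝟙 (N.obj (.w w0)) := by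
  refine Fin.reverseInduction (motive := fun j => nτ (nF0o hR N) j = 𝟙 (N.obj (.w w0))) ?_ (fun j ih => ?_) j
  · exact nτ_last _
  · rw [nτ_cs]; exact (Category.id_comp _).trans ih
theorem nσG (hR : [] ∉ R) (N : ROld k m sL tL sW tW ae w0 R) (j : Fin (m+1)) : nσ (nG0o hR N) j = 𝟙 (N.obj (.w w0)) := by
  refine Fin.induction (motive := fun j => nσ (nG0o hR N) j = 𝟙 (N.obj (.w w0))) ?_ (fun j ih => ?_) j
  · rfl
  · rw [nσ_succ]; exact (Category.comp_id _).trans ih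

variable [Fintype L] [Fintype W]
theorem ic {X Y : ModuleCat.{0} k} (f : X ⟶ Y) : 𝟙 X ≫ f = f ≫ 𝟙 Y := by simp
def nakD (k : Type) [Field k] (m : ℕ) (sL tL : AL → L) (sW tW : AW → W) (ae : L) (w0 : W) (hR : [] ∉ R) : CData (ROld k m sL tL sW tW ae w0 R) (RNew k m sL tL sW tW ae w0 R) where
  G₁ := nG1 R k m sL tL sW tW ae w0
  G₀ := nG0 k m sL tL sW tW ae w0 hR
  F₀ := nF0 k m sL tL sW tW ae w0 hR
  F₁ := nF1 R k m sL tL sW tW ae w0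
  η := 
   { app := fun M => nho (M := nG1o M) (N := nG0o hR M) (fun _ => 0) (nτ M) (fun _ => 0) (fun _ => to_zm _ _) ((h_τ M).trans (zero_comp).symm) 
        (fun j => (nτ_cs M j).symm.trans (Category.comp_id _).symm) (zm_to _ _) (fun _ => zm_to _ _)
     naturality := fun M N f => extN (fun _ => to_zm _ _) (fun j => (nτ_nat f j).symm) (fun _ => zm_to _ _) }
  ξ := 
   { app := fun M => oho (M := nF0o hR M) (N := nF1o M) (fun _ => 0) (nσ M) (fun _ => 0) (fun _ => zm_to _ _) (zm_to _ _)
        (fun j => (Category.id_comp _).trans (nσ_succ M j)) (to_zm _ _) (fun _ => to_zm _ _)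
     naturality := fun M N f => extN (fun _ => zm_to _ _) (fun j => (nσ_nat f j).symm) (fun _ => to_zm _ _) }
  u M := oho (N := nF0o hR (nG0o hR M)) (fun _ => 0) (nτ M) (fun _ => 𝟙 _) (fun _ => to_zm _ _) ((h_τ M).trans (zero_comp).symm) 
        (fun j => (nτ_cs M j).symm.trans (Category.comp_id _).symm) (congrArg (· ≫ 𝟙 (M.obj (.w w0))) (nτ_last M).symm) (fun a => ci _)
  v M := oho (N := nF1o (nG1o M)) (fun _ => 𝟙 _) (fun _ => 𝟙 _) (fun _ => 0) (fun _ => ci _) (ci _) (fun j => ci _) (to_zm _ _) (fun a => to_zm _ _)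
  q N := nho (M := nG0o hR (nF0o hR N)) (fun _ => 0) (nσ N) (fun _ => 𝟙 _) (fun _ => zm_to _ _) (zm_to _ _)
        (fun j => (Category.id_comp _).trans (nσ_succ N j)) rfl (fun a => ci _)
  p N := nho (M := nG1o (nF1o N)) (fun _ => 𝟙 _) (fun _ => 𝟙 _) (fun _ => 0) (fun _ => ci _) (ci _) (fun j => ci _) (zm_to _ _) (fun a => zm_to _ _)
  nu f := extN (fun _ => to_zm _ _) (fun j => (nτ_nat f j).symm) (fun _ => ci _)
  nv f := extN (fun _ => ci _) (fun j => ci _) (fun _ => to_zm _ _)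
  nq f := extN (fun _ => zm_to _ _) (fun j => (nσ_nat f j).symm) (fun _ => ci _)
  np f := extN (fun _ => ci _) (fun j => ci _) (fun _ => zm_to _ _)
  t0 M := extN (fun _ => zm_to _ _) (fun j => (Category.id_comp _).trans (nσG hR M j)) (fun _ => Category.comp_id _) 
  t0' M := extN (fun _ => zm_to _ _) (fun j => (Category.comp_id _).trans (nτF hR M j)) (fun _ => Category.comp_id _) 
  t1 M := extN (fun _ => Category.comp_id _) (fun j => Category.comp_id _) (fun _ => zm_to _ _) 
  t1' M := extN (fun _ => Category.comp_id _) (fun j => Category.comp_id _) (fun _ => zm_to _ _) 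
  c1 M := extN (fun _ => to_zm _ _) (fun j => (congrArg (nτ M j ≫ ·) (nσG hR M j)).trans (ci _)) (fun _ => to_zm _ _) 
  c2 M := extN (fun _ => zm_to _ _) (fun j => (ci _).trans (congrArg (· ≫ nσ M j) (nτF hR M j)).symm) (fun _ => zm_to _ _) 
variable {hR : [] ∉ R}
instance : ExD (nakD k m sL tL sW tW ae w0 hR) where
  e1 := Rep.ex_to (F := nG1 R k m sL tL sW tW ae w0) fun
    | .l x, S, hS => (Rep.se_iff S).1 hS (.l x)
    | .c x, S, hS => (Rep.se_iff S).1 hS (.c x)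
    | .w x, S, hS => zm_se _ (fun _ => zm_isZero) S
  e2 := Rep.ex_to (F := nG0 k m sL tL sW tW ae w0 hR) fun
    | .l x, S, hS => zm_se _ (fun _ => zm_isZero) S
    | .c x, S, hS => (Rep.se_iff S).1 hS (.w w0)
    | .w x, S, hS => (Rep.se_iff S).1 hS (.w x)
  e3 := Rep.ex_to (F := nF0 k m sL tL sW tW ae w0 hR) fun
    | .l x, S, hS => zm_se _ (fun _ => zm_isZero) S
    | .c x, S, hS => (Rep.se_iff S).1 hS (.w w0)
    | .w x, S, hS => (Rep.se_iff S).1 hS (.w x)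
  e4 := Rep.ex_to (F := nF1 R k m sL tL sW tW ae w0) fun
    | .l x, S, hS => (Rep.se_iff S).1 hS (.l x)
    | .c x, S, hS => (Rep.se_iff S).1 hS (.c x)
    | .w x, S, hS => zm_se _ (fun _ => zm_isZero) S
theorem nak_eq : (coconeT (nakD k m sL tL sW tW ae w0 hR).ξ).IsEquivalence := by
  refine equivJ (nakD k m sL tL sW tW ae w0 hR) (Rep.JE _ _ _ _) ?_ ?_ (Rep.JE _ _ _ _) ?_ ?_
  · intro Y; refine Rep.isZero_of (s := nS sL sW ae) (t := nT tL tW w0) ?_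
    rintro (x|x|x) <;> exact zm_isZero
  · rintro (x|x|x)
    · exact Or.inl fun Y => ⟨zz zm_isZero zm_isZero _, iso_id _ rfl⟩
    · exact Or.inl fun Y => ⟨iso_id _ (nσG hR Y x), iso_id _ rfl⟩
    · exact Or.inr fun Y => ⟨zz zm_isZero zm_isZero _, iso_id _ rfl⟩
  · intro Y; refine Rep.isZero_of (s := nS' sL sW ae w0) (t := nT' tL tW) ?_
    rintro (x|x|x) <;> exact zm_isZero
  · rintro (x|x|x)
    · exact Or.inr fun Y => ⟨zz zm_isZero zm_isZero _, iso_id _ rfl⟩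
    · exact Or.inr fun Y => ⟨iso_id _ (nτF hR Y x), iso_id _ rfl⟩
    · exact Or.inl fun Y => ⟨zz zm_isZero zm_isZero _, iso_id _ rfl⟩
noncomputable def nakT (k : Type) [Field k] (m : ℕ) (sL tL : AL → L) (sW tW : AW → W) (ae : L) (w0 : W) (hR : [] ∉ R) : TEq (RNew k m sL tL sW tW ae w0 R) (ROld k m sL tL sW tW ae w0 R) :=
  haveI := nak_eq (k := k) (m := m) (sL := sL) (tL := tL) (sW := sW) (tW := tW) (ae := ae) (w0 := w0) (hR := hR)
  { F := coconeT (nakD k m sL tL sW tW ae w0 hR).ξ }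
end nakstep
end QN

namespace QN
set_option linter.all false
section nakseq
open CategoryTheory CategoryTheory.Limits

/-- numerical data of the Nakayama algebra (0-indexed) -/
structure NSq (n T : ℕ) (a m : ℕ → ℕ) : Prop where
  hc : ∀ i, i < T → a i + m i + 2 < n
  hs : ∀ i j, i < j → j < T → a i + m i + 1 ≤ a j
def nO (T : ℕ) (a m : ℕ → ℕ) (t x y : ℕ) : Prop :=
  (y = x + 1 ∧ ∀ i, t ≤ i → i < T → y ≠ a i + m i + 2) ∨ ∃ i, t ≤ i ∧ i < T ∧ x = a i + m i + 2 ∧ y = a i + 1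
def nF (n T : ℕ) (a m : ℕ → ℕ) (t : ℕ) (x y : Fin n) : Prop := nO T a m t x.1 y.1
def prs (x l : ℕ) : List (ℕ × ℕ) := (List.range' x l).map fun x => (x, x+1)
def opr {n : ℕ} {o : Fin n → Fin n → Prop} (q : oA o) : ℕ × ℕ := (q.1.1.1, q.1.2.1)
theorem opr_inj {n : ℕ} {o : Fin n → Fin n → Prop} : Function.Injective (opr (o := o)) := by
  rintro ⟨⟨⟨x, _⟩, ⟨y, _⟩⟩, _⟩ ⟨⟨⟨x', _⟩, ⟨y', _⟩⟩, _⟩ h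
  simp only [opr, Prod.mk.injEq] at h
  obtain ⟨rfl, rfl⟩ := h; rfl
def nRl (n T : ℕ) (a m : ℕ → ℕ) (t : ℕ) : Set (List (oA (nF n T a m t))) := {p | ∃ i < t, p.map opr = prs (a i) (m i + 2)}

section
variable {n T : ℕ} {a m : ℕ → ℕ} (H : NSq n T a m) {t : ℕ} (ht : t < T)
abbrev nL (n : ℕ) (A : ℕ) := {x : Fin n // x.1 ≤ A}
abbrev nW (n : ℕ) (C : ℕ) := {x : Fin n // C ≤ x.1}
abbrev nAL (n T : ℕ) (a m : ℕ → ℕ) (t : ℕ) := {p : nL n (a t) × nL n (a t) // nF n T a m t p.1.1 p.2.1}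
abbrev nAW (n T : ℕ) (a m : ℕ → ℕ) (t : ℕ) := {p : nW n (a t + m t + 2) × nW n (a t + m t + 2) // nF n T a m t p.1.1 p.2.1}
def nsL (n T : ℕ) (a m : ℕ → ℕ) (t : ℕ) : nAL n T a m t → nL n (a t) := fun p => p.1.1
def ntL (n T : ℕ) (a m : ℕ → ℕ) (t : ℕ) : nAL n T a m t → nL n (a t) := fun p => p.1.2
def nsW (n T : ℕ) (a m : ℕ → ℕ) (t : ℕ) : nAW n T a m t → nW n (a t + m t + 2) := fun p => p.1.1
def ntW (n T : ℕ) (a m : ℕ → ℕ) (t : ℕ) : nAW n T a m t → nW n (a t + m t + 2) := fun p => p.1.2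
def nae : nL n (a t) := ⟨⟨a t, by have := H.hc t ht; omega⟩, le_rfl⟩
def nw0 : nW n (a t + m t + 2) := ⟨⟨a t + m t + 2, H.hc t ht⟩, le_rfl⟩

include H ht in
theorem nfar (i : ℕ) (h1 : t + 1 ≤ i) (h2 : i < T) : a t + m t + 1 ≤ a i := H.hs t i h1 h2

def nEf : NV (nL n (a t)) (nW n (a t + m t + 2)) (m t) → Fin n
  | .l x => x.1 | .c j => ⟨a t + 1 + j, by have := H.hc t ht; have := j.2; omega⟩ | .w x => x.1
noncomputable def nE : NV (nL n (a t)) (nW n (a t + m t + 2)) (m t) ≃ Fin n :=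
  Equiv.ofBijective (nEf H ht) (by
    constructor
    · rintro (⟨⟨x, hx⟩, hx'⟩ | ⟨x, hx⟩ | ⟨⟨x, hx⟩, hx'⟩) (⟨⟨y, hy⟩, hy'⟩ | ⟨y, hy⟩ | ⟨⟨y, hy⟩, hy'⟩) h <;> simp [nEf] at h ⊢ <;> (try dsimp only at *) <;> omega
    · rintro ⟨x, hx⟩
      by_cases h1 : x ≤ a t
      · exact ⟨.l ⟨⟨x, hx⟩, h1⟩, rfl⟩
      by_cases h2 : a t + m t + 2 ≤ x
      · exact ⟨.w ⟨⟨x, hx⟩, h2⟩, rfl⟩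
      · exact ⟨.c ⟨x - (a t + 1), by omega⟩, by simp [nEf]; omega⟩)

include H ht in
theorem nO_lt {x y : ℕ} (h : nO T a m t x y) (h1 : x ≤ a t) : y = x + 1 := by
  rcases h with ⟨h, _⟩ | ⟨i, h2, h3, h4, h5⟩
  · exact h
  · rcases h2.eq_or_lt with rfl | h2
    · omega
    · have := nfar H ht i h2 h3; omega
include H ht in
theorem nO_le {x y : ℕ} (h : y ≤ a t + m t + 1) : nO T a m (t+1) x y ↔ y = x + 1 := by
  constructor
  · rintro (⟨h, _⟩ | ⟨i, h2, h3, h4, h5⟩)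
    · exact h
    · have := nfar H ht i h2 h3; omega
  · intro h'
    exact Or.inl ⟨h', fun i h1 h2 => by have := nfar H ht i h1 h2; omega⟩
include H ht in
theorem nO_le' {x y : ℕ} (h : y ≤ a t + m t + 1) : nO T a m t x y ↔ y = x + 1 ∨ (x = a t + m t + 2 ∧ y = a t + 1) := by
  constructor
  · rintro (⟨h, _⟩ | ⟨i, h2, h3, h4, h5⟩)
    · exact Or.inl h
    · rcases h2.eq_or_lt with rfl | h2
      · right; omega
      · have := nfar H ht i h2 h3; omega
  · rintro (h' | ⟨h1, h2⟩)
    · exact Or.inl ⟨h', fun i h1 h2 => by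
        rcases h1.eq_or_lt with rfl | h1
        · omega
        · have := nfar H ht i h1 h2; omega⟩
    · exact Or.inr ⟨t, le_rfl, ht, h1, h2⟩
include H ht in
theorem nO_w {x y : ℕ} (h : a t + m t + 2 ≤ x) (h' : a t + m t + 2 ≤ y) : nO T a m t x y ↔ nO T a m (t+1) x y := by
  constructor
  · rintro (⟨h, h2⟩ | ⟨i, h2, h3, h4, h5⟩)
    · exact Or.inl ⟨h, fun i h3 h4 => h2 i (by omega) h4⟩
    · rcases h2.eq_or_lt with rfl | h2
      · omega
      · exact Or.inr ⟨i, h2, h3, h4, h5⟩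
  · rintro (⟨h, h2⟩ | ⟨i, h2, h3, h4, h5⟩)
    · exact Or.inl ⟨h, fun i h3 h4 => by
        rcases h3.eq_or_lt with rfl | h3
        · omega
        · exact h2 i h3 h4⟩
    · exact Or.inr ⟨i, by omega, h3, h4, h5⟩
include H ht in
theorem nO_c {x : ℕ} : nO T a m (t+1) x (a t + m t + 2) ↔ a t + m t + 2 = x + 1 ∨ a t + m t + 2 ≤ x ∧ nO T a m (t+1) x (a t + m t + 2) := by
  constructor
  · intro h
    rcases h with ⟨h, _⟩ | ⟨i, h2, h3, h4, h5⟩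
    · exact Or.inl h
    · have := nfar H ht i h2 h3; right; exact ⟨by omega, Or.inr ⟨i, h2, h3, h4, h5⟩⟩
  · rintro (h | h)
    · exact Or.inl ⟨h, fun i h1 h2 => by have := nfar H ht i h1 h2; omega⟩
    · exact h.2
/-- the arrow bijection for the old quiver -/
def nfO : NA (nAL n T a m t) (nAW n T a m t) (m t) → oA (nF n T a m (t+1))
  | .l p => ⟨(p.1.1.1, p.1.2.1), by have := nO_lt H ht p.2 p.1.1.2; exact (nO_le H ht (le_trans p.1.2.2 (by omega))).2 this⟩
  | .h => ⟨(⟨a t, by have := H.hc t ht; omega⟩, ⟨a t + 1, by have := H.hc t ht; omega⟩), (nO_le H ht (by simp)).2 rfl⟩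
  | .c j => ⟨(⟨a t + 1 + j, by have := H.hc t ht; have := j.2; omega⟩, ⟨a t + 1 + j + 1, by have := H.hc t ht; have := j.2; omega⟩), (nO_le H ht (by have := j.2; simp; omega)).2 rfl⟩
  | .z => ⟨(⟨a t + m t + 1, by have := H.hc t ht; omega⟩, ⟨a t + m t + 2, H.hc t ht⟩), (nO_c H ht).2 (Or.inl rfl)⟩
  | .w p => ⟨(p.1.1.1, p.1.2.1), (nO_w H ht p.1.1.2 p.1.2.2).1 p.2⟩
def nfN : NA (nAL n T a m t) (nAW n T a m t) (m t) → oA (nF n T a m t)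
  | .l p => ⟨(p.1.1.1, p.1.2.1), p.2⟩
  | .h => ⟨(⟨a t, by have := H.hc t ht; omega⟩, ⟨a t + 1, by have := H.hc t ht; omega⟩), (nO_le' H ht (by simp)).2 (Or.inl rfl)⟩
  | .c j => ⟨(⟨a t + 1 + j, by have := H.hc t ht; have := j.2; omega⟩, ⟨a t + 1 + j + 1, by have := H.hc t ht; have := j.2; omega⟩), (nO_le' H ht (by have := j.2; simp; omega)).2 (Or.inl rfl)⟩
  | .z => ⟨(⟨a t + m t + 2, H.hc t ht⟩, ⟨a t + 1, by have := H.hc t ht; omega⟩), (nO_le' H ht (by simp)).2 (Or.inr ⟨rfl, rfl⟩)⟩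
  | .w p => ⟨(p.1.1.1, p.1.2.1), p.2⟩
theorem nfO_bij : Function.Bijective (nfO H ht) := by
  have hct := H.hc t ht
  constructor
  · rintro (⟨⟨⟨⟨x, hx⟩, hx'⟩, ⟨⟨y, hy⟩, hy'⟩⟩, hp⟩ | _ | ⟨x, hx⟩ | _ | ⟨⟨⟨⟨x, hx⟩, hx'⟩, ⟨⟨y, hy⟩, hy'⟩⟩, hp⟩) 
      (⟨⟨⟨⟨u, hu⟩, hu'⟩, ⟨⟨v, hv⟩, hv'⟩⟩, hq⟩ | _ | ⟨u, hu⟩ | _ | ⟨⟨⟨⟨u, hu⟩, hu'⟩, ⟨⟨v, hv⟩, hv'⟩⟩, hq⟩) h <;>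
      (have h1 := congrArg (fun q => (opr q).1) h; have h2 := congrArg (fun q => (opr q).2) h; dsimp only [nfO, opr] at h1 h2
       clear h
       try change x ≤ _ at hx'
       try change _ ≤ x at hx'
       try change y ≤ _ at hy'
       try change _ ≤ y at hy'
       try change u ≤ _ at hu'
       try change _ ≤ u at hu'
       try change v ≤ _ at hv'
       try change _ ≤ v at hv'
       first
       | (exfalso; omega)
       | (simp <;> omega))
  · rintro ⟨⟨⟨x, hx⟩, ⟨y, hy⟩⟩, h⟩
    change nO T a m (t+1) x y at h
    by_cases h1 : y ≤ a t + m t + 1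
    · obtain rfl := (nO_le H ht h1).1 h
      by_cases h2 : x + 1 ≤ a t
      · exact ⟨.l ⟨⟨⟨⟨x, hx⟩, by simp; omega⟩, ⟨⟨x+1, hy⟩, h2⟩⟩, (nO_le' H ht h1).2 (Or.inl rfl)⟩, rfl⟩
      by_cases h3 : x = a t
      · subst h3; exact ⟨.h, rfl⟩
      · exact ⟨.c ⟨x - (a t + 1), by omega⟩, by apply opr_inj; simp [nfO, opr]; omega⟩
    by_cases h2 : a t + m t + 2 ≤ x
    · exact ⟨.w ⟨⟨⟨⟨x, hx⟩, h2⟩, ⟨⟨y, hy⟩, by simp; omega⟩⟩, (nO_w H ht h2 (by simp; omega)).2 h⟩, rfl⟩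
    · have h3 : y = x + 1 := by
        rcases h with ⟨h, _⟩ | ⟨i, h5, h3, h4, h6⟩
        · exact h
        · have := nfar H ht i h5 h3; omega
      exact ⟨.z, by apply opr_inj; simp [nfO, opr]; omega⟩
theorem nfN_bij : Function.Bijective (nfN H ht) := by
  have hct := H.hc t ht
  constructor
  · rintro (⟨⟨⟨⟨x, hx⟩, hx'⟩, ⟨⟨y, hy⟩, hy'⟩⟩, hp⟩ | _ | ⟨x, hx⟩ | _ | ⟨⟨⟨⟨x, hx⟩, hx'⟩, ⟨⟨y, hy⟩, hy'⟩⟩, hp⟩) 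
      (⟨⟨⟨⟨u, hu⟩, hu'⟩, ⟨⟨v, hv⟩, hv'⟩⟩, hq⟩ | _ | ⟨u, hu⟩ | _ | ⟨⟨⟨⟨u, hu⟩, hu'⟩, ⟨⟨v, hv⟩, hv'⟩⟩, hq⟩) h <;>
      (have h1 := congrArg (fun q => (opr q).1) h; have h2 := congrArg (fun q => (opr q).2) h; dsimp only [nfN, opr] at h1 h2
       clear h
       try change x ≤ _ at hx'
       try change _ ≤ x at hx'
       try change y ≤ _ at hy'
       try change _ ≤ y at hy'
       try change u ≤ _ at hu'
       try change _ ≤ u at hu'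
       try change v ≤ _ at hv'
       try change _ ≤ v at hv'
       first
       | (exfalso; omega)
       | (simp <;> omega))
  · rintro ⟨⟨⟨x, hx⟩, ⟨y, hy⟩⟩, h⟩
    change nO T a m t x y at h
    by_cases h1 : y ≤ a t + m t + 1
    · rcases (nO_le' H ht h1).1 h with rfl | ⟨rfl, rfl⟩
      · by_cases h2 : x + 1 ≤ a t
        · exact ⟨.l ⟨⟨⟨⟨x, hx⟩, by simp; omega⟩, ⟨⟨x+1, hy⟩, h2⟩⟩, (nO_le' H ht h1).2 (Or.inl rfl)⟩, rfl⟩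
        by_cases h3 : x = a t
        · subst h3; exact ⟨.h, rfl⟩
        · exact ⟨.c ⟨x - (a t + 1), by omega⟩, by apply opr_inj; simp [nfN, opr]; omega⟩
      · exact ⟨.z, rfl⟩
    by_cases h2 : a t + m t + 2 ≤ x
    · exact ⟨.w ⟨⟨⟨⟨x, hx⟩, h2⟩, ⟨⟨y, hy⟩, by simp; omega⟩⟩, h⟩, rfl⟩
    · exfalso
      rcases h with ⟨h, h'⟩ | ⟨i, h5, h3, h4, h6⟩
      · exact h' t le_rfl ht (by omega)
      · rcases h5.eq_or_lt with rfl | h5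
        · omega
        · have := nfar H ht i h5 h3; omega
theorem prs_mem {x l : ℕ} {p : ℕ × ℕ} (h : p ∈ prs x l) : p.2 = p.1 + 1 ∧ x ≤ p.1 ∧ p.1 < x + l := by
  simp only [prs, List.mem_map, List.mem_range'_1] at h
  obtain ⟨y, h, rfl⟩ := h
  exact ⟨rfl, h⟩
def nPr (n T : ℕ) (a m : ℕ → ℕ) (t : ℕ) : nAL n T a m t ⊕ Unit → ℕ × ℕ
  | .inl p => (p.1.1.1.1, p.1.2.1.1) | .inr _ => (a t, a t + 1)
def nRR (n T : ℕ) (a m : ℕ → ℕ) (t : ℕ) : Set (List (nAL n T a m t ⊕ Unit)) := {q | ∃ i < t, q.map (nPr n T a m t) = prs (a i) (m i + 2)}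
theorem nRR_nil : [] ∉ nRR n T a m t := by
  rintro ⟨i, _, h⟩
  simp [prs, List.range'] at h
theorem npO (q : nAL n T a m t ⊕ Unit) : opr (nfO H ht (nι _ _ q)) = nPr n T a m t q := by rcases q with q | q <;> rfl
theorem npN (q : nAL n T a m t ⊕ Unit) : opr (nfN H ht (nι _ _ q)) = nPr n T a m t q := by rcases q with q | q <;> rfl
theorem ntl_map (j : Fin (m t + 1)) : (ntl (nAL n T a m t) (nAW n T a m t) (m t) j).map (fun q => opr (nfO H ht q)) = prs (a t + 1 + j) (m t + 1 - j) := by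
  induction j using Fin.reverseInduction with
  | last => 
    rw [ntl_last]; simp [prs, List.range', nfO, opr]; omega
  | cast j ih =>
    rw [ntl_cs, List.map_cons, ih]
    have : m t + 1 - j.castSucc.1 = (m t + 1 - j.succ.1) + 1 := by simp; omega
    rw [this, prs, prs, List.range'_succ, List.map_cons]
    rfl
include H ht in
theorem h_inr {i : ℕ} (hi : i < t) {p : List (NA (nAL n T a m t) (nAW n T a m t) (m t))} (g : NA (nAL n T a m t) (nAW n T a m t) (m t) → ℕ × ℕ)
    (hp : p.map g = prs (a i) (m i + 2)) (hg : ∀ q, (g q).2 ≤ a t + 1 → (g q).2 = (g q).1 + 1 → ∃ q', nι _ _ q' = q) : ∃ q : List _, q.map (nι _ _) = p := by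
  have : p ∈ Set.range (List.map (nι (AL := nAL n T a m t) (nAW n T a m t) (m t))) := by
    rw [Set.range_list_map]
    intro q hq
    have h1 : g q ∈ prs (a i) (m i + 2) := by rw [← hp]; exact List.mem_map_of_mem hq
    obtain ⟨h2, h3, h4⟩ := prs_mem h1
    have := H.hs i t hi ht
    exact hg q (by omega) h2
  exact this
noncomputable def qO : QIso (nS (nsL n T a m t) (nsW n T a m t) (nae H ht)) (nT (ntL n T a m t) (ntW n T a m t) (nw0 H ht)) (nR (nAW n T a m t) (m t) (nRR n T a m t))
    (oS (nF n T a m (t+1))) (oT (nF n T a m (t+1))) (nRl n T a m (t+1)) where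
  e := nE H ht
  f := Equiv.ofBijective _ (nfO_bij H ht)
  hs q := by
    apply Fin.ext
    rcases q with q | q | q | q | q
    all_goals first | rfl | (show a t + m t + 1 = a t + 1 + m t; omega)
  ht q := by
    apply Fin.ext
    rcases q with q | q | q | q | q
    all_goals first | rfl | skip
  hr p := by
    constructor
    · rintro (⟨q, ⟨i, hi, hq⟩, rfl⟩ | rfl)
      · refine ⟨i, by omega, ?_⟩
        rw [← hq, List.map_map, List.map_map]
        exact congrArg (fun f => List.map f q) (funext (npO H ht))
      · refine ⟨t, by omega, ?_⟩
        rw [List.map_map, List.map_cons]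
        refine (congrArg _ (ntl_map H ht 0)).trans ?_
        rw [prs, prs, show m t + 2 = (m t + 1) + 1 by omega, List.range'_succ, List.map_cons]
        rfl
    · rintro ⟨i, hi, hp⟩
      rw [List.map_map] at hp
      rcases Nat.lt_succ_iff_lt_or_eq.1 hi with hi | rfl
      · left
        obtain ⟨q, rfl⟩ := h_inr H ht hi _ hp (by
          rintro (q | q | q | q | q) h1 h2
          · exact ⟨.inl q, rfl⟩
          · exact ⟨.inr (), rfl⟩
          · change a t + 1 + q + 1 ≤ a t + 1 at h1; omega
          · change a t + m t + 2 ≤ a t + 1 at h1; omega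
          · have : a t + m t + 2 ≤ _ := q.1.2.2
            have h3 := this.trans h1
            omega)
        refine ⟨q, ⟨i, hi, ?_⟩, rfl⟩
        rw [← hp, List.map_map]
        exact congrArg (fun f => List.map f q) (funext fun x => (npO H ht x).symm)
      · right
        have hinj : Function.Injective (opr ∘ (Equiv.ofBijective _ (nfO_bij H ht))) := opr_inj.comp (Equiv.injective _)
        apply List.map_injective_iff.2 hinj
        rw [hp, List.map_cons]
        symm
        refine (congrArg _ (ntl_map H ht 0)).trans ?_
        rw [prs, prs, show m i + 2 = (m i + 1) + 1 by omega, List.range'_succ, List.map_cons]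
        rfl
noncomputable def qN : QIso (nS' (nsL n T a m t) (nsW n T a m t) (nae H ht) (nw0 H ht)) (nT' (ntL n T a m t) (ntW n T a m t)) (nR' (nAW n T a m t) (m t) (nRR n T a m t))
    (oS (nF n T a m t)) (oT (nF n T a m t)) (nRl n T a m t) where
  e := nE H ht
  f := Equiv.ofBijective _ (nfN_bij H ht)
  hs q := by
    apply Fin.ext
    rcases q with q | q | q | q | q
    all_goals rfl
  ht q := by
    apply Fin.ext
    rcases q with q | q | q | q | q
    all_goals rfl
  hr p := by
    constructor
    · rintro ⟨q, ⟨i, hi, hq⟩, rfl⟩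
      refine ⟨i, hi, ?_⟩
      rw [← hq, List.map_map, List.map_map]
      exact congrArg (fun f => List.map f q) (funext (npN H ht))
    · rintro ⟨i, hi, hp⟩
      rw [List.map_map] at hp
      obtain ⟨q, rfl⟩ := h_inr H ht hi _ hp (by
          rintro (q | q | q | q | q) h1 h2
          · exact ⟨.inl q, rfl⟩
          · exact ⟨.inr (), rfl⟩
          · change a t + 1 + q + 1 ≤ a t + 1 at h1; omega
          · change a t + 1 = a t + m t + 2 + 1 at h2; omega
          · have : a t + m t + 2 ≤ _ := q.1.2.2
            have h3 := this.trans h1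
            omega)
      refine ⟨q, ⟨i, hi, ?_⟩, rfl⟩
      rw [← hp, List.map_map]
      exact congrArg (fun f => List.map f q) (funext fun x => (npN H ht x).symm)
end
abbrev RSt (k : Type) [Field k] (n T : ℕ) (a m : ℕ → ℕ) (t : ℕ) := Rep k (oS (nF n T a m t)) (oT (nF n T a m t)) (nRl n T a m t)
noncomputable def stT (k : Type) [Field k] {n T : ℕ} {a m : ℕ → ℕ} (H : NSq n T a m) {t : ℕ} (ht : t < T) : TEq (RSt k n T a m t) (RSt k n T a m (t+1)) :=
  (TEq.ofEquiv (Rep.pull (qN H ht))).trans ((nakT k (m t) (nsL n T a m t) (ntL n T a m t) (nsW n T a m t) (ntW n T a m t) (nae H ht) (nw0 H ht) nRR_nil).trans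
    (TEq.ofEquiv (Rep.pull (qO H ht).symm)))
theorem stAll (k : Type) [Field k] {n T : ℕ} {a m : ℕ → ℕ} (H : NSq n T a m) (t : ℕ) (ht : t ≤ T) : Nonempty (TEq (RSt k n T a m 0) (RSt k n T a m t)) := by
  induction t with
  | zero => exact ⟨TEq.refl _⟩
  | succ t ih => exact ⟨(ih (by omega)).some.trans (stT k H (by omega))⟩
end nakseq
end QN

namespace QN
set_option linter.all false
section quipu
open CategoryTheory CategoryTheory.Limits

theorem tree_of_parent {V : Type} [Finite V] (G : SimpleGraph V) (root : V) (par : V → V) (h : V → ℕ) (hh : ∀ v, v ≠ root → h (par v) < h v)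
    (hadj : ∀ u v, G.Adj u v ↔ (u ≠ root ∧ v = par u) ∨ (v ≠ root ∧ u = par v)) : G.IsTree := by
  classical
  have := Fintype.ofFinite V
  have hconn : G.Connected := by
    have h1 : ∀ n v, h v ≤ n → G.Reachable v root := by
      intro n
      induction n with
      | zero =>
        intro v hv
        by_cases hr : v = root
        · subst hr; exact SimpleGraph.Reachable.refl _
        · have := hh v hr; omega
      | succ n ih =>
        intro v hv
        by_cases hr : v = root
        · subst hr; exact SimpleGraph.Reachable.refl _
        · have := hh v hr
          exact (SimpleGraph.Adj.reachable ((hadj v (par v)).2 (Or.inl ⟨hr, rfl⟩))).trans (ih _ (by omega))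
    haveI : Nonempty V := ⟨root⟩
    exact SimpleGraph.Connected.mk (fun u v => (h1 _ u le_rfl).trans (h1 _ v le_rfl).symm)
  rw [SimpleGraph.isTree_iff_connected_and_card]
  refine ⟨hconn, le_antisymm ?_ ?_⟩
  · have : G.edgeSet ⊆ (fun v => s(v, par v)) '' {v | v ≠ root} := by
      intro e
      induction e using Sym2.ind with
      | _ u v =>
        rw [SimpleGraph.mem_edgeSet, hadj]
        rintro (⟨h1, rfl⟩ | ⟨h1, rfl⟩)
        · exact ⟨u, h1, rfl⟩
        · exact ⟨v, h1, Sym2.eq_swap⟩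
    have h2 : Nat.card G.edgeSet ≤ Set.ncard {v : V | v ≠ root} := (Set.ncard_le_ncard this (Set.toFinite _)).trans (Set.ncard_image_le (Set.toFinite _))
    have h3 : Set.ncard {v : V | v ≠ root} = Nat.card V - 1 := by
      have : {v : V | v ≠ root} = {root}ᶜ := by ext; simp
      rw [this, Set.ncard_compl, Set.ncard_singleton]
    have : 0 < Nat.card V := Nat.card_pos_iff.2 ⟨⟨root⟩, inferInstance⟩
    omega
  · exact SimpleGraph.Connected.card_vert_le_card_edgeSet_add_one hconn

def qK {s : ℕ} (kk : Fin s → ℕ) (j : ℕ) : ℕ := if h : j < s then kk ⟨j, h⟩ else 0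
theorem qK_val {s : ℕ} (kk : Fin s → ℕ) (j : Fin s) : qK kk j.1 = kk j := by simp [qK]
def qb (K : ℕ → ℕ) (i : ℕ) : ℕ := i + ∑ j ∈ Finset.range (i+1), K j
theorem bpos_eq (r : ℕ) (kk : Fin (r + 2) → ℕ) (i : Fin (r + 1)) : bpos r kk i = qb (qK kk) i.1 := by
  unfold bpos qb
  congr 1
  have : ∀ j : Fin (r+2), (if j.1 ≤ i.1 then kk j else 0) = (fun j : ℕ => if j ≤ i.1 then qK kk j else 0) j.1 := by
    intro j; simp [qK_val]
  rw [Finset.sum_congr rfl (fun j _ => this j), Fin.sum_univ_eq_sum_range (fun j : ℕ => if j ≤ i.1 then qK kk j else 0), ← Finset.sum_filter]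
  refine Finset.sum_congr ?_ (fun _ _ => rfl)
  ext x; simp; omega
theorem qb_lt (K : ℕ → ℕ) {i j : ℕ} (h : i < j) : qb K i < qb K j := by
  unfold qb
  have : ∑ x ∈ Finset.range (i+1), K x ≤ ∑ x ∈ Finset.range (j+1), K x := Finset.sum_le_sum_of_subset (Finset.range_mono (by omega))
  omega
theorem qb_lt_iff (K : ℕ → ℕ) {i j : ℕ} : qb K i < qb K j ↔ i < j := 
  (show StrictMono (qb K) from fun i j h => qb_lt K h).lt_iff_lt
theorem qb_len (r : ℕ) (kk : Fin (r + 2) → ℕ) (i : Fin (r + 1)) : bpos r kk i + kk (Fin.last (r+1)) < r + 1 + ∑ j, kk j := by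
  rw [bpos_eq, Fin.sum_univ_castSucc]
  have h1 : qb (qK kk) i.1 ≤ qb (qK kk) r := by
    rcases (Nat.lt_succ_iff.1 i.2).eq_or_lt with h | h
    · rw [h]
    · exact (qb_lt _ h).le
  have h2 : qb (qK kk) r = r + ∑ i : Fin (r+1), kk i.castSucc := by
    unfold qb
    rw [← Fin.sum_univ_eq_sum_range]
    congr 1
    exact Finset.sum_congr rfl fun j _ => qK_val kk j.castSucc
  omega

/-- rank and parent function of a quipu -/
def qpar (r : ℕ) (kk : Fin (r + 2) → ℕ) (mm : Fin (r + 1) → ℕ) : QuipuV r kk mm → QuipuV r kk mm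
  | .inl p => .inl ⟨p.1 - 1, by have := p.2; omega⟩
  | .inr ⟨i, j⟩ => if j.1 = 0 then .inl ⟨bpos r kk i, by have := qb_len r kk i; omega⟩ else .inr ⟨i, ⟨j.1 - 1, by have := j.2; omega⟩⟩
def qhgt (r : ℕ) (kk : Fin (r + 2) → ℕ) (mm : Fin (r + 1) → ℕ) : QuipuV r kk mm → ℕ
  | .inl p => p.1
  | .inr ⟨i, j⟩ => r + 1 + ∑ i, kk i + j.1
theorem quipu_tree (r : ℕ) (kk : Fin (r + 2) → ℕ) (mm : Fin (r + 1) → ℕ) : (quipuGraph r kk mm).IsTree := by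
  refine tree_of_parent _ (.inl ⟨0, by omega⟩) (qpar r kk mm) (qhgt r kk mm) ?_ ?_
  · rintro (⟨p, hp⟩ | ⟨i, ⟨j, hj⟩⟩) h
    · simp at h
      simp [qpar, qhgt]; omega
    · have := qb_len r kk i
      simp only [qpar]
      split_ifs with h1
      · simp [qhgt]; omega
      · simp [qhgt]; omega
  · rintro (⟨p, hp⟩ | ⟨i, ⟨j, hj⟩⟩) (⟨p', hp'⟩ | ⟨i', ⟨j', hj'⟩⟩)
    · simp [quipuGraph, qpar]; omega
    · simp only [quipuGraph, qpar, SimpleGraph.fromRel_adj]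
      by_cases h1 : j' = 0 <;> simp [h1]
    · simp only [quipuGraph, qpar, SimpleGraph.fromRel_adj]
      by_cases h1 : j = 0 <;> simp [h1]
    · simp only [quipuGraph, qpar, SimpleGraph.fromRel_adj]
      by_cases h2 : i = i'
      · subst h2
        by_cases h1 : j' = 0 <;> by_cases h3 : j = 0 <;> simp [h1, h3] <;> omega
      · have h2' : ¬ i' = i := fun h => h2 h.symm
        have h3 : ¬ i.1 = i'.1 := fun h => h2 (Fin.ext h)
        have h3' : ¬ i'.1 = i.1 := fun h => h2 (Fin.ext h.symm)
        by_cases h1 : j' = 0 <;> by_cases h4 : j = 0 <;> simp [h1, h4, h2, h2', h3, h3']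
section pos
variable (T : ℕ) (K M : ℕ → ℕ)
def qf (p : ℕ) : ℕ := p + ∑ i ∈ Finset.range T, if qb K i < p then M i else 0
def qA (i : ℕ) : ℕ := qf T K M (qb K i)
theorem qf_lt {p q : ℕ} (h : p < q) : qf T K M p < qf T K M q := by
  unfold qf
  have : (∑ i ∈ Finset.range T, if qb K i < p then M i else 0) ≤ ∑ i ∈ Finset.range T, if qb K i < q then M i else 0 := by
    refine Finset.sum_le_sum fun i _ => ?_
    split_ifs <;> omega
  omega
theorem qf_lt_iff {p q : ℕ} : qf T K M p < qf T K M q ↔ p < q := (show StrictMono (qf T K M) from fun i j h => qf_lt T K M h).lt_iff_lt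
theorem qf_le_iff {p q : ℕ} : qf T K M p ≤ qf T K M q ↔ p ≤ q := (show StrictMono (qf T K M) from fun i j h => qf_lt T K M h).le_iff_le
theorem qf_inj {p q : ℕ} (h : qf T K M p = qf T K M q) : p = q := (show StrictMono (qf T K M) from fun i j h => qf_lt T K M h).injective h
theorem qf_b {i : ℕ} (hi : i < T) : qf T K M (qb K i + 1) = qA T K M i + 1 + M i := by
  unfold qA qf
  have : (∑ j ∈ Finset.range T, if qb K j < qb K i + 1 then M j else 0) = (∑ j ∈ Finset.range T, if qb K j < qb K i then M j else 0) + M i := by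
    have h1 : M i = ∑ j ∈ Finset.range T, if j = i then M j else 0 := by
      rw [Finset.sum_ite_eq' ]; simp [hi]
    conv_rhs => rw [h1]
    rw [← Finset.sum_add_distrib]
    refine Finset.sum_congr rfl fun j _ => ?_
    by_cases h : j = i
    · subst h; simp
    · have : qb K j ≠ qb K i := fun h' => by
        rcases lt_or_gt_of_ne h with h2 | h2
        · have := qb_lt K h2; omega
        · have := qb_lt K h2; omega
      have h3 : qb K j < qb K i + 1 ↔ qb K j < qb K i := by omega
      simp [h, h3]
  omega
theorem qf_nb {p : ℕ} (h : ∀ i < T, qb K i ≠ p) : qf T K M (p + 1) = qf T K M p + 1 := by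
  unfold qf
  have : (∑ j ∈ Finset.range T, if qb K j < p + 1 then M j else 0) = (∑ j ∈ Finset.range T, if qb K j < p then M j else 0) := by
    refine Finset.sum_congr rfl fun j hj => ?_
    have := h j (Finset.mem_range.1 hj)
    have h3 : qb K j < p + 1 ↔ qb K j < p := by omega
    simp [h3]
  omega
theorem qA_eq {i : ℕ} (hi : i < T) : qA T K M i = K 0 + ∑ j ∈ Finset.range i, (M j + K (j+1) + 1) := by
  unfold qA qf
  have : (∑ j ∈ Finset.range T, if qb K j < qb K i then M j else 0) = ∑ j ∈ Finset.range i, M j := by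
    rw [← Finset.sum_filter]
    refine Finset.sum_congr ?_ fun _ _ => rfl
    ext j; simp [qb_lt_iff]; omega
  rw [this, qb, Finset.sum_range_succ', Finset.sum_add_distrib, Finset.sum_add_distrib]
  simp; ring
theorem qf_len {p : ℕ} (h : ∀ i < T, qb K i < p) : qf T K M p = p + ∑ i ∈ Finset.range T, M i := by
  unfold qf
  congr 1
  refine Finset.sum_congr rfl fun j hj => ?_
  simp [h j (Finset.mem_range.1 hj)]
end pos
section iso
variable (r : ℕ) (kk : Fin (r + 2) → ℕ) (mm : Fin (r + 1) → ℕ)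
abbrev qN0 : ℕ := kk 0 + ∑ j : Fin (r + 1), (mm j + kk j.succ + 1)
abbrev qF (p : ℕ) := qf (r+1) (qK kk) (qK mm) p
abbrev qAA (i : ℕ) := qA (r+1) (qK kk) (qK mm) i
theorem qN0_eq : qN0 r kk mm = qF r kk mm (r + 1 + ∑ i, kk i) := by
  rw [qF, qf_len]
  · rw [qN0, Fin.sum_univ_succ (f := kk), ← Fin.sum_univ_eq_sum_range, Finset.sum_add_distrib, Finset.sum_add_distrib]
    simp [qK_val]; ring
  · intro i hi
    have := qb_len r kk ⟨i, hi⟩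
    rw [bpos_eq] at this; dsimp only at this; omega
def qe : QuipuV r kk mm → ℕ
  | .inl p => qF r kk mm p.1
  | .inr ⟨i, j⟩ => qAA r kk mm i.1 + 1 + j.1
theorem qA_fb (i : Fin (r+1)) : qF r kk mm (qb (qK kk) i + 1) = qAA r kk mm i.1 + 1 + mm i := by
  rw [qF, qf_b _ _ _ i.2, qK_val]
theorem qe_lt (x) : qe r kk mm x < qN0 r kk mm := by
  rw [qN0_eq]
  rcases x with ⟨p, hp⟩ | ⟨i, ⟨j, hj⟩⟩
  · exact qf_lt _ _ _ hp
  · have := qA_fb r kk mm i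
    have h2 := qb_len r kk i
    rw [bpos_eq] at h2
    refine lt_of_lt_of_le ?_ ((qf_le_iff _ _ _).2 (show qb (qK kk) i + 1 ≤ _ by omega))
    change qF r kk mm _ = _ at this
    show qAA r kk mm i.1 + 1 + j < qF r kk mm _
    omega
theorem qe_inj : Function.Injective (qe r kk mm) := by
  have key : ∀ (p : ℕ) (i : Fin (r+1)) (j : ℕ), j < mm i → qF r kk mm p ≠ qAA r kk mm i.1 + 1 + j := by
    intro p i j hj h
    have h1 := qA_fb r kk mm i
    have h2 : qF r kk mm (qb (qK kk) i) < qF r kk mm p := by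
      change qAA r kk mm i.1 < _
      omega
    have h3 : qF r kk mm p < qF r kk mm (qb (qK kk) i + 1) := by omega
    have h2 := (qf_lt_iff _ _ _).1 h2
    have h3 := (qf_lt_iff _ _ _).1 h3
    omega
  have key2 : ∀ (i i' : Fin (r+1)) (j j' : ℕ), j < mm i → j' < mm i' → i < i' → qAA r kk mm i.1 + 1 + j < qAA r kk mm i'.1 + 1 + j' := by
    intro i i' j j' hj hj' h
    have h1 := qA_fb r kk mm i
    have h3 := qb_lt (qK kk) h
    have h2 : qF r kk mm (qb (qK kk) i + 1) ≤ qF r kk mm (qb (qK kk) i') := (qf_le_iff _ _ _).2 h3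
    change _ ≤ qAA r kk mm i'.1 at h2
    omega
  rintro (⟨p, hp⟩ | ⟨i, ⟨j, hj⟩⟩) (⟨p', hp'⟩ | ⟨i', ⟨j', hj'⟩⟩) h
  · have := qf_inj _ _ _ h
    simp at this
    subst this; rfl
  · exact absurd h (key _ _ _ hj')
  · exact absurd h.symm (key _ _ _ hj)
  · change qAA r kk mm i.1 + 1 + j = qAA r kk mm i'.1 + 1 + j' at h
    rcases lt_trichotomy i i' with h1 | rfl | h1
    · have := key2 _ _ _ _ hj hj' h1; omega
    · have : j = j' := by omega
      subst this; rfl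
    · have := key2 _ _ _ _ hj' hj h1; omega
noncomputable def qE : QuipuV r kk mm ≃ Fin (qN0 r kk mm) := Equiv.ofBijective (fun x => ⟨qe r kk mm x, qe_lt r kk mm x⟩) (by
  rw [Fintype.bijective_iff_injective_and_card]
  refine ⟨fun x y h => qe_inj r kk mm (congrArg Fin.val h), ?_⟩
  rw [Fintype.card_fin, qN0, Fintype.card_sum, Fintype.card_fin, Fintype.card_sigma, Fin.sum_univ_succ (f := kk), Finset.sum_add_distrib, Finset.sum_add_distrib]
  simp; ring)
theorem qE_val (x) : (qE r kk mm x).1 = qe r kk mm x := rfl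
/-- numerical data of the Nakayama algebra -/
def qa (i : ℕ) : ℕ := qAA r kk mm i - 1
theorem qns (i : Fin (r+1)) : (kk 0 + ∑ j : Fin (r + 1), if j.1 < i.1 then mm j + kk j.succ + 1 else 0) = qAA r kk mm i := by
  rw [qAA, qA_eq _ _ _ i.2]
  congr 1
  have : ∀ j : Fin (r+1), (if j.1 < i.1 then mm j + kk j.succ + 1 else 0) = (fun j : ℕ => if j < i.1 then qK mm j + qK kk (j+1) + 1 else 0) j.1 := by
    intro j; dsimp only; rw [qK_val, ← qK_val kk j.succ]; rfl
  rw [Finset.sum_congr rfl (fun j _ => this j), Fin.sum_univ_eq_sum_range (fun j : ℕ => if j < i.1 then qK mm j + qK kk (j+1) + 1 else 0), ← Finset.sum_filter]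
  refine Finset.sum_congr ?_ fun _ _ => rfl
  ext x; simp; omega
theorem qAA_pos (h : 1 ≤ kk 0) {i : ℕ} (hi : i < r + 1) : 1 ≤ qAA r kk mm i := by
  rw [← qns r kk mm ⟨i, hi⟩]; omega
theorem qns_lt (h : 1 ≤ kk (Fin.last (r+1))) (i : Fin (r+1)) : qAA r kk mm i + 1 + mm i < qN0 r kk mm := by
  rw [← qA_fb, qN0_eq]
  apply qf_lt
  have h2 := qb_len r kk i
  rw [bpos_eq] at h2
  omega
theorem q_NSq (h : 1 ≤ kk 0) (h' : 1 ≤ kk (Fin.last (r+1))) : NSq (qN0 r kk mm) (r+1) (qa r kk mm) (qK mm) where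
  hc i hi := by
    have := qns_lt r kk mm h' ⟨i, hi⟩
    have h1 := qAA_pos r kk mm h hi
    rw [show qK mm i = mm ⟨i, hi⟩ from qK_val mm ⟨i, hi⟩]
    unfold qa; simp only at this; omega
  hs i j hij hj := by
    have h1 := qA_fb r kk mm ⟨i, hij.trans hj⟩
    have h3 := qb_lt (qK kk) hij
    have h2 : qF r kk mm (qb (qK kk) i + 1) ≤ qF r kk mm (qb (qK kk) j) := (qf_le_iff _ _ _).2 h3
    change _ ≤ qAA r kk mm j at h2
    have h4 := qAA_pos r kk mm h (hij.trans hj)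
    rw [show qK mm i = mm ⟨i, _⟩ from qK_val mm ⟨i, hij.trans hj⟩]
    unfold qa; simp only at h1; omega
def qor (x y : QuipuV r kk mm) : Prop := nF (qN0 r kk mm) (r+1) (qa r kk mm) (qK mm) 0 (qE r kk mm x) (qE r kk mm y)
theorem qor_iff (h : 1 ≤ kk 0) (x y : QuipuV r kk mm) : qor r kk mm x y ↔ 
    (qe r kk mm y = qe r kk mm x + 1 ∧ ∀ i : Fin (r+1), qe r kk mm y ≠ qF r kk mm (qb (qK kk) i + 1)) ∨ ∃ i : Fin (r+1), qe r kk mm x = qF r kk mm (qb (qK kk) i + 1) ∧ qe r kk mm y = qF r kk mm (qb (qK kk) i) := by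
  have h1 : ∀ i : Fin (r+1), qa r kk mm i + qK mm i + 2 = qF r kk mm (qb (qK kk) i + 1) := fun i => by
    rw [qA_fb, qK_val]
    have := qAA_pos r kk mm h i.2
    unfold qa; omega
  have h2 : ∀ i : Fin (r+1), qa r kk mm i + 1 = qF r kk mm (qb (qK kk) i) := fun i => by
    have := qAA_pos r kk mm h i.2
    change _ = qAA r kk mm i
    unfold qa; omega
  refine or_congr (and_congr Iff.rfl ?_) ?_
  · constructor
    · intro h i; rw [← h1]; exact h i (Nat.zero_le _) i.2
    · intro h i _ hi; have := h ⟨i, hi⟩; rw [← h1] at this; exact this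
  · constructor
    · rintro ⟨i, _, hi, h3, h4⟩
      refine ⟨⟨i, hi⟩, ?_, ?_⟩
      · rw [← h1]; exact h3
      · rw [← h2]; exact h4
    · rintro ⟨i, h3, h4⟩
      refine ⟨i, Nat.zero_le _, i.2, ?_, ?_⟩
      · rw [← h1] at h3; exact h3
      · rw [← h2] at h4; exact h4
theorem qor_orient (h : 1 ≤ kk 0) (h' : 1 ≤ kk (Fin.last (r+1))) : IsOrientation (quipuGraph r kk mm) (qor r kk mm) := by
  have hlen : ∀ i : Fin (r+1), qb (qK kk) i + 1 < r + 1 + ∑ i, kk i := fun i => by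
    have h2 := qb_len r kk i
    rw [bpos_eq] at h2
    omega
  have hmono := @qf_lt (r+1) (qK kk) (qK mm)
  have inj := qe_inj r kk mm
  -- images of the cord vertices are not images of main string vertices
  have hcm : ∀ (i : Fin (r+1)) (j : Fin (mm i)) (i' : Fin (r+1)), qe r kk mm (.inr ⟨i, j⟩) ≠ qF r kk mm (qb (qK kk) i' + 1) := by
    intro i j i' he
    have := @inj (.inr ⟨i, j⟩) (.inl ⟨_, hlen i'⟩) he
    cases this
  have fwd : ∀ x y : QuipuV r kk mm, (match x, y with
    | Sum.inl v, Sum.inl w => w.1 = v.1 + 1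
    | Sum.inl v, Sum.inr ⟨i, j⟩ => v.1 = bpos r kk i ∧ j.1 = 0
    | Sum.inr ⟨i, j⟩, Sum.inr ⟨i', j'⟩ => i.1 = i'.1 ∧ j'.1 = j.1 + 1
    | Sum.inr _, Sum.inl _ => False) → qor r kk mm x y ∨ qor r kk mm y x := by
    rintro (⟨p, hp⟩ | ⟨i, ⟨j, hj⟩⟩) (⟨p', hp'⟩ | ⟨i', ⟨j', hj'⟩⟩) hρ
    · change p' = p + 1 at hρ
      subst hρ
      by_cases hb : ∃ i : Fin (r+1), qb (qK kk) i = p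
      · obtain ⟨i, hi⟩ := hb
        right
        rw [qor_iff r kk mm h]
        subst hi
        exact Or.inr ⟨i, rfl, rfl⟩
      · left
        rw [qor_iff r kk mm h]
        refine Or.inl ⟨qf_nb _ _ _ (fun i hi hh => hb ⟨⟨i, hi⟩, hh⟩), fun i he => ?_⟩
        have := qf_inj _ _ _ he
        exact hb ⟨i, by simp only at this; omega⟩
    · obtain ⟨h1, h2⟩ := hρ
      left
      rw [qor_iff r kk mm h]
      refine Or.inl ⟨?_, fun i => hcm i' ⟨j', hj'⟩ i⟩
      rw [bpos_eq] at h1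
      dsimp only at h1 h2
      subst h1 h2
      rfl
    · exact hρ.elim
    · obtain ⟨h1, h2⟩ := hρ
      obtain rfl := Fin.ext h1
      dsimp only at h2
      subst h2
      left
      rw [qor_iff r kk mm h]
      exact Or.inl ⟨rfl, fun i2 => hcm i ⟨j+1, hj'⟩ i2⟩
  have bwd : ∀ x y : QuipuV r kk mm, qor r kk mm x y → (quipuGraph r kk mm).Adj x y := by
    intro x y hxy
    rw [qor_iff r kk mm h] at hxy
    rcases hxy with ⟨h1, h2⟩ | ⟨i, h1, h2⟩
    · rcases x with ⟨p, hp⟩ | ⟨i, ⟨j, hj⟩⟩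
      · by_cases hb : ∃ i : Fin (r+1), qb (qK kk) i = p
        · obtain ⟨i, rfl⟩ := hb
          change qe r kk mm y = qAA r kk mm i + 1 at h1
          by_cases hm : mm i = 0
          · exact absurd (by rw [h1, qA_fb, hm]) (h2 i)
          · obtain rfl := @inj y (.inr ⟨i, ⟨0, Nat.pos_of_ne_zero hm⟩⟩) h1
            simp [quipuGraph, bpos_eq]
        · change qe r kk mm y = qF r kk mm p + 1 at h1
          rw [qF, ← qf_nb _ _ _ (fun i hi hh => hb ⟨⟨i, hi⟩, hh⟩)] at h1
          have h3 := qe_lt r kk mm y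
          rw [h1, qN0_eq, qf_lt_iff] at h3
          obtain rfl := @inj y (.inl ⟨p+1, h3⟩) h1
          simp [quipuGraph]
      · change qe r kk mm y = qAA r kk mm i + 1 + j + 1 at h1
        by_cases hm : j + 1 < mm i
        · obtain rfl := @inj y (.inr ⟨i, ⟨j + 1, hm⟩⟩) h1
          simp [quipuGraph]
        · exact absurd (by rw [h1, qA_fb]; omega) (h2 i)
    · obtain rfl := @inj x (.inl ⟨_, hlen i⟩) h1
      obtain rfl := @inj y (.inl ⟨qb (qK kk) i, lt_trans (Nat.lt_succ_self _) (hlen i)⟩) h2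
      simp [quipuGraph]
  refine ⟨fun x y => ⟨fun hxy => ?_, ?_⟩, ?_⟩
  · rw [quipuGraph, SimpleGraph.fromRel_adj] at hxy
    rcases hxy.2 with h1 | h1
    · exact fwd x y h1
    · exact (fwd y x h1).symm
  · rintro (h1 | h1)
    · exact bwd _ _ h1
    · exact (bwd _ _ h1).symm
  · intro x y h1 h2
    rw [qor_iff r kk mm h] at h1 h2
    rcases h1 with ⟨h3, h4⟩ | ⟨i, h3, h4⟩ <;> rcases h2 with ⟨h5, h6⟩ | ⟨i', h5, h6⟩
    · omega
    · exact h4 _ h5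
    · exact h6 _ h3
    · have h7 : qF r kk mm (qb (qK kk) i) < qF r kk mm (qb (qK kk) i + 1) := hmono (by omega)
      have h8 : qF r kk mm (qb (qK kk) i') < qF r kk mm (qb (qK kk) i' + 1) := hmono (by omega)
      omega
noncomputable def qlf : (linQuiver (qN0 r kk mm)).A ≃ oA (nF (qN0 r kk mm) (r+1) (qa r kk mm) (qK mm) (r+1)) :=
 Equiv.ofBijective (fun a => ⟨((linQuiver (qN0 r kk mm)).s a, (linQuiver (qN0 r kk mm)).t a), Or.inl ⟨rfl, fun i h1 h2 => by omega⟩⟩) (by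
    constructor
    · intro x y hxy
      apply Fin.ext
      exact congrArg (fun q => q.1.1.1) hxy
    · rintro ⟨⟨⟨x, hx⟩, ⟨y, hy⟩⟩, hxy | ⟨i, h1, h2, _⟩⟩
      · have h3 : y = x + 1 := hxy.1
        subst h3
        exact ⟨⟨x, by omega⟩, rfl⟩
      · omega)
/-- the last stage is the Nakayama algebra -/
noncomputable def qLin (h : 1 ≤ kk 0) (h' : 1 ≤ kk (Fin.last (r+1))) : QIso (linQuiver (qN0 r kk mm)).s (linQuiver (qN0 r kk mm)).t 
    {p | ∃ i : Fin (r+1), p = linPath (qN0 r kk mm) (kk 0 + ∑ j : Fin (r + 1), if j.1 < i.1 then mm j + kk j.succ + 1 else 0) (mm i + 2)}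
    (oS (nF (qN0 r kk mm) (r+1) (qa r kk mm) (qK mm) (r+1))) (oT (nF (qN0 r kk mm) (r+1) (qa r kk mm) (qK mm) (r+1))) (nRl (qN0 r kk mm) (r+1) (qa r kk mm) (qK mm) (r+1)) where
  e := Equiv.refl _
  f := qlf r kk mm
  hs a := rfl
  ht a := rfl
  hr p := by
    let f := qlf r kk mm
    have hinj : Function.Injective (opr ∘ f) := opr_inj.comp f.injective
    have key : ∀ i : Fin (r+1), (linPath (qN0 r kk mm) (kk 0 + ∑ j : Fin (r + 1), if j.1 < i.1 then mm j + kk j.succ + 1 else 0) (mm i + 2)).map (opr ∘ f) = prs (qa r kk mm i) (qK mm i + 2) := by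
      intro i
      rw [qns, qK_val, linPath, prs, List.map_filterMap]
      have hlt := qns_lt r kk mm h' i
      have hpos := qAA_pos r kk mm h i.2
      have : ∀ j ∈ List.range (mm i + 2), (Option.map (opr ∘ f) (if h : qAA r kk mm i - 1 + j < qN0 r kk mm - 1 then some (⟨qAA r kk mm i - 1 + j, h⟩ : (linQuiver (qN0 r kk mm)).A) else none)) = some ((fun x => (x, x+1)) (qa r kk mm i + j)) := by
        intro j hj
        rw [List.mem_range] at hj
        rw [dif_pos (by omega)]
        rfl
      rw [List.filterMap_congr this, List.range'_eq_map_range, List.map_map]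
      exact List.filterMap_eq_map (f := fun j => (fun x => (x, x+1)) (qa r kk mm i + j))  ▸ rfl
    constructor
    · rintro ⟨i, rfl⟩
      exact ⟨i.1, i.2, by rw [List.map_map]; exact key i⟩
    · rintro ⟨i, hi, hp⟩
      refine ⟨⟨i, hi⟩, List.map_injective_iff.2 hinj ?_⟩
      rw [key ⟨i, hi⟩, ← hp, List.map_map]
theorem nRl_zero (n T : ℕ) (a m : ℕ → ℕ) : nRl n T a m 0 = ∅ := by
  ext p; simp [nRl]
/-- quipus and Nakayama algebras are derived equivalent -/
theorem quipu_nak (k : Type) [Field k] (h : 1 ≤ kk 0) (h' : 1 ≤ kk (Fin.last (r+1))) :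
   Nonempty (TEq (RepO k (qor r kk mm)) (Rep k (linQuiver (qN0 r kk mm)).s (linQuiver (qN0 r kk mm)).t 
    {p | ∃ i : Fin (r+1), p = linPath (qN0 r kk mm) (kk 0 + ∑ j : Fin (r + 1), if j.1 < i.1 then mm j + kk j.succ + 1 else 0) (mm i + 2)})) := by
  obtain ⟨e⟩ := stAll k (q_NSq r kk mm h h') (r+1) le_rfl
  have e1 : TEq (RepO k (qor r kk mm)) (RepO k (nF (qN0 r kk mm) (r+1) (qa r kk mm) (qK mm) 0)) := relabO k (qE r kk mm) _ _ (fun x y => Iff.rfl)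
  unfold RSt at e
  rw [nRl_zero] at e
  exact ⟨e1.trans (e.trans (TEq.ofEquiv (Rep.pull (qLin r kk mm h h'))))⟩
end iso
theorem back (k : Type) [Field k] {V : Type} [Fintype V]
    (G : SimpleGraph V) (o : V → V → Prop) (hor : IsOrientation G o) (r : ℕ) (kk : Fin (r + 2) → ℕ) (mm : Fin (r + 1) → ℕ)
    (h : 1 ≤ kk 0) (h' : 1 ≤ kk (Fin.last (r + 1))) (f : G ≃g quipuGraph r kk mm) : Nonempty (TEq (RepO k o) (Rep k (linQuiver (qN0 r kk mm)).s (linQuiver (qN0 r kk mm)).t 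
    {p | ∃ i : Fin (r+1), p = linPath (qN0 r kk mm) (kk 0 + ∑ j : Fin (r + 1), if j.1 < i.1 then mm j + kk j.succ + 1 else 0) (mm i + 2)})) := by
  obtain ⟨e⟩ := quipu_nak r kk mm k h h'
  let o' : QuipuV r kk mm → QuipuV r kk mm → Prop := fun x y => o (f.symm x) (f.symm y)
  have e1 : TEq (RepO k o) (RepO k o') := relabO k f.toEquiv _ _ (fun x y => by simp [o'])
  have ho' : IsOrientation (quipuGraph r kk mm) o' := ⟨fun x y => by rw [← hor.1, f.symm.map_adj_iff], fun x y => hor.2 _ _⟩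
  obtain ⟨e2⟩ := orient_TEq k (quipu_tree r kk mm) o' _ ho' (qor_orient r kk mm h h')
  exact ⟨e1.trans (e2.trans e)⟩
end quipu
end QN

namespace QN
set_option linter.all false
section D5
open CategoryTheory CategoryTheory.Limits CategoryTheory.Pretriangulated HomologicalComplex ZeroObject
universe v u
variable {C : Type u} [Category.{v} C] [Abelian C]

noncomputable abbrev Sf (C : Type u) [Category.{v} C] [Abelian C] : C ⥤ DerivedCategory C := DerivedCategory.singleFunctor C 0
noncomputable abbrev Sg (M : C) : DerivedCategory C := (Sf C).obj M
noncomputable abbrev H0 (C : Type u) [Category.{v} C] [Abelian C] : DerivedCategory C ⥤ C := DerivedCategory.homologyFunctor C 0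
noncomputable def th (M : C) : Sg M ≅ DerivedCategory.Q.obj ((single C (ComplexShape.up ℤ) 0).obj M) := (DerivedCategory.singleFunctorIsoCompQ C 0).app M
theorem th_nat {M N : C} (f : M ⟶ N) : (Sf C).map f ≫ (th N).hom = (th M).hom ≫ DerivedCategory.Q.map ((single C (ComplexShape.up ℤ) 0).map f) :=
  (DerivedCategory.singleFunctorIsoCompQ C 0).hom.naturality f
noncomputable def qh (K : CochainComplex C ℤ) : (H0 C).obj (DerivedCategory.Q.obj K) ≅ K.homology 0 := (DerivedCategory.homologyFunctorFactors C 0).app K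
theorem qh_nat {K L : CochainComplex C ℤ} (f : K ⟶ L) : (H0 C).map (DerivedCategory.Q.map f) ≫ (qh L).hom = (qh K).hom ≫ homologyMap f 0 :=
  (DerivedCategory.homologyFunctorFactors C 0).hom.naturality f
noncomputable def h0 (M : C) : (H0 C).obj (Sg M) ≅ M := (H0 C).mapIso (th M) ≪≫ qh _ ≪≫ singleObjHomologySelfIso (ComplexShape.up ℤ) 0 M
theorem h0_hom (M : C) : (h0 M).hom = (H0 C).map (th M).hom ≫ (qh _).hom ≫ (singleObjHomologySelfIso (ComplexShape.up ℤ) 0 M).hom := rfl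
theorem h0_inv (M : C) : (h0 M).inv = ((singleObjHomologySelfIso (ComplexShape.up ℤ) 0 M).inv ≫ (qh _).inv) ≫ (H0 C).map (th M).inv := rfl
theorem h0_nat {M N : C} (f : M ⟶ N) : (H0 C).map ((Sf C).map f) ≫ (h0 N).hom = (h0 M).hom ≫ f := by
  simp only [h0_hom, Category.assoc]
  rw [← Functor.map_comp_assoc, th_nat, Functor.map_comp_assoc, reassoc_of% (qh_nat ((single C (ComplexShape.up ℤ) 0).map f)), singleObjHomologySelfIso_hom_naturality]
theorem Sf_ext {M N : C} {f g : Sg M ⟶ Sg N} (h : (H0 C).map f = (H0 C).map g) : f = g := by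
  obtain ⟨f, rfl⟩ := (Sf C).map_surjective f
  obtain ⟨g, rfl⟩ := (Sf C).map_surjective g
  congr 1
  rw [← cancel_epi (h0 M).hom, ← h0_nat, ← h0_nat, h]

theorem proj_surj {P : C} [Projective P] (Y : DerivedCategory C) (g : P ⟶ (H0 C).obj Y) :
    ∃ f : Sg P ⟶ Y, (H0 C).map f = (h0 P).hom ≫ g := by
  obtain ⟨K, ⟨e⟩⟩ : ∃ K, Nonempty (DerivedCategory.Q.obj K ≅ Y) := ⟨_, ⟨DerivedCategory.Q.objObjPreimageIso Y⟩⟩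
  let g' : P ⟶ K.homology 0 := g ≫ (H0 C).map e.inv ≫ (qh K).hom
  let l := Projective.factorThru g' (K.homologyπ 0)
  have hl : l ≫ K.homologyπ 0 = g' := Projective.factorThru_comp _ _
  let f : (single C (ComplexShape.up ℤ) 0).obj P ⟶ K := mkHomFromSingle (l ≫ K.iCycles 0) (by intro k _; simp)
  have hf : (singleObjHomologySelfIso (ComplexShape.up ℤ) 0 P).inv ≫ homologyMap f 0 = g' := by
    rw [← singleObjCyclesSelfIso_inv_homologyπ, Category.assoc, homologyπ_naturality, ← hl, ← Category.assoc]
    congr 1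
    rw [← cancel_mono (K.iCycles 0), Category.assoc, cyclesMap_i, singleObjCyclesSelfIso_inv_iCycles_assoc, mkHomFromSingle_f]
    simp
  refine ⟨(th P).hom ≫ DerivedCategory.Q.map f ≫ e.hom, ?_⟩
  rw [← cancel_mono ((H0 C).map e.inv), ← cancel_mono (qh K).hom, ← Functor.map_comp]
  simp only [Category.assoc, Iso.hom_inv_id, Category.comp_id]
  rw [← cancel_epi (h0 P).inv, Iso.inv_hom_id_assoc]
  refine Eq.trans ?_ hf
  have m : (H0 C).map (th P).inv ≫ (H0 C).map ((th P).hom ≫ DerivedCategory.Q.map f) = (H0 C).map (DerivedCategory.Q.map f) :=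
    ((H0 C).map_comp _ _).symm.trans (congrArg (H0 C).map (Iso.inv_hom_id_assoc _ _))
  rw [h0_inv]
  simp only [Category.assoc, reassoc_of% m, qh_nat f, Iso.inv_hom_id_assoc]

theorem inj_surj {I : C} [Injective I] (Y : DerivedCategory C) (g : (H0 C).obj Y ⟶ I) :
    ∃ f : Y ⟶ Sg I, (H0 C).map f ≫ (h0 I).hom = g := by
  obtain ⟨K, ⟨e⟩⟩ : ∃ K, Nonempty (DerivedCategory.Q.obj K ≅ Y) := ⟨_, ⟨DerivedCategory.Q.objObjPreimageIso Y⟩⟩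
  let g' : K.homology 0 ⟶ I := (qh K).inv ≫ (H0 C).map e.hom ≫ g
  let l := Injective.factorThru g' (K.homologyι 0)
  have hl : K.homologyι 0 ≫ l = g' := Injective.comp_factorThru _ _
  let f : K ⟶ (single C (ComplexShape.up ℤ) 0).obj I := mkHomToSingle (K.pOpcycles 0 ≫ l) (by intro k _; simp)
  have hf : homologyMap f 0 ≫ (singleObjHomologySelfIso (ComplexShape.up ℤ) 0 I).hom = g' := by
    rw [← cancel_mono (singleObjOpcyclesSelfIso (ComplexShape.up ℤ) 0 I).hom, Category.assoc, singleObjHomologySelfIso_hom_singleObjOpcyclesSelfIso_hom,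
      homologyι_naturality, ← hl, Category.assoc]
    congr 1
    rw [← cancel_epi (K.pOpcycles 0), p_opcyclesMap, mkHomToSingle_f, singleObjOpcyclesSelfIso_hom]
    simp
  refine ⟨e.inv ≫ DerivedCategory.Q.map f ≫ (th I).inv, ?_⟩
  have : (H0 C).map (DerivedCategory.Q.map f ≫ (th I).inv) ≫ (h0 I).hom = (qh K).hom ≫ g' := by
    rw [← hf, ← reassoc_of% (qh_nat f)]
    have m : (H0 C).map (DerivedCategory.Q.map f ≫ (th I).inv) ≫ (H0 C).map (th I).hom = (H0 C).map (DerivedCategory.Q.map f) :=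
      ((H0 C).map_comp _ _).symm.trans (congrArg (H0 C).map (by rw [Category.assoc, Iso.inv_hom_id, Category.comp_id]))
    rw [h0_hom, reassoc_of% m]
  rw [Functor.map_comp, Category.assoc, this]
  simp [g', ← Functor.map_comp_assoc]

theorem proj_inj {P : C} [Projective P] {Y : DerivedCategory C} (f : Sg P ⟶ Y) (h : (H0 C).map f = 0) : f = 0 := by
  obtain ⟨W, w, z, hT⟩ := distinguished_cocone_triangle₁ f
  have ex : (ShortComplex.mk ((H0 C).map w) ((H0 C).map f) _).Exact := (H0 C).map_distinguished_exact _ hT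
  have : Epi ((H0 C).map w) := (ex.epi_f_iff).2 h
  obtain ⟨s, hs⟩ := proj_surj W (Projective.factorThru (h0 P).inv ((H0 C).map w))
  have : s ≫ w = 𝟙 _ := Sf_ext (by simp [hs])
  rw [← Category.id_comp f, ← this, Category.assoc, show w ≫ f = 0 from comp_distTriang_mor_zero₁₂ _ hT, comp_zero]
theorem inj_inj {I : C} [Injective I] {Y : DerivedCategory C} (f : Y ⟶ Sg I) (h : (H0 C).map f = 0) : f = 0 := by
  obtain ⟨W, w, z, hT⟩ := distinguished_cocone_triangle f
  have ex : (ShortComplex.mk ((H0 C).map f) ((H0 C).map w) _).Exact := (H0 C).map_distinguished_exact _ hT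
  have : Mono ((H0 C).map w) := (ex.mono_g_iff).2 h
  obtain ⟨s, hs⟩ := inj_surj W (Injective.factorThru (h0 I).hom ((H0 C).map w))
  have : w ≫ s = 𝟙 _ := Sf_ext (by rw [← cancel_mono (h0 I).hom]; simp [hs])
  rw [← Category.comp_id f, ← this, ← Category.assoc, show f ≫ w = 0 from comp_distTriang_mor_zero₁₂ _ hT, zero_comp]

noncomputable def hs (X : DerivedCategory C) (n a a' : ℤ) (h : n + a = a') : (DerivedCategory.homologyFunctor C a).obj (X⟦n⟧) ≅ (DerivedCategory.homologyFunctor C a').obj X :=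
  ((H0 C).shiftIso n a a' h).app X
theorem hz (M : C) (n : ℤ) (h : n ≠ 0) : IsZero ((DerivedCategory.homologyFunctor C n).obj (Sg M)) := by
  rcases lt_or_gt_of_ne h with h | h
  · exact DerivedCategory.isZero_of_isGE _ 0 n h
  · exact DerivedCategory.isZero_of_isLE _ 0 n h
theorem hzs (M : C) (a n : ℤ) (h : a + n ≠ 0) : IsZero ((DerivedCategory.homologyFunctor C n).obj ((Sg M)⟦a⟧)) := (hz M _ h).of_iso (hs _ a n _ rfl)
theorem inj_zero {I : C} [Injective I] {Y : DerivedCategory C} (b : ℤ) (f : Y ⟶ (Sg I)⟦b⟧) (h : IsZero ((DerivedCategory.homologyFunctor C (-b)).obj Y)) : f = 0 := by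
  have h1 : f⟦-b⟧' ≫ ((shiftFunctorCompIsoId _ b (-b) (add_neg_cancel b)).app (Sg I)).hom = 0 := inj_inj _ (IsZero.eq_of_src (h.of_iso (hs _ (-b) 0 _ (add_zero _))) _ _)
  have h2 : f⟦-b⟧' = 0 := by rw [← cancel_mono ((shiftFunctorCompIsoId _ b (-b) (add_neg_cancel b)).app (Sg I)).hom, h1, zero_comp]
  exact ((shiftFunctor (DerivedCategory C) (-b)).map_eq_zero_iff).1 h2

class Hered (C : Type u) [Category.{v} C] [Abelian C] : Prop where
  ep : EnoughProjectives C
  res : ∀ N : C, ∃ (I Q : C) (i : N ⟶ I) (p : I ⟶ Q) (w : i ≫ p = 0), (ShortComplex.mk i p w).ShortExact ∧ Injective I ∧ Injective Q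
variable [Hered C]

theorem van (N : C) {Y : DerivedCategory C} (b : ℤ) (f : Y ⟶ (Sg N)⟦b⟧) (h : IsZero ((DerivedCategory.homologyFunctor C (-b)).obj Y))
    (h' : IsZero ((DerivedCategory.homologyFunctor C (1-b)).obj Y)) : f = 0 := by
  obtain ⟨I, Q, i, p, w, hS, hI, hQ⟩ := Hered.res N
  have hT' := inv_rot_of_distTriang _ (Triangle.shift_distinguished _ hS.singleTriangle_distinguished b)
  obtain ⟨g, hg⟩ := Triangle.coyoneda_exact₂ _ hT' f (by
    have : f ≫ (Sf C).map i⟦b⟧' = 0 := inj_zero b _ h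
    have : f ≫ (b.negOnePow • ((Sf C).map i)⟦b⟧') = 0 := by rw [Linear.comp_units_smul, this, smul_zero]
    exact this)
  rw [hg]
  change Y ⟶ ((Sg Q)⟦b⟧)⟦(-1:ℤ)⟧ at g
  have : g ≫ ((shiftFunctorAdd (DerivedCategory C) b (-1)).app (Sg Q)).inv = 0 := inj_zero _ _ (by rwa [show -(b + -1) = 1 - b by ring])
  have : g = 0 := by rw [← cancel_mono ((shiftFunctorAdd (DerivedCategory C) b (-1)).app (Sg Q)).inv, this, zero_comp]
  rw [this]; exact zero_comp
theorem vanS (M N : C) (b : ℤ) (h : b ≠ 0) (h' : b ≠ 1) (f : Sg M ⟶ (Sg N)⟦b⟧) : f = 0 :=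
  van N b f (hz M _ (by omega)) (hz M _ (by omega))

theorem proj_ker {K P M : C} {i : K ⟶ P} {p : P ⟶ M} {w : i ≫ p = 0} (hS : (ShortComplex.mk i p w).ShortExact) [Projective P] : Projective K := by
  constructor
  intro E X f e he
  have hE : (ShortComplex.mk (kernel.ι e) e (kernel.condition e)).ShortExact := { exact := ShortComplex.exact_kernel e }
  have hT := inv_rot_of_distTriang _ hS.singleTriangle_distinguished
  obtain ⟨h, hh⟩ := Triangle.yoneda_exact₂ _ hT ((Sf C).map f ≫ hE.singleδ) (van _ 1 _ (hzs _ _ _ (by norm_num)) (hzs _ _ _ (by norm_num)))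
  have h0 : h = 0 := proj_inj (P := P) h (IsZero.eq_of_tgt (hzs _ 1 0 (by norm_num)) _ _)
  obtain ⟨g, hg⟩ := Triangle.coyoneda_exact₃ _ hE.singleTriangle_distinguished ((Sf C).map f) (hh.trans (by rw [h0]; exact comp_zero))
  obtain ⟨g, rfl⟩ := (Sf C).map_surjective (X := K) (Y := E) g
  exact ⟨g, (Sf C).map_injective (by rw [Functor.map_comp]; exact hg.symm)⟩

theorem retr (Y : DerivedCategory C) : ∃ (s : Sg ((H0 C).obj Y) ⟶ Y) (p : Y ⟶ Sg ((H0 C).obj Y)), s ≫ p = 𝟙 _ := by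
  obtain ⟨s, hs⟩ : ∃ s : Sg ((H0 C).obj Y) ⟶ Y, (H0 C).map s = (h0 _).hom := by
    have := Hered.ep (C := C)
    let π := Projective.π ((H0 C).obj Y)
    have hS : (ShortComplex.mk (kernel.ι π) π (kernel.condition π)).ShortExact := { exact := ShortComplex.exact_kernel π }
    have := proj_ker hS
    obtain ⟨f, hf⟩ := proj_surj Y π
    obtain ⟨s, hs⟩ := Triangle.yoneda_exact₂ _ hS.singleTriangle_distinguished f (by
      refine proj_inj (P := kernel π) _ ?_
      refine (Functor.map_comp _ _ _).trans ?_
      have : (H0 C).map ((Sf C).map (kernel.ι π)) ≫ (H0 C).map f = 0 := by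
        rw [hf, ← Category.assoc, h0_nat, Category.assoc, kernel.condition, comp_zero]
      exact this)
    refine ⟨s, ?_⟩
    have h2 : (H0 C).map ((Sf C).map π) ≫ (H0 C).map s = (H0 C).map f := (Functor.map_comp _ _ _).symm.trans (congrArg _ hs.symm)
    have h3 := h0_nat π
    have : Epi ((H0 C).map ((Sf C).map π)) := by
      have h4 : (H0 C).map ((Sf C).map π) = (h0 _).hom ≫ π ≫ (h0 _).inv := by rw [← reassoc_of% h3]; simp
      rw [h4]; infer_instance
    rw [← cancel_epi ((H0 C).map ((Sf C).map π)), h2, h3, hf]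
  obtain ⟨p, hp⟩ : ∃ p : Y ⟶ Sg ((H0 C).obj Y), (H0 C).map p ≫ (h0 _).hom = 𝟙 _ := by
    obtain ⟨I, Q, i, q, w, hS, hI, hQ⟩ := Hered.res ((H0 C).obj Y)
    obtain ⟨f, hf⟩ := inj_surj Y i
    obtain ⟨s, hs⟩ : ∃ s : Y ⟶ Sg ((H0 C).obj Y), f = s ≫ (Sf C).map i := Triangle.coyoneda_exact₂ _ hS.singleTriangle_distinguished f (by
      refine inj_inj (I := Q) _ ?_
      refine (Functor.map_comp _ _ _).trans ?_
      have := h0_nat q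
      rw [← cancel_mono (h0 Q).hom]
      refine (Category.assoc _ _ _).trans ((congrArg (_ ≫ ·) this).trans ?_)
      refine (Category.assoc _ _ _).symm.trans ((congrArg (· ≫ q) hf).trans ?_)
      simp [w])
    refine ⟨s, ?_⟩
    have h2 : (H0 C).map s ≫ (H0 C).map ((Sf C).map i) = (H0 C).map f := (Functor.map_comp _ _ _).symm.trans (congrArg _ hs.symm)
    have h3 := h0_nat i
    have : Mono i := hS.mono_f
    rw [← cancel_mono i, Category.assoc, ← h3, reassoc_of% h2, hf, Category.id_comp]
  refine ⟨s, p, Sf_ext ?_⟩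
  have : (H0 C).map p = (h0 _).inv := by rw [← cancel_mono (h0 _).hom, hp, Iso.inv_hom_id]
  rw [Functor.map_comp, hs, this]; simp

theorem stalk (Y : DerivedCategory C) (h0 : ¬ IsZero Y) (hi : ∀ e : Y ⟶ Y, e ≫ e = e → e = 0 ∨ e = 𝟙 Y) :
    ∃ (j : ℤ) (M : C), Nonempty (Y ≅ (Sg M)⟦j⟧) := by
  obtain ⟨j, hj⟩ : ∃ j : ℤ, ¬ IsZero ((DerivedCategory.homologyFunctor C j).obj Y) := by
    by_contra hc
    push Not at hc
    apply h0
    have hZ := isZero_zero (DerivedCategory C)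
    have : IsIso (0 : Y ⟶ (0 : DerivedCategory C)) := (DerivedCategory.isIso_iff _ _).2 fun n => ⟨0, (hc n).eq_of_src _ _, ((Functor.map_isZero _ hZ)).eq_of_src _ _⟩
    exact hZ.of_iso (asIso 0)
  obtain ⟨s, p, hsp⟩ := retr (Y⟦j⟧)
  generalize hM : (H0 C).obj (Y⟦j⟧) = M at s p hsp
  have hM0 : ¬ IsZero M := fun h => hj ((hM ▸ h).of_iso (hs Y j 0 j (add_zero j)).symm)
  obtain ⟨e, he⟩ := (shiftFunctor (DerivedCategory C) j).map_surjective (p ≫ s)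
  have := hi e ((shiftFunctor (DerivedCategory C) j).map_injective (by rw [Functor.map_comp, he]; rw [Category.assoc, ← Category.assoc s, hsp, Category.id_comp]))
  rcases this with rfl | rfl
  · exfalso
    rw [Functor.map_zero] at he
    have : 𝟙 (Sg M) = 0 := by 
      calc 𝟙 (Sg M) = (s ≫ p) ≫ s ≫ p := by rw [hsp, Category.id_comp]
        _ = s ≫ (p ≫ s) ≫ p := by simp only [Category.assoc]
        _ = 0 := by rw [← he, zero_comp, comp_zero]
    apply hM0
    rw [IsZero.iff_id_eq_zero]
    exact (Sf C).map_injective (by rw [CategoryTheory.Functor.map_id, Functor.map_zero]; exact this)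
  · refine ⟨-j, M, ⟨((shiftFunctorCompIsoId (DerivedCategory C) j (-j) (add_neg_cancel j)).app Y).symm ≪≫ (shiftFunctor (DerivedCategory C) (-j)).mapIso ⟨p, s, ?_, hsp⟩⟩⟩
    rw [← he, CategoryTheory.Functor.map_id]
end D5
end QN

namespace QN
set_option linter.all false
section hered
open CategoryTheory CategoryTheory.Limits
variable {V : Type} {o : V → V → Prop}

class Acy (o : V → V → Prop) : Prop where
  ex : ∃ f : V → ℤ, ∀ x y, o x y → f y < f x
theorem Acy.wf [Finite V] (h : Acy o) : WellFounded (fun y x => o x y) := by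
  obtain ⟨f, hf⟩ := h.ex
  have h1 : WellFounded (fun a b : Set.range f => a.1 < b.1) := (Finite.to_wellFoundedLT (α := Set.range f)).wf
  exact Subrelation.wf (r := InvImage (fun a b : Set.range f => a.1 < b.1) (Set.rangeFactorization f)) (fun {x y} h => hf _ _ h) (InvImage.wf _ h1)
theorem acy_flip [Finite V] {i : V} (h : Acy o) (hi : IsSink o i ∨ IsSource o i) : Acy (flipAt i o) := by
  classical
  obtain ⟨f, hf⟩ := h.ex
  obtain ⟨B, hB⟩ := (Set.finite_range fun x => |f x|).bddAbove
  replace hB : ∀ x, |f x| ≤ B := fun x => hB ⟨x, rfl⟩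
  refine ⟨⟨Function.update f i (if IsSink o i then B + 1 else - B - 1), fun x y hxy => ?_⟩⟩
  have hx := abs_le.1 (hB x)
  have hy := abs_le.1 (hB y)
  unfold flipAt at hxy
  by_cases h1 : x = i <;> by_cases h2 : y = i
  · subst h1; subst h2; rw [if_pos (Or.inl rfl)] at hxy; exact absurd (hf _ _ hxy) (lt_irrefl _)
  · subst h1
    rw [if_pos (Or.inl rfl)] at hxy
    rw [if_pos (hi.resolve_right fun h => h _ hxy)]
    simp [h2]; omega
  · subst h2
    rw [if_pos (Or.inr rfl)] at hxy
    rw [if_neg (fun h => h _ hxy)]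
    simp [h1]; omega
  · rw [if_neg (by tauto)] at hxy
    simp [h1, h2, hf _ _ hxy]
theorem acy_tree [Fintype V] {G : SimpleGraph V} (hG : G.IsTree) (ho : IsOrientation G o) : Acy o := by
  obtain ⟨v⟩ := hG.1.nonempty
  obtain ⟨T⟩ := exists_rooted hG v
  have h2 := reach_any hG T.toward o T.toward_orient ho
  have h0 : Acy T.toward := ⟨fun x => T.dep x, fun x y h => by obtain ⟨h, rfl⟩ := h; have := T.dep_par x h; simp [this]⟩
  clear ho
  generalize T.toward = t at h2 h0
  induction h2 with
  | refl => exact h0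
  | tail _ hs ih => obtain ⟨i, hi, rfl⟩ := hs; exact acy_flip ih hi

theorem recg {k : Type} [Field k] [Finite V] (hw : Acy o) {X B Y : V → Type} [∀ x, AddCommGroup (X x)] [∀ x, AddCommGroup (B x)] [∀ x, AddCommGroup (Y x)]
    [∀ x, Module k (X x)] [∀ x, Module k (B x)] [∀ x, Module k (Y x)] (xm : ∀ x y, o x y → X x →ₗ[k] X y) (bm : ∀ x y, o x y → B x →ₗ[k] B y)
    (ym : ∀ x y, o x y → Y x →ₗ[k] Y y) (hY : ∀ x, Function.Surjective fun (m : Y x) (y : {y // o x y}) => ym x y.1 y.2 m)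
    (f : ∀ x, X x →ₗ[k] B x) (hf : ∀ x, Function.Injective (f x)) (hfx : ∀ x y h m, f y (xm x y h m) = bm x y h (f x m))
    (u : ∀ x, X x →ₗ[k] Y x) (d : ∀ x y, o x y → B x →ₗ[k] Y y) (hu : ∀ x y h m, ym x y h (u x m) - u y (xm x y h m) = d x y h (f x m)) :
    ∃ g : ∀ x, B x →ₗ[k] Y x, (∀ x m, g x (f x m) = u x m) ∧ ∀ x y h m, ym x y h (g x m) - g y (bm x y h m) = d x y h m := by
  have hj : ∀ x, ∃ r : (∀ y : {y // o x y}, Y y.1) →ₗ[k] Y x, (LinearMap.pi fun y : {y // o x y} => ym x y.1 y.2) ∘ₗ r = LinearMap.id :=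
    fun x => LinearMap.exists_rightInverse_of_surjective _ (LinearMap.range_eq_top.2 (hY x))
  have hl : ∀ x, ∃ l : B x →ₗ[k] X x, l ∘ₗ f x = LinearMap.id := fun x => LinearMap.exists_leftInverse_of_injective _ (LinearMap.ker_eq_bot.2 (hf x))
  choose r hr using hj
  choose l hl using hl
  replace hl : ∀ x m, l x (f x m) = m := fun x m => LinearMap.congr_fun (hl x) m
  let st : ∀ x, (∀ y, o x y → {g : B y →ₗ[k] Y y // ∀ m, g (f y m) = u y m}) → {g : B x →ₗ[k] Y x // ∀ m, g (f x m) = u x m} := fun x ih =>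
    ⟨u x ∘ₗ l x + r x ∘ₗ (LinearMap.pi fun y => d x y.1 y.2 + (ih y.1 y.2).1 ∘ₗ bm x y.1 y.2 - ym x y.1 y.2 ∘ₗ u x ∘ₗ l x), fun m => by
      have : (LinearMap.pi fun y : {y // o x y} => d x y.1 y.2 + (ih y.1 y.2).1 ∘ₗ bm x y.1 y.2 - ym x y.1 y.2 ∘ₗ u x ∘ₗ l x) (f x m) = 0 := by
        funext y
        simp [hl, ← hu, ← hfx, (ih y.1 y.2).2]
      rw [LinearMap.add_apply, LinearMap.comp_apply, LinearMap.comp_apply, this, map_zero, add_zero, hl]⟩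
  obtain ⟨g, hg⟩ : ∃ g, ∀ x, g x = st x (fun y _ => g y) := ⟨hw.wf.fix st, hw.wf.fix_eq st⟩
  refine ⟨fun x => (g x).1, fun x => (g x).2, fun x y h m => ?_⟩
  dsimp only
  have e : (g x).1 = u x ∘ₗ l x + r x ∘ₗ (LinearMap.pi fun y => d x y.1 y.2 + (g y.1).1 ∘ₗ bm x y.1 y.2 - ym x y.1 y.2 ∘ₗ u x ∘ₗ l x) :=
    congrArg Subtype.val (hg x)
  have e2 := congrFun (LinearMap.congr_fun (hr x) ((LinearMap.pi fun y : {y // o x y} => d x y.1 y.2 + (g y.1).1 ∘ₗ bm x y.1 y.2 - ym x y.1 y.2 ∘ₗ u x ∘ₗ l x) m)) ⟨y, h⟩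
  simp only [LinearMap.comp_apply, LinearMap.pi_apply, LinearMap.id_apply] at e2
  rw [e, LinearMap.add_apply, map_add, LinearMap.comp_apply (r x) (LinearMap.pi _), e2]
  simp

variable {k : Type} [Field k] [Fintype V]
/-- structure maps -/
abbrev mm (M : RepO k o) {x y : V} (h : o x y) : M.obj x →ₗ[k] M.obj y := (M.map ⟨(x, y), h⟩).hom
abbrev al {M N : RepO k o} (f : M ⟶ N) (x : V) : M.obj x →ₗ[k] N.obj x := (Rep.ap f x).hom
theorem al_nat {M N : RepO k o} (f : M ⟶ N) {x y : V} (h : o x y) (m : M.obj x) : al f y (mm M h m) = mm N h (al f x m) :=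
  LinearMap.congr_fun (congrArg ModuleCat.Hom.hom (Rep.ap_nat f ⟨(x, y), h⟩)) m
theorem al_ext {M N : RepO k o} {f g : M ⟶ N} (h : ∀ x m, al f x m = al g x m) : f = g :=
  Rep.hext fun v => ModuleCat.hom_ext (LinearMap.ext (h v))
def mkR (X : V → Type) [∀ x, AddCommGroup (X x)] [∀ x, Module k (X x)] (f : ∀ x y, o x y → X x →ₗ[k] X y) : RepO k o where
  obj v := ModuleCat.of k (X v)
  map a := ModuleCat.ofHom (f a.1.1 a.1.2 a.2)
  rel p hp := hp.elim
def mkH {M N : RepO k o} (f : ∀ x, M.obj x →ₗ[k] N.obj x) (h : ∀ x y (h : o x y) m, f y (mm M h m) = mm N h (f x m)) : M ⟶ N :=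
  Rep.hom (fun v => ModuleCat.ofHom (f v)) (fun a => ModuleCat.hom_ext (LinearMap.ext (h a.1.1 a.1.2 a.2)))
@[simp] theorem al_mkH {M N : RepO k o} (f : ∀ x, M.obj x →ₗ[k] N.obj x) (h) (x : V) : al (mkH f h : M ⟶ N) x = f x := rfl
theorem ses_iff {X Y Z : RepO k o} {f : X ⟶ Y} {g : Y ⟶ Z} (w : f ≫ g = 0) : (ShortComplex.mk f g w).ShortExact ↔
    ∀ x, Function.Injective (al f x) ∧ (∀ y, al g x y = 0 → ∃ z, al f x z = y) ∧ Function.Surjective (al g x) :=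
  (Rep.se_iff _).trans (forall_congr' fun _ => Rep.exact_iff _)

def JC (Y : RepO k o) : Prop := ∀ x, Function.Surjective fun (m : Y.obj x) (y : {y // o x y}) => mm Y y.2 m

theorem JC.rec (hw : Acy o) {B Y : RepO k o} (hY : JC Y) (d : ∀ x y, o x y → B.obj x →ₗ[k] Y.obj y) :
    ∃ g : ∀ x, B.obj x →ₗ[k] Y.obj x, ∀ x y (h : o x y) m, mm Y h (g x m) - g y (mm B h m) = d x y h m := by
  obtain ⟨g, _, h⟩ := recg (k := k) (X := fun _ => PUnit) (B := fun x => B.obj x) (Y := fun x => Y.obj x) hw (fun _ _ _ => 0) (fun x y h => mm B h) (fun x y h => mm Y h) hY 0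
    (fun x => Function.injective_of_subsingleton _) (fun _ _ _ _ => by simp) 0 d (fun _ _ _ _ => by simp)
  exact ⟨g, h⟩
theorem JC.inj (hw : Acy o) {Y : RepO k o} (hY : JC Y) : Injective Y := by
  constructor
  intro X B u f hf
  have hS : (ShortComplex.mk f (cokernel.π f) (cokernel.condition f)).ShortExact := { exact := ShortComplex.exact_cokernel f }
  obtain ⟨g, h1, h2⟩ := recg (k := k) (X := fun x => X.obj x) (B := fun x => B.obj x) (Y := fun x => Y.obj x) hw (fun _ _ h => mm X h) (fun x y h => mm B h) (fun x y h => mm Y h) hY (al f)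
    (fun x => ((ses_iff _).1 hS x).1) (fun _ _ h m => al_nat f h m) (al u) (fun _ _ _ => 0) (fun _ _ h m => by rw [al_nat u h m]; simp)
  exact ⟨mkH g fun x y h m => (sub_eq_zero.1 (h2 x y h m)).symm, al_ext fun x m => h1 x m⟩

/-- paths -/
inductive Pt (o : V → V → Prop) : V → V → Type
  | nil (x : V) : Pt o x x
  | cons {x y z : V} (h : o x y) (p : Pt o y z) : Pt o x z
theorem pt_fin (hw : Acy o) (x : V) : Finite (Σ y, Pt o x y) := by
  induction x using hw.wf.induction with | _ x ih => ?_
  have := fun y : {y // o x y} => ih y.1 y.2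
  refine Finite.of_surjective (fun q : Option (Σ y : {y // o x y}, Σ z, Pt o y.1 z) => (q.elim ⟨x, .nil x⟩ fun q => ⟨q.2.1, .cons q.1.2 q.2.2⟩ : Σ y, Pt o x y)) ?_
  rintro ⟨z, p⟩
  cases p with
  | nil => exact ⟨none, rfl⟩
  | cons h p => exact ⟨some ⟨⟨_, h⟩, _, p⟩, rfl⟩
def pth (M : RepO k o) {x y : V} : Pt o x y → M.obj x →ₗ[k] M.obj y
  | .nil x => LinearMap.id
  | .cons h p => pth M p ∘ₗ mm M h
def cof (N : RepO k o) : RepO k o := mkR (fun x => ∀ q : Σ y, Pt o x y, N.obj q.1) fun x y h => LinearMap.pi fun q => LinearMap.proj (⟨q.1, .cons h q.2⟩ : Σ y, Pt o x y)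
def toCof (N : RepO k o) : N ⟶ cof N := mkH (fun x => LinearMap.pi fun q => pth N q.2) fun x y h m => rfl
theorem JC_cof (N : RepO k o) : JC (cof N) := fun x n =>
  ⟨fun q => match q with
    | ⟨_, .nil _⟩ => 0
    | ⟨_, .cons h p⟩ => n ⟨_, h⟩ ⟨_, p⟩, rfl⟩
theorem JC.quot {I Q : RepO k o} (h : JC I) (p : I ⟶ Q) (hp : ∀ x, Function.Surjective (al p x)) : JC Q := fun x n => by
  choose n' hn' using fun y : {y // o x y} => hp y.1 (n y)
  obtain ⟨m, hm⟩ := h x n'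
  exact ⟨al p x m, funext fun y => by rw [← hn', ← hm]; exact (al_nat p y.2 m).symm⟩
theorem sum_lt' {ι : Type} [Finite ι] {c : Cardinal.{0}} (hc : Cardinal.aleph0 ≤ c) (f : ι → Cardinal.{0}) (h : ∀ i, f i < c) : Cardinal.sum f < c := by
  refine (Cardinal.sum_le_mk_mul_iSup f).trans_lt (Cardinal.mul_lt_of_lt hc ((Cardinal.lt_aleph0_of_finite ι).trans_le hc) ?_)
  rcases isEmpty_or_nonempty ι with h' | h'
  · rw [ciSup_of_empty]; exact (Cardinal.aleph0_pos).trans_le hc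
  · obtain ⟨i, hi⟩ := exists_eq_ciSup_of_finite (f := f)
    rw [← hi]; exact h i
theorem rank_pi_lt {ι : Type} [Finite ι] {c : Cardinal.{0}} (hc : Cardinal.aleph0 ≤ c) {W : ι → Type} [∀ i, AddCommGroup (W i)] [∀ i, Module k (W i)]
    (h : ∀ i, Module.rank k (W i) < c) : Module.rank k (∀ i, W i) < c := by
  rw [rank_pi]; exact sum_lt' hc _ h
/-- injective resolution -/
theorem resol (hw : Acy o) (N : RepO k o) : ∃ (I Q : RepO k o) (i : N ⟶ I) (p : I ⟶ Q) (w : i ≫ p = 0), (ShortComplex.mk i p w).ShortExact ∧ JC I ∧ JC Q ∧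
    ∀ c : Cardinal.{0}, Cardinal.aleph0 ≤ c → (∀ x, Module.rank k (N.obj x) < c) → ∀ x, Module.rank k (I.obj x) < c := by
  have hm : Mono (toCof N) := ⟨fun f g h => al_ext fun x m => by
    have : al (f ≫ toCof N) x m = al (g ≫ toCof N) x m := by rw [h]
    exact congrFun this ⟨x, .nil x⟩⟩
  have hS : (ShortComplex.mk (toCof N) (cokernel.π _) (cokernel.condition _)).ShortExact := { exact := ShortComplex.exact_cokernel _ }
  refine ⟨cof N, _, toCof N, _, _, hS, JC_cof N, (JC_cof N).quot _ fun x => ((ses_iff _).1 hS x).2.2, fun c hc h x => ?_⟩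
  have := pt_fin hw x
  exact rank_pi_lt hc fun q : Σ y, Pt o x y => h q.1
instance [hw : Acy o] : Hered (RepO k o) where
  ep := (Functor.asEquivalence (Rep.Phi k (oS o) (oT o) ∅)).enoughProjectives_iff.2 inferInstance
  res N := by
    obtain ⟨I, Q, i, p, w, h, h1, h2, _⟩ := resol hw N
    exact ⟨I, Q, i, p, w, h, h1.inj hw, h2.inj hw⟩
end hered
end QN

namespace QN
set_option linter.all false
section euler
open CategoryTheory CategoryTheory.Limits CategoryTheory.Pretriangulated
variable {V : Type} {o : V → V → Prop} {k : Type} [Field k] [Fintype V]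

instance : Linear k (RepO k o) where
  homModule M N :=
    { smul := fun c f => mkH (fun x => c • al f x) fun x y h m => by simp [al_nat f h]
      one_smul := fun f => al_ext fun x m => one_smul k (al f x m)
      mul_smul := fun a b f => al_ext fun x m => mul_smul a b (al f x m)
      smul_zero := fun a => al_ext fun x m => smul_zero a
      smul_add := fun a f g => al_ext fun x m => smul_add a (al f x m) (al g x m)
      add_smul := fun a b f => al_ext fun x m => add_smul a b (al f x m)
      zero_smul := fun f => al_ext fun x m => zero_smul k (al f x m) }
  smul_comp _ _ _ c f g := al_ext fun x m => (al g x).map_smul c (al f x m)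
  comp_smul _ _ _ f c g := rfl

theorem al_smul {M N : RepO k o} (c : k) (f : M ⟶ N) (x : V) (m : M.obj x) : al (c • f) x m = c • al f x m := rfl

/-- dimension vector -/
noncomputable def dv (M : RepO k o) : V → ℤ := fun x => Module.finrank k (M.obj x)
def FD (M : RepO k o) : Prop := ∀ x, Module.Finite k (M.obj x)

def homK (M N : RepO k o) : (M ⟶ N) →ₗ[k] (∀ x, M.obj x →ₗ[k] N.obj x) where
  toFun f := al f
  map_add' _ _ := rfl
  map_smul' _ _ := rfl
theorem homK_inj (M N : RepO k o) : Function.Injective (homK M N) := fun f g h => al_ext fun x m => LinearMap.congr_fun (congrFun h x) m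
def homD (M N : RepO k o) : (∀ x, M.obj x →ₗ[k] N.obj x) →ₗ[k] (∀ a : oA o, M.obj a.1.1 →ₗ[k] N.obj a.1.2) where
  toFun g a := mm N a.2 ∘ₗ g a.1.1 - g a.1.2 ∘ₗ mm M a.2
  map_add' f g := by funext a; ext m; simp; abel
  map_smul' c f := by funext a; ext m; simp [smul_sub]
theorem homKD (M N : RepO k o) : LinearMap.ker (homD M N) = LinearMap.range (homK M N) := by
  ext g
  constructor
  · intro h
    refine ⟨mkH g fun x y hxy m => ?_, rfl⟩
    have := LinearMap.congr_fun (congrFun h (⟨(x, y), hxy⟩ : oA o)) m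
    exact (sub_eq_zero.1 this).symm
  · rintro ⟨f, rfl⟩
    funext a; ext m
    exact sub_eq_zero.2 (al_nat f a.2 m).symm
theorem hom_fin {M N : RepO k o} (hM : FD M) (hN : FD N) : Module.Finite k (M ⟶ N) := by
  have : ∀ x, Module.Finite k (M.obj x) := hM
  have : ∀ x, Module.Finite k (N.obj x) := hN
  exact Module.Finite.of_injective _ (homK_inj M N)
theorem hom_J (hw : Acy o) {M N : RepO k o} (hM : FD M) (hN : FD N) (hJ : JC N) : (Module.finrank k (M ⟶ N) : ℤ) = eul ℤ o (dv M) (dv N) := by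
  classical
  have : ∀ x, Module.Finite k (M.obj x) := hM
  have : ∀ x, Module.Finite k (N.obj x) := hN
  have h1 := LinearMap.finrank_range_add_finrank_ker (homD M N)
  rw [homKD, LinearMap.finrank_range_of_inj (homK_inj M N), LinearMap.range_eq_top.2, finrank_top, Module.finrank_pi_fintype, Module.finrank_pi_fintype] at h1
  · simp only [Module.finrank_linearMap] at h1
    rw [eul_apply]
    have h2 : ∑ v, ∑ w, (if o v w then dv M v * dv N w else 0) = ∑ a : oA o, dv M a.1.1 * dv N a.1.2 := by
      rw [← Fintype.sum_prod_type' (f := fun v w => if o v w then dv M v * dv N w else 0), ← Finset.sum_filter]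
      exact Finset.sum_subtype _ (by simp) _
    rw [h2]
    simp only [dv]
    rw [eq_sub_iff_add_eq, add_comm]
    exact_mod_cast h1
  · intro d
    obtain ⟨g, hg⟩ := hJ.rec hw (B := M) (fun x y h => d ⟨(x, y), h⟩)
    exact ⟨g, funext fun a => LinearMap.ext fun m => hg a.1.1 a.1.2 a.2 m⟩

abbrev HD (M N : RepO k o) (n : ℤ) := (Sg M ⟶ (Sg N)⟦n⟧)
noncomputable def hd0 (M N : RepO k o) : (M ⟶ N) ≃ₗ[k] HD M N 0 :=
  LinearEquiv.ofBijective ((Linear.rightComp k (Sg M) ((shiftFunctorZero (DerivedCategory (RepO k o)) ℤ).inv.app (Sg N))) ∘ₗ (Sf (RepO k o)).mapLinearMap k) (by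
    constructor
    · intro f g h
      exact (Sf _).map_injective ((cancel_mono _).1 h)
    · intro f
      obtain ⟨g, hg⟩ := (Sf _).map_surjective (f ≫ (shiftFunctorZero (DerivedCategory (RepO k o)) ℤ).hom.app (Sg N))
      exact ⟨g, by simp [hg]⟩)
/-- the Ext sequence -/
theorem ext_seq [hw : Acy o] (M : RepO k o) {N I Q : RepO k o} {i : N ⟶ I} {p : I ⟶ Q} {w : i ≫ p = 0} (hS : (ShortComplex.mk i p w).ShortExact) (hI : JC I) :
    ∃ d : (M ⟶ Q) →ₗ[k] HD M N 1, Function.Surjective d ∧ LinearMap.ker d = LinearMap.range (Linear.rightComp k M p) := by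
  have hI' := hI.inj hw
  refine ⟨Linear.rightComp k (Sg M) hS.singleδ ∘ₗ (Sf (RepO k o)).mapLinearMap k, ?_, ?_⟩
  · intro f
    obtain ⟨g, hg⟩ : ∃ g : Sg M ⟶ Sg Q, f = g ≫ hS.singleδ := Triangle.coyoneda_exact₁ _ hS.singleTriangle_distinguished f (inj_zero 1 _ (hz M _ (by norm_num)))
    obtain ⟨g, rfl⟩ := (Sf _).map_surjective g
    exact ⟨g, hg.symm⟩
  · ext f
    constructor
    · intro h
      obtain ⟨g, hg⟩ : ∃ g : Sg M ⟶ Sg I, (Sf _).map f = g ≫ (Sf _).map p := Triangle.coyoneda_exact₃ _ hS.singleTriangle_distinguished ((Sf _).map f) h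
      obtain ⟨g, rfl⟩ := (Sf _).map_surjective g
      exact ⟨g, (Sf _).map_injective (by rw [hg]; simp)⟩
    · rintro ⟨g, rfl⟩
      have : (Sf _).map p ≫ hS.singleδ = 0 := comp_distTriang_mor_zero₂₃ _ hS.singleTriangle_distinguished
      change (Sf _).map (g ≫ p) ≫ hS.singleδ = 0
      rw [Functor.map_comp, Category.assoc, this, comp_zero]
theorem euler [hw : Acy o] {M N : RepO k o} (hM : FD M) (hN : FD N) : Module.Finite k (HD M N 0) ∧ Module.Finite k (HD M N 1) ∧
    (Module.finrank k (HD M N 0) : ℤ) - Module.finrank k (HD M N 1) = eul ℤ o (dv M) (dv N) := by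
  obtain ⟨I, Q, i, p, w, hS, hI, hQ, hr⟩ := resol hw N
  have hS' := (ses_iff w).1 hS
  have fI : FD I := fun x => Module.rank_lt_aleph0_iff.1 (hr _ le_rfl (fun x => Module.rank_lt_aleph0_iff.2 (hN x)) x)
  have fQ : FD Q := fun x => have := fI x; Module.Finite.of_surjective _ (hS' x).2.2
  obtain ⟨d, hd, hk⟩ := ext_seq M hS hI
  have := hom_fin hM hN
  have := hom_fin hM fQ
  have := hom_fin hM fI
  refine ⟨Module.Finite.equiv (hd0 M N), Module.Finite.of_surjective _ hd, ?_⟩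
  have e1 := LinearMap.finrank_range_add_finrank_ker d
  have e2 := LinearMap.finrank_range_add_finrank_ker (Linear.rightComp k M p)
  have e3 : LinearMap.ker (Linear.rightComp k M p) = LinearMap.range (Linear.rightComp k M i) := by
    have := hS.mono_f
    ext f
    constructor
    · intro h
      exact ⟨hS.exact.lift f h, hS.exact.lift_f f h⟩
    · rintro ⟨g, rfl⟩
      simp [w]
  have e4 : Function.Injective (Linear.rightComp k M i) := fun f g h => by have : Mono i := hS.mono_f; exact (cancel_mono i).1 h
  rw [e3, LinearMap.finrank_range_of_inj e4] at e2
  rw [hk, LinearMap.range_eq_top.2 hd, finrank_top] at e1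
  rw [← (hd0 M N).finrank_eq]
  have h1 := hom_J hw hM fI hI
  have h2 := hom_J hw hM fQ hQ
  have h3 : dv I = dv N + dv Q := by
    funext x
    have := fI x
    have e := LinearMap.finrank_range_add_finrank_ker (al p x)
    have e' : LinearMap.ker (al p x) = LinearMap.range (al i x) := by
      ext m
      refine ⟨(hS' x).2.1 m, ?_⟩
      rintro ⟨g, rfl⟩
      have : al (i ≫ p) x g = 0 := by rw [w]; rfl
      exact this
    rw [e', LinearMap.finrank_range_of_inj (hS' x).1, LinearMap.range_eq_top.2 (hS' x).2.2, finrank_top] at e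
    simp only [dv, Pi.add_apply]
    omega
  rw [h3, map_add] at h1
  omega
end euler
end QN

namespace QN
set_option linter.all false
section simp5
open CategoryTheory CategoryTheory.Limits CategoryTheory.Pretriangulated
variable {V : Type} {o : V → V → Prop} {k : Type} [Field k] [Fintype V]

/-- simple representations -/
def Sm (k : Type) [Field k] (o : V → V → Prop) (v : V) : RepO k o := mkR (fun x => PLift (x = v) → k) (fun _ _ _ => 0)
def one' (v : V) : (Sm k o v).obj v := fun _ => (1 : k)
theorem Sm_eq (v : V) (m : (Sm k o v).obj v) : ∃ c : k, m = c • one' v := by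
  refine ⟨(show PLift (v = v) → k from m) ⟨rfl⟩, ?_⟩
  funext h
  exact (mul_one _).symm
theorem Sm_zero {x v : V} (h : x ≠ v) (m : (Sm k o v).obj x) : m = 0 := funext fun q => (h q.down).elim
def evS (v : V) (N : RepO k o) : (Sm k o v ⟶ N) →ₗ[k] N.obj v where
  toFun f := al f v (one' v)
  map_add' _ _ := rfl
  map_smul' _ _ := rfl
theorem evS_inj (v : V) (N : RepO k o) : Function.Injective (evS v N) := fun f g h => al_ext fun x m => by
  by_cases hx : x = v
  · subst hx
    obtain ⟨c, rfl⟩ := Sm_eq x m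
    rw [map_smul, map_smul]
    exact congrArg (c • ·) h
  · rw [Sm_zero hx m, map_zero, map_zero]
theorem Sm_end (v : V) (f : Sm k o v ⟶ Sm k o v) : ∃ c : k, f = c • 𝟙 _ := by
  obtain ⟨c, hc⟩ := Sm_eq v (evS v _ f)
  exact ⟨c, evS_inj v _ hc⟩
theorem Sm_FD (v : V) : FD (Sm k o v) := fun x => inferInstanceAs (Module.Finite k (PLift (x = v) → k))
theorem Sm_dv (v : V) : dv (Sm k o v) = bv ℤ v := funext fun x => by
  classical
  have h : dv (Sm k o v) x = (Module.finrank k (PLift (x = v) → k) : ℤ) := rfl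
  rw [h, bv_apply, Module.finrank_pi]
  by_cases hx : x = v
  · rw [if_pos hx, Fintype.card_eq_one_iff.2 ⟨⟨hx⟩, fun _ => rfl⟩]; rfl
  · have : IsEmpty (PLift (x = v)) := ⟨fun q => hx q.down⟩
    rw [if_neg hx, Fintype.card_eq_zero]; rfl
/-- k-simple endomorphism ring -/
def Sc (M : RepO k o) : Prop := (∀ f : M ⟶ M, ∃ c : k, f = c • 𝟙 _) ∧ (𝟙 M : M ⟶ M) ≠ 0
theorem Sm_Sc (v : V) : Sc (Sm k o v) := ⟨Sm_end v, fun h => by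
  have : al (𝟙 (Sm k o v)) v (one' v) = al 0 v (one' v) := by rw [h]
  exact one_ne_zero (congrFun this ⟨rfl⟩ : (1 : k) = 0)⟩
theorem Sm_rank (v : V) [Acy o] {N : RepO k o} {c : Cardinal.{0}} (hc : Cardinal.aleph0 ≤ c) (h : ∀ x, Module.rank k (N.obj x) < c) (n : ℤ) :
    Module.rank k (HD (Sm k o v) N n) < Cardinal.lift.{1} c := by
  by_cases h0 : n = 0
  · subst h0
    have := (hd0 (Sm k o v) N).lift_rank_eq
    rw [Cardinal.lift_id'.{0, 1}] at this
    rw [← this, Cardinal.lift_lt]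
    exact (LinearMap.rank_le_of_injective _ (evS_inj v N)).trans_lt (h v)
  by_cases h1 : n = 1
  · subst h1
    obtain ⟨I, Q, i, p, w, hS, hI, hQ, hr⟩ := resol ‹_› N
    obtain ⟨d, hd, -⟩ := ext_seq (Sm k o v) hS hI
    have := LinearMap.lift_rank_le_of_surjective d hd
    rw [Cardinal.lift_id'.{0, 1}] at this
    refine this.trans_lt (Cardinal.lift_lt.2 ?_)
    refine (LinearMap.rank_le_of_injective _ (evS_inj v Q)).trans_lt ?_
    exact (LinearMap.rank_le_of_surjective _ ((ses_iff w).1 hS v).2.2).trans_lt (hr c hc h v)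
  · have : Subsingleton (HD (Sm k o v) N n) := ⟨fun f g => by rw [vanS _ _ n h0 h1 f, vanS _ _ n h0 h1 g]⟩
    rw [rank_subsingleton']
    rw [← Cardinal.lift_zero.{0,1}, Cardinal.lift_lt]
    exact Cardinal.aleph0_pos.trans_le hc
/-- the top of a representation -/
noncomputable def Tp (M : RepO k o) (y : V) : Submodule k (M.obj y) :=
  open Classical in LinearMap.range (LinearMap.lsum k (fun x : {x // o x y} => M.obj x.1) k fun x => mm M x.2)
def cst (M : RepO k o) {x y : V} (h : x = y) : M.obj x →ₗ[k] M.obj y := h ▸ LinearMap.id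
noncomputable def dTp (M : RepO k o) (y : V) : Module.Dual k (M.obj y ⧸ Tp M y) →ₗ[k] (M ⟶ Sm k o y) where
  toFun φ := mkH (fun x => LinearMap.pi fun h : PLift (x = y) => (φ ∘ₗ (Tp M y).mkQ) ∘ₗ cst M h.down) fun x z h m => by
    funext ⟨q⟩
    subst q
    have : mm M h m ∈ Tp M z := by classical exact ⟨Pi.single (⟨x, h⟩ : {x // o x z}) m, LinearMap.lsum_piSingle ..⟩
    have h2 : (Tp M z).mkQ (mm M h m) = 0 := (Submodule.Quotient.mk_eq_zero _).2 this
    change φ ((Tp M z).mkQ (mm M h m)) = 0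
    rw [h2, map_zero]
  map_add' _ _ := rfl
  map_smul' _ _ := rfl
theorem dTp_inj (M : RepO k o) (y : V) : Function.Injective (dTp M y) := fun φ ψ h => by
  refine LinearMap.ext fun u => ?_
  obtain ⟨m, rfl⟩ := (Tp M y).mkQ_surjective u
  have : al (dTp M y φ) y m = al (dTp M y ψ) y m := by rw [h]
  exact congrFun this ⟨rfl⟩
theorem top_rank [hw : Acy o] {M : RepO k o} {c : Cardinal.{0}} (hc : Cardinal.aleph0 ≤ c) (h : ∀ y, Module.rank k (M.obj y ⧸ Tp M y) < c) (y : V) : Module.rank k (M.obj y) < c := by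
  have hw' : Acy (fun x y => o y x) := by obtain ⟨f, hf⟩ := hw.ex; exact ⟨fun x => - f x, fun x y h => neg_lt_neg (hf _ _ h)⟩
  induction y using hw'.wf.induction with | _ y ih => ?_
  rw [← Submodule.rank_quotient_add_rank (Tp M y)]
  refine Cardinal.add_lt_of_lt hc (h y) ((LinearMap.rank_le_of_surjective _ (LinearMap.surjective_rangeRestrict _)).trans_lt ?_)
  exact rank_pi_lt hc fun x => ih x.1 x.2
theorem dual_rank [hw : Acy o] {M : RepO k o} {c : Cardinal.{0}} (hc : Cardinal.aleph0 ≤ c) {x : V} (h : c ≤ Module.rank k (M.obj x)) :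
    ∃ y, Cardinal.lift.{1} c < Module.rank k (HD M (Sm k o y) 0) := by
  by_contra hcon
  push Not at hcon
  refine absurd (top_rank hc (fun y => ?_) x) (not_lt.2 h)
  have h1 := (hd0 M (Sm k o y)).lift_rank_eq
  rw [Cardinal.lift_id'.{0, 1}] at h1
  have h2 := hcon y
  rw [← h1, Cardinal.lift_le] at h2
  by_contra h3
  have h3 := not_lt.1 h3
  have h4 := rank_lt_rank_dual (hc.trans h3)
  exact absurd ((h4.trans_le (LinearMap.rank_le_of_injective _ (dTp_inj M y))).trans_le h2) (not_lt.2 h3)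
end simp5
end QN

namespace QN
set_option linter.all false
section tr5
open CategoryTheory CategoryTheory.Limits CategoryTheory.Pretriangulated
section gen
universe v u v' u'
variable {C : Type u} {D : Type u'} [Category.{v} C] [Category.{v'} D] [Preadditive C] [Preadditive D] [HasShift C ℤ] [HasShift D ℤ]
  [∀ n : ℤ, (shiftFunctor D n).Additive] (F : C ⥤ D) [F.Additive] [F.CommShift ℤ] [F.Full] [F.Faithful]
theorem tr_gen {X Y : C} {X' Y' : D} {a b n m : ℤ} (α : F.obj X ≅ X'⟦a⟧) (β : F.obj Y ≅ Y'⟦b⟧) (h : m + a = b + n) :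
    ∃ Ψ : (X' ⟶ Y'⟦m⟧) ≃+ (X ⟶ Y⟦n⟧), (∀ u u', F.map u ≫ α.hom = α.hom ≫ u'⟦a⟧' → ∀ f, Ψ (u' ≫ f) = u ≫ Ψ f) ∧
      (∀ w w', F.map w ≫ β.hom = β.hom ≫ w'⟦b⟧' → ∀ f, Ψ (f ≫ w'⟦m⟧') = Ψ f ≫ w⟦n⟧') := by
  let s := (shiftFunctorAdd' D b n (b + n) rfl).symm ≪≫ shiftFunctorAdd' D m a (b + n) h
  let τ : F.obj (Y⟦n⟧) ≅ (Y'⟦m⟧)⟦a⟧ := (F.commShiftIso n).app Y ≪≫ (shiftFunctor D n).mapIso β ≪≫ s.app Y'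
  have hτ : ∀ w w', F.map w ≫ β.hom = β.hom ≫ w'⟦b⟧' → F.map (w⟦n⟧') ≫ τ.hom = τ.hom ≫ w'⟦m⟧'⟦a⟧' := by
    intro w w' hw
    have h1 : F.map (w⟦n⟧') ≫ (F.commShiftIso n).hom.app Y = (F.commShiftIso n).hom.app Y ≫ (F.map w)⟦n⟧' := (F.commShiftIso n).hom.naturality w
    have h2 : (w'⟦b⟧')⟦n⟧' ≫ s.hom.app Y' = s.hom.app Y' ≫ w'⟦m⟧'⟦a⟧' := s.hom.naturality w'
    have h3 : (F.map w)⟦n⟧' ≫ β.hom⟦n⟧' = β.hom⟦n⟧' ≫ (w'⟦b⟧')⟦n⟧' := by rw [← Functor.map_comp, hw, Functor.map_comp]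
    have : τ.hom = (F.commShiftIso n).hom.app Y ≫ β.hom⟦n⟧' ≫ s.hom.app Y' := rfl
    rw [this, reassoc_of% h1, reassoc_of% h3, h2]; simp only [Category.assoc]
  let L : (X ⟶ Y⟦n⟧) ≃+ (F.obj X ⟶ (Y'⟦m⟧)⟦a⟧) := AddEquiv.ofBijective (AddMonoidHom.mk' (fun f => F.map f ≫ τ.hom) fun f g => by simp)
    ⟨fun f g hfg => F.map_injective ((cancel_mono τ.hom).1 hfg), fun g => by obtain ⟨f, hf⟩ := F.map_surjective (g ≫ τ.inv); exact ⟨f, by simp [hf]⟩⟩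
  let R : (X' ⟶ Y'⟦m⟧) ≃+ (F.obj X ⟶ (Y'⟦m⟧)⟦a⟧) := AddEquiv.ofBijective (AddMonoidHom.mk' (fun f => α.hom ≫ f⟦a⟧') fun f g => by simp [Functor.map_add])
    ⟨fun f g hfg => (shiftFunctor D a).map_injective ((cancel_epi α.hom).1 hfg), fun g => by obtain ⟨f, hf⟩ := (shiftFunctor D a).map_surjective (α.inv ≫ g); exact ⟨f, by simp [hf]⟩⟩
  have key : ∀ f, F.map ((R.trans L.symm) f) ≫ τ.hom = α.hom ≫ f⟦a⟧' := fun f => L.apply_symm_apply (R f)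
  refine ⟨R.trans L.symm, fun u u' hu f => L.injective ?_, fun w w' hw f => L.injective ?_⟩
  · change F.map _ ≫ τ.hom = F.map _ ≫ τ.hom
    rw [key, Functor.map_comp, Functor.map_comp, Category.assoc, key, reassoc_of% hu]
  · change F.map _ ≫ τ.hom = F.map _ ≫ τ.hom
    rw [key, Functor.map_comp, Functor.map_comp, Category.assoc, hτ w w' hw, reassoc_of% key]
theorem cor_r {X : C} {X' : D} {a : ℤ} (α : F.obj X ≅ X'⟦a⟧) (u : X ⟶ X) : ∃ u' : X' ⟶ X', F.map u ≫ α.hom = α.hom ≫ u'⟦a⟧' := by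
  obtain ⟨f, hf⟩ := (shiftFunctor D a).map_surjective (α.inv ≫ F.map u ≫ α.hom); exact ⟨f, by simp [hf]⟩
theorem cor_l {X : C} {X' : D} {a : ℤ} (α : F.obj X ≅ X'⟦a⟧) (u' : X' ⟶ X') : ∃ u : X ⟶ X, F.map u ≫ α.hom = α.hom ≫ u'⟦a⟧' := by
  obtain ⟨f, hf⟩ := F.map_surjective (α.hom ≫ u'⟦a⟧' ≫ α.inv); exact ⟨f, by simp [hf]⟩
theorem cor_inj {X : C} {X' : D} {a : ℤ} (α : F.obj X ≅ X'⟦a⟧) {u₁ u₂ : X ⟶ X} {u' : X' ⟶ X'} (h₁ : F.map u₁ ≫ α.hom = α.hom ≫ u'⟦a⟧') (h₂ : F.map u₂ ≫ α.hom = α.hom ≫ u'⟦a⟧') : u₁ = u₂ :=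
  F.map_injective ((cancel_mono α.hom).1 (h₁.trans h₂.symm))
theorem cor_inj' {X : C} {X' : D} {a : ℤ} (α : F.obj X ≅ X'⟦a⟧) {u : X ⟶ X} {u₁ u₂ : X' ⟶ X'} (h₁ : F.map u ≫ α.hom = α.hom ≫ u₁⟦a⟧') (h₂ : F.map u ≫ α.hom = α.hom ≫ u₂⟦a⟧') : u₁ = u₂ :=
  (shiftFunctor D a).map_injective ((cancel_epi α.hom).1 (h₁.symm.trans h₂))
end gen
/-- semilinear comparison -/
def SL (k : Type) [Field k] (H' H : Type 1) [AddCommGroup H'] [AddCommGroup H] [Module k H'] [Module k H] (P : Prop) : Prop :=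
  ∃ (Ψ : H' ≃+ H) (i : k → k), (∀ r, i r = 0 → r = 0) ∧ (∀ r f, Ψ (i r • f) = r • Ψ f) ∧ (Function.Surjective i → P)
theorem SL.rank {k : Type} [Field k] {H' H : Type 1} [AddCommGroup H'] [AddCommGroup H] [Module k H'] [Module k H] {P : Prop} (h : SL k H' H P) : Module.rank k H' ≤ Module.rank k H := by
  obtain ⟨Ψ, i, hi, h1, _⟩ := h
  exact rank_le_of_injective_injective i Ψ.toAddMonoidHom hi Ψ.injective h1
theorem SL.sc {k : Type} [Field k] {H' H : Type 1} [AddCommGroup H'] [AddCommGroup H] [Module k H'] [Module k H] {P : Prop} (h : SL k H' H P) [Module.Finite k H'] [Nontrivial H']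
    (hr : Module.rank k H ≤ Module.rank k H') : P := by
  obtain ⟨Ψ, i, hi, h1, h2⟩ := h
  refine h2 fun t => ?_
  let b := Module.finBasis k H'
  have hj : LinearIndependent k (fun j => Ψ (b j)) := by
    rw [Fintype.linearIndependent_iff]
    intro g hg j
    have h3 : Ψ (∑ j, i (g j) • b j) = 0 := by rw [map_sum, ← hg]; exact Finset.sum_congr rfl fun j _ => h1 _ _
    exact hi _ (Fintype.linearIndependent_iff.1 b.linearIndependent _ ((map_eq_zero_iff _ Ψ.injective).1 h3) j)
  have : Module.Finite k H := Module.rank_lt_aleph0_iff.1 (hr.trans_lt (Module.rank_lt_aleph0_iff.2 ‹_›))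
  have hs := hj.span_eq_top_of_card_eq_finrank' (by
    refine le_antisymm (hj.fintype_card_le_finrank) ?_
    rw [Fintype.card_fin]; exact Module.finrank_le_finrank_of_rank_le_rank (by simpa using hr) (Module.rank_lt_aleph0_iff.2 ‹_›))
  have h0 : 0 < Module.finrank k H' := Module.finrank_pos
  have hx : Ψ (t • b ⟨0, h0⟩) ∈ Submodule.span k (Set.range fun j => Ψ (b j)) := hs ▸ Submodule.mem_top
  obtain ⟨g, hg⟩ := (Submodule.mem_span_range_iff_exists_fun k).1 hx
  have h3 : ∑ j, i (g j) • b j = t • b ⟨0, h0⟩ := Ψ.injective (by rw [map_sum, ← hg]; exact Finset.sum_congr rfl fun j _ => h1 _ _)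
  refine ⟨g ⟨0, h0⟩, ?_⟩
  have h4 := congrArg (fun x => b.repr x ⟨0, h0⟩) h3
  simpa [Finsupp.single_apply] using h4
variable {V V' : Type} {o : V → V → Prop} {o' : V' → V' → Prop} {k : Type} [Field k] [Fintype V] [Fintype V']
def Cr (e : TEq (RepO k o) (RepO k o')) (M : RepO k o) (M' : RepO k o') (a : ℤ) : Prop := Nonempty (e.F.obj (Sg M) ≅ (Sg M')⟦a⟧)
theorem Cr.symm {e : TEq (RepO k o) (RepO k o')} {M : RepO k o} {M' : RepO k o'} {a : ℤ} (h : Cr e M M' a) : Cr e.symm M' M (-a) := by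
  obtain ⟨α⟩ := h
  exact ⟨e.symm.F.mapIso ((shiftShiftNeg (Sg M') a).symm ≪≫ (shiftFunctor _ (-a)).mapIso α.symm) ≪≫ (e.symm.F.commShiftIso (-a)).app _ ≪≫ (shiftFunctor _ (-a)).mapIso (e.symm_iso' (Sg M))⟩
theorem sem {e : TEq (RepO k o) (RepO k o')} {M : RepO k o} {M' : RepO k o'} {a : ℤ} (α : e.F.obj (Sg M) ≅ (Sg M')⟦a⟧) (h : Sc M') :
    ∃ i : k → k, (∀ r, i r = 0 → r = 0) ∧ (∀ r, e.F.map (r • 𝟙 (Sg M)) ≫ α.hom = α.hom ≫ (i r • 𝟙 (Sg M'))⟦a⟧') ∧ (Function.Surjective i → Sc M) := by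
  have hs : ∀ u : Sg M' ⟶ Sg M', ∃ c : k, u = c • 𝟙 _ := fun u => by
    obtain ⟨f, rfl⟩ := (Sf _).map_surjective u
    obtain ⟨c, rfl⟩ := h.1 f
    exact ⟨c, by rw [Functor.map_smul, CategoryTheory.Functor.map_id]⟩
  choose i hi using fun r : k => (show ∃ c : k, e.F.map (r • 𝟙 (Sg M)) ≫ α.hom = α.hom ≫ (c • 𝟙 (Sg M'))⟦a⟧' by
    obtain ⟨u, hu⟩ := cor_r e.F α (r • 𝟙 (Sg M))
    obtain ⟨c, rfl⟩ := hs u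
    exact ⟨c, hu⟩)
  have h1 : 𝟙 (Sg M) ≠ 0 := fun h1 => h.2 ((Sf _).map_injective (by
    rw [CategoryTheory.Functor.map_id, Functor.map_zero]
    exact cor_inj' e.F α (u := 𝟙 (Sg M)) (by simp) (by rw [h1]; simp)))
  refine ⟨i, fun r hr => ?_, hi, fun hsur => ⟨fun f => ?_, fun h2 => h1 ?_⟩⟩
  · have h2 := hi r
    rw [hr, zero_smul] at h2
    have h3 : r • 𝟙 (Sg M) = 0 := cor_inj e.F α h2 (by simp)
    exact (smul_eq_zero.1 h3).resolve_right h1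
  · obtain ⟨u, hu⟩ := cor_r e.F α ((Sf _).map f)
    obtain ⟨c, rfl⟩ := hs u
    obtain ⟨r, rfl⟩ := hsur c
    exact ⟨r, (Sf _).map_injective ((cor_inj e.F α hu (hi r)).trans (by rw [Functor.map_smul, CategoryTheory.Functor.map_id]))⟩
  · rw [← CategoryTheory.Functor.map_id, h2, Functor.map_zero]
theorem TR1 {e : TEq (RepO k o) (RepO k o')} {M N : RepO k o} {M' N' : RepO k o'} {a b m n : ℤ} (hM : Cr e M M' a) (hN : Cr e N N' b) (hm : m + a = b + n) (h : Sc N') :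
    SL k (HD M' N' m) (HD M N n) (Sc N) := by
  obtain ⟨α⟩ := hM
  obtain ⟨β⟩ := hN
  obtain ⟨Ψ, _, h2⟩ := tr_gen e.F α β hm
  obtain ⟨i, hi, hc, hs⟩ := sem β h
  refine ⟨Ψ, i, hi, fun r f => ?_, hs⟩
  have := h2 _ _ (hc r) f
  rw [Functor.map_smul, Functor.map_smul, CategoryTheory.Functor.map_id, CategoryTheory.Functor.map_id, Linear.comp_smul, Linear.comp_smul, Category.comp_id, Category.comp_id] at this
  exact this
theorem TR2 {e : TEq (RepO k o) (RepO k o')} {M N : RepO k o} {M' N' : RepO k o'} {a b m n : ℤ} (hM : Cr e M M' a) (hN : Cr e N N' b) (hm : m + a = b + n) (h : Sc M') :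
    SL k (HD M' N' m) (HD M N n) (Sc M) := by
  obtain ⟨α⟩ := hM
  obtain ⟨β⟩ := hN
  obtain ⟨Ψ, h1, _⟩ := tr_gen e.F α β hm
  obtain ⟨i, hi, hc, hs⟩ := sem α h
  refine ⟨Ψ, i, hi, fun r f => ?_, hs⟩
  have := h1 _ _ (hc r) f
  rw [Linear.smul_comp, Linear.smul_comp, Category.id_comp, Category.id_comp] at this
  exact this
theorem fd_one [Acy o] [Acy o'] {e : TEq (RepO k o) (RepO k o')} {M : V → RepO k o'} {a : V → ℤ} {N : V' → RepO k o} {b : V' → ℤ} (hM : ∀ v, Cr e (Sm k o v) (M v) (a v))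
    (hN : ∀ y, Cr e (N y) (Sm k o' y) (b y)) {c : Cardinal.{0}} (hc : Cardinal.aleph0 ≤ c) (h : ∀ y w, Module.rank k ((N y).obj w) ≤ c) (v : V) (x : V') : Module.rank k ((M v).obj x) < c := by
  by_contra hcon
  obtain ⟨y, hy⟩ := dual_rank hc (not_lt.1 hcon)
  have h1 := (TR1 (m := 0) (n := a v - b y) (hM v) (hN y) (by ring) (Sm_Sc y)).rank
  have h2 := Sm_rank v (c := Order.succ c) (hc.trans (Order.le_succ c)) (fun w => Order.lt_succ_of_le (h y w)) (a v - b y)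
  rw [Cardinal.lift_succ, Order.lt_succ_iff] at h2
  exact absurd ((hy.trans_le h1).trans_le h2) (lt_irrefl _)
theorem fd_two [Acy o] [Acy o'] {e : TEq (RepO k o) (RepO k o')} {M : V → RepO k o'} {a : V → ℤ} {N : V' → RepO k o} {b : V' → ℤ} (hM : ∀ v, Cr e (Sm k o v) (M v) (a v))
    (hN : ∀ y, Cr e (N y) (Sm k o' y) (b y)) (y : V') : FD (N y) := fun w => by
  by_contra hcon
  have h0 : Cardinal.aleph0 ≤ Module.rank k ((N y).obj w) := not_lt.1 fun h => hcon (Module.rank_lt_aleph0_iff.1 h)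
  have : Nonempty (V' × V) := ⟨(y, w)⟩
  obtain ⟨⟨z, u⟩, hz⟩ := Finite.exists_max fun p : V' × V => Module.rank k ((N p.1).obj p.2)
  have hc := h0.trans (hz (y, w))
  have h1 := fd_one hM hN hc (fun y w => hz (y, w))
  exact absurd (fd_one (e := e.symm) (fun y => (hN y).symm) (fun v => (hM v).symm) hc (fun v x => (h1 v x).le) z u) (lt_irrefl _)
end tr5
end QN

namespace QN
set_option linter.all false
section cl5
open CategoryTheory CategoryTheory.Limits CategoryTheory.Pretriangulated
variable {V V' : Type} {o : V → V → Prop} {o' : V' → V' → Prop} {k : Type} [Field k] [Fintype V] [Fintype V']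
theorem lin_ext {A : Type} [AddCommGroup A] {f g : (V → ℤ) →ₗ[ℤ] A} (h : ∀ v, f (bv ℤ v) = g (bv ℤ v)) : f = g := LinearMap.ext fun x => by
  rw [vec_eq_sum x, map_sum, map_sum]; exact Finset.sum_congr rfl fun v _ => by rw [map_smul, map_smul, h]
theorem eul_nd [hw : Acy o] {x : V → ℤ} (h : ∀ y, eul ℤ o (bv ℤ y) x = 0) : x = 0 := by
  funext y
  induction y using hw.wf.induction with | _ y ih => ?_
  have := h y
  rw [eul_left, Finset.sum_eq_zero, sub_zero] at this
  · exact this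
  · intro w _
    split_ifs with hw
    exacts [ih w hw, rfl]
theorem eul_nd' [hw : Acy o] {x : V → ℤ} (h : ∀ y, eul ℤ o x (bv ℤ y) = 0) : x = 0 := by
  have hw' : Acy (fun x y => o y x) := by obtain ⟨f, hf⟩ := hw.ex; exact ⟨fun x => - f x, fun x y h => neg_lt_neg (hf _ _ h)⟩
  funext y
  induction y using hw'.wf.induction with | _ y ih => ?_
  have := h y
  rw [eul_right, Finset.sum_eq_zero, sub_zero] at this
  · exact this
  · intro w _
    split_ifs with hw
    exacts [ih w hw, rfl]
theorem HD_zero [Acy o] (M N : RepO k o) {n : ℤ} (h0 : n ≠ 0) (h1 : n ≠ 1) : Module.finrank k (HD M N n) = 0 := by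
  have : Subsingleton (HD M N n) := ⟨fun f g => by rw [vanS _ _ n h0 h1 f, vanS _ _ n h0 h1 g]⟩
  exact Module.finrank_zero_of_subsingleton
theorem Cr.symm' {e : TEq (RepO k o) (RepO k o')} {M : RepO k o} {M' : RepO k o'} {a : ℤ} (h : Cr e.symm M' M a) : Cr e M M' (-a) := by
  obtain ⟨α⟩ := h
  exact ⟨e.F.mapIso ((shiftShiftNeg (Sg M) a).symm ≪≫ (shiftFunctor _ (-a)).mapIso α.symm) ≪≫ (e.F.commShiftIso (-a)).app _ ≪≫ (shiftFunctor _ (-a)).mapIso (e.symm_iso (Sg M'))⟩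
/-- equality of ranks -/
theorem RE {e : TEq (RepO k o) (RepO k o')} {M N : RepO k o} {M' N' : RepO k o'} {a b m n : ℤ} (hM : Cr e M M' a) (hN : Cr e N N' b) (hm : m + a = b + n)
    (h : Sc M ∨ Sc N) (h' : Sc M' ∨ Sc N') : Module.rank k (HD M' N' m) = Module.rank k (HD M N n) := by
  refine le_antisymm ?_ ?_
  · rcases h' with h' | h'
    exacts [(TR2 hM hN hm h').rank, (TR1 hM hN hm h').rank]
  · rcases h with h | h
    exacts [(TR2 hM.symm hN.symm (by lia) h).rank, (TR1 hM.symm hN.symm (by lia) h).rank]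
theorem EU [Acy o] [Acy o'] {e : TEq (RepO k o) (RepO k o')} {M N : RepO k o} {M' N' : RepO k o'} {a b : ℤ} (hM : Cr e M M' a) (hN : Cr e N N' b)
    (h : Sc M ∨ Sc N) (h' : Sc M' ∨ Sc N') (fM : FD M) (fN : FD N) (fM' : FD M') (fN' : FD N') :
    eul ℤ o' ((a.negOnePow : ℤ) • dv M') ((b.negOnePow : ℤ) • dv N') = eul ℤ o (dv M) (dv N) := by
  have key : ∀ m n, m + a = b + n → Module.finrank k (HD M' N' m) = Module.finrank k (HD M N n) := fun m n hm => congrArg Cardinal.toNat (RE hM hN hm h h')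
  rw [map_smul, map_smul, LinearMap.smul_apply, ← (euler fM fN).2.2, ← (euler fM' fN').2.2, smul_smul, ← Units.val_mul, ← Int.negOnePow_add]
  by_cases h0 : a = b
  · rw [key 0 0 (by lia), key 1 1 (by lia), Int.negOnePow_even _ ⟨a, by lia⟩]; simp
  by_cases h1 : a = b + 1
  · rw [key 0 1 (by lia), key 1 2 (by lia), ← key (-1) 0 (by lia), HD_zero M N (n := 2), HD_zero M' N' (n := -1), Int.negOnePow_odd _ ⟨b, by lia⟩] <;> simp
  by_cases h2 : b = a + 1
  · rw [key 0 (-1) (by lia), key 1 0 (by lia), ← key 2 1 (by lia), HD_zero M N (n := -1), HD_zero M' N' (n := 2), Int.negOnePow_odd _ ⟨a, by lia⟩] <;> simp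
  · rw [key 0 (a - b) (by lia), key 1 (1 + a - b) (by lia), ← key (b - a) 0 (by lia), ← key (1 + b - a) 1 (by lia), HD_zero, HD_zero, HD_zero, HD_zero] <;> first | simp; done | lia
theorem im [Acy o'] (e : TEq (RepO k o) (RepO k o')) (v : V) : ∃ M a, Cr e (Sm k o v) M a := by
  have hs : ∀ u : Sg (Sm k o v) ⟶ Sg (Sm k o v), ∃ c : k, u = c • 𝟙 _ := fun u => by
    obtain ⟨f, rfl⟩ := (Sf _).map_surjective u
    obtain ⟨c, rfl⟩ := Sm_end v f
    exact ⟨c, by rw [Functor.map_smul, CategoryTheory.Functor.map_id]⟩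
  have h1 : 𝟙 (Sg (Sm k o v)) ≠ 0 := fun h => (Sm_Sc v).2 ((Sf _).map_injective (by rw [CategoryTheory.Functor.map_id, Functor.map_zero]; exact h))
  obtain ⟨j, M, h⟩ := stalk (e.F.obj (Sg (Sm k o v))) (fun h => h1 (e.F.map_injective (h.eq_of_src _ _))) (fun p hp => by
    obtain ⟨u, rfl⟩ := e.F.map_surjective p
    obtain ⟨c, rfl⟩ := hs u
    rw [← Functor.map_comp] at hp
    have h2 := e.F.map_injective hp
    rw [Linear.smul_comp, Category.id_comp, smul_smul, ← sub_eq_zero, ← sub_smul] at h2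
    rcases mul_eq_zero.1 (show c * (c - 1) = 0 by rw [mul_sub, mul_one]; exact (smul_eq_zero.1 h2).resolve_right h1) with h3 | h3
    · left; rw [h3, zero_smul, Functor.map_zero]
    · right; rw [sub_eq_zero.1 h3, one_smul, CategoryTheory.Functor.map_id])
  exact ⟨M, j, h⟩
theorem sc_one [Acy o] [Acy o'] {e : TEq (RepO k o) (RepO k o')} {M : V → RepO k o'} {a : V → ℤ} {N : V' → RepO k o} {b : V' → ℤ} (hM : ∀ v, Cr e (Sm k o v) (M v) (a v))
    (hN : ∀ y, Cr e (N y) (Sm k o' y) (b y)) (v : V) : FD (M v) ∧ Sc (M v) := by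
  have fM : FD (M v) := fd_two (e := e.symm) (fun y => (hN y).symm) (fun v => (hM v).symm) v
  refine ⟨fM, ?_⟩
  by_contra hcon
  have h0 : ∀ y m, m = 0 ∨ m = 1 → Module.finrank k (HD (M v) (Sm k o' y) m) = 0 := fun y m hm => by
    have hf : Module.Finite k (HD (M v) (Sm k o' y) m) := by
      rcases hm with rfl | rfl
      exacts [(euler fM (Sm_FD y)).1, (euler fM (Sm_FD y)).2.1]
    by_contra h1
    have hr := RE (n := m + a v - b y) (m := m) (hM v) (hN y) (by lia) (.inl (Sm_Sc v)) (.inr (Sm_Sc y))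
    have hf' : Module.Finite k (HD (Sm k o v) (N y) (m + a v - b y)) := Module.rank_lt_aleph0_iff.1 (hr ▸ Module.rank_lt_aleph0_iff.2 hf)
    have : Nontrivial (HD (Sm k o v) (N y) (m + a v - b y)) := Module.nontrivial_of_finrank_pos (R := k) (Nat.pos_of_ne_zero ((congrArg Cardinal.toNat hr).symm.trans_ne h1))
    exact hcon ((TR2 (m := m + a v - b y) (n := m) (hM v).symm (hN y).symm (by lia) (Sm_Sc v)).sc hr.le)
  have h1 : dv (M v) = 0 := eul_nd' (o := o') fun y => by
    rw [← Sm_dv (k := k) (o := o') y, ← (euler fM (Sm_FD y)).2.2, h0 y 0 (.inl rfl), h0 y 1 (.inr rfl)]; simp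
  have h2 : 𝟙 (M v) = 0 := al_ext fun x m => by
    have h3 : Module.finrank k ((M v).obj x) = 0 := by have := congrFun h1 x; simpa [dv] using this
    have : Module.Finite k ((M v).obj x) := fM x
    have : Subsingleton ((M v).obj x) := Module.finrank_zero_iff.1 h3
    exact Subsingleton.elim _ _
  obtain ⟨α⟩ := hM v
  refine (Sm_Sc (k := k) (o := o) v).2 ((Sf _).map_injective (e.F.map_injective ((cancel_mono α.hom).1 ?_)))
  rw [CategoryTheory.Functor.map_id, CategoryTheory.Functor.map_id, Category.id_comp, Functor.map_zero, Functor.map_zero, zero_comp]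
  have h4 : 𝟙 (Sg (M v)) = 0 := by rw [← CategoryTheory.Functor.map_id, h2, Functor.map_zero]
  have h5 : 𝟙 ((Sg (M v))⟦a v⟧) = 0 := by rw [← CategoryTheory.Functor.map_id, h4, Functor.map_zero]
  rw [← Category.comp_id α.hom, h5, comp_zero]
end cl5
end QN

namespace QN
set_option linter.all false
section cl6
open CategoryTheory CategoryTheory.Limits CategoryTheory.Pretriangulated
variable {V V' : Type} {o : V → V → Prop} {o' : V' → V' → Prop} {k : Type} [Field k] [Fintype V] [Fintype V']
/-- signed class of a shifted module -/
noncomputable def sg (a : ℤ) (M : RepO k o) : V → ℤ := (a.negOnePow : ℤ) • dv M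
theorem sg_sg (a : ℤ) (x : V → ℤ) : (a.negOnePow : ℤ) • (a.negOnePow : ℤ) • x = x := by
  rw [smul_smul, ← Units.val_mul, ← Int.negOnePow_add, Int.negOnePow_even _ ⟨a, rfl⟩]; simp
noncomputable def lc (x : V → V' → ℤ) : (V → ℤ) →ₗ[ℤ] (V' → ℤ) := ∑ v, (LinearMap.proj v).smulRight (x v)
theorem lc_bv (x : V → V' → ℤ) (v : V) : lc x (bv ℤ v) = x v := by
  classical
  simp [lc, LinearMap.sum_apply, bv_apply]
variable [Acy o] [Acy o'] {e : TEq (RepO k o) (RepO k o')} {M : V → RepO k o'} {a : V → ℤ} {N : V' → RepO k o} {b : V' → ℤ}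
theorem EU1 (hM : ∀ v, Cr e (Sm k o v) (M v) (a v)) (hN : ∀ y, Cr e (N y) (Sm k o' y) (b y)) (x y : V → ℤ) :
    eul ℤ o' (lc (fun v => sg (a v) (M v)) x) (lc (fun v => sg (a v) (M v)) y) = eul ℤ o x y := by
  set F := lc (fun v => sg (a v) (M v))
  have : (eul ℤ o').compl₁₂ F F = eul ℤ o := lin_ext fun v => lin_ext fun w => by
    rw [LinearMap.compl₁₂_apply, lc_bv, lc_bv, ← Sm_dv (k := k) (o := o) v, ← Sm_dv (k := k) (o := o) w]
    exact EU (hM v) (hM w) (.inl (Sm_Sc v)) (.inl (sc_one hM hN v).2) (Sm_FD v) (Sm_FD w) (sc_one hM hN v).1 (sc_one hM hN w).1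
  exact LinearMap.congr_fun (LinearMap.congr_fun this x) y
theorem EU2 (hM : ∀ v, Cr e (Sm k o v) (M v) (a v)) (hN : ∀ y, Cr e (N y) (Sm k o' y) (b y)) (x : V → ℤ) (y : V' → ℤ) :
    eul ℤ o' (lc (fun v => sg (a v) (M v)) x) y = eul ℤ o x (lc (fun y => sg (b y) (N y)) y) := by
  set F := lc (fun v => sg (a v) (M v))
  set G := lc (fun y => sg (b y) (N y))
  have : (eul ℤ o').compl₁₂ F LinearMap.id = (eul ℤ o).compl₁₂ LinearMap.id G := lin_ext fun v => lin_ext fun y => by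
    rw [LinearMap.compl₁₂_apply, LinearMap.compl₁₂_apply, lc_bv, LinearMap.id_apply, LinearMap.id_apply, lc_bv, ← Sm_dv (k := k) (o := o) v, ← Sm_dv (k := k) (o := o') y]
    have := EU (hM v) (hN y) (.inl (Sm_Sc v)) (.inr (Sm_Sc y)) (Sm_FD v) (sc_one (e := e.symm) (fun y => (hN y).symm) (fun v => (hM v).symm) y).1 (sc_one hM hN v).1 (Sm_FD y)
    rw [sg, sg, map_smul (eul ℤ o (dv (Sm k o v))), ← this, ← map_smul, sg_sg]
  exact LinearMap.congr_fun (LinearMap.congr_fun this x) y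
theorem GF (hM : ∀ v, Cr e (Sm k o v) (M v) (a v)) (hN : ∀ y, Cr e (N y) (Sm k o' y) (b y)) (x : V → ℤ) :
    lc (fun y => sg (b y) (N y)) (lc (fun v => sg (a v) (M v)) x) = x :=
  sub_eq_zero.1 (eul_nd (o := o) fun y => by rw [map_sub, ← EU2 hM hN, EU1 hM hN, sub_self])
theorem FG (hM : ∀ v, Cr e (Sm k o v) (M v) (a v)) (hN : ∀ y, Cr e (N y) (Sm k o' y) (b y)) (y : V' → ℤ) :
    lc (fun v => sg (a v) (M v)) (lc (fun y => sg (b y) (N y)) y) = y := by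
  have := GF (e := e.symm) (fun y => (hN y).symm) (fun v => (hM v).symm) y
  have h : ∀ (a : ℤ) {U : Type} [Fintype U] {o : U → U → Prop} (M : RepO k o), sg (-a) M = sg a M := fun a _ _ _ M => by rw [sg, sg, Int.negOnePow_neg]
  simpa only [h] using this
/-- the class of an equivalence -/
structure Cls (e : TEq (RepO k o) (RepO k o')) (φ : (V → ℤ) ≃ₗ[ℤ] (V' → ℤ)) (ε : ℤ) : Prop where
  hε : ε = 1 ∨ ε = -1
  im : ∀ v, ∃ M a, Cr e (Sm k o v) M a ∧ φ (bv ℤ v) = ε • sg a M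
theorem ex_N (e : TEq (RepO k o) (RepO k o')) : ∃ (N : V' → RepO k o) (b : V' → ℤ), ∀ y, Cr e (N y) (Sm k o' y) (b y) := by
  choose N b h using QN.im (o' := o) e.symm
  exact ⟨N, fun y => - b y, fun y => (h y).symm'⟩
theorem Cls.ex (e : TEq (RepO k o) (RepO k o')) : ∃ φ, Cls e φ 1 := by
  choose M a hM using QN.im e
  obtain ⟨N, b, hN⟩ := ex_N e
  exact ⟨LinearEquiv.ofLinear _ _ (LinearMap.ext (FG hM hN)) (LinearMap.ext (GF hM hN)), .inl rfl, fun v => ⟨M v, a v, hM v, by rw [one_smul]; exact lc_bv _ v⟩⟩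
theorem Cls.sq {φ : (V → ℤ) ≃ₗ[ℤ] (V' → ℤ)} {ε : ℤ} (h : Cls e φ ε) : ε * ε = 1 := by rcases h.hε with rfl | rfl <;> rfl
theorem Cls.iso {φ : (V → ℤ) ≃ₗ[ℤ] (V' → ℤ)} {ε : ℤ} (h : Cls e φ ε) (x y : V → ℤ) : eul ℤ o' (φ x) (φ y) = eul ℤ o x y := by
  choose M a hM hφ using h.im
  obtain ⟨N, b, hN⟩ := ex_N e
  have h1 : φ.toLinearMap = ε • lc (fun v => sg (a v) (M v)) := lin_ext fun v => (hφ v).trans (by rw [LinearMap.smul_apply, lc_bv])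
  have h2 : ∀ x, φ x = ε • lc (fun v => sg (a v) (M v)) x := LinearMap.congr_fun h1
  rw [h2, h2, map_smul, map_smul, LinearMap.smul_apply, smul_smul, h.sq, one_smul, EU1 hM hN]
theorem Cls.symm {φ : (V → ℤ) ≃ₗ[ℤ] (V' → ℤ)} {ε : ℤ} (h : Cls e φ ε) : Cls e.symm φ.symm ε := by
  choose M a hM hφ using h.im
  obtain ⟨N, b, hN⟩ := ex_N e
  have h1 : φ.toLinearMap = ε • lc (fun v => sg (a v) (M v)) := lin_ext fun v => (hφ v).trans (by rw [LinearMap.smul_apply, lc_bv])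
  have h2 : ∀ x, φ x = ε • lc (fun v => sg (a v) (M v)) x := LinearMap.congr_fun h1
  refine ⟨h.hε, fun y => ⟨N y, _, (hN y).symm, ?_⟩⟩
  rw [LinearEquiv.symm_apply_eq, map_smul, h2, sg, Int.negOnePow_neg, ← sg, ← lc_bv (fun y => sg (b y) (N y)) y, FG hM hN, smul_smul, h.sq, one_smul]
theorem Cls.sg {φ : (V → ℤ) ≃ₗ[ℤ] (V' → ℤ)} {ε : ℤ} (h : Cls e φ ε) (v : V) : Coh (φ (bv ℤ v)) := by
  obtain ⟨M, a, -, h1⟩ := h.im v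
  have hd : ∀ x, 0 ≤ dv M x := fun x => Int.natCast_nonneg _
  rw [h1, QN.sg]
  rcases h.hε with rfl | rfl <;> rcases Int.units_eq_one_or a.negOnePow with h2 | h2 <;> rw [h2] <;> simp [Coh, hd]
theorem Cls.neg {φ : (V → ℤ) ≃ₗ[ℤ] (V' → ℤ)} {ε : ℤ} (h : Cls e φ ε) : Cls e (φ.trans (LinearEquiv.neg ℤ)) (-ε) := by
  refine ⟨by rcases h.hε with rfl | rfl <;> simp, fun v => ?_⟩
  obtain ⟨M, a, hM, h1⟩ := h.im v
  exact ⟨M, a, hM, by simp [h1]⟩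
end cl6
end QN

namespace QN
set_option linter.all false
section cl7
open CategoryTheory CategoryTheory.Limits CategoryTheory.Pretriangulated
universe v u v' u'
theorem tri_d {C : Type u} [Category.{v} C] [Abelian C] {T : Triangle (DerivedCategory C)} (hT : T ∈ distTriang _) {N A B : C} {m : ℤ} (e1 : T.obj₁ ≅ (Sg N)⟦m⟧) (e2 : T.obj₂ ≅ Sg A)
    (e3 : T.obj₃ ≅ Sg B) (d : C → ℤ) (di : ∀ X Y, (X ≅ Y) → d X = d Y) (d0 : ∀ X, IsZero X → d X = 0) (Fi : C → Prop) (fi : ∀ X Y, (X ≅ Y) → Fi X → Fi Y)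
    (da : ∀ S : ShortComplex C, S.ShortExact → Fi S.X₂ → d S.X₂ = d S.X₁ + d S.X₃) (hA : Fi A) (hB : Fi B) : (m.negOnePow : ℤ) * d N = d A - d B := by
  have z1 : ∀ n, m + n ≠ 0 → IsZero ((DerivedCategory.homologyFunctor C n).obj T.obj₁) := fun n h => (hzs N m n h).of_iso ((DerivedCategory.homologyFunctor C n).mapIso e1)
  have z2 : ∀ n, n ≠ 0 → IsZero ((DerivedCategory.homologyFunctor C n).obj T.obj₂) := fun n h => (hz A n h).of_iso ((DerivedCategory.homologyFunctor C n).mapIso e2)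
  have z3 : ∀ n, n ≠ 0 → IsZero ((DerivedCategory.homologyFunctor C n).obj T.obj₃) := fun n h => (hz B n h).of_iso ((DerivedCategory.homologyFunctor C n).mapIso e3)
  have f1 : ∀ n, m + n = 0 → ((DerivedCategory.homologyFunctor C n).obj T.obj₁ ≅ N) := fun n h => (DerivedCategory.homologyFunctor C n).mapIso e1 ≪≫ hs _ m n 0 h ≪≫ h0 N
  let f2 : (H0 C).obj T.obj₂ ≅ A := (H0 C).mapIso e2 ≪≫ h0 A
  let f3 : (H0 C).obj T.obj₃ ≅ B := (H0 C).mapIso e3 ≪≫ h0 B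
  by_cases hm : m = -1
  · have hS : (ShortComplex.mk _ _ (DerivedCategory.HomologySequence.comp_δ T hT 0 1 rfl)).ShortExact :=
      { exact := DerivedCategory.HomologySequence.exact₃ T hT 0 1 rfl
        mono_f := (DerivedCategory.HomologySequence.mono_homologyMap_mor₂_iff T hT 0).2 ((z1 0 (by lia)).eq_of_src _ _)
        epi_g := (DerivedCategory.HomologySequence.exact₁ T hT 0 1 rfl).epi_f ((z2 1 (by lia)).eq_of_tgt _ _) }
    have := da _ hS (fi _ _ f3.symm hB)
    rw [di _ _ f3, di _ _ f2, di _ _ (f1 1 (by lia))] at this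
    rw [hm, this]; simp
  have hS : (ShortComplex.mk ((H0 C).map T.mor₁) ((H0 C).map T.mor₂) (by rw [← Functor.map_comp, comp_distTriang_mor_zero₁₂ _ hT, Functor.map_zero])).ShortExact :=
    { exact := DerivedCategory.HomologySequence.exact₂ T hT 0
      mono_f := (DerivedCategory.HomologySequence.mono_homologyMap_mor₁_iff T hT (-1) 0 rfl).2 ((z3 (-1) (by lia)).eq_of_src _ _)
      epi_g := (DerivedCategory.HomologySequence.epi_homologyMap_mor₂_iff T hT 0 1 rfl).2 ((z1 1 (by lia)).eq_of_tgt _ _) }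
  have h1 := da _ hS (fi _ _ f2.symm hA)
  rw [di _ _ f3, di _ _ f2] at h1
  by_cases hm0 : m = 0
  · rw [di _ _ (f1 0 (by lia))] at h1
    rw [h1, hm0]; simp
  · rw [d0 _ (z1 0 (by lia))] at h1
    have h2 := (DerivedCategory.HomologySequence.exact₁ T hT (-m-1) (-m) (by lia)).isZero_of_both_zeros ((z3 _ (by lia)).eq_of_src _ _) ((z2 _ (by lia)).eq_of_tgt _ _)
    rw [← di _ _ (f1 (-m) (by lia)), d0 _ h2, h1]; simp
theorem coc_tri {A : Type u} [Category.{v} A] [Abelian A] {B : Type u'} [Category.{v'} B] [Abelian B] {F₀ F₁ : B ⥤ A} [Ex F₀] [Ex F₁] (ξ : F₀ ⟶ F₁) (M : B) :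
    ∃ T : Triangle (DerivedCategory A), T ∈ distTriang _ ∧ Nonempty (T.obj₁ ≅ (coconeT ξ).obj (Sg M)) ∧ Nonempty (T.obj₂ ≅ Sg (F₀.obj M)) ∧ Nonempty (T.obj₃ ≅ Sg (F₁.obj M)) :=
  ⟨_, DerivedCategory.mappingCocone_triangle_distinguished (mt ξ ((HomologicalComplex.single B (ComplexShape.up ℤ) 0).obj M)),
    ⟨((coconeT_fac ξ).app _).symm ≪≫ (coconeT ξ).mapIso (th M).symm⟩,
    ⟨DerivedCategory.Q.mapIso ((HomologicalComplex.singleMapHomologicalComplex F₀ (ComplexShape.up ℤ) 0).app M) ≪≫ (th _).symm⟩,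
    ⟨DerivedCategory.Q.mapIso ((HomologicalComplex.singleMapHomologicalComplex F₁ (ComplexShape.up ℤ) 0).app M) ≪≫ (th _).symm⟩⟩
section
variable {k : Type} [Field k] {V A : Type} [Fintype V] {s t : A → V} {R : Set (List A)}
theorem rep_fin {X Y : Rep k s t R} (e : X ≅ Y) (x : V) : Nonempty (X.obj x ≃ₗ[k] Y.obj x) := ⟨((Rep.E k s t R x).mapIso e).toLinearEquiv⟩
theorem rep_tri {T : Triangle (DerivedCategory (Rep k s t R))} (hT : T ∈ distTriang _) {N A B : Rep k s t R} {m : ℤ} (e1 : T.obj₁ ≅ (Sg N)⟦m⟧) (e2 : T.obj₂ ≅ Sg A)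
    (e3 : T.obj₃ ≅ Sg B) (x : V) (hA : Module.Finite k (A.obj x)) (hB : Module.Finite k (B.obj x)) :
    (m.negOnePow : ℤ) * Module.finrank k (N.obj x) = Module.finrank k (A.obj x) - Module.finrank k (B.obj x) := by
  refine tri_d hT e1 e2 e3 (fun X => Module.finrank k (X.obj x)) (fun X Y e => ?_) (fun X h => ?_) (fun X => Module.Finite k (X.obj x)) (fun X Y e hX => ?_) (fun S hS hf => ?_) hA hB
  · obtain ⟨f⟩ := rep_fin e x
    exact congrArg _ f.finrank_eq
  · have : Subsingleton (X.obj x) := ModuleCat.subsingleton_of_isZero ((Rep.E k s t R x).map_isZero h)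
    exact congrArg _ Module.finrank_zero_of_subsingleton
  · obtain ⟨f⟩ := rep_fin e x
    exact Module.Finite.equiv f
  · obtain ⟨h1, h2, h3⟩ := (Rep.exact_iff _).1 ((Rep.se_iff S).1 hS x)
    let p : S.X₂.obj x →ₗ[k] S.X₃.obj x := (Rep.ap S.g x).hom
    let i : S.X₁.obj x →ₗ[k] S.X₂.obj x := (Rep.ap S.f x).hom
    have e := LinearMap.finrank_range_add_finrank_ker p
    have e' : LinearMap.ker p = LinearMap.range i := by
      ext y; refine ⟨fun hy => h2 y hy, ?_⟩
      rintro ⟨z, rfl⟩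
      have : Rep.ap (S.f ≫ S.g) x = 0 := by rw [S.zero]; rfl
      exact LinearMap.congr_fun (congrArg ModuleCat.Hom.hom this) z
    rw [e', LinearMap.finrank_range_of_inj (show Function.Injective i from h1), LinearMap.range_eq_top.2 (show Function.Surjective p from h3), finrank_top] at e
    lia
end
section
variable {k : Type} [Field k] {V : Type} [Fintype V] {o : V → V → Prop}
open Classical in
theorem refl_iso {i : V} (h : IsSink o i) {M : RepO k o} {N : RepO k (flipAt i o)} {m : ℤ} (hc : Cr (reflO k h) M N m) :
    Nonempty ((reflT k (oSW o i) (oTW o i) (oβ o i)).F.obj (Sg ((Rep.pull (qk h)).obj M)) ≅ (Sg ((Rep.pull (qc h)).obj N))⟦m⟧) := by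
  obtain ⟨α⟩ := hc
  let T := reflT k (oSW o i) (oTW o i) (oβ o i)
  let P := Rep.pull (k := k) (qk h)
  let Q := Rep.pull (k := k) (qc h).symm
  have := TEq.mapD_isEq Q
  have α' : Q.mapDerivedCategory.obj (T.F.obj (P.mapDerivedCategory.obj (Sg M))) ≅ (Sg N)⟦m⟧ := α
  let N₁ := (Rep.pull (k := k) (qc h)).obj N
  have n : Q.obj N₁ ≅ N := (Rep.pullIso (qc h)).app N
  have β : (Sg N)⟦m⟧ ≅ Q.mapDerivedCategory.obj ((Sg N₁)⟦m⟧) := (shiftFunctor _ m).mapIso ((Sf _).mapIso n.symm ≪≫ ((Q.mapDerivedCategorySingleFunctor 0).app N₁).symm) ≪≫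
    ((Q.mapDerivedCategory.commShiftIso m).app (Sg N₁)).symm
  exact ⟨T.F.mapIso ((P.mapDerivedCategorySingleFunctor 0).app M).symm ≪≫ Q.mapDerivedCategory.preimageIso (α' ≪≫ β)⟩
open Classical in
theorem refl_cl {G : SimpleGraph V} (ho : IsOrientation G o) {i : V} (h : IsSink o i) {M : RepO k o} {N : RepO k (flipAt i o)} {m : ℤ} (hc : Cr (reflO k h) M N m) (fM : FD M) :
    sg m N = refl G i (dv M) := by
  obtain ⟨α⟩ := refl_iso h hc
  obtain ⟨T, hT, ⟨e1⟩, ⟨e2⟩, ⟨e3⟩⟩ := coc_tri (reflD k (oSW o i) (oTW o i) (oβ o i)).ξ ((Rep.pull (qk h)).obj M)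
  have key := fun x => rep_tri hT (e1 ≪≫ α) e2 e3 x
  funext w
  rw [refl_apply]
  by_cases hw : w = i
  · subst hw
    have hf : ∀ x, Module.Finite k (M.obj x) := fM
    have := key none (inferInstanceAs (Module.Finite k (∀ b : oB o w, M.obj b.1.1))) (hf w)
    have e : (Module.finrank k (∀ b : oB o w, M.obj b.1.1) : ℤ) = nbr G (dv M) w := by
      rw [Module.finrank_pi_fintype, nbr, Nat.cast_sum, ← Finset.sum_filter]
      refine Finset.sum_bij (fun b _ => b.1.1) (fun b _ => Finset.mem_filter.2 ⟨Finset.mem_univ _, (ho.1 _ _).2 (.inr b.2)⟩) (fun b _ c _ hbc => Subtype.ext (Subtype.ext hbc)) (fun x hx => ?_) (fun _ _ => rfl)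
      have h1 := ((ho.1 _ _).1 (Finset.mem_filter.1 hx).2).resolve_left (h x)
      exact ⟨⟨⟨x, fun hx => h x (by rwa [hx] at h1 ⊢)⟩, h1⟩, Finset.mem_univ _, rfl⟩
    rw [if_pos rfl, ← e, neg_add_eq_sub]
    exact this
  · have hf : ∀ x, Module.Finite k (M.obj x) := fM
    have := key (some ⟨w, hw⟩) (hf w) (inferInstanceAs (Module.Finite k PUnit))
    rw [if_neg hw]
    have h0 : Module.finrank k PUnit.{1} = 0 := Module.finrank_zero_of_subsingleton
    have e : (m.negOnePow : ℤ) * Module.finrank k (N.obj w) = Module.finrank k (M.obj w) - Module.finrank k PUnit.{1} := this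
    rw [h0, Nat.cast_zero, sub_zero] at e
    exact e
end
end cl7
end QN

namespace QN
set_option linter.all false
section cl8
open CategoryTheory CategoryTheory.Limits CategoryTheory.Pretriangulated
variable {V V' : Type} {k : Type} [Field k] [Fintype V] [Fintype V']
theorem Cr.of_trans {U : Type} [Fintype U] {o : V → V → Prop} {o' : V' → V' → Prop} {p : U → U → Prop} {e : TEq (RepO k o) (RepO k o')} {f : TEq (RepO k o') (RepO k p)} {L : RepO k o}
    {M : RepO k o'} {N : RepO k p} {a b : ℤ} (hM : Cr e L M a) (hN : Cr (e.trans f) L N b) : Cr f M N (b - a) := by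
  obtain ⟨α⟩ := hM
  obtain ⟨β⟩ := hN
  have β' : f.F.obj (e.F.obj (Sg L)) ≅ (Sg N)⟦b⟧ := β
  have γ : (f.F.obj (Sg M))⟦a⟧ ≅ (Sg N)⟦b⟧ := ((f.F.commShiftIso a).app _).symm ≪≫ f.F.mapIso α.symm ≪≫ β'
  exact ⟨(shiftShiftNeg _ a).symm ≪≫ (shiftFunctor _ (-a)).mapIso γ ≪≫ ((shiftFunctorAdd' _ b (-a) (b - a) (by lia)).app _).symm⟩
theorem Cls.comp {o : V → V → Prop} {o' p : V' → V' → Prop} [Acy o] [Acy o'] [Acy p] {e : TEq (RepO k o) (RepO k o')} {T : TEq (RepO k o') (RepO k p)} {φ : (V → ℤ) ≃ₗ[ℤ] (V' → ℤ)} {ε : ℤ}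
    (h : Cls e φ ε) (ψ : (V' → ℤ) ≃ₗ[ℤ] (V' → ℤ)) (hT : ∀ M N m, FD M → FD N → Cr T M N m → ψ (dv M) = QN.sg m N) : Cls (e.trans T) (φ.trans ψ) ε := by
  choose M a hM hφ using h.im
  choose N b hN using QN.im (e.trans T)
  obtain ⟨M', a', hM'⟩ := ex_N e
  obtain ⟨N', b', hN'⟩ := ex_N (e.trans T)
  refine ⟨h.hε, fun v => ⟨N v, b v, hN v, ?_⟩⟩
  have h1 := hT _ _ _ (sc_one hM hM' v).1 (sc_one hN hN' v).1 ((hM v).of_trans (hN v))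
  rw [LinearEquiv.trans_apply, hφ, map_smul, QN.sg, map_smul, h1, QN.sg, QN.sg, smul_smul (a v).negOnePow.val, ← Units.val_mul, ← Int.negOnePow_add, add_sub_cancel]
/-- the invariant relation between orientations and lattice isometries -/
def IC (k : Type) [Field k] (G : SimpleGraph V) (G' : SimpleGraph V') (o : V → V → Prop) (o' : V' → V' → Prop) (φ : (V → ℤ) ≃ₗ[ℤ] (V' → ℤ)) : Prop :=
  IsOrientation G o ∧ IsOrientation G' o' ∧ ∃ (_ : Acy o) (_ : Acy o') (e : TEq (RepO k o) (RepO k o')) (ε : ℤ), Cls e φ ε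
variable {G : SimpleGraph V} {G' : SimpleGraph V'} {o : V → V → Prop} {o' : V' → V' → Prop} {φ : (V → ℤ) ≃ₗ[ℤ] (V' → ℤ)}
theorem IC.symm (h : IC k G G' o o' φ) : IC k G' G o' o φ.symm := by
  obtain ⟨h1, h2, h3, h4, e, ε, h5⟩ := h
  exact ⟨h2, h1, h4, h3, e.symm, ε, h5.symm⟩
theorem IC.right {i : V'} (h : IC k G G' o o' φ) (hi : IsSink o' i ∨ IsSource o' i) : IC k G G' o (flipAt i o') (φ.trans (refl G' i)) := by
  obtain ⟨h1, h2, h3, h4, e, ε, h5⟩ := h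
  have h6 := acy_flip h4 hi
  refine ⟨h1, flipAt_orient h2 i, h3, h6, ?_⟩
  rcases hi with hi | hi
  · exact ⟨e.trans (reflO k hi), ε, h5.comp _ fun M N m fM _ hc => (refl_cl h2 hi hc fM).symm⟩
  · obtain ⟨p, rfl⟩ : ∃ p, o' = flipAt i p := ⟨flipAt i o', (flipAt_flipAt i o').symm⟩
    have hp := flipAt_source hi
    have h7 := flipAt_orient h2 i
    rw [flipAt_flipAt] at hp h7
    revert h6
    rw [flipAt_flipAt]
    intro h6
    refine ⟨e.trans (reflO k hp).symm, ε, h5.comp _ fun M N m _ fN hc => ?_⟩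
    have h8 := refl_cl h7 hp hc.symm' fN
    rw [sg, ← refl_refl G' i (dv N), ← h8, sg, Int.negOnePow_neg, map_smul, sg_sg]
theorem IC.left {i : V} (h : IC k G G' o o' φ) (hi : IsSink o i ∨ IsSource o i) : IC k G G' (flipAt i o) o' ((refl G i).trans φ) := by
  have h1 := (h.symm.right hi).symm
  have h2 : (φ.symm.trans (refl G i)).symm = (refl G i).trans φ := LinearEquiv.ext fun x => by
    rw [LinearEquiv.symm_apply_eq]; simp [refl_refl]
  rwa [h2] at h1
theorem IC.fam (k : Type) [Field k] (G : SimpleGraph V) (G' : SimpleGraph V') : Fam G G' (IC k G G') where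
  or1 o o' φ h := h.1
  or2 o o' φ h := h.2.1
  iso o o' φ h := by obtain ⟨h1, h2, h3, h4, e, ε, h5⟩ := h; exact h5.iso
  sg o o' φ h := by obtain ⟨h1, h2, h3, h4, e, ε, h5⟩ := h; exact h5.sg
  sg' o o' φ h := by obtain ⟨h1, h2, h3, h4, e, ε, h5⟩ := h; exact h5.symm.sg
  neg o o' φ h := by obtain ⟨h1, h2, h3, h4, e, ε, h5⟩ := h; exact ⟨h1, h2, h3, h4, e, _, h5.neg⟩
  left o o' φ i h hi := h.left hi
  right o o' φ i h hi := h.right hi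
theorem tree_iso (hG : G.IsTree) (hG' : G'.IsTree) (ho : IsOrientation G o) (ho' : IsOrientation G' o') (e : TEq (RepO k o) (RepO k o')) : Nonempty (G ≃g G') := by
  have h1 := acy_tree hG ho
  have h2 := acy_tree hG' ho'
  obtain ⟨φ, hφ⟩ := Cls.ex e
  exact famC (IC.fam k G G') hG hG' (o := o) (o' := o') (φ := φ) ⟨ho, ho', h1, h2, e, 1, hφ⟩
end cl8
end QN

/-- **Theorem 4.5.** Let `P_{(k_0,…,k_{r+1})}^{(m_0,…,m_r)}` be a quipu with
`k_0 ≥ 1` and `k_{r+1} ≥ 1`, and set `n_i = k_0 + ∑_{j=1}^{i} (m_{j-1} + k_j + 1)`.  For a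
quiver `D` which is an orientation of a quipu, the path algebra `kD` is derived equivalent
to the linear Nakayama algebra
`A_{n_{r+1},(k_0,n_1,…,n_r)}^{(m_0+2,…,m_r+2)}` if and only if the underlying undirected
graph of `D` is isomorphic to `P_{(k_0,…,k_{r+1})}^{(m_0,…,m_r)}`. -/
theorem quipu_to_nakayama (k : Type) [Field k] {V : Type} [Fintype V]
    (G : SimpleGraph V) (o : V → V → Prop) (hor : IsOrientation G o)
    (hD : ∃ (r' : ℕ) (kk' : Fin (r' + 2) → ℕ) (mm' : Fin (r' + 1) → ℕ),
      Nonempty (G ≃g quipuGraph r' kk' mm'))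
    (r : ℕ) (kk : Fin (r + 2) → ℕ) (mm : Fin (r + 1) → ℕ)
    (hk0 : 1 ≤ kk 0) (hklast : 1 ≤ kk (Fin.last (r + 1))) :
    DerivedEquivalent k (PathAlgebra k (orientQuiver V o))
        (NakayamaAlgebra k (kk 0 + ∑ j : Fin (r + 1), (mm j + kk j.succ + 1)) (r + 1)
          (fun i => kk 0 + ∑ j : Fin (r + 1), if j.1 < i.1 then mm j + kk j.succ + 1 else 0)
          (fun i => mm i + 2)) ↔
      Nonempty (G ≃g quipuGraph r kk mm) := by
  refine (QN.derEq_iff (QN.oS o) (QN.oT o) ∅ (linQuiver (QN.qN0 r kk mm)).s (linQuiver (QN.qN0 r kk mm)).t 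
    {p | ∃ i : Fin (r+1), p = linPath (QN.qN0 r kk mm) (kk 0 + ∑ j : Fin (r + 1), if j.1 < i.1 then mm j + kk j.succ + 1 else 0) (mm i + 2)}).trans ?_
  constructor
  · rintro ⟨e⟩
    obtain ⟨r', kk', mm', ⟨f⟩⟩ := hD
    obtain ⟨e'⟩ := QN.quipu_nak r kk mm k hk0 hklast
    exact QN.tree_iso (f.isTree_iff.2 (QN.quipu_tree r' kk' mm')) (QN.quipu_tree r kk mm) hor (QN.qor_orient r kk mm hk0 hklast) (e.trans e'.symm)
  · rintro ⟨f⟩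
    exact QN.back k G o hor r kk mm hk0 hklast f
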